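/- Let N = {N(t) : t ∈ [0,1]} be a continuous nest on a separable infinite-dimensional complex Hilbert space H and let I be a nonzero stable ideal of the nest algebra Alg N. Then there exists a stable net O of families of intervals of N such that I = {X ∈ Alg N : lim_{P∈O} sup_{E∈P} ‖EXE‖_e = 0}. -/

import Mathlib

open Set Filter Topology

noncomputable def essNorm {H : Type*} [NormedAddCommGroup H] [InnerProductSpace ℂ H]
    [CompleteSpace H] (T : H →L[ℂ] H) : ℝ :=
  Metric.infDist T {K : H →L[ℂ] H | IsCompactOperator ⇑K}

/-- A continuous nest on `H`, parameterized by `[0,1]`: an increasing family of orthogonal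
projections `N t` whose ranges strictly increase, with `N 0 = 0`, `N 1 = 1`, and
`t ↦ N t ξ` norm-continuous on `[0,1]` for every `ξ`. -/
structure ContinuousNest (H : Type*) [NormedAddCommGroup H] [InnerProductSpace ℂ H]
    [CompleteSpace H] where
  N : ℝ → H →L[ℂ] H
  idem : ∀ t ∈ Icc (0 : ℝ) 1, IsIdempotentElem (N t)
  selfAdjoint : ∀ t ∈ Icc (0 : ℝ) 1, IsSelfAdjoint (N t)
  range_lt : ∀ s t : ℝ, s ∈ Icc (0 : ℝ) 1 → t ∈ Icc (0 : ℝ) 1 → s < t →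
    LinearMap.range (N s).toLinearMap < LinearMap.range (N t).toLinearMap
  N_zero : N 0 = 0
  N_one : N 1 = 1
  contOn : ∀ ξ : H, ContinuousOn (fun t => N t ξ) (Icc (0 : ℝ) 1)

variable {H : Type*} [NormedAddCommGroup H] [InnerProductSpace ℂ H] [CompleteSpace H]

/-- `P₁` refines `P₂`: every interval of `P₁` is dominated by an interval of `P₂`
(in the Loewner order). -/
def OpRefines (P₁ P₂ : Set (H →L[ℂ] H)) : Prop :=
  ∀ E ∈ P₁, ∃ F ∈ P₂, ContinuousLinearMap.IsPositive (F - E)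

namespace ContinuousNest

variable (𝒩 : ContinuousNest H)

/-- The nest algebra of `𝒩`. -/
def alg : Set (H →L[ℂ] H) := {T | ∀ t ∈ Icc (0 : ℝ) 1, (1 - 𝒩.N t) * T * 𝒩.N t = 0}

/-- An interval of the nest: a difference `N t - N s` with `0 ≤ s ≤ t ≤ 1`. -/
def IsInterval (E : H →L[ℂ] H) : Prop :=
  ∃ s t : ℝ, 0 ≤ s ∧ s ≤ t ∧ t ≤ 1 ∧ E = 𝒩.N t - 𝒩.N s

def IsIntervalFamily (P : Set (H →L[ℂ] H)) : Prop := ∀ E ∈ P, 𝒩.IsInterval E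

/-- A net of families of intervals: directed under refinement. -/
def IsNet (O : Set (Set (H →L[ℂ] H))) : Prop :=
  (∀ P ∈ O, 𝒩.IsIntervalFamily P) ∧
  ∀ P ∈ O, ∀ Q ∈ O, ∃ R ∈ O, OpRefines R P ∧ OpRefines R Q

def nestSet : Set (H →L[ℂ] H) := 𝒩.N '' Icc (0 : ℝ) 1

/-- An order automorphism of the nest: an order-preserving bijection of `{N t : t ∈ [0,1]}`
onto itself. -/
def IsAuto (θ : (H →L[ℂ] H) → H →L[ℂ] H) : Prop :=
  Set.BijOn θ 𝒩.nestSet 𝒩.nestSet ∧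
  ∀ s t : ℝ, s ∈ Icc (0 : ℝ) 1 → t ∈ Icc (0 : ℝ) 1 → s ≤ t →
    ContinuousLinearMap.IsPositive (θ (𝒩.N t) - θ (𝒩.N s))

/-- The image family `θ(P) = {θ(N t) - θ(N s) : N t - N s ∈ P}`. -/
def autoImage (θ : (H →L[ℂ] H) → H →L[ℂ] H) (P : Set (H →L[ℂ] H)) : Set (H →L[ℂ] H) :=
  {E | ∃ s t : ℝ, 0 ≤ s ∧ s ≤ t ∧ t ≤ 1 ∧ 𝒩.N t - 𝒩.N s ∈ P ∧ E = θ (𝒩.N t) - θ (𝒩.N s)}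

/-- A stable net of intervals. -/
def IsStableNet (O : Set (Set (H →L[ℂ] H))) : Prop :=
  𝒩.IsNet O ∧ ∀ θ, 𝒩.IsAuto θ → ∀ P ∈ O, 𝒩.autoImage θ P ∈ O

/-- The kernel of a net `O`: those `X` in the nest algebra with
`lim_{P ∈ O} sup_{E ∈ P} ‖EXE‖ₑ = 0`; since the sup decreases under refinement, this limit
is `0` iff for every `ε > 0` some `P ∈ O` has all `‖EXE‖ₑ < ε`. -/
def kernel (O : Set (Set (H →L[ℂ] H))) : Set (H →L[ℂ] H) :=
  {X | X ∈ 𝒩.alg ∧ ∀ ε : ℝ, 0 < ε → ∃ P ∈ O, ∀ E ∈ P, essNorm (E * X * E) < ε}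

/-- A two-sided ideal of the nest algebra. -/
def IsIdeal (I : Set (H →L[ℂ] H)) : Prop :=
  I ⊆ 𝒩.alg ∧ (0 : H →L[ℂ] H) ∈ I ∧
  (∀ X ∈ I, ∀ Y ∈ I, X + Y ∈ I) ∧ (∀ X ∈ I, -X ∈ I) ∧
  ∀ A ∈ 𝒩.alg, ∀ X ∈ I, A * X ∈ I ∧ X * A ∈ I

/-- A stable ideal: a norm-closed two-sided ideal invariant under every automorphism
`T ↦ S T S⁻¹` of the nest algebra implemented by an invertible `S ∈ B(H)`. -/
def IsStableIdeal (I : Set (H →L[ℂ] H)) : Prop :=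
  𝒩.IsIdeal I ∧ IsClosed I ∧
  ∀ S : (H →L[ℂ] H)ˣ,
    (fun T => (↑S : H →L[ℂ] H) * T * (↑S⁻¹ : H →L[ℂ] H)) '' 𝒩.alg = 𝒩.alg →
    (fun T => (↑S : H →L[ℂ] H) * T * (↑S⁻¹ : H →L[ℂ] H)) '' I = I

end ContinuousNest

/-! ### 𝒰-trees -/
namespace UT

def pre (X : ℕ → ℕ) (n : ℕ) : List ℕ := (List.range n).map X

lemma pre_succ (X : ℕ → ℕ) (n : ℕ) : pre X (n+1) = pre X n ++ [X n] := by
  simp [pre, List.range_succ]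

@[simp] lemma pre_length (X : ℕ → ℕ) (n : ℕ) : (pre X n).length = n := by simp [pre]

lemma pre_take (X : ℕ → ℕ) (i n : ℕ) (h : i ≤ n) : (pre X n).take i = pre X i := by
  simp [pre, ← List.map_take, List.take_range, Nat.min_eq_left h]

def sh (X : ℕ → ℕ) : ℕ → ℕ := fun n => X (n+1)

lemma pre_cons (X : ℕ → ℕ) (n : ℕ) : pre X (n+1) = X 0 :: pre (sh X) n := by
  simp [pre, List.range_succ_eq_map, sh, Function.comp_def]

lemma pre_drop (X : ℕ → ℕ) (i n : ℕ) : (pre X (n+i)).drop i = pre (fun k => X (k+i)) n := by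
  induction i generalizing X with
  | zero => rfl
  | succ i ih =>
    rw [← add_assoc, pre_cons, List.drop_succ_cons, ih]
    congr 1

variable (U : Ultrafilter ℕ)

/-- `S` contains all branches of a `U`-tree with stem `b`. -/
def Gen (b : List ℕ) (S : Set (ℕ → ℕ)) : Prop :=
  ∃ T : List ℕ → Set ℕ, (∀ c, T c ∈ U) ∧
    ∀ X, pre X b.length = b → (∀ n ≥ b.length, X n ∈ T (pre X n)) → X ∈ S

variable {U}

lemma Gen.mono {b S S'} (h : Gen U b S) (hS : S ⊆ S') : Gen U b S' := by
  obtain ⟨T, h1, h2⟩ := h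
  exact ⟨T, h1, fun X hX hX' => hS (h2 X hX hX')⟩

lemma gen_univ (b) : Gen U b univ := ⟨fun _ => univ, fun _ => Filter.univ_mem, fun _ _ _ => trivial⟩

lemma Gen.inter {b S S'} (h : Gen U b S) (h' : Gen U b S') : Gen U b (S ∩ S') := by
  obtain ⟨T, h1, h2⟩ := h
  obtain ⟨T', h1', h2'⟩ := h'
  exact ⟨fun c => T c ∩ T' c, fun c => Filter.inter_mem (h1 c) (h1' c),
    fun X hX hX' => ⟨h2 X hX fun n hn => (hX' n hn).1, h2' X hX fun n hn => (hX' n hn).2⟩⟩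

lemma Gen.nonempty {b S} (h : Gen U b S) : S.Nonempty := by
  obtain ⟨T, h1, h2⟩ := h
  have hne : ∀ c, ∃ n, n ∈ T c := fun c => Ultrafilter.nonempty_of_mem (h1 c)
  choose f hf using hne
  let L : ℕ → List ℕ := fun n => Nat.rec b (fun _ l => l ++ [f l]) n
  have Ls : ∀ n, L (n+1) = L n ++ [f (L n)] := fun n => rfl
  let X : ℕ → ℕ := fun n => if h : n < b.length then b[n] else f (L (n - b.length))
  have hb : pre X b.length = b := by
    apply List.ext_getElem
    · simp
    · intro i h1 h2
      simp [pre, X, h2]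
  have hL : ∀ n, pre X (b.length + n) = L n := by
    intro n
    induction n with
    | zero => exact hb
    | succ n ih =>
      rw [← add_assoc, pre_succ, ih, Ls]
      simp [X]
  refine ⟨X, h2 X hb fun n hn => ?_⟩
  obtain ⟨k, rfl⟩ := Nat.exists_eq_add_of_le hn
  rw [hL]
  have : X (b.length + k) = f (L k) := by simp [X]
  rw [this]; exact hf _

lemma gen_assemble {b : List ℕ} {S} (h : ∀ᶠ n in (U : Filter ℕ), Gen U (b ++ [n]) S) : Gen U b S := by
  classical
  have : ∀ n, ∃ T : List ℕ → Set ℕ, (∀ c, T c ∈ U) ∧ (Gen U (b ++ [n]) S →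
    ∀ X, pre X (b ++ [n]).length = b ++ [n] → (∀ m ≥ (b++[n]).length, X m ∈ T (pre X m)) → X ∈ S) := by
    intro n
    by_cases hn : Gen U (b ++ [n]) S
    · obtain ⟨T, h1, h2⟩ := hn
      exact ⟨T, h1, fun _ => h2⟩
    · exact ⟨fun _ => univ, fun _ => Filter.univ_mem, fun h => absurd h hn⟩
  choose T hT1 hT2 using this
  refine ⟨fun c => {n | Gen U (b ++ [n]) S} ∩ T (c.getD b.length 0) c, fun c => Filter.inter_mem h (hT1 _ _), ?_⟩
  intro X hX hX'
  have h0 := (hX' b.length le_rfl).1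
  have h1 : pre X (b ++ [X b.length]).length = b ++ [X b.length] := by
    simp [pre_succ, hX]
  refine hT2 (X b.length) h0 X h1 ?_
  intro m hm
  simp at hm
  have := (hX' m (by omega)).2
  have e : (pre X m).getD b.length 0 = X b.length := by
    simp [pre, List.getD, List.getElem?_map, List.getElem?_range (show b.length < m by omega)]
  rwa [e] at this

lemma gen_fusion {P : List ℕ → Prop} {S : ℕ → Set (ℕ → ℕ)}
    (h1 : ∀ c, P c → ∀ᶠ n in (U : Filter ℕ), P (c ++ [n]))
    (h2 : ∀ c, P c → ∀ m, Gen U c (S m)) {b} (hb : P b) : Gen U b (⋂ m, S m) := by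
  classical
  have : ∀ c m, ∃ T : List ℕ → Set ℕ, (∀ d, T d ∈ U) ∧ (P c →
    ∀ X, pre X c.length = c → (∀ n ≥ c.length, X n ∈ T (pre X n)) → X ∈ S m) := by
    intro c m
    by_cases hc : P c
    · obtain ⟨T, h1, h2⟩ := h2 c hc m
      exact ⟨T, h1, fun _ => h2⟩
    · exact ⟨fun _ => univ, fun _ => Filter.univ_mem, fun h => absurd h hc⟩
  choose T hT1 hT2 using this
  refine ⟨fun c => {n | P c → P (c ++ [n])} ∩
    ⋂ i ∈ Finset.range (c.length+1), ⋂ m ∈ Finset.range (i+1), T (c.take i) m c, ?_, ?_⟩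
  · intro c
    refine Filter.inter_mem ?_ ?_
    · by_cases hc : P c
      · exact (h1 c hc).mono fun n hn _ => hn
      · exact Filter.univ_mem' fun n h => absurd h hc
    · refine (Filter.biInter_finset_mem _).2 fun i _ => (Filter.biInter_finset_mem _).2 fun m _ => hT1 _ _ _
  · intro X hX hX'
    have hP : ∀ k, P (pre X (b.length + k)) := by
      intro k
      induction k with
      | zero => simpa [hX] using hb
      | succ k ih =>
        rw [← add_assoc, pre_succ]
        exact (hX' _ (by omega)).1 ih
    refine mem_iInter.2 fun m => ?_
    have hp := hP m
    refine hT2 _ m hp X (by simp) ?_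
    intro n hn
    simp at hn
    have := (hX' n (by omega)).2
    simp only [mem_iInter, Finset.mem_range, pre_length] at this
    have := this (b.length + m) (by omega) m (by omega)
    rwa [pre_take _ _ _ hn] at this

variable (U) in
/-- completely Ramsey sets -/
def CR (S : Set (ℕ → ℕ)) : Prop := ∀ b, Gen U b S ∨ Gen U b Sᶜ

lemma CR.compl {S} (h : CR U S) : CR U Sᶜ := fun b => by
  rw [compl_compl]; exact (h b).symm

lemma CR.iUnion {S : ℕ → Set (ℕ → ℕ)} (h : ∀ n, CR U (S n)) : CR U (⋃ n, S n) := by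
  intro b
  by_cases hb : Gen U b (⋃ n, S n)
  · exact Or.inl hb
  right
  rw [compl_iUnion]
  refine gen_fusion (P := fun c => ¬ Gen U c (⋃ n, S n)) ?_ ?_ hb
  · intro c hc
    rw [Ultrafilter.eventually_not]
    intro h
    exact hc (gen_assemble h)
  · intro c hc m
    exact (h m c).resolve_left fun h => hc (h.mono (subset_iUnion _ _))

lemma CR.iInter {S : ℕ → Set (ℕ → ℕ)} (h : ∀ n, CR U (S n)) : CR U (⋂ n, S n) := by
  rw [← compl_compl (⋂ n, S n), compl_iInter]
  exact (CR.iUnion fun n => (h n).compl).compl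

lemma cr_empty : CR U ∅ := fun b => Or.inr (by simpa using gen_univ b)

lemma CR.biUnion {ι : Type*} {A : Set ι} (hA : A.Countable) {S : ι → Set (ℕ → ℕ)}
    (h : ∀ i ∈ A, CR U (S i)) : CR U (⋃ i ∈ A, S i) := by
  rcases A.eq_empty_or_nonempty with rfl | hne
  · simpa using cr_empty
  · obtain ⟨f, rfl⟩ := hA.exists_eq_range hne
    rw [biUnion_range]
    exact CR.iUnion fun n => h _ ⟨n, rfl⟩

lemma CR.inter {S S'} (h : CR U S) (h' : CR U S') : CR U (S ∩ S') := by
  intro b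
  rcases h b with h | h
  · rcases h' b with h' | h'
    · exact Or.inl (h.inter h')
    · exact Or.inr (h'.mono fun x hx hx' => hx hx'.2)
  · exact Or.inr (h.mono fun x hx hx' => hx hx'.1)

lemma CR.union {S S'} (h : CR U S) (h' : CR U S') : CR U (S ∪ S') := by
  rw [← compl_compl (S ∪ S'), compl_union]
  exact (h.compl.inter h'.compl).compl

lemma exists_gen_of_iUnion {ι : Type*} {A : Set ι} (hA : A.Countable) {S : ι → Set (ℕ → ℕ)}
    (h : ∀ i ∈ A, CR U (S i)) (b) (hS : Gen U b (⋃ i ∈ A, S i)) : ∃ c, ∃ i ∈ A, Gen U c (S i) := by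
  rcases A.eq_empty_or_nonempty with rfl | hne
  · obtain ⟨x, hx⟩ := hS.nonempty
    simp at hx
  · obtain ⟨f, rfl⟩ := hA.exists_eq_range hne
    by_contra! hc
    have : Gen U b (⋂ n, (S (f n))ᶜ) := gen_fusion (P := fun _ => True) (by simp)
      (fun c _ m => (h _ ⟨m, rfl⟩ c).resolve_left (hc c _ ⟨m, rfl⟩)) trivial
    obtain ⟨x, hx⟩ := (this.inter hS).nonempty
    simp at hx
    obtain ⟨h1, i, hi⟩ := hx
    exact h1 i hi

lemma gen_shift_cons {c S} (h : Gen U c S) (n) : Gen U (n :: c) (sh ⁻¹' S) := by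
  obtain ⟨T, h1, h2⟩ := h
  refine ⟨fun d => T d.tail, fun d => h1 _, ?_⟩
  intro X hX hX'
  rw [List.length_cons, pre_cons] at hX
  refine h2 _ (List.cons.inj hX).2 fun m hm => ?_
  have := hX' (m+1) (by simpa using hm)
  rwa [pre_cons] at this

lemma gen_shift_nil {S} (h : Gen U [] S) : Gen U [] (sh ⁻¹' S) := by
  refine gen_assemble (Eventually.of_forall fun n => gen_shift_cons h n)

lemma CR.shift {S} (h : CR U S) : CR U (sh ⁻¹' S) := by
  intro b
  cases b with
  | nil => exact (h []).imp gen_shift_nil gen_shift_nil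
  | cons n c => exact (h c).imp (fun h => gen_shift_cons h n) (fun h => gen_shift_cons h n)

lemma CR.shift_iter {S} (h : CR U S) (i : ℕ) : CR U {X | (fun k => X (k+i)) ∈ S} := by
  induction i with
  | zero => exact h
  | succ i ih =>
    have := ih.shift
    convert this using 1
    ext X
    simp [sh, add_assoc]

lemma gen_forall_shift {S} (h : Gen U [] S) : Gen U [] {X | ∀ i, (fun k => X (k+i)) ∈ S} := by
  obtain ⟨T, h1, h2⟩ := h
  refine ⟨fun d => ⋂ i ∈ Finset.range (d.length+1), T (d.drop i), ?_, ?_⟩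
  · intro d
    exact (Filter.biInter_finset_mem _).2 fun i _ => h1 _
  · intro X _ hX i
    refine h2 _ rfl fun n _ => ?_
    have := hX (n+i) (by simp)
    simp only [mem_iInter, Finset.mem_range, pre_length] at this
    have := this i (by omega)
    rwa [pre_drop] at this

lemma cr_lt : CR U {X | X 0 < X 1} := by
  have step : ∀ S : Set (ℕ → ℕ), ∀ b, (∀ n, Gen U (b ++ [n]) S ∨ Gen U (b ++ [n]) Sᶜ) → Gen U b S ∨ Gen U b Sᶜ := by
    intro S b h
    by_cases h' : ∀ᶠ n in (U : Filter ℕ), Gen U (b ++ [n]) S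
    · exact Or.inl (gen_assemble h')
    · right
      rw [← Ultrafilter.eventually_not] at h'
      exact gen_assemble (h'.mono fun n hn => (h n).resolve_left hn)
  have two : ∀ a b c, Gen U (a :: b :: c) {X | X 0 < X 1} ∨ Gen U (a :: b :: c) {X | X 0 < X 1}ᶜ := by
    intro a b c
    have key : ∀ X, pre X (a :: b :: c).length = a :: b :: c → X 0 = a ∧ X 1 = b := by
      intro X hX
      rw [List.length_cons, List.length_cons, pre_cons, pre_cons] at hX
      simp at hX
      exact ⟨hX.1, hX.2.1⟩
    by_cases h : a < b
    · exact Or.inl ⟨fun _ => univ, fun _ => Filter.univ_mem, fun X hX _ => by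
        simp [key X hX, h]⟩
    · exact Or.inr ⟨fun _ => univ, fun _ => Filter.univ_mem, fun X hX _ => by
        simp only [mem_compl_iff, mem_ofPred_eq, key X hX, h, not_false_eq_true]⟩
  have one : ∀ a, Gen U [a] {X | X 0 < X 1} ∨ Gen U [a] {X | X 0 < X 1}ᶜ :=
    fun a => step _ _ fun n => two a n []
  intro b
  match b with
  | [] => exact step _ _ fun n => one n
  | [a] => exact one a
  | a :: b :: c => exact two a b c

lemma gen_lt (hU : (U : Filter ℕ) ≤ cofinite) : Gen U [] {X | X 0 < X 1} := by
  refine ⟨fun d => {n | ∀ m ∈ d, m < n}, ?_, ?_⟩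
  · intro d
    have : {n | ∀ m ∈ d, m < n} ∈ (cofinite : Filter ℕ) := by
      rw [Nat.cofinite_eq_atTop]
      induction d with
      | nil => simp
      | cons a d ih =>
        filter_upwards [ih, eventually_gt_atTop a] with n h1 h2
        simp only [List.mem_cons] at h1 ⊢
        rintro m (rfl | hm)
        · exact h2
        · exact h1 m hm
    exact hU this
  · intro X _ hX
    have := hX 1 (by simp)
    exact this (X 0) (by simp [pre])

end UT

open UT

inductive Tr : Type
  | leaf : Tr
  | node (e : Bool → Bool) (c : Bool → ℕ → Tr) : Tr

namespace Tr

inductive Le : Tr → Tr → Prop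
  | leaf (t : Tr) : Le leaf t
  | node (e : Bool → Bool) (c : Bool → ℕ → Tr) (e' : Bool → Bool) (c' : Bool → ℕ → Tr)
      (l : Bool → ℕ → ℕ) (he : ∀ s, e s = true → e' s = true)
      (h : ∀ s k, e s = true → Le (c s k) (c' s (l s k))) : Le (node e c) (node e' c')
  | bare (e : Bool → Bool) (c : Bool → ℕ → Tr) (t : Tr) (he : ∀ s, e s = false) : Le (node e c) t
  | drop (t : Tr) (e' : Bool → Bool) (c' : Bool → ℕ → Tr) (s : Bool) (k : ℕ) (hs : e' s = true)
      (h : Le t (c' s k)) : Le t (node e' c')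

/-- children of a tree on side `s` -/
def ch (s : Bool) : Tr → Set Tr
  | leaf => ∅
  | node e c => {w | e s = true ∧ ∃ k, w = c s k}

def Child (w z : Tr) : Prop := ∃ s, w ∈ ch s z

lemma child_wf : WellFounded Child := by
  refine ⟨fun z => ?_⟩
  induction z with
  | leaf => exact ⟨_, fun w ⟨s, hw⟩ => by simp [ch] at hw⟩
  | node e c ih =>
    refine ⟨_, fun w ⟨s, hw⟩ => ?_⟩
    obtain ⟨_, k, rfl⟩ := hw
    exact ih s k

lemma ch_countable (s z) : (ch s z).Countable := by
  cases z with
  | leaf => simp [ch]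
  | node e c =>
    refine (countable_range (c s)).mono ?_
    rintro w ⟨_, k, rfl⟩
    exact ⟨k, rfl⟩

lemma le_of_child {t w z s} (hw : w ∈ ch s z) (h : Le t w) : Le t z := by
  cases z with
  | leaf => simp [ch] at hw
  | node e c =>
    obtain ⟨hs, k, rfl⟩ := hw
    exact Le.drop _ _ _ _ _ hs h

lemma exists_of_not_le {z z'} (h : ¬ Le z z') : ∃ s w, w ∈ ch s z ∧ ∀ w' ∈ ch s z', ¬ Le w w' := by
  by_contra! hc
  apply h
  -- `z'` must be a node or z a leaf
  revert h hc
  induction z' with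
  | leaf =>
    intro h hc
    cases z with
    | leaf => exact Le.leaf _
    | node e c =>
      by_cases he : ∃ s, e s = true
      · obtain ⟨s, hs⟩ := he
        obtain ⟨w', hw', _⟩ := hc s (c s 0) ⟨hs, 0, rfl⟩
        simp [ch] at hw'
      · exact Le.bare _ _ _ (by simpa using he)
  | node e' c' ih =>
    intro h hc
    cases z with
    | leaf => exact Le.leaf _
    | node e c =>
      have : ∀ s k, ∃ l, e s = true → Le (c s k) (c' s l) := by
        intro s k
        by_cases hs : e s = true
        · obtain ⟨w', ⟨_, l, rfl⟩, hl⟩ := hc s (c s k) ⟨hs, k, rfl⟩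
          exact ⟨l, fun _ => hl⟩
        · exact ⟨0, fun h => absurd h hs⟩
      choose l hl using this
      refine Le.node _ _ _ _ l ?_ hl
      intro s hs
      obtain ⟨w', ⟨h, _⟩, _⟩ := hc s (c s 0) ⟨hs, 0, rfl⟩
      exact h

def Lt : Tr → Tr → Prop := Relation.TransGen Child
def Lte : Tr → Tr → Prop := Relation.ReflTransGen Child

lemma lt_wf : WellFounded Lt := child_wf.transGen

variable (U : Ultrafilter ℕ)

structure Nice (g : (ℕ → ℕ) → Tr) : Prop where
  ctb : (range g).Countable
  cr : ∀ v, CR U (g ⁻¹' {v})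
  bad : ∀ X, StrictMono X → ¬ Le (g X) (g (sh X))

variable {U}

lemma Nice.cr_set {g} (hg : Nice U g) (A : Set Tr) : CR U (g ⁻¹' A) := by
  have : g ⁻¹' A = ⋃ v ∈ (A ∩ range g), g ⁻¹' {v} := by
    ext X; simp
  rw [this]
  exact CR.biUnion (hg.ctb.mono inter_subset_right) fun v _ => hg.cr v

/-- limit of a pointwise decreasing sequence of nice arrays -/
lemma nice_limit {g : ℕ → (ℕ → ℕ) → Tr} (hg : ∀ n, Nice U (g n))
    (hd : ∀ n X, Lte (g (n+1) X) (g n X)) :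
    ∃ g', Nice U g' ∧ ∀ n X, Lte (g' X) (g n X) := by
  have hmono : ∀ X n k, Lte (g (n+k) X) (g n X) := by
    intro X n k
    induction k with
    | zero => exact Relation.ReflTransGen.refl
    | succ k ih => exact Relation.ReflTransGen.trans (hd (n+k) X) ih
  have hev : ∀ X, ∃ v, ∀ᶠ n in atTop, g n X = v := by
    intro X
    obtain ⟨n, hn⟩ : ∃ n, ∀ k, ¬ Lt (g k X) (g n X) := by
      obtain ⟨v, ⟨n, rfl⟩, hv⟩ := lt_wf.has_min (range fun n => g n X) ⟨_, 0, rfl⟩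
      exact ⟨n, fun k => hv _ ⟨k, rfl⟩⟩
    refine ⟨g n X, eventually_atTop.2 ⟨n, fun m hm => ?_⟩⟩
    obtain ⟨k, rfl⟩ := Nat.exists_eq_add_of_le hm
    rcases Relation.reflTransGen_iff_eq_or_transGen.1 (hmono X n k) with h | h
    · exact h.symm
    · exact absurd h (hn _)
  choose g' hg' using hev
  refine ⟨g', ⟨?_, ?_, ?_⟩, ?_⟩
  · refine (countable_iUnion fun n => (hg n).ctb).mono ?_
    rintro _ ⟨X, rfl⟩
    obtain ⟨n, hn⟩ := (hg' X).exists
    exact mem_iUnion.2 ⟨n, X, hn⟩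
  · intro v
    have : g' ⁻¹' {v} = ⋃ n, ⋂ m, g (n+m) ⁻¹' {v} := by
      ext X
      simp only [mem_preimage, mem_singleton_iff, mem_iUnion, mem_iInter]
      constructor
      · rintro rfl
        obtain ⟨n, hn⟩ := eventually_atTop.1 (hg' X)
        exact ⟨n, fun m => hn _ (by omega)⟩
      · rintro ⟨n, hn⟩
        obtain ⟨k, hk⟩ := eventually_atTop.1 (hg' X)
        rw [← hk (n+k) (by omega), hn]
    rw [this]
    exact CR.iUnion fun n => CR.iInter fun m => (hg _).cr v
  · intro X hX
    obtain ⟨n, h1, h2⟩ := ((hg' X).and (hg' (sh X))).exists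
    rw [← h1, ← h2]
    exact (hg n).bad X hX
  · intro n X
    obtain ⟨k, hk⟩ := eventually_atTop.1 (hg' X)
    rw [← hk (n+k) (by omega)]
    exact hmono X n k

variable (U) in
def Cond (g : (ℕ → ℕ) → Tr) (b : List ℕ) (v : Tr) (g' : (ℕ → ℕ) → Tr) : Prop :=
  Nice U g' ∧ (∀ X, Lte (g' X) (g X)) ∧ Gen U b {X | g' X = v ∧ Lt (g' X) (g X)}

lemma exists_minimal {g0} (hg0 : Nice U g0) : ∃ g, Nice U g ∧ ∀ b v g', ¬ Cond U g b v g' := by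
  classical
  have step : ∀ (g : (ℕ → ℕ) → Tr) (b : List ℕ), ∃ g1, Nice U g → (Nice U g1 ∧ (∀ X, Lte (g1 X) (g X)) ∧
      ∀ v g', Cond U g b v g' → ∃ v1, Gen U b {X | g1 X = v1} ∧ ∀ w g'', Cond U g b w g'' → ¬ Lt w v1) := by
    intro g b
    by_cases h : ∃ v g', Cond U g b v g'
    · obtain ⟨v, ⟨g', hg'⟩, hv⟩ := lt_wf.has_min {v | ∃ g', Cond U g b v g'} h
      refine ⟨g', fun hg => ⟨hg'.1, hg'.2.1, fun _ _ _ => ⟨v, hg'.2.2.mono fun X hX => hX.1, ?_⟩⟩⟩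
      intro w g'' hw
      exact hv w ⟨g'', hw⟩
    · exact ⟨g, fun hg => ⟨hg, fun _ => Relation.ReflTransGen.refl, fun v g' hv => absurd ⟨v, g', hv⟩ h⟩⟩
  choose st hst using step
  let G : ℕ → (ℕ → ℕ) → Tr := fun n => Nat.rec g0 (fun n g =>
    st g ((Encodable.decode (α := List ℕ) n).getD [])) n
  have Gs : ∀ n, G (n+1) = st (G n) ((Encodable.decode (α := List ℕ) n).getD []) := fun n => rfl
  have hN : ∀ n, Nice U (G n) := by
    intro n
    induction n with
    | zero => exact hg0
    | succ n ih => rw [Gs]; exact (hst _ _ ih).1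
  obtain ⟨g, hg, hgl⟩ := nice_limit hN (fun n X => by rw [Gs]; exact (hst _ _ (hN n)).2.1 X)
  refine ⟨g, hg, fun b v g' hc => ?_⟩
  have hb : ((Encodable.decode (α := List ℕ) (Encodable.encode b)).getD []) = b := by simp
  set i := Encodable.encode b
  have hs := hst (G i) b (hN i)
  have e : st (G i) b = G (i+1) := by rw [Gs, hb]
  rw [e] at hs
  have hc' : Cond U (G i) b v g' := by
    refine ⟨hc.1, fun X => (hc.2.1 X).trans (hgl _ X), hc.2.2.mono fun X hX => ⟨hX.1, ?_⟩⟩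
    exact Relation.TransGen.trans_left hX.2 (hgl _ X)
  obtain ⟨v1, h1, h2⟩ := hs.2.2 v g' hc'
  obtain ⟨X, hX1, hX2⟩ := (h1.inter hc.2.2).nonempty
  refine h2 v g' hc' ?_
  have := Relation.TransGen.trans_left hX2.2 (hgl (i+1) X)
  rw [hX2.1, hX1] at this
  exact this

theorem no_nice (hU : (U : Filter ℕ) ≤ cofinite) {g0} (hg0 : Nice U g0) : False := by
  classical
  obtain ⟨g, hg, hmin⟩ := exists_minimal hg0
  have : ∀ z z', ∃ s w, ¬ Le z z' → w ∈ ch s z ∧ ∀ w' ∈ ch s z', ¬ Le w w' := by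
    intro z z'
    by_cases h : Le z z'
    · exact ⟨true, z, fun h' => absurd h h'⟩
    · obtain ⟨s, w, h⟩ := exists_of_not_le h
      exact ⟨s, w, fun _ => h⟩
  choose σ w hw using this
  -- preimages of relations on (g X, g (sh X))
  have cr2 : ∀ R : Tr → Tr → Prop, CR U {X | R (g X) (g (sh X))} := by
    intro R
    have : {X | R (g X) (g (sh X))} = ⋃ z ∈ range g, (g ⁻¹' {z} ∩ sh ⁻¹' (g ⁻¹' {z' | R z z'})) := by
      ext X
      simp only [mem_iUnion, mem_inter_iff, mem_preimage, mem_singleton_iff, mem_range, exists_prop]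
      constructor
      · intro h
        exact ⟨g X, ⟨X, rfl⟩, rfl, h⟩
      · rintro ⟨z, _, h, h'⟩
        rw [← h] at h'
        exact h'
    rw [this]
    exact CR.biUnion hg.ctb fun z _ => (hg.cr z).inter (hg.cr_set _).shift
  let SM : Set (ℕ → ℕ) := {X | ∀ i, (fun k => X (k+i)) ∈ {X : ℕ → ℕ | X 0 < X 1}}
  have hSM : ∀ X, X ∈ SM → StrictMono X := by
    intro X hX
    refine strictMono_nat_of_lt_succ fun n => ?_
    have := hX n
    simpa [add_comm] using this
  have gSM : Gen U [] SM := gen_forall_shift (gen_lt hU)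
  have crF : ∀ S : Set (ℕ → ℕ), CR U S → CR U {X | ∀ i, (fun k => X (k+i)) ∈ S} := by
    intro S hS
    have : {X : ℕ → ℕ | ∀ i, (fun k => X (k+i)) ∈ S} = ⋂ i, {X | (fun k => X (k+i)) ∈ S} := by
      ext X; simp
    rw [this]
    exact CR.iInter fun i => hS.shift_iter i
  have crSM : CR U SM := crF _ cr_lt
  obtain ⟨s0, hs0⟩ : ∃ s0, Gen U [] (SM ∩ {X | σ (g X) (g (sh X)) = s0}) := by
    rcases cr2 (fun z z' => σ z z' = true) [] with h | h
    · exact ⟨true, gSM.inter h⟩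
    · refine ⟨false, gSM.inter (h.mono fun X hX => ?_)⟩
      simpa using hX
  set D := SM ∩ {X | σ (g X) (g (sh X)) = s0} with hD
  have crD : CR U D := crSM.inter (cr2 (fun z z' => σ z z' = s0))
  set D' : Set (ℕ → ℕ) := {X | ∀ i, (fun k => X (k+i)) ∈ D} with hD'
  have crD' : CR U D' := crF _ crD
  have gD' : Gen U [] D' := gen_forall_shift hs0
  have D'D : ∀ X ∈ D', X ∈ D := fun X hX => hX 0
  have D'sh : ∀ X ∈ D', sh X ∈ D' := by
    intro X hX i
    have := hX (i+1)
    exact this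
  let g' : (ℕ → ℕ) → Tr := fun X => if X ∈ D' then w (g X) (g (sh X)) else g X
  have hin : ∀ X ∈ D', g' X ∈ ch s0 (g X) ∧ ∀ w' ∈ ch s0 (g (sh X)), ¬ Le (g' X) w' := by
    intro X hX
    have h := hw _ _ (hg.bad X (hSM X (D'D X hX).1))
    rw [(D'D X hX).2] at h
    simpa [g', hX] using h
  have hout : ∀ X, X ∉ D' → g' X = g X := fun X hX => by simp [g', hX]
  have nice' : Nice U g' := by
    refine ⟨?_, ?_, ?_⟩
    · have : range g' ⊆ range g ∪ ⋃ z ∈ range g, ch s0 z := by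
        rintro _ ⟨X, rfl⟩
        by_cases hX : X ∈ D'
        · exact Or.inr (mem_biUnion ⟨X, rfl⟩ (hin X hX).1)
        · exact Or.inl ⟨X, (hout X hX).symm⟩
      exact (hg.ctb.union (hg.ctb.biUnion fun z _ => ch_countable _ _)).mono this
    · intro v
      have : g' ⁻¹' {v} = (D' ∩ {X | w (g X) (g (sh X)) = v}) ∪ (D'ᶜ ∩ g ⁻¹' {v}) := by
        ext X
        by_cases hX : X ∈ D' <;> simp [g', hX]
      rw [this]
      exact (crD'.inter (cr2 fun z z' => w z z' = v)).union (crD'.compl.inter (hg.cr v))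
    · intro X hX hle
      by_cases h1 : X ∈ D'
      · exact (hin X h1).2 _ (hin _ (D'sh X h1)).1 hle
      · rw [hout X h1] at hle
        by_cases h2 : sh X ∈ D'
        · exact hg.bad X hX (le_of_child (hin _ h2).1 hle)
        · rw [hout _ h2] at hle
          exact hg.bad X hX hle
  have hlt : ∀ X ∈ D', Lt (g' X) (g X) := fun X hX => Relation.TransGen.single ⟨s0, (hin X hX).1⟩
  have hle : ∀ X, Lte (g' X) (g X) := by
    intro X
    by_cases hX : X ∈ D'
    · exact (hlt X hX).to_reflTransGen
    · rw [hout X hX]; exact Relation.ReflTransGen.refl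
  obtain ⟨b, v, _, hv⟩ := exists_gen_of_iUnion (S := fun v => D' ∩ g' ⁻¹' {v}) nice'.ctb
    (fun v _ => crD'.inter (nice'.cr v)) [] (gD'.mono fun X hX => by simp [hX])
  exact hmin b v g' ⟨nice', hle, hv.mono fun X hX => ⟨hX.2, hlt X hX.1⟩⟩

theorem wqo (τ : ℕ → Tr) : ∃ n m, n < m ∧ Le (τ n) (τ m) := by
  by_contra! h
  have hU : ((hyperfilter ℕ : Ultrafilter ℕ) : Filter ℕ) ≤ cofinite := hyperfilter_le_cofinite
  refine no_nice hU (g0 := fun X => τ (X 0)) ⟨?_, ?_, ?_⟩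
  · refine (countable_range τ).mono ?_
    rintro _ ⟨X, rfl⟩
    exact ⟨_, rfl⟩
  · intro v b
    cases b with
    | nil =>
      by_cases h : ∀ᶠ n in ((hyperfilter ℕ : Ultrafilter ℕ) : Filter ℕ), τ n = v
      · left
        refine ⟨fun _ => {n | τ n = v}, fun _ => h, fun X _ hX => hX 0 (by simp)⟩
      · right
        rw [← Ultrafilter.eventually_not] at h
        refine ⟨fun _ => {n | τ n ≠ v}, fun _ => h, fun X _ hX => hX 0 (by simp)⟩
    | cons a c =>
      have key : ∀ X, pre X (a :: c).length = a :: c → X 0 = a := by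
        intro X hX
        rw [List.length_cons, pre_cons] at hX
        exact (List.cons.inj hX).1
      by_cases h : τ a = v
      · exact Or.inl ⟨fun _ => univ, fun _ => Filter.univ_mem, fun X hX _ => by simp [key X hX, h]⟩
      · exact Or.inr ⟨fun _ => univ, fun _ => Filter.univ_mem, fun X hX _ => by simp [key X hX, h]⟩
  · intro X hX
    exact h _ _ (hX Nat.zero_lt_one)

end Tr

/-! ### order isomorphisms between intervals -/

structure IsoOn (ψ : ℝ → ℝ) (a b p q : ℝ) : Prop where
  mono : StrictMonoOn ψ (Icc a b)
  surj : ψ '' Icc a b = Icc p q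

namespace IsoOn
variable {ψ : ℝ → ℝ} {a b p q : ℝ}

lemma mapsTo (h : IsoOn ψ a b p q) {x} (hx : x ∈ Icc a b) : ψ x ∈ Icc p q := by
  rw [← h.surj]; exact ⟨x, hx, rfl⟩

lemma left (h : IsoOn ψ a b p q) (hab : a ≤ b) : ψ a = p := by
  have h1 := h.mapsTo (left_mem_Icc.2 hab)
  have h2 : p ∈ Icc p q := ⟨le_rfl, h1.1.trans h1.2⟩
  rw [← h.surj] at h2
  obtain ⟨x, hx, hxp⟩ := h2
  have := h.mono.monotoneOn (left_mem_Icc.2 hab) hx hx.1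
  exact le_antisymm (this.trans hxp.le) h1.1

lemma right (h : IsoOn ψ a b p q) (hab : a ≤ b) : ψ b = q := by
  have h1 := h.mapsTo (right_mem_Icc.2 hab)
  have h2 : q ∈ Icc p q := ⟨h1.1.trans h1.2, le_rfl⟩
  rw [← h.surj] at h2
  obtain ⟨x, hx, hxp⟩ := h2
  have := h.mono.monotoneOn hx (right_mem_Icc.2 hab) hx.2
  exact le_antisymm h1.2 (hxp.symm.le.trans this)

lemma mapsTo_Ioo (h : IsoOn ψ a b p q) {x} (hx : x ∈ Ioo a b) : ψ x ∈ Ioo p q := by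
  have hab := (hx.1.trans hx.2).le
  rw [← h.left hab, ← h.right hab]
  exact ⟨h.mono (left_mem_Icc.2 hab) (Ioo_subset_Icc_self hx) hx.1,
    h.mono (Ioo_subset_Icc_self hx) (right_mem_Icc.2 hab) hx.2⟩

lemma lt (h : IsoOn ψ a b p q) (hab : a < b) : p < q := by
  rw [← h.left hab.le, ← h.right hab.le]
  exact h.mono (left_mem_Icc.2 hab.le) (right_mem_Icc.2 hab.le) hab

/-- restriction to a subinterval -/
lemma restrict (h : IsoOn ψ a b p q) {c d} (hc : c ∈ Icc a b) (hd : d ∈ Icc a b) (_hcd : c ≤ d) :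
    IsoOn ψ c d (ψ c) (ψ d) := by
  have hs : Icc c d ⊆ Icc a b := Icc_subset_Icc hc.1 hd.2
  refine ⟨h.mono.mono hs, ?_⟩
  ext y
  constructor
  · rintro ⟨x, hx, rfl⟩
    exact ⟨h.mono.monotoneOn hc (hs hx) hx.1, h.mono.monotoneOn (hs hx) hd hx.2⟩
  · intro hy
    have : y ∈ Icc p q := ⟨(h.mapsTo hc).1.trans hy.1, hy.2.trans (h.mapsTo hd).2⟩
    rw [← h.surj] at this
    obtain ⟨x, hx, rfl⟩ := this
    exact ⟨x, ⟨(h.mono.le_iff_le hc hx).1 hy.1, (h.mono.le_iff_le hx hd).1 hy.2⟩, rfl⟩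

lemma id (a b : ℝ) : IsoOn (fun x => x) a b a b := ⟨strictMonoOn_id, by simp⟩

lemma glue {ψ₁ ψ₂ : ℝ → ℝ} {c y} (hac : a ≤ c) (hcb : c ≤ b) (h1 : IsoOn ψ₁ a c p y) (h2 : IsoOn ψ₂ c b y q) :
    IsoOn (fun x => if x ≤ c then ψ₁ x else ψ₂ x) a b p q := by
  have e1 : ψ₁ c = y := h1.right hac
  have e2 : ψ₂ c = y := h2.left hcb
  refine ⟨?_, ?_⟩
  · intro x hx x' hx' hxx
    simp only
    split_ifs with h h'
    · exact h1.mono ⟨hx.1, h⟩ ⟨hx'.1, h'⟩ hxx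
    · have a1 := h1.mono.monotoneOn ⟨hx.1, h⟩ (right_mem_Icc.2 hac) h
      have a2 := h2.mono (left_mem_Icc.2 hcb) ⟨(not_le.1 h').le, hx'.2⟩ (not_le.1 h')
      linarith
    · exfalso; linarith
    · exact h2.mono ⟨(not_le.1 h).le, hx.2⟩ ⟨by linarith, hx'.2⟩ hxx
  · have hy1 := h1.mapsTo (right_mem_Icc.2 hac)
    have hy2 := h2.mapsTo (left_mem_Icc.2 hcb)
    rw [e1] at hy1
    rw [e2] at hy2
    ext t
    constructor
    · rintro ⟨x, hx, rfl⟩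
      simp only
      split_ifs with h
      · have := h1.mapsTo ⟨hx.1, h⟩
        exact ⟨this.1, this.2.trans hy2.2⟩
      · have := h2.mapsTo (x := x) ⟨(not_le.1 h).le, hx.2⟩
        exact ⟨hy1.1.trans this.1, this.2⟩
    · intro ht
      rcases le_or_gt t y with h | h
      · have : t ∈ Icc p y := ⟨ht.1, h⟩
        rw [← h1.surj] at this
        obtain ⟨x, hx, rfl⟩ := this
        exact ⟨x, ⟨hx.1, hx.2.trans hcb⟩, by simp [hx.2]⟩
      · have : t ∈ Icc y q := ⟨h.le, ht.2⟩
        rw [← h2.surj] at this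
        obtain ⟨x, hx, rfl⟩ := this
        have : c < x := by
          rcases hx.1.eq_or_lt with rfl | h'
          · linarith
          · exact h'
        exact ⟨x, ⟨hac.trans hx.1, hx.2⟩, by simp [this]⟩

lemma neg (h : IsoOn ψ a b p q) : IsoOn (fun x => -ψ (-x)) (-b) (-a) (-q) (-p) := by
  refine ⟨?_, ?_⟩
  · intro x hx y hy hxy
    have h1 : -y ∈ Icc a b := ⟨by linarith [hy.2], by linarith [hy.1]⟩
    have h2 : -x ∈ Icc a b := ⟨by linarith [hx.2], by linarith [hx.1]⟩
    have := h.mono h1 h2 (by linarith)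
    simp only; linarith
  · ext t
    constructor
    · rintro ⟨x, hx, rfl⟩
      have := h.mapsTo (x := -x) ⟨by linarith [hx.2], by linarith [hx.1]⟩
      exact ⟨by simp only; linarith [this.2], by simp only; linarith [this.1]⟩
    · intro ht
      have : -t ∈ Icc p q := ⟨by linarith [ht.2], by linarith [ht.1]⟩
      rw [← h.surj] at this
      obtain ⟨x, hx, hxt⟩ := this
      exact ⟨-x, ⟨by linarith [hx.2], by linarith [hx.1]⟩, by simp [hxt]⟩

lemma linear {a b p q : ℝ} (hab : a < b) (hpq : p < q) : ∃ ψ, IsoOn ψ a b p q := by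
  refine ⟨fun x => p + (x - a) * ((q - p) / (b - a)), ?_, ?_⟩
  · intro x _ y _ hxy
    have : 0 < (q - p) / (b - a) := div_pos (by linarith) (by linarith)
    simp only
    nlinarith
  · have hb : 0 < b - a := by linarith
    have hq : 0 < q - p := by linarith
    ext t
    constructor
    · rintro ⟨x, hx, rfl⟩
      have h1 : 0 ≤ (x - a) * ((q - p) / (b - a)) := mul_nonneg (by linarith [hx.1]) (by positivity)
      have h2 : (x - a) * ((q - p) / (b - a)) ≤ (b - a) * ((q - p) / (b - a)) :=
        mul_le_mul_of_nonneg_right (by linarith [hx.2]) (by positivity)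
      rw [mul_div_cancel₀ _ hb.ne'] at h2
      exact ⟨by simp only; linarith, by simp only; linarith⟩
    · intro ht
      refine ⟨a + (t - p) * ((b - a) / (q - p)), ⟨?_, ?_⟩, ?_⟩
      · have : 0 ≤ (t - p) * ((b - a) / (q - p)) := mul_nonneg (by linarith [ht.1]) (by positivity)
        linarith
      · have h2 : (t - p) * ((b - a) / (q - p)) ≤ (q - p) * ((b - a) / (q - p)) :=
          mul_le_mul_of_nonneg_right (by linarith [ht.2]) (by positivity)
        rw [mul_div_cancel₀ _ hq.ne'] at h2
        linarith
      · simp only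
        field_simp
        ring

end IsoOn

/-- index of the piece `(r (k+1), r k]` containing `x`. -/
lemma exists_piece {r : ℕ → ℝ} {z : ℝ} (_hr : StrictAnti r) (hz : Tendsto r atTop (𝓝 z)) {x : ℝ}
    (hx : z < x) (hx0 : x ≤ r 0) : ∃ k, r (k+1) < x ∧ x ≤ r k := by
  classical
  have hev : ∃ k, r k < x := (hz.eventually (gt_mem_nhds hx)).exists
  have h := Nat.find_spec hev
  have hm := fun k => Nat.find_min hev (m := k)
  set n := Nat.find hev
  have hn : n ≠ 0 := by
    intro h0
    rw [h0] at h
    linarith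
  obtain ⟨k, hk⟩ := Nat.exists_eq_succ_of_ne_zero hn
  rw [hk] at h
  exact ⟨k, h, not_lt.1 (hm k (by omega))⟩

lemma StrictAnti.gt_lim {r : ℕ → ℝ} {z : ℝ} (hr : StrictAnti r) (hz : Tendsto r atTop (𝓝 z)) (k) : z < r k :=
  (hr.antitone.le_of_tendsto hz (k+1)).trans_lt (hr (Nat.lt_succ_self k))

lemma IsoOn.glue_seq {r y : ℕ → ℝ} {z z' : ℝ} (hr : StrictAnti r) (hrz : Tendsto r atTop (𝓝 z))
    (hy : Tendsto y atTop (𝓝 z')) {ψ : ℕ → ℝ → ℝ}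
    (h : ∀ k, IsoOn (ψ k) (r (k+1)) (r k) (y (k+1)) (y k)) :
    ∃ φ, IsoOn φ z (r 0) z' (y 0) ∧ (φ z = z') ∧ ∀ k, ∀ x ∈ Ioc (r (k+1)) (r k), φ x = ψ k x := by
  classical
  have hya : StrictAnti y := strictAnti_nat_of_succ_lt fun k => (h k).lt (hr (Nat.lt_succ_self k))
  have hyz : ∀ k, z' < y k := fun k => hya.gt_lim hy k
  have hrz' : ∀ k, z < r k := fun k => hr.gt_lim hrz k
  let φ : ℝ → ℝ := fun x => if hx : ∃ k, r (k+1) < x ∧ x ≤ r k then ψ hx.choose x else z'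
  have hφ : ∀ k, ∀ x ∈ Ioc (r (k+1)) (r k), φ x = ψ k x := by
    intro k x hx
    have hx' : ∃ k, r (k+1) < x ∧ x ≤ r k := ⟨k, hx⟩
    have : hx'.choose = k := by
      have hs := hx'.choose_spec
      set l := hx'.choose
      by_contra hne
      rcases Nat.lt_or_gt_of_ne hne with h1 | h1
      · have := hr.antitone (show l+1 ≤ k from h1)
        linarith [hx.1, hx.2, hs.1]
      · have := hr.antitone (show k+1 ≤ l from h1)
        linarith [hx.1, hx.2, hs.2]
    simp only [φ, dif_pos hx', this]
  have hφz : φ z = z' := by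
    have : ¬ ∃ k, r (k+1) < z ∧ z ≤ r k := by
      rintro ⟨k, h1, _⟩
      linarith [hrz' (k+1)]
    simp only [φ, dif_neg this]
  have hmem : ∀ k, ∀ x ∈ Ioc (r (k+1)) (r k), φ x ∈ Ioc (y (k+1)) (y k) := by
    intro k x hx
    rw [hφ k x hx]
    have hkk := (hr (Nat.lt_succ_self k)).le
    refine ⟨?_, ((h k).mapsTo (Ioc_subset_Icc_self hx)).2⟩
    rw [← (h k).left hkk]
    exact (h k).mono (left_mem_Icc.2 hkk) (Ioc_subset_Icc_self hx) hx.1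
  refine ⟨φ, ⟨?_, ?_⟩, hφz, hφ⟩
  · intro x hx x' hx' hxx
    obtain ⟨k', hk'⟩ := exists_piece hr hrz (hx.1.trans_lt hxx) hx'.2
    rcases hx.1.eq_or_lt with rfl | hzx
    · rw [hφz]
      exact (hyz _).trans (hmem k' x' hk').1
    · obtain ⟨k, hk⟩ := exists_piece hr hrz hzx hx.2
      rcases Nat.lt_trichotomy k k' with hlt | rfl | hlt
      · exfalso
        have := hr.antitone (show k+1 ≤ k' from hlt)
        linarith [hk.1, hk'.2]
      · rw [hφ k x hk, hφ k x' hk']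
        exact (h k).mono (Ioc_subset_Icc_self hk) (Ioc_subset_Icc_self hk') hxx
      · have := hya.antitone (show k'+1 ≤ k from hlt)
        linarith [(hmem k x hk).2, (hmem k' x' hk').1]
  · ext t
    constructor
    · rintro ⟨x, hx, rfl⟩
      rcases hx.1.eq_or_lt with rfl | hzx
      · rw [hφz]; exact ⟨le_rfl, (hyz 0).le⟩
      · obtain ⟨k, hk⟩ := exists_piece hr hrz hzx hx.2
        have := hmem k x hk
        exact ⟨((hyz _).trans this.1).le, this.2.trans (hya.antitone (Nat.zero_le k))⟩
    · intro ht
      rcases ht.1.eq_or_lt with rfl | hzt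
      · exact ⟨z, ⟨le_rfl, (hrz' 0).le⟩, hφz⟩
      · obtain ⟨k, hk⟩ := exists_piece hya hy hzt ht.2
        have : t ∈ Icc (y (k+1)) (y k) := Ioc_subset_Icc_self hk
        rw [← (h k).surj] at this
        obtain ⟨x, hx, rfl⟩ := this
        have hx1 : r (k+1) < x := by
          rcases hx.1.eq_or_lt with rfl | h'
          · have := (h k).left (hr (Nat.lt_succ_self k)).le
            linarith [hk.1]
          · exact h'
        exact ⟨x, ⟨(hrz' _).le.trans hx.1, hx.2.trans (hr.antitone (Nat.zero_le k))⟩, hφ k x ⟨hx1, hx.2⟩⟩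

/-! ### Embeddings carrying marks `M` into `W` -/

def Emb (M W : Set ℝ) (a b p q : ℝ) : Prop :=
  ∃ ψ, IsoOn ψ a b p q ∧ ∀ x ∈ M ∩ Ioo a b, ψ x ∈ W

lemma Emb.glue {M W : Set ℝ} {a b c p q y} (hac : a ≤ c) (hcb : c ≤ b) (hc : c ∈ M → y ∈ W)
    (h1 : Emb M W a c p y) (h2 : Emb M W c b y q) : Emb M W a b p q := by
  obtain ⟨ψ₁, h1, h1'⟩ := h1
  obtain ⟨ψ₂, h2, h2'⟩ := h2
  refine ⟨_, h1.glue hac hcb h2, ?_⟩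
  rintro x ⟨hxM, hx⟩
  split_ifs with h
  · rcases h.eq_or_lt with rfl | h
    · rw [h1.right hac]; exact hc hxM
    · exact h1' x ⟨hxM, hx.1, h⟩
  · exact h2' x ⟨hxM, not_le.1 h, hx.2⟩

lemma Emb.glue_seq {M W : Set ℝ} {r y : ℕ → ℝ} {z z' : ℝ} (hr : StrictAnti r)
    (hrz : Tendsto r atTop (𝓝 z)) (hy : Tendsto y atTop (𝓝 z')) (hM : ∀ k, r (k+1) ∉ M)
    (h : ∀ k, Emb M W (r (k+1)) (r k) (y (k+1)) (y k)) : Emb M W z (r 0) z' (y 0) := by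
  choose ψ h1 h2 using h
  obtain ⟨φ, hφ, -, h3⟩ := IsoOn.glue_seq hr hrz hy h1
  refine ⟨φ, hφ, ?_⟩
  rintro x ⟨hxM, hx⟩
  obtain ⟨k, hk⟩ := exists_piece hr hrz hx.1 hx.2.le
  rw [h3 k x hk]
  refine h2 k x ⟨hxM, hk.1, ?_⟩
  rcases hk.2.eq_or_lt with h' | h'
  · exfalso
    cases k with
    | zero => linarith [hx.2]
    | succ k => exact hM k (h' ▸ hxM)
  · exact h'

lemma Emb.empty {M W : Set ℝ} {a b p q} (hab : a < b) (hpq : p < q) (h : M ∩ Ioo a b = ∅) : Emb M W a b p q := by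
  obtain ⟨ψ, hψ⟩ := IsoOn.linear hab hpq
  exact ⟨ψ, hψ, by simp [h]⟩

lemma Emb.single {M W : Set ℝ} {a b p q m w} (hab : a < b) (h : M ∩ Ioo a b ⊆ {m}) (hw : w ∈ W)
    (hwp : w ∈ Ioo p q) : Emb M W a b p q := by
  by_cases hm : m ∈ Ioo a b
  · refine Emb.glue (c := m) (y := w) hm.1.le hm.2.le (fun _ => hw) (Emb.empty hm.1 hwp.1 ?_) (Emb.empty hm.2 hwp.2 ?_)
    · ext x
      simp only [mem_inter_iff, mem_Ioo, mem_empty_iff_false, iff_false]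
      rintro ⟨h1, h2⟩
      exact h2.2.ne (h ⟨h1, h2.1, h2.2.trans hm.2⟩)
    · ext x
      simp only [mem_inter_iff, mem_Ioo, mem_empty_iff_false, iff_false]
      rintro ⟨h1, h2⟩
      exact h2.1.ne' (h ⟨h1, hm.1.trans h2.1, h2.2⟩)
  · refine Emb.empty hab (hwp.1.trans hwp.2) ?_
    ext x
    simp only [mem_inter_iff, mem_empty_iff_false, iff_false]
    rintro ⟨h1, h2⟩
    have := h ⟨h1, h2⟩
    rw [mem_singleton_iff] at this
    exact hm (this ▸ h2)

lemma Emb.neg {M W : Set ℝ} {a b p q} (h : Emb M W a b p q) :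
    Emb (Neg.neg ⁻¹' M) (Neg.neg ⁻¹' W) (-b) (-a) (-q) (-p) := by
  obtain ⟨ψ, h1, h2⟩ := h
  refine ⟨_, h1.neg, ?_⟩
  rintro x ⟨hx, hx'⟩
  have := h2 (-x) ⟨hx, by linarith [hx'.2], by linarith [hx'.1]⟩
  simpa using this

lemma cut_left {M : Set ℝ} {a b} (ha : a ∉ closure M) (hab : a < b) : ∃ a' ∈ Ioo a b, ∀ x ∈ Icc a a', x ∉ M := by
  have := isClosed_closure.isOpen_compl.mem_nhds ha
  obtain ⟨ε, hε, h⟩ := Metric.mem_nhds_iff.1 this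
  refine ⟨min (a + ε/2) ((a+b)/2), ⟨lt_min (by linarith) (by linarith), (min_le_right _ _).trans_lt (by linarith)⟩, ?_⟩
  intro x hx hxM
  have hb : x ∈ Metric.ball a ε → False := fun hx => h hx (subset_closure hxM)
  apply hb
  rw [Metric.mem_ball, Real.dist_eq, abs_lt]
  have := hx.2.trans (min_le_left _ _)
  exact ⟨by linarith [hx.1], by linarith⟩

lemma Emb.widen_right {M W : Set ℝ} {a b p q q'} (hb : b ∉ closure M) (hab : a < b) (hq : q ≤ q')
    (h : Emb M W a b p q) : Emb M W a b p q' := by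
  have hb' : -b ∉ closure (Neg.neg ⁻¹' M) := by
    have : closure (Neg.neg ⁻¹' M) = Neg.neg ⁻¹' closure M :=
      (Homeomorph.neg ℝ).preimage_closure M |>.symm
    rw [this]; simpa using hb
  obtain ⟨c, hc, hcM⟩ := cut_left hb' (show -b < -a by linarith)
  obtain ⟨ψ, h1, h2⟩ := h
  have hc1 : -c ∈ Ioo a b := ⟨by linarith [hc.2], by linarith [hc.1]⟩
  have hm := h1.mapsTo_Ioo hc1
  refine Emb.glue (c := -c) (y := ψ (-c)) hc1.1.le hc1.2.le (fun h => absurd h (hcM c ⟨hc.1.le, le_rfl⟩)) ?_ ?_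
  · refine ⟨ψ, ?_, fun x hx => h2 x ⟨hx.1, hx.2.1, hx.2.2.trans hc1.2⟩⟩
    have := h1.restrict (left_mem_Icc.2 hab.le) (Ioo_subset_Icc_self hc1) hc1.1.le
    rwa [h1.left hab.le] at this
  · refine Emb.empty hc1.2 (hm.2.trans_le hq) ?_
    ext x
    simp only [mem_inter_iff, mem_Ioo, mem_empty_iff_false, iff_false]
    rintro ⟨h1, h2⟩
    exact hcM (-x) ⟨by linarith [h2.2], by linarith [h2.1]⟩ (by simpa using h1)

/-! ### the tree machine -/

/-- Cousin type lemma. -/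
lemma cousin {C : Set ℝ} {P : ℝ → ℝ → Prop} {a b : ℝ} (hab : a < b) (ha : a ∈ C) (hb : b ∈ C)
    (hd : ∀ u v, a ≤ u → u < v → v ≤ b → ∃ c ∈ Ioo u v, c ∈ C)
    (ht : ∀ u c v, a ≤ u → u < c → c < v → v ≤ b → u ∈ C → c ∈ C → v ∈ C → P u c → P c v → P u v)
    (hl : ∀ y ∈ Icc a b, ∃ ε > 0, ∀ c d, c ∈ C → d ∈ C → a ≤ c → d ≤ b → c < d → y - ε < c → d < y + ε →
      c ≤ y → y ≤ d → P c d) : P a b := by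
  let A : Set ℝ := {x | x ∈ Icc a b ∧ ∀ d ∈ C, a < d → d ≤ x → P a d}
  have haA : a ∈ A := ⟨left_mem_Icc.2 hab.le, fun d _ h1 h2 => absurd h1 (not_lt.2 h2)⟩
  have hbdd : BddAbove A := ⟨b, fun x hx => hx.1.2⟩
  set s := sSup A with hs
  have has : a ≤ s := le_csSup hbdd haA
  have hsb : s ≤ b := csSup_le ⟨a, haA⟩ fun x hx => hx.1.2
  obtain ⟨ε, hε, hP⟩ := hl s ⟨has, hsb⟩
  have hlt : ∀ d ∈ C, a < d → d < s → P a d := by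
    intro d hd h1 h2
    obtain ⟨x, hx, hdx⟩ := exists_lt_of_lt_csSup ⟨a, haA⟩ h2
    exact hx.2 d hd h1 hdx.le
  have hge : ∀ d ∈ C, a < d → d ≤ b → s ≤ d → d < s + ε → P a d := by
    intro d hdC h1 h2 h3 h4
    rcases has.eq_or_lt with h | h
    · exact hP a d ha hdC le_rfl h2 h1 (by linarith) h4 has h3
    · obtain ⟨c, hc, hcC⟩ := hd (max a (s - ε)) s (le_max_left _ _) (max_lt h (by linarith)) hsb
      have hac := (le_max_left _ _).trans_lt hc.1
      have hsc := (le_max_right _ _).trans_lt hc.1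
      exact ht a c d le_rfl hac (hc.2.trans_le h3) h2 ha hcC hdC (hlt c hcC hac hc.2)
        (hP c d hcC hdC hac.le h2 (hc.2.trans_le h3) hsc h4 hc.2.le h3)
  by_cases hsb' : s + ε ≤ b
  · exfalso
    have : s + ε/2 ∈ A := by
      refine ⟨⟨by linarith, by linarith⟩, fun d hdC h1 h2 => ?_⟩
      rcases lt_or_ge d s with h | h
      · exact hlt d hdC h1 h
      · exact hge d hdC h1 (by linarith) h (by linarith)
    have := le_csSup hbdd this
    linarith
  · exact hge b hb hab le_rfl hsb (by linarith)

inductive ChainOf (M : Set ℝ) (Q : ℝ → ℝ → Prop) : ℝ → ℝ → Prop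
  | single (a b : ℝ) (hab : a < b) (ha : a ∉ closure M) (hb : b ∉ closure M) (h : Q a b) : ChainOf M Q a b
  | trans (a c b : ℝ) (h1 : ChainOf M Q a c) (h2 : ChainOf M Q c b) : ChainOf M Q a b

namespace ChainOf
variable {M : Set ℝ} {Q Q' : ℝ → ℝ → Prop} {a b : ℝ}

lemma lt (h : ChainOf M Q a b) : a < b := by
  induction h with
  | single a b hab => exact hab
  | trans a c b _ _ h1 h2 => exact h1.trans h2

lemma cut_left (h : ChainOf M Q a b) : a ∉ closure M := by
  induction h with
  | single a b hab ha hb => exact ha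
  | trans a c b _ _ h1 h2 => exact h1

lemma mono (hQ : ∀ a b, Q a b → Q' a b) (h : ChainOf M Q a b) : ChainOf M Q' a b := by
  induction h with
  | single a b hab ha hb h => exact single a b hab ha hb (hQ _ _ h)
  | trans a c b _ _ h1 h2 => exact trans a c b h1 h2

/-- countable extraction -/
lemma extract {R : Tr → Prop} {X : Tr → ℝ → ℝ → Prop}
    (h : ChainOf M (fun a b => ∃ τ, R τ ∧ X τ a b) a b) :
    ∃ c : ℕ → Tr, (∀ i, R (c i)) ∧ ChainOf M (fun a b => ∃ i, X (c i) a b) a b := by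
  induction h with
  | single a b hab ha hb h =>
    obtain ⟨τ, h1, h2⟩ := h
    exact ⟨fun _ => τ, fun _ => h1, single a b hab ha hb ⟨0, h2⟩⟩
  | trans a c b _ _ h1 h2 =>
    obtain ⟨f, hf, hf'⟩ := h1
    obtain ⟨g, hg, hg'⟩ := h2
    refine ⟨fun n => if n % 2 = 0 then f (n/2) else g (n/2), fun i => ?_, trans a c b
      (hf'.mono fun a b ⟨i, hi⟩ => ⟨2*i, ?_⟩) (hg'.mono fun a b ⟨i, hi⟩ => ⟨2*i+1, ?_⟩)⟩
    · dsimp only; split_ifs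
      · exact hf _
      · exact hg _
    · simpa using hi
    · have : (2*i+1)/2 = i := by omega
      simpa [this, Nat.add_mod] using hi

end ChainOf

def RHalf (M : Set ℝ) (Q : ℝ → ℝ → Prop) (z b : ℝ) : Prop :=
  ∃ r : ℕ → ℝ, r 0 = b ∧ StrictAnti r ∧ Tendsto r atTop (𝓝 z) ∧ ∀ k, ChainOf M Q (r (k+1)) (r k)

lemma RHalf.mono {M : Set ℝ} {Q Q' : ℝ → ℝ → Prop} {z b} (hQ : ∀ a b, Q a b → Q' a b) (h : RHalf M Q z b) :
    RHalf M Q' z b := by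
  obtain ⟨r, h0, h1, h2, h3⟩ := h
  exact ⟨r, h0, h1, h2, fun k => (h3 k).mono hQ⟩

lemma half_emb {M W : Set ℝ} {Q : ℝ → ℝ → Prop} {z b z' q : ℝ} (hq : z' < q)
    (hQ : ∀ a b, a < b → Q a b → ∀ ε > 0, ∃ p1 q1, z' < p1 ∧ q1 < z' + ε ∧ Emb M W a b p1 q1)
    (h : RHalf M Q z b) : Emb M W z b z' q := by
  have hchain : ∀ a b, ChainOf M Q a b → ∀ ε > 0, ∀ q, z' < q → ∃ p, z' < p ∧ p < z' + ε ∧ Emb M W a b p q := by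
    intro a b h
    induction h with
    | single a b hab ha hb h =>
      intro ε hε q hq
      obtain ⟨p1, q1, h1, h2, h3⟩ := hQ a b hab h (min ε (q - z')) (lt_min hε (by linarith))
      have hlt : p1 < q1 := by
        obtain ⟨ψ, h, _⟩ := h3
        exact h.lt hab
      have e1 := min_le_left ε (q - z')
      have e2 := min_le_right ε (q - z')
      exact ⟨p1, h1, by linarith, h3.widen_right hb hab (by linarith)⟩
    | trans a c b hac hcb h1 h2 =>
      intro ε hε q hq
      obtain ⟨p, hp, hp', hpe⟩ := h2 ε hε q hq
      obtain ⟨p2, hp2, hp2', hpe2⟩ := h1 ε hε p hp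
      exact ⟨p2, hp2, hp2', hpe2.glue hac.lt.le hcb.lt.le
        (fun h => absurd (subset_closure h) hcb.cut_left) hpe⟩
  obtain ⟨r, rfl, hr, hrz, hch⟩ := h
  have : ∀ (k : ℕ) (q : {q : ℝ // z' < q}), ∃ p : {q : ℝ // z' < q}, (p : ℝ) < z' + 1/((k:ℝ)+1) ∧
      Emb M W (r (k+1)) (r k) p q := by
    intro k q
    obtain ⟨p, h1, h2, h3⟩ := hchain _ _ (hch k) (1/((k:ℝ)+1)) (by positivity) q q.2
    exact ⟨⟨p, h1⟩, h2, h3⟩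
  choose f hf1 hf2 using this
  let y : ℕ → {q : ℝ // z' < q} := fun n => Nat.rec ⟨q, hq⟩ (fun k q => f k q) n
  have ys : ∀ n, y (n+1) = f n (y n) := fun n => rfl
  have hy : Tendsto (fun n : ℕ => (y n).1) atTop (𝓝 z') := by
    rw [← tendsto_add_atTop_iff_nat 1]
    have h0 : Tendsto (fun n : ℕ => z' + 1/((n:ℝ)+1)) atTop (𝓝 (z' + 0)) :=
      tendsto_const_nhds.add tendsto_one_div_add_atTop_nhds_zero_nat
    rw [add_zero] at h0
    refine tendsto_of_tendsto_of_tendsto_of_le_of_le tendsto_const_nhds h0 (fun n => (y (n+1)).2.le) (fun n => ?_)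
    simp only [ys]
    exact (hf1 n (y n)).le
  exact Emb.glue_seq hr hrz hy (fun k h => (hch k).cut_left (subset_closure h))
    (fun k => by rw [ys]; exact hf2 k (y k))

def Has (M : Set ℝ) : Tr → ℝ → ℝ → Prop
  | .leaf, a, b => ∃ m, M ∩ Ioo a b ⊆ {m}
  | .node e c, a, b => ∃ z ∈ Ioo a b,
      ((e true = false ∧ M ∩ Ioo z b = ∅) ∨
        (e true = true ∧ RHalf M (fun a b => ∃ i, Has M (c true i) a b) z b)) ∧
      ((e false = false ∧ M ∩ Ioo a z = ∅) ∨
        (e false = true ∧ RHalf (Neg.neg ⁻¹' M) (fun a b => ∃ i, Has M (c false i) (-b) (-a)) (-z) (-a)))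

def Host (W : Set ℝ) : Tr → ℝ → ℝ → Prop
  | .leaf, p, q => (W ∩ Ioo p q).Nonempty
  | .node e c, p, q => ∃ z ∈ W ∩ Ioo p q,
      (e true = true → ∀ k, ∀ ε > 0, ∃ p1 q1, z < p1 ∧ q1 < z + ε ∧ Host W (c true k) p1 q1) ∧
      (e false = true → ∀ k, ∀ ε > 0, ∃ p1 q1, z - ε < p1 ∧ q1 < z ∧ Host W (c false k) p1 q1)

lemma neg_neg_preimage (M : Set ℝ) : Neg.neg ⁻¹' (Neg.neg ⁻¹' M) = M := by
  ext x; simp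

theorem emb_of_has_host {M W : Set ℝ} (τ : Tr) : ∀ a b p q, a < b → Has M τ a b → Host W τ p q → Emb M W a b p q := by
  induction τ with
  | leaf =>
    rintro a b p q hab ⟨m, hm⟩ ⟨w, hw, hwp⟩
    exact Emb.single hab hm hw hwp
  | node e c ih =>
    rintro a b p q hab ⟨z, hz, hR, hL⟩ ⟨w, ⟨hw, hwp⟩, hR', hL'⟩
    refine Emb.glue (c := z) (y := w) hz.1.le hz.2.le (fun _ => hw) ?_ ?_
    · rcases hL with ⟨_, h⟩ | ⟨he, h⟩
      · exact Emb.empty hz.1 hwp.1 h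
      · have := half_emb (M := Neg.neg ⁻¹' M) (W := Neg.neg ⁻¹' W) (z' := -w) (q := -p) (by linarith [hwp.1]) ?_ h
        · have := this.neg
          simpa only [neg_neg, neg_neg_preimage] using this
        · rintro a b hab ⟨i, hi⟩ ε hε
          obtain ⟨p1, q1, h1, h2, h3⟩ := hL' he i ε hε
          refine ⟨-q1, -p1, by linarith, by linarith, ?_⟩
          have := (ih false i (-b) (-a) p1 q1 (by linarith) hi h3).neg
          simpa only [neg_neg] using this
    · rcases hR with ⟨_, h⟩ | ⟨he, h⟩
      · exact Emb.empty hz.2 hwp.2 h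
      · refine half_emb hwp.2 ?_ h
        rintro a b hab ⟨i, hi⟩ ε hε
        obtain ⟨p1, q1, h1, h2, h3⟩ := hR' he i ε hε
        exact ⟨p1, q1, h1, h2, ih true i a b p1 q1 hab hi h3⟩

lemma Host.widen {W : Set ℝ} {τ p q p' q'} (h : Host W τ p q) (hp : p' ≤ p) (hq : q ≤ q') : Host W τ p' q' := by
  cases τ with
  | leaf =>
    obtain ⟨w, hw, h1⟩ := h
    exact ⟨w, hw, hp.trans_lt h1.1, h1.2.trans_le hq⟩
  | node e c =>
    obtain ⟨z, ⟨hz, h1⟩, h2⟩ := h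
    exact ⟨z, ⟨hz, hp.trans_lt h1.1, h1.2.trans_le hq⟩, h2⟩

lemma Host.nonempty {W : Set ℝ} {τ p q} (h : Host W τ p q) : (W ∩ Ioo p q).Nonempty := by
  cases τ with
  | leaf => exact h
  | node e c =>
    obtain ⟨z, hz, _⟩ := h
    exact ⟨z, hz⟩

lemma Host.of_le {W : Set ℝ} {τ τ'} (h : Tr.Le τ τ') : ∀ p q, Host W τ' p q → Host W τ p q := by
  induction h with
  | leaf t => exact fun p q h => h.nonempty
  | bare e c t he =>
    intro p q h
    obtain ⟨z, hz⟩ := h.nonempty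
    exact ⟨z, hz, by simp [he], by simp [he]⟩
  | node e c e' c' l he h ih =>
    rintro p q ⟨z, hz, h1, h2⟩
    refine ⟨z, hz, fun hs k ε hε => ?_, fun hs k ε hε => ?_⟩
    · obtain ⟨p1, q1, a1, a2, a3⟩ := h1 (he _ hs) (l true k) ε hε
      exact ⟨p1, q1, a1, a2, ih _ _ hs _ _ a3⟩
    · obtain ⟨p1, q1, a1, a2, a3⟩ := h2 (he _ hs) (l false k) ε hε
      exact ⟨p1, q1, a1, a2, ih _ _ hs _ _ a3⟩
  | drop t e' c' s k hs h ih =>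
    rintro p q ⟨z, hz, h1, h2⟩
    cases s with
    | true =>
      obtain ⟨p1, q1, a1, a2, a3⟩ := h1 hs k (q - z) (by linarith [hz.2.2])
      exact (ih _ _ a3).widen (by linarith [hz.2.1]) (by linarith)
    | false =>
      obtain ⟨p1, q1, a1, a2, a3⟩ := h2 hs k (z - p) (by linarith [hz.2.1])
      exact (ih _ _ a3).widen (by linarith) (by linarith [hz.2.2])

def Tr.mir : Tr → Tr
  | .leaf => .leaf
  | .node e c => .node (fun s => e (!s)) (fun s k => (c (!s) k).mir)

lemma Has.mir {M : Set ℝ} {τ} : ∀ {a b}, Has M τ a b → Has (Neg.neg ⁻¹' M) τ.mir (-b) (-a) := by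
  induction τ with
  | leaf =>
    rintro a b ⟨m, hm⟩
    refine ⟨-m, fun x hx => ?_⟩
    have := hm (a := -x) ⟨hx.1, by linarith [hx.2.2], by linarith [hx.2.1]⟩
    simp only [mem_singleton_iff] at this ⊢; linarith
  | node e c ih =>
    rintro a b ⟨z, hz, h1, h2⟩
    refine ⟨-z, ⟨by linarith [hz.2], by linarith [hz.1]⟩, ?_, ?_⟩
    · rcases h2 with ⟨he, h⟩ | ⟨he, h⟩
      · refine Or.inl ⟨he, ?_⟩
        ext x
        simp only [mem_inter_iff, mem_empty_iff_false, iff_false]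
        rintro ⟨h1, h2⟩
        have : -x ∈ M ∩ Ioo a z := ⟨h1, by linarith [h2.2], by linarith [h2.1]⟩
        rw [h] at this; exact this
      · refine Or.inr ⟨he, h.mono ?_⟩
        rintro a b ⟨i, hi⟩
        refine ⟨i, ?_⟩
        have := ih false i hi
        simpa using this
    · rcases h1 with ⟨he, h⟩ | ⟨he, h⟩
      · refine Or.inl ⟨he, ?_⟩
        ext x
        simp only [mem_inter_iff, mem_empty_iff_false, iff_false]
        rintro ⟨h1, h2⟩
        have : -x ∈ M ∩ Ioo z b := ⟨h1, by linarith [h2.2], by linarith [h2.1]⟩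
        rw [h] at this; exact this
      · refine Or.inr ⟨he, ?_⟩
        rw [neg_neg_preimage, neg_neg, neg_neg]
        refine h.mono ?_
        rintro a b ⟨i, hi⟩
        exact ⟨i, ih true i hi⟩

lemma Host.mir {W : Set ℝ} {τ} : ∀ {a b}, Host W τ a b → Host (Neg.neg ⁻¹' W) τ.mir (-b) (-a) := by
  induction τ with
  | leaf =>
    rintro a b ⟨m, hm, h⟩
    exact ⟨-m, by simpa using hm, by linarith [h.2], by linarith [h.1]⟩
  | node e c ih =>
    rintro a b ⟨z, hz, h1, h2⟩
    refine ⟨-z, ⟨by simpa using hz.1, by linarith [hz.2.2], by linarith [hz.2.1]⟩, ?_, ?_⟩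
    · intro he k ε hε
      obtain ⟨p1, q1, a1, a2, a3⟩ := h2 he k ε hε
      exact ⟨-q1, -p1, by linarith, by linarith, ih false k a3⟩
    · intro he k ε hε
      obtain ⟨p1, q1, a1, a2, a3⟩ := h1 he k ε hε
      exact ⟨-q1, -p1, by linarith, by linarith, ih true k a3⟩

/-! ### marks -/

def AccR (M : Set ℝ) (x : ℝ) : Prop := ∀ ε > 0, (M ∩ Ioo x (x + ε)).Nonempty
def AccL (M : Set ℝ) (x : ℝ) : Prop := ∀ ε > 0, (M ∩ Ioo (x - ε) x).Nonempty

structure Setting (M W : Set ℝ) : Prop where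
  closed : IsClosed W
  disj : ∀ x ∈ M, x ∉ W
  accR : ∀ x, AccR M x → AccR W x
  accL : ∀ x, AccL M x → AccL W x

lemma accR_neg {M : Set ℝ} {x} : AccR (Neg.neg ⁻¹' M) x ↔ AccL M (-x) := by
  constructor
  · intro h ε hε
    obtain ⟨y, hy, h1⟩ := h ε hε
    exact ⟨-y, hy, by linarith [h1.2], by linarith [h1.1]⟩
  · intro h ε hε
    obtain ⟨y, hy, h1⟩ := h ε hε
    exact ⟨-y, by simpa using hy, by linarith [h1.2], by linarith [h1.1]⟩

lemma accL_neg {M : Set ℝ} {x} : AccL (Neg.neg ⁻¹' M) x ↔ AccR M (-x) := by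
  conv_rhs => rw [← neg_neg_preimage M]
  rw [accR_neg, neg_neg]

lemma accR_closure {W : Set ℝ} {x} (h : AccR W x) : x ∈ closure W := by
  rw [Metric.mem_closure_iff]
  intro ε hε
  obtain ⟨y, hy, h1⟩ := h ε hε
  refine ⟨y, hy, ?_⟩
  rw [Real.dist_eq, abs_lt]
  exact ⟨by linarith [h1.2], by linarith [h1.1]⟩

lemma closure_neg_preimage (M : Set ℝ) : closure (Neg.neg ⁻¹' M) = Neg.neg ⁻¹' closure M :=
  (Homeomorph.neg ℝ).preimage_closure M |>.symm

lemma accL_closure {W : Set ℝ} {x} (h : AccL W x) : x ∈ closure W := by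
  have : AccR (Neg.neg ⁻¹' W) (-x) := accR_neg.2 (by simpa using h)
  have := accR_closure this
  rw [closure_neg_preimage] at this
  simpa using this

lemma not_accR {M : Set ℝ} {x} (h : ¬ AccR M x) : ∃ ε > 0, M ∩ Ioo x (x + ε) = ∅ := by
  unfold AccR at h
  push Not at h
  exact h

lemma not_accL {M : Set ℝ} {x} (h : ¬ AccL M x) : ∃ ε > 0, M ∩ Ioo (x - ε) x = ∅ := by
  unfold AccL at h
  push Not at h
  exact h

lemma mem_closure_cases {M : Set ℝ} {x} (h : x ∈ closure M) : x ∈ M ∨ AccR M x ∨ AccL M x := by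
  by_contra! hc
  obtain ⟨h1, h2, h3⟩ := hc
  obtain ⟨ε, hε, he⟩ := not_accR h2
  obtain ⟨δ, hδ, hd⟩ := not_accL h3
  obtain ⟨y, hy, hxy⟩ := Metric.mem_closure_iff.1 h (min ε δ) (lt_min hε hδ)
  rw [Real.dist_eq, abs_lt] at hxy
  have e1 := min_le_left ε δ
  have e2 := min_le_right ε δ
  rcases lt_trichotomy x y with h | h | h
  · have : y ∈ M ∩ Ioo x (x + ε) := ⟨hy, h, by linarith⟩
    rw [he] at this; exact this
  · exact h1 (h ▸ hy)
  · have : y ∈ M ∩ Ioo (x - δ) x := ⟨hy, by linarith, h⟩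
    rw [hd] at this; exact this

namespace Setting
variable {M W : Set ℝ}

lemma neg (hS : Setting M W) : Setting (Neg.neg ⁻¹' M) (Neg.neg ⁻¹' W) where
  closed := hS.closed.preimage continuous_neg
  disj x hx := hS.disj _ hx
  accR x hx := accR_neg.2 (hS.accL _ (accR_neg.1 hx))
  accL x hx := accL_neg.2 (hS.accR _ (accL_neg.1 hx))

lemma accR_mem (hS : Setting M W) {x} (h : AccR M x) : x ∈ W := hS.closed.closure_eq ▸ accR_closure (hS.accR x h)
lemma accL_mem (hS : Setting M W) {x} (h : AccL M x) : x ∈ W := hS.closed.closure_eq ▸ accL_closure (hS.accL x h)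

lemma isol (hS : Setting M W) {m} (hm : m ∈ M) : ∃ ε > 0, M ∩ Ioo (m - ε) (m + ε) ⊆ {m} := by
  obtain ⟨ε, hε, he⟩ := not_accR fun h => hS.disj m hm (hS.accR_mem h)
  obtain ⟨δ, hδ, hd⟩ := not_accL fun h => hS.disj m hm (hS.accL_mem h)
  refine ⟨min ε δ, lt_min hε hδ, fun y hy => ?_⟩
  have e1 := min_le_left ε δ
  have e2 := min_le_right ε δ
  rcases lt_trichotomy m y with h | h | h
  · have : y ∈ M ∩ Ioo m (m + ε) := ⟨hy.1, h, by linarith [hy.2.2]⟩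
    rw [he] at this; exact absurd this (notMem_empty _)
  · exact h.symm
  · have : y ∈ M ∩ Ioo (m - δ) m := ⟨hy.1, by linarith [hy.2.1], h⟩
    rw [hd] at this; exact absurd this (notMem_empty _)

lemma cut_dense (hS : Setting M W) {u v : ℝ} (huv : u < v) : ∃ c ∈ Ioo u v, c ∉ closure M := by
  have key : ∀ u v : ℝ, u < v → M ∩ Ioo u v = ∅ → ∃ c ∈ Ioo u v, c ∉ closure M := by
    intro u v huv h
    refine ⟨(u+v)/2, ⟨by linarith, by linarith⟩, fun hc => ?_⟩
    obtain ⟨y, hy, hy'⟩ := mem_closure_iff.1 hc (Ioo u v) isOpen_Ioo ⟨by linarith, by linarith⟩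
    have : y ∈ M ∩ Ioo u v := ⟨hy', hy⟩
    rw [h] at this; exact this
  by_cases h : M ∩ Ioo u v = ∅
  · exact key u v huv h
  · obtain ⟨m, hm, hmu⟩ := nonempty_iff_ne_empty.2 h
    obtain ⟨ε, hε, he⟩ := not_accR fun h => hS.disj m hm (hS.accR_mem h)
    have hlt : m < min (m + ε) v := lt_min (by linarith) hmu.2
    obtain ⟨c, hc, hc'⟩ := key m (min (m+ε) v) hlt (by
      apply eq_empty_of_subset_empty
      rw [← he]
      exact fun y hy => ⟨hy.1, hy.2.1, hy.2.2.trans_le (min_le_left _ _)⟩)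
    exact ⟨c, ⟨hmu.1.trans hc.1, hc.2.trans_le (min_le_right _ _)⟩, hc'⟩

end Setting

def Good (M W : Set ℝ) (x : ℝ) : Prop :=
  ∃ ε > 0, ∀ a b, a ∉ closure M → b ∉ closure M → x - ε < a → a < x → x < b → b < x + ε →
    ∃ τ, Has M τ a b ∧ Host W τ a b

lemma Good.neg {M W : Set ℝ} {x} (h : Good M W x) : Good (Neg.neg ⁻¹' M) (Neg.neg ⁻¹' W) (-x) := by
  obtain ⟨ε, hε, h⟩ := h
  refine ⟨ε, hε, fun a b ha hb h1 h2 h3 h4 => ?_⟩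
  rw [closure_neg_preimage] at ha hb
  obtain ⟨τ, h5, h6⟩ := h (-b) (-a) hb ha (by linarith) (by linarith) (by linarith) (by linarith)
  exact ⟨τ.mir, by simpa using h5.mir, by simpa using h6.mir⟩

instance : Inhabited Tr := ⟨.leaf⟩

/-- eventually everything hosted to the right of `x` is recurrent -/
lemma recurrent (W : Set ℝ) (x : ℝ) : ∃ ε > 0, ∀ τ a b, x < a → b < x + ε → Host W τ a b →
    ∀ ε' > 0, ∃ p q, x < p ∧ q < x + ε' ∧ Host W τ p q := by
  by_contra! h
  choose! τ a b h1 h2 h3 ε' h4 h5 using h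
  let δ : ℕ → ℝ := fun n => Nat.rec 1 (fun _ d => min (ε' d) d) n
  have ds : ∀ n, δ (n+1) = min (ε' (δ n)) (δ n) := fun n => rfl
  have dp : ∀ n, 0 < δ n := by
    intro n
    induction n with
    | zero => exact one_pos
    | succ n ih => rw [ds]; exact lt_min (h4 _ ih) ih
  have dm : Antitone δ := antitone_nat_of_succ_le fun n => by rw [ds]; exact min_le_right _ _
  obtain ⟨n, m, hnm, hle⟩ := Tr.wqo fun n => τ (δ n)
  have hh := Host.of_le hle _ _ (h3 _ (dp m))
  refine h5 _ (dp n) _ _ (h1 _ (dp m)) ?_ hh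
  have e1 := h2 _ (dp m)
  have e2 := dm (show n+1 ≤ m from hnm)
  have e3 : δ (n+1) ≤ ε' (δ n) := by rw [ds]; exact min_le_left _ _
  linarith

lemma exists_cuts {M W : Set ℝ} (hS : Setting M W) {x b : ℝ} (hb : b ∉ closure M) (hxb : x < b) :
    ∃ r : ℕ → ℝ, r 0 = b ∧ StrictAnti r ∧ Tendsto r atTop (𝓝 x) ∧ (∀ k, r k ∉ closure M) ∧ (∀ k, x < r k) := by
  have : ∀ (k : ℕ) (u : {u : ℝ // x < u ∧ u ∉ closure M}), ∃ v : {u : ℝ // x < u ∧ u ∉ closure M},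
      v.1 < u.1 ∧ v.1 < x + 1/((k:ℝ)+1) := by
    intro k u
    have hp : (0:ℝ) < 1/((k:ℝ)+1) := by positivity
    obtain ⟨c, hc, hc'⟩ := hS.cut_dense (show x < min u.1 (x + 1/((k:ℝ)+1)) from lt_min u.2.1 (by linarith))
    exact ⟨⟨c, hc.1, hc'⟩, hc.2.trans_le (min_le_left _ _), hc.2.trans_le (min_le_right _ _)⟩
  choose f hf1 hf2 using this
  let r : ℕ → {u : ℝ // x < u ∧ u ∉ closure M} := fun n => Nat.rec ⟨b, hxb, hb⟩ (fun k q => f k q) n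
  have rs : ∀ n, r (n+1) = f n (r n) := fun n => rfl
  refine ⟨fun n => (r n).1, rfl, strictAnti_nat_of_succ_lt fun n => ?_, ?_, fun k => (r k).2.2, fun k => (r k).2.1⟩
  · rw [rs]; exact hf1 _ _
  · rw [← tendsto_add_atTop_iff_nat 1]
    have h0 : Tendsto (fun n : ℕ => x + 1/((n:ℝ)+1)) atTop (𝓝 (x + 0)) :=
      tendsto_const_nhds.add tendsto_one_div_add_atTop_nhds_zero_nat
    rw [add_zero] at h0
    refine tendsto_of_tendsto_of_tendsto_of_le_of_le tendsto_const_nhds h0 (fun n => (r (n+1)).2.1.le) (fun n => ?_)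
    simp only [rs]
    exact (hf2 n (r n)).le

lemma lemma_R {M W : Set ℝ} (hS : Setting M W) {x : ℝ} (hacc : AccR M x)
    (hgood : ∃ ε > 0, ∀ y ∈ closure M, y ∉ M → y ∈ Ioo x (x+ε) → Good M W y) :
    ∃ ε > 0, ∀ b, b ∉ closure M → x < b → b < x + ε → ∃ c : ℕ → Tr,
      (∀ k, ∀ ε > 0, ∃ p q, x < p ∧ q < x + ε ∧ Host W (c k) p q) ∧
      RHalf M (fun a b => ∃ i, Has M (c i) a b) x b := by
  obtain ⟨ε0, hε0, hg⟩ := hgood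
  obtain ⟨ε1, hε1, hrec⟩ := recurrent W x
  refine ⟨min ε0 ε1, lt_min hε0 hε1, fun b hb hxb hbe => ?_⟩
  have hb0 : b < x + ε0 := by linarith [min_le_left ε0 ε1]
  have hb1 : b < x + ε1 := by linarith [min_le_right ε0 ε1]
  obtain ⟨r, r0, hr, hrx, hrc, hxr⟩ := exists_cuts hS hb hxb
  have hleaf : ∀ ε > 0, ∃ p q, x < p ∧ q < x + ε ∧ Host W .leaf p q := by
    intro ε hε
    obtain ⟨w, hw, h1⟩ := hS.accR x hacc ε hε
    exact ⟨(x+w)/2, (w + (x+ε))/2, by linarith [h1.1], by linarith [h1.2], w, hw, by linarith [h1.1], by linarith [h1.2]⟩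
  have hch : ∀ k, ∃ c : ℕ → Tr, (∀ i, ∀ ε > 0, ∃ p q, x < p ∧ q < x + ε ∧ Host W (c i) p q) ∧
      ChainOf M (fun a b => ∃ i, Has M (c i) a b) (r (k+1)) (r k) := by
    intro k
    refine ChainOf.extract (R := fun τ => ∀ ε > 0, ∃ p q, x < p ∧ q < x + ε ∧ Host W τ p q) (X := fun τ a b => Has M τ a b) ?_
    have hrb : r k ≤ b := r0 ▸ hr.antitone (Nat.zero_le k)
    refine cousin (C := (closure M)ᶜ) (hr (Nat.lt_succ_self k)) (hrc _) (hrc _) ?_ ?_ ?_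
    · intro u v _ huv _
      exact hS.cut_dense huv
    · intro u c v _ huc hcv _ hu hc hv h1 h2
      exact ChainOf.trans _ _ _ h1 h2
    · intro y hy
      have hxy : x < y := (hxr _).trans_le hy.1
      by_cases hyM : y ∈ closure M
      · by_cases hyM' : y ∈ M
        · obtain ⟨ε, hε, he⟩ := hS.isol hyM'
          refine ⟨ε, hε, fun c d hc hd _ _ hcd h1 h2 _ _ => ChainOf.single _ _ hcd hc hd ⟨.leaf, hleaf, y, ?_⟩⟩
          exact fun u hu => he ⟨hu.1, h1.trans hu.2.1, hu.2.2.trans h2⟩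
        · obtain ⟨ε, hε, he⟩ := hg y hyM hyM' ⟨hxy, hy.2.trans_lt (hrb.trans_lt hb0)⟩
          refine ⟨ε, hε, fun c d hc hd hc' hd' hcd h1 h2 h3 h4 => ChainOf.single _ _ hcd hc hd ?_⟩
          have h3' : c < y := lt_of_le_of_ne h3 fun h => hc (h ▸ hyM)
          have h4' : y < d := lt_of_le_of_ne h4 fun h => hd (h ▸ hyM)
          obtain ⟨τ, t1, t2⟩ := he c d hc hd h1 h3' h4' h2
          exact ⟨τ, hrec τ c d ((hxr _).trans_le hc') (hd'.trans_lt (hrb.trans_lt hb1)) t2, t1⟩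
      · obtain ⟨ε, hε, h⟩ := Metric.mem_nhds_iff.1 (isClosed_closure.isOpen_compl.mem_nhds hyM)
        refine ⟨ε, hε, fun c d hc hd _ _ hcd h1 h2 _ _ => ChainOf.single _ _ hcd hc hd ⟨.leaf, hleaf, y, ?_⟩⟩
        intro u hu
        have : u ∈ Metric.ball y ε := by
          rw [Metric.mem_ball, Real.dist_eq, abs_lt]
          exact ⟨by linarith [hu.2.1], by linarith [hu.2.2]⟩
        exact absurd (subset_closure hu.1) (h this)
  choose c hc1 hc2 using hch
  refine ⟨fun n => c n.unpair.1 n.unpair.2, fun k => hc1 _ _, r, r0, hr, hrx, fun k => (hc2 k).mono ?_⟩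
  rintro a b ⟨i, hi⟩
  exact ⟨Nat.pair k i, by simpa using hi⟩

/-- one sided data at `x`, right -/
lemma side_right {M W : Set ℝ} (hS : Setting M W) {x : ℝ}
    (hgood : ∃ ε > 0, ∀ y ∈ closure M, y ∉ M → y ∈ Ioo x (x+ε) → Good M W y) :
    ∃ ε > 0, ∀ b, b ∉ closure M → x < b → b < x + ε → ∃ (e : Bool) (c : ℕ → Tr),
      (e = true → ∀ k, ∀ ε > 0, ∃ p q, x < p ∧ q < x + ε ∧ Host W (c k) p q) ∧
      ((e = false ∧ M ∩ Ioo x b = ∅) ∨ (e = true ∧ RHalf M (fun a b => ∃ i, Has M (c i) a b) x b)) := by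
  by_cases hacc : AccR M x
  · obtain ⟨ε, hε, h⟩ := lemma_R hS hacc hgood
    refine ⟨ε, hε, fun b hb h1 h2 => ?_⟩
    obtain ⟨c, hc1, hc2⟩ := h b hb h1 h2
    exact ⟨true, c, fun _ => hc1, Or.inr ⟨rfl, hc2⟩⟩
  · obtain ⟨ε, hε, he⟩ := not_accR hacc
    refine ⟨ε, hε, fun b hb h1 h2 => ⟨false, fun _ => .leaf, by simp, Or.inl ⟨rfl, ?_⟩⟩⟩
    apply eq_empty_of_subset_empty
    rw [← he]
    exact fun y hy => ⟨hy.1, hy.2.1, hy.2.2.trans h2⟩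

lemma good_of_near {M W : Set ℝ} (hS : Setting M W) {x : ℝ} (hx : x ∈ W)
    (hgood : ∃ ε > 0, ∀ y ∈ closure M, y ∉ M → y ∈ Ioo (x-ε) (x+ε) → y ≠ x → Good M W y) : Good M W x := by
  obtain ⟨ε, hε, hg⟩ := hgood
  obtain ⟨ε1, hε1, h1⟩ := side_right hS (x := x) ⟨ε, hε, fun y hy hy' hyx =>
    hg y hy hy' ⟨by linarith [hyx.1], hyx.2⟩ hyx.1.ne'⟩
  obtain ⟨ε2, hε2, h2⟩ := side_right hS.neg (x := -x) ⟨ε, hε, fun y hy hy' hyx => by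
    rw [closure_neg_preimage] at hy
    have := hg (-y) hy hy' ⟨by linarith [hyx.2], by linarith [hyx.1]⟩ (by linarith [hyx.1])
    simpa using this.neg⟩
  refine ⟨min ε1 ε2, lt_min hε1 hε2, fun a b ha hb hxa hax hxb hbx => ?_⟩
  have m1 := min_le_left ε1 ε2
  have m2 := min_le_right ε1 ε2
  obtain ⟨e1, c1, p1, q1⟩ := h1 b hb hxb (by linarith)
  obtain ⟨e2, c2, p2, q2⟩ := h2 (-a) (by rw [closure_neg_preimage]; simpa using ha) (by linarith) (by linarith)
  refine ⟨.node (fun s => if s then e1 else e2) (fun s k => if s then c1 k else (c2 k).mir), ?_, ?_⟩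
  · refine ⟨x, ⟨hax, hxb⟩, by simpa using q1, ?_⟩
    rcases q2 with ⟨he, h⟩ | ⟨he, h⟩
    · refine Or.inl ⟨by simpa using he, ?_⟩
      apply eq_empty_of_forall_notMem
      intro y hy
      have : -y ∈ Neg.neg ⁻¹' M ∩ Ioo (-x) (-a) := ⟨by simpa using hy.1, by linarith [hy.2.2], by linarith [hy.2.1]⟩
      rw [h] at this
      exact this
    · refine Or.inr ⟨by simpa using he, h.mono ?_⟩
      rintro a b ⟨i, hi⟩
      exact ⟨i, by simpa [neg_neg_preimage] using hi.mir⟩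
  · refine ⟨x, ⟨hx, hax, hxb⟩, ?_, ?_⟩
    · simpa using p1
    · intro he k ε hε
      obtain ⟨p, q, a1, a2, a3⟩ := p2 (by simpa using he) k ε hε
      refine ⟨-q, -p, by linarith, by linarith, ?_⟩
      simpa [neg_neg_preimage] using a3.mir

lemma preperfect_of {Z : Set ℝ} (h : ∀ x ∈ Z, ∀ ε > 0, ∃ y ∈ Z, y ∈ Ioo (x-ε) (x+ε) ∧ y ≠ x) : Preperfect Z := by
  intro x hx
  rw [accPt_iff_nhds]
  intro U hU
  obtain ⟨ε, hε, he⟩ := Metric.mem_nhds_iff.1 hU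
  obtain ⟨y, hy, h1, h2⟩ := h x hx ε hε
  refine ⟨y, ⟨he ?_, hy⟩, h2⟩
  rw [Metric.mem_ball, Real.dist_eq, abs_lt]
  exact ⟨by linarith [h1.1], by linarith [h1.2]⟩

lemma uncountable_of_preperfect {Z W : Set ℝ} (hW : IsClosed W) (hZW : Z ⊆ W) (hZ : Preperfect Z)
    {u v : ℝ} (hne : (Z ∩ Ioo u v).Nonempty) : ¬ (W ∩ Ioo u v).Countable := by
  obtain ⟨z, hz, hzu⟩ := hne
  set u' := (u+z)/2
  set v' := (z+v)/2
  have h1 : Preperfect (Ioo u' v' ∩ Z) := hZ.open_inter isOpen_Ioo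
  have h2 := h1.perfect_closure
  have h3 : closure (Ioo u' v' ∩ Z) ⊆ W ∩ Ioo u v := by
    intro y hy
    refine ⟨?_, ?_⟩
    · exact closure_minimal (inter_subset_right.trans hZW) hW hy
    · have : y ∈ Icc u' v' := closure_minimal (inter_subset_left.trans Ioo_subset_Icc_self) isClosed_Icc hy
      simp only [u', v'] at this
      exact ⟨by linarith [this.1, hzu.1], by linarith [this.2, hzu.2]⟩
  have h4 : (closure (Ioo u' v' ∩ Z)).Nonempty :=
    ⟨z, subset_closure ⟨⟨by simp only [u']; linarith [hzu.1], by simp only [v']; linarith [hzu.2]⟩, hz⟩⟩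
  obtain ⟨f, hf, -, hinj⟩ := h2.exists_nat_bool_injection h4
  intro hc
  have : (range f).Countable := hc.mono (hf.trans h3)
  have h5 : Countable (ℕ → Bool) := by
    have h6 := this.to_subtype
    exact (Set.rangeFactorization_injective.2 hinj).countable
  have h7 := Cardinal.mk_le_aleph0_iff.2 h5
  simp only [Cardinal.mk_pi, Cardinal.mk_fintype, Fintype.card_bool] at h7
  have := Cardinal.aleph0_lt_continuum
  simp at h7
  exact absurd h7 (not_le.2 this)

lemma all_good {M W : Set ℝ} (hS : Setting M W) {u v : ℝ} (hc : (W ∩ Ioo u v).Countable) :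
    ∀ y ∈ closure M, y ∉ M → y ∈ Ioo u v → Good M W y := by
  by_contra! h
  obtain ⟨y0, h1, h2, h3, h4⟩ := h
  let Z : Set ℝ := {y | y ∈ closure M ∧ y ∉ M ∧ y ∈ Ioo u v ∧ ¬ Good M W y}
  have hZW : Z ⊆ W := by
    intro y hy
    rcases mem_closure_cases hy.1 with h | h | h
    · exact absurd h hy.2.1
    · exact hS.accR_mem h
    · exact hS.accL_mem h
  refine uncountable_of_preperfect hS.closed hZW (preperfect_of ?_) ⟨y0, ⟨h1, h2, h3, h4⟩, h3⟩ hc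
  intro x hx ε hε
  by_contra! hcon
  refine hx.2.2.2 (good_of_near hS (hZW hx) ⟨min ε (min (x - u) (v - x)), lt_min hε (lt_min (by linarith [hx.2.2.1.1]) (by linarith [hx.2.2.1.2])), ?_⟩)
  intro y hy hyM hyx hne
  by_contra hng
  have m1 := min_le_left ε (min (x - u) (v - x))
  have m2 := (min_le_right ε (min (x - u) (v - x))).trans (min_le_left _ _)
  have m3 := (min_le_right ε (min (x - u) (v - x))).trans (min_le_right _ _)
  exact hne (hcon y ⟨hy, hyM, ⟨by linarith [hyx.1], by linarith [hyx.2]⟩, hng⟩ ⟨by linarith [hyx.1], by linarith [hyx.2]⟩)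

/-- half lemma in the countable case -/
lemma half_countable {M W : Set ℝ} (hS : Setting M W) {z ε : ℝ} (hε : 0 < ε)
    (hc : (W ∩ Ioo z (z+ε)).Countable) :
    ∃ δ > 0, ∀ b, b ∉ closure M → z < b → b < z + δ → ∀ q, z < q → Emb M W z b z q := by
  obtain ⟨δ, hδ, h⟩ := side_right hS (x := z) ⟨ε, hε, fun y h1 h2 h3 => all_good hS hc y h1 h2 h3⟩
  refine ⟨δ, hδ, fun b hb h1 h2 q hq => ?_⟩
  obtain ⟨e, c, p1, p2⟩ := h b hb h1 h2
  rcases p2 with ⟨he, h⟩ | ⟨he, h⟩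
  · exact Emb.empty h1 hq h
  · refine half_emb hq ?_ h
    rintro a b hab ⟨i, hi⟩ ε hε
    obtain ⟨p, q, a1, a2, a3⟩ := p1 he i ε hε
    exact ⟨p, q, a1, a2, emb_of_has_host _ _ _ _ _ hab hi a3⟩

lemma Preperfect.acc_cases {K : Set ℝ} (hK : Preperfect K) {x} (hx : x ∈ K) : AccR K x ∨ AccL K x := by
  by_contra! h
  obtain ⟨ε, hε, h1⟩ := not_accR h.1
  obtain ⟨δ, hδ, h2⟩ := not_accL h.2
  have := accPt_iff_nhds.1 (hK x hx) (Ioo (x-δ) (x+ε)) (Ioo_mem_nhds (by linarith) (by linarith))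
  obtain ⟨y, hy, hne⟩ := this
  rcases lt_or_gt_of_ne hne with h3 | h3
  · have : y ∈ K ∩ Ioo (x-δ) x := ⟨hy.2, hy.1.1, h3⟩
    rw [h2] at this; exact this
  · have : y ∈ K ∩ Ioo x (x+ε) := ⟨hy.2, h3, hy.1.2⟩
    rw [h1] at this; exact this

lemma AccL.exists {K : Set ℝ} {x u : ℝ} (h : AccL K x) (hu : u < x) : ∃ k ∈ K, u < k ∧ k < x := by
  obtain ⟨y, hy, h1⟩ := h (x - u) (by linarith)
  exact ⟨y, hy, by linarith [h1.1], h1.2⟩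

lemma AccR.exists {K : Set ℝ} {x u : ℝ} (h : AccR K x) (hu : x < u) : ∃ k ∈ K, x < k ∧ k < u := by
  obtain ⟨y, hy, h1⟩ := h (u - x) (by linarith)
  exact ⟨y, hy, h1.1, by linarith [h1.2]⟩

/-- the countable set of left-accumulated points of a perfect compact set -/
lemma exists_left_dense {K : Set ℝ} (hK : Preperfect K) (hc : IsCompact K) (hne : K.Nonempty) :
    ∃ E : Set ℝ, E.Countable ∧ E ⊆ Ioo (sInf K) (sSup K) ∧ (∀ e ∈ E, AccL K e) ∧
      (∀ k1 ∈ K, ∀ k2 ∈ K, k1 < k2 → ∃ e ∈ E, k1 ≤ e ∧ e < k2) := by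
  have hp := hc.sInf_mem hne
  have hq := hc.sSup_mem hne
  have hle : ∀ k ∈ K, sInf K ≤ k := fun k hk => csInf_le hc.bddBelow hk
  have hge : ∀ k ∈ K, k ≤ sSup K := fun k hk => le_csSup hc.bddAbove hk
  have key : ∀ r, sInf K < r → r < sSup K → AccL K (sSup (K ∩ Iio r)) := by
    intro r h1 h2
    have hn : (K ∩ Iio r).Nonempty := ⟨_, hp, h1⟩
    have hb : BddAbove (K ∩ Iio r) := hc.bddAbove.mono inter_subset_left
    have hl := isLUB_csSup hn hb
    by_contra hacc
    obtain ⟨ε, hε, hem⟩ := not_accL hacc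
    obtain ⟨k, hk, hk1⟩ := exists_lt_of_lt_csSup hn (sub_lt_self (sSup (K ∩ Iio r)) hε)
    have hk2 : k = sSup (K ∩ Iio r) := by
      refine le_antisymm (hl.1 hk) (not_lt.1 fun hlt => ?_)
      have : k ∈ K ∩ Ioo (sSup (K ∩ Iio r) - ε) (sSup (K ∩ Iio r)) := ⟨hk.1, hk1, hlt⟩
      rw [hem] at this; exact this
    rw [← hk2] at hacc
    rcases hK.acc_cases hk.1 with h | h
    · obtain ⟨k', hk', h3, h4⟩ := h.exists hk.2
      have := hl.1 ⟨hk', h4⟩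
      linarith
    · exact hacc h
  refine ⟨(fun r : ℚ => sSup (K ∩ Iio (r:ℝ))) '' {r : ℚ | sInf K < r ∧ (r:ℝ) < sSup K}, (to_countable _).image _, ?_, ?_, ?_⟩
  · rintro _ ⟨r, hr, rfl⟩
    obtain ⟨k, hk, h1⟩ := (key r hr.1 hr.2).exists (sub_one_lt _)
    refine ⟨(hle k hk).trans_lt h1.2, ?_⟩
    refine lt_of_le_of_lt (csSup_le ⟨_, hp, hr.1⟩ fun k hk => hk.2.le) hr.2
  · rintro _ ⟨r, hr, rfl⟩
    exact key r hr.1 hr.2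
  · intro k1 h1 k2 h2 h12
    obtain ⟨r, hr1, hr2⟩ := exists_rat_btwn h12
    refine ⟨_, ⟨r, ⟨(hle _ h1).trans_lt hr1, hr2.trans_le (hge _ h2)⟩, rfl⟩, ?_, ?_⟩
    · exact le_csSup (hc.bddAbove.mono inter_subset_left) ⟨h1, hr1⟩
    · exact lt_of_le_of_lt (csSup_le ⟨_, h1, hr1⟩ fun k hk => hk.2.le) hr2

/-- interpolation of a strictly monotone function on a closed set -/
lemma interpolate {G : Set ℝ} {a b : ℝ} (hG : IsClosed G) (haG : a ∈ G) (hbG : b ∈ G)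
    {σ : ℝ → ℝ} (hσ : StrictMonoOn σ (G ∩ Icc a b))
    (hs : ∀ y ∈ Icc (σ a) (σ b), ∃ x1 ∈ G ∩ Icc a b, ∃ x2 ∈ G ∩ Icc a b, x1 ≤ x2 ∧ σ x1 ≤ y ∧ y ≤ σ x2 ∧ G ∩ Ioo x1 x2 = ∅) :
    ∃ ψ, IsoOn ψ a b (σ a) (σ b) ∧ ∀ x ∈ G ∩ Icc a b, ψ x = σ x := by
  classical
  have hc := fun x (hx : x ∈ Icc a b) => (hG.inter (isClosed_Icc (a := a) (b := b)))
  have gap : ∀ x ∈ Icc a b, x ∉ G → ∃ l ∈ G ∩ Icc a b, ∃ r ∈ G ∩ Icc a b, l < x ∧ x < r ∧ G ∩ Ioo l r = ∅ := by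
    intro x hx hxG
    have c1 : IsCompact (G ∩ Icc a x) := isCompact_Icc.inter_left hG
    have c2 : IsCompact (G ∩ Icc x b) := isCompact_Icc.inter_left hG
    have l1 := c1.sSup_mem ⟨a, haG, le_rfl, hx.1⟩
    have r1 := c2.sInf_mem ⟨b, hbG, hx.2, le_rfl⟩
    refine ⟨_, ⟨l1.1, l1.2.1, l1.2.2.trans hx.2⟩, _, ⟨r1.1, hx.1.trans r1.2.1, r1.2.2⟩, lt_of_le_of_ne l1.2.2 fun h => hxG (h ▸ l1.1),
      lt_of_le_of_ne r1.2.1 fun h => hxG (h ▸ r1.1), ?_⟩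
    rw [eq_empty_iff_forall_notMem]
    rintro y ⟨hy, hy1, hy2⟩
    rcases le_total y x with h | h
    · exact absurd (le_csSup c1.bddAbove ⟨hy, l1.2.1.trans hy1.le, h⟩) (not_le.2 hy1)
    · exact absurd (csInf_le c2.bddBelow ⟨hy, h, hy2.le.trans r1.2.2⟩) (not_le.2 hy2)
  choose! l hl r hr hlx hxr hlr using gap
  let ψ : ℝ → ℝ := fun x => if x ∈ G then σ x else σ (l x) + (x - l x) / (r x - l x) * (σ (r x) - σ (l x))
  have ψG : ∀ x ∈ G, ψ x = σ x := fun x hx => if_pos hx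
  have ψn : ∀ x, x ∉ G → ψ x = σ (l x) + (x - l x) / (r x - l x) * (σ (r x) - σ (l x)) := fun x hx => if_neg hx
  have pos : ∀ x ∈ Icc a b, x ∉ G → 0 < σ (r x) - σ (l x) := fun x hx hxG => by
    have := hσ (hl x hx hxG) (hr x hx hxG) ((hlx x hx hxG).trans (hxr x hx hxG))
    linarith
  have low : ∀ x ∈ Icc a b, x ∉ G → σ (l x) < ψ x := fun x hx hxG => by
    rw [ψn x hxG]
    have h1 := pos x hx hxG
    have h2 := hlx x hx hxG
    have h3 := hxr x hx hxG
    have : 0 < (x - l x) / (r x - l x) := div_pos (by linarith) (by linarith)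
    nlinarith
  have upp : ∀ x ∈ Icc a b, x ∉ G → ψ x < σ (r x) := fun x hx hxG => by
    rw [ψn x hxG]
    have h1 := pos x hx hxG
    have h2 := hlx x hx hxG
    have h3 := hxr x hx hxG
    have : (x - l x) / (r x - l x) < 1 := by rw [div_lt_one (by linarith)]; linarith
    nlinarith
  have up : ∀ x ∈ Icc a b, ∀ g ∈ G ∩ Icc a b, x < g → ψ x < σ g := by
    intro x hx g hg hxg
    by_cases hxG : x ∈ G
    · rw [ψG x hxG]; exact hσ ⟨hxG, hx⟩ hg hxg
    · refine (upp x hx hxG).trans_le ((hσ.le_iff_le (hr x hx hxG) hg).2 (not_lt.1 fun h => ?_))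
      have : g ∈ G ∩ Ioo (l x) (r x) := ⟨hg.1, (hlx x hx hxG).trans hxg, h⟩
      rw [hlr x hx hxG] at this; exact this
  have lo : ∀ x ∈ Icc a b, ∀ g ∈ G ∩ Icc a b, g < x → σ g < ψ x := by
    intro x hx g hg hxg
    by_cases hxG : x ∈ G
    · rw [ψG x hxG]; exact hσ hg ⟨hxG, hx⟩ hxg
    · refine lt_of_le_of_lt ((hσ.le_iff_le hg (hl x hx hxG)).2 (not_lt.1 fun h => ?_)) (low x hx hxG)
      have : g ∈ G ∩ Ioo (l x) (r x) := ⟨hg.1, h, hxg.trans (hxr x hx hxG)⟩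
      rw [hlr x hx hxG] at this; exact this
  have uniq : ∀ x ∈ Icc a b, x ∉ G → ∀ u ∈ G ∩ Icc a b, ∀ v ∈ G ∩ Icc a b, u < x → x < v → G ∩ Ioo u v = ∅ → l x = u ∧ r x = v := by
    intro x hx hxG u hu v hv hux hxv huv
    have h1 := hlx x hx hxG
    have h2 := hxr x hx hxG
    have n1 : ∀ g ∈ G, ¬ (l x < g ∧ g < r x) := fun g hg h => by
      have : g ∈ G ∩ Ioo (l x) (r x) := ⟨hg, h⟩
      rw [hlr x hx hxG] at this; exact this
    have n2 : ∀ g ∈ G, ¬ (u < g ∧ g < v) := fun g hg h => by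
      have : g ∈ G ∩ Ioo u v := ⟨hg, h⟩
      rw [huv] at this; exact this
    constructor
    · rcases lt_trichotomy (l x) u with h | h | h
      · exact absurd ⟨h, hux.trans h2⟩ (n1 u hu.1)
      · exact h
      · exact absurd ⟨h, h1.trans hxv⟩ (n2 _ (hl x hx hxG).1)
    · rcases lt_trichotomy (r x) v with h | h | h
      · exact absurd ⟨hux.trans h2, h⟩ (n2 _ (hr x hx hxG).1)
      · exact h
      · exact absurd ⟨h1.trans hxv, h⟩ (n1 v hv.1)
  refine ⟨ψ, ⟨?_, ?_⟩, fun x hx => ψG x hx.1⟩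
  · intro x hx y hy hxy
    by_cases hxG : x ∈ G
    · rw [ψG x hxG]; exact lo y hy x ⟨hxG, hx⟩ hxy
    by_cases hyG : y ∈ G
    · rw [ψG y hyG]; exact up x hx y ⟨hyG, hy⟩ hxy
    by_cases h : y < r x
    · obtain ⟨e1, e2⟩ := uniq y hy hyG _ (hl x hx hxG) _ (hr x hx hxG) ((hlx x hx hxG).trans hxy) h (hlr x hx hxG)
      rw [ψn x hxG, ψn y hyG, e1, e2]
      have h1 := pos x hx hxG
      have h2 := hlx x hx hxG
      have h3 := hxr x hx hxG
      have : (x - l x) / (r x - l x) < (y - l x) / (r x - l x) := div_lt_div_of_pos_right (by linarith) (by linarith)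
      nlinarith
    · have h' : r x < y := lt_of_le_of_ne (not_lt.1 h) fun e => hyG (e ▸ (hr x hx hxG).1)
      exact (upp x hx hxG).trans (lo y hy _ (hr x hx hxG) h')
  · ext y
    constructor
    · rintro ⟨x, hx, rfl⟩
      constructor
      · rcases hx.1.eq_or_lt with h | h
        · rw [← h, ψG a haG]
        · exact (lo x hx a ⟨haG, le_rfl, hx.1.trans hx.2⟩ h).le
      · rcases hx.2.eq_or_lt with h | h
        · rw [h, ψG b hbG]
        · exact (up x hx b ⟨hbG, hx.1.trans hx.2, le_rfl⟩ h).le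
    · intro hy
      obtain ⟨u, hu, v, hv, huv, h1, h2, h3⟩ := hs y hy
      rcases h1.eq_or_lt with h1 | h1
      · exact ⟨u, hu.2, by rw [ψG u hu.1, h1]⟩
      rcases h2.eq_or_lt with h2 | h2
      · exact ⟨v, hv.2, by rw [ψG v hv.1, h2]⟩
      have huv : u < v := (hσ.lt_iff_lt hu hv).1 (h1.trans h2)
      set x := u + (y - σ u) / (σ v - σ u) * (v - u) with hxdef
      have q1 : 0 < (y - σ u) / (σ v - σ u) := div_pos (by linarith) (by linarith)
      have q2 : (y - σ u) / (σ v - σ u) < 1 := by rw [div_lt_one (by linarith)]; linarith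
      have hux : u < x := by nlinarith
      have hxv : x < v := by nlinarith
      have hx : x ∈ Icc a b := ⟨hu.2.1.trans hux.le, hxv.le.trans hv.2.2⟩
      have hxG : x ∉ G := fun h => by
        have : x ∈ G ∩ Ioo u v := ⟨h, hux, hxv⟩
        rw [h3] at this; exact this
      refine ⟨x, hx, ?_⟩
      obtain ⟨e1, e2⟩ := uniq x hx hxG u hu v hv hux hxv h3
      have n1 : v - u ≠ 0 := by linarith
      have n2 : σ v - σ u ≠ 0 := by linarith
      rw [ψn x hxG, e1, e2, hxdef]
      field_simp
      ring

lemma Setting.exists_cut_set {M W : Set ℝ} (hS : Setting M W) {a b : ℝ} :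
    ∃ T : Set ℝ, T.Countable ∧ T ⊆ Ioo a b \ closure M ∧ ∀ u v, a ≤ u → u < v → v ≤ b → ∃ t ∈ T, u < t ∧ t < v := by
  have : ∀ r : {r : ℚ × ℚ // a < r.1 ∧ (r.1:ℝ) < r.2 ∧ (r.2:ℝ) < b}, ∃ c ∈ Ioo (r.1.1:ℝ) r.1.2, c ∉ closure M :=
    fun r => hS.cut_dense r.2.2.1
  choose c hc hc' using this
  refine ⟨range c, countable_range c, ?_, ?_⟩
  · rintro _ ⟨r, rfl⟩
    exact ⟨⟨r.2.1.trans (hc r).1, (hc r).2.trans r.2.2.2⟩, hc' r⟩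
  · intro u v hu huv hv
    obtain ⟨r1, h1, h2⟩ := exists_rat_btwn huv
    obtain ⟨r2, h3, h4⟩ := exists_rat_btwn h2
    refine ⟨_, ⟨⟨(r1, r2), hu.trans_lt h1, h3, h4.trans_le hv⟩, rfl⟩, ?_, ?_⟩
    · exact h1.trans (hc ⟨(r1, r2), hu.trans_lt h1, h3, h4.trans_le hv⟩).1
    · exact (hc ⟨(r1, r2), hu.trans_lt h1, h3, h4.trans_le hv⟩).2.trans h4

lemma emb_perfect {M W K : Set ℝ} (hS : Setting M W) (hK : Preperfect K) (hc : IsCompact K) (hne : K.Nonempty)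
    (hKW : K ⊆ W) {a b : ℝ} (hab : a < b) (ha : a ∉ closure M) (hb : b ∉ closure M) :
    Emb M W a b (sInf K) (sSup K) := by
  classical
  obtain ⟨E, hE1, hE2, hE3, hE4⟩ := exists_left_dense hK hc hne
  obtain ⟨T, hT1, hT2, hT3⟩ := hS.exists_cut_set (a := a) (b := b)
  have hp := hc.sInf_mem hne
  have hq := hc.sSup_mem hne
  have hle : ∀ k ∈ K, sInf K ≤ k := fun k hk => csInf_le hc.bddBelow hk
  have hge : ∀ k ∈ K, k ≤ sSup K := fun k hk => le_csSup hc.bddAbove hk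
  have hpR : AccR K (sInf K) := (hK.acc_cases hp).resolve_right fun h => by
    obtain ⟨k, hk, h1⟩ := h.exists (sub_one_lt _)
    exact absurd (hle k hk) (not_le.2 h1.2)
  have hqL : AccL K (sSup K) := (hK.acc_cases hq).resolve_left fun h => by
    obtain ⟨k, hk, h1⟩ := h.exists (lt_add_one _)
    exact absurd (hge k hk) (not_le.2 h1.1)
  -- points of `E` just to the left of left-accumulated points
  have eL : ∀ x, AccL K x → ∀ u < x, ∃ e ∈ E, u < e ∧ e < x := by
    intro x hx u hu
    obtain ⟨k2, hk2, h1, h2⟩ := hx.exists hu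
    obtain ⟨k3, hk3, h3, h4⟩ := hx.exists h2
    obtain ⟨e, he, h5, h6⟩ := hE4 k2 hk2 k3 hk3 h3
    exact ⟨e, he, by linarith, by linarith⟩
  have eR : ∀ x, AccR K x → ∀ u > x, ∃ e ∈ E, x < e ∧ e < u := by
    intro x hx u hu
    obtain ⟨k2, hk2, h1, h2⟩ := hx.exists hu
    obtain ⟨k3, hk3, h3, h4⟩ := hx.exists h1
    obtain ⟨e, he, h5, h6⟩ := hE4 k3 hk3 k2 hk2 h4
    exact ⟨e, he, by linarith, by linarith⟩
  obtain ⟨e0, he0, -⟩ := eL _ hqL _ (sub_one_lt _)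
  obtain ⟨t0, ht0, -⟩ := hT3 a b le_rfl hab le_rfl
  have : Countable T := hT1.to_subtype
  have : Countable E := hE1.to_subtype
  have : Nonempty T := ⟨⟨t0, ht0⟩⟩
  have : Nonempty E := ⟨⟨e0, he0⟩⟩
  have : DenselyOrdered T := ⟨fun u v huv => by
    obtain ⟨t, ht, h1, h2⟩ := hT3 u v (hT2 u.2).1.1.le huv (hT2 v.2).1.2.le
    exact ⟨⟨t, ht⟩, h1, h2⟩⟩
  have : NoMinOrder T := ⟨fun u => by
    obtain ⟨t, ht, h1, h2⟩ := hT3 a u le_rfl (hT2 u.2).1.1 (hT2 u.2).1.2.le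
    exact ⟨⟨t, ht⟩, h2⟩⟩
  have : NoMaxOrder T := ⟨fun u => by
    obtain ⟨t, ht, h1, h2⟩ := hT3 u b (hT2 u.2).1.1.le (hT2 u.2).1.2 le_rfl
    exact ⟨⟨t, ht⟩, h1⟩⟩
  have : DenselyOrdered E := ⟨fun u v huv => by
    obtain ⟨t, ht, h1, h2⟩ := eL v (hE3 v v.2) u huv
    exact ⟨⟨t, ht⟩, h1, h2⟩⟩
  have : NoMinOrder E := ⟨fun u => by
    obtain ⟨t, ht, h1, h2⟩ := eL u (hE3 u u.2) _ (sub_one_lt _)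
    exact ⟨⟨t, ht⟩, h2⟩⟩
  have : NoMaxOrder E := ⟨fun u => by
    obtain ⟨t, ht, h1, h2⟩ := eL _ hqL u (hE2 u.2).2
    exact ⟨⟨t, ht⟩, h1⟩⟩
  obtain ⟨f⟩ := Order.iso_of_countable_dense T E
  -- the extension
  let L : ℝ → Set ℝ := fun x => {y | ∃ t : T, t.1 < x ∧ (f t).1 = y}
  let σ : ℝ → ℝ := fun x => if x = a then sInf K else sSup (L x)
  have Lb : ∀ x, BddAbove (L x) := fun x => ⟨sSup K, by
    rintro _ ⟨t, -, rfl⟩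
    exact (hE2 (f t).2).2.le⟩
  have Ln : ∀ x, a < x → x ≤ b → (L x).Nonempty := fun x h1 h2 => by
    obtain ⟨t, ht, h3, h4⟩ := hT3 a x le_rfl h1 h2
    exact ⟨_, ⟨t, ht⟩, h4, rfl⟩
  have σL : ∀ x, a < x → x ≤ b → IsLUB (L x) (σ x) := fun x h1 h2 => by
    simp only [σ, if_neg h1.ne']
    exact isLUB_csSup (Ln x h1 h2) (Lb x)
  -- strict upper bound
  have σLs : ∀ x, a < x → x ≤ b → ∀ t : T, t.1 < x → (f t).1 < σ x := fun x h1 h2 t ht => by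
    obtain ⟨t', ht', h3, h4⟩ := hT3 t x (hT2 t.2).1.1.le ht h2
    have h5 : (f t).1 < (f ⟨t', ht'⟩).1 := f.strictMono (show t < ⟨t', ht'⟩ from h3)
    exact h5.trans_le ((σL x h1 h2).1 ⟨_, h4, rfl⟩)
  have σK : ∀ x, a < x → x ≤ b → σ x ∈ K ∧ AccL K (σ x) := fun x h1 h2 => by
    have hacc : AccL K (σ x) := by
      intro ε hε
      obtain ⟨_, ⟨t, ht, rfl⟩, h3⟩ := (lt_isLUB_iff (σL x h1 h2)).1 (show σ x - ε < σ x by linarith)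
      obtain ⟨k, hk, h4, h5⟩ := (hE3 _ (f t).2).exists h3
      exact ⟨k, hk, h4, h5.trans (σLs x h1 h2 t ht)⟩
    exact ⟨hc.isClosed.closure_eq ▸ accL_closure hacc, hacc⟩
  have σa : σ a = sInf K := if_pos rfl
  have σb : σ b = sSup K := by
    refine (σL b hab le_rfl).unique ⟨?_, fun u hu => not_lt.1 fun h => ?_⟩
    · rintro _ ⟨t, -, rfl⟩
      exact (hE2 (f t).2).2.le
    · obtain ⟨e, he, h1, h2⟩ := eL _ hqL u h
      have := hu ⟨f.symm ⟨e, he⟩, (hT2 (f.symm ⟨e, he⟩).2).1.2, rfl⟩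
      simp at this; linarith
  -- lower property
  have σR : ∀ x, a ≤ x → x < b → x ∉ T → ∀ y, (∀ t : T, x < t.1 → y ≤ (f t).1) → y ≤ σ x := by
    intro x h1 h2 hxT y hy
    by_contra! hlt
    have hK1 : σ x ∈ K := by
      rcases h1.eq_or_lt with h | h
      · rw [← h, σa]; exact hp
      · exact (σK x h h2.le).1
    -- find `e ∈ E` with `σ x ≤ e < y`
    have : ∃ e ∈ E, σ x ≤ e ∧ e < y := by
      by_cases hR : AccR K (σ x)
      · obtain ⟨e, he, h3, h4⟩ := eR _ hR y hlt
        exact ⟨e, he, h3.le, h4⟩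
      · obtain ⟨ε, hε, hem⟩ := not_accR hR
        have hlq : σ x < sSup K := by
          obtain ⟨t, ht, h3, h4⟩ := hT3 x b h1 h2 le_rfl
          exact hlt.trans_le ((hy ⟨t, ht⟩ h3).trans (hE2 (f _).2).2.le)
        obtain ⟨k, hk, h3, h4⟩ := hqL.exists hlq
        have c2 : IsCompact (K ∩ Icc (σ x + ε) (sSup K)) := hc.inter_right isClosed_Icc
        have hk' : σ x + ε ≤ k := not_lt.1 fun h => by
          have : k ∈ K ∩ Ioo (σ x) (σ x + ε) := ⟨hk, h3, h⟩
          rw [hem] at this; exact this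
        have hkm := c2.sInf_mem ⟨k, hk, hk', h4.le⟩
        have hkl := fun z hz => csInf_le c2.bddBelow (a := z) hz
        obtain ⟨e, he, h5, h6⟩ := hE4 _ hK1 _ hkm.1 (by linarith [hkm.2.1])
        obtain ⟨k2, hk2, h7, h8⟩ := (hE3 e he).exists (sub_one_lt e)
        have hee : e = σ x := by
          by_contra hne'
          have hlt' : σ x < e := lt_of_le_of_ne h5 (Ne.symm hne')
          obtain ⟨k2, hk2, h7, h8⟩ := (hE3 e he).exists hlt'
          have h9 : σ x + ε ≤ k2 := not_lt.1 fun h => by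
            have : k2 ∈ K ∩ Ioo (σ x) (σ x + ε) := ⟨hk2, h7, h⟩
            rw [hem] at this; exact this
          have := hkl k2 ⟨hk2, h9, hge _ hk2⟩
          linarith
        exact ⟨e, he, h5, hee ▸ hlt⟩
    obtain ⟨e, he, h3, h4⟩ := this
    rcases lt_trichotomy (f.symm ⟨e, he⟩).1 x with h | h | h
    · have hax : a < x := (hT2 (f.symm ⟨e, he⟩).2).1.1.trans h
      have := σLs x hax h2.le _ h
      simp at this; linarith
    · exact hxT (h ▸ (f.symm ⟨e, he⟩).2)
    · have := hy _ h
      simp at this; linarith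
  -- strictness on the right
  have σRs : ∀ x, a ≤ x → x ∉ T → ∀ t : T, x < t.1 → σ x < (f t).1 := by
    intro x h1 hxT t ht
    rcases h1.eq_or_lt with h | h
    · rw [← h, σa]; exact (hE2 (f t).2).1
    · have h2 := (hT2 t.2).1.2
      obtain ⟨t', ht', h3, h4⟩ := hT3 x t h.le ht h2.le
      have h5 : (f ⟨t', ht'⟩).1 < (f t).1 := f.strictMono (show (⟨t', ht'⟩ : T) < t from h4)
      refine lt_of_le_of_lt ((σL x h (ht.trans h2).le).2 ?_) h5
      rintro _ ⟨s, hs, rfl⟩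
      exact (f.strictMono (show s < ⟨t', ht'⟩ from hs.trans h3)).le
  let G : Set ℝ := closure M ∪ {a, b}
  have hGc : IsClosed G := isClosed_closure.union (Set.toFinite _).isClosed
  have hGT : ∀ x ∈ G, x ∉ T := by
    rintro x (h | h | h) hxT
    · exact (hT2 hxT).2 h
    · exact absurd (hT2 hxT).1.1 (by rw [h]; exact lt_irrefl _)
    · exact absurd (hT2 hxT).1.2 (by rw [mem_singleton_iff.1 h]; exact lt_irrefl _)
  have hσ : StrictMonoOn σ (G ∩ Icc a b) := by
    intro x hx y hy hxy
    obtain ⟨t, ht, h1, h2⟩ := hT3 x y hx.2.1 hxy hy.2.2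
    exact (σRs x hx.2.1 (hGT x hx.1) ⟨t, ht⟩ h1).trans (σLs y (hx.2.1.trans_lt hxy) hy.2.2 ⟨t, ht⟩ h2)
  have haG : a ∈ G := Or.inr (Or.inl rfl)
  have hbG : b ∈ G := Or.inr (Or.inr rfl)
  obtain ⟨ψ, h1, h2⟩ := interpolate hGc haG hbG hσ (by
    intro y hy
    have cG : IsClosed (G ∩ Icc a b) := hGc.inter isClosed_Icc
    -- left part
    let A : Set ℝ := {x | x ∈ G ∩ Icc a b ∧ σ x ≤ y}
    let B : Set ℝ := {x | x ∈ G ∩ Icc a b ∧ y ≤ σ x}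
    have An : A.Nonempty := ⟨a, ⟨haG, le_rfl, hab.le⟩, hy.1⟩
    have Bn : B.Nonempty := ⟨b, ⟨hbG, hab.le, le_rfl⟩, hy.2⟩
    have Ab : BddAbove A := ⟨b, fun x hx => hx.1.2.2⟩
    have Bb : BddBelow B := ⟨a, fun x hx => hx.1.2.1⟩
    have A1 : sSup A ∈ G ∩ Icc a b := closure_minimal (fun x hx => hx.1) cG (csSup_mem_closure An Ab)
    have B1 : sInf B ∈ G ∩ Icc a b := closure_minimal (fun x hx => hx.1) cG (csInf_mem_closure Bn Bb)
    have A2 : σ (sSup A) ≤ y := by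
      rcases A1.2.1.eq_or_lt with h | h
      · rw [← h]; exact hy.1
      · refine (σL _ h A1.2.2).2 ?_
        rintro _ ⟨t, ht, rfl⟩
        obtain ⟨x, hx, hx2⟩ := exists_lt_of_lt_csSup An ht
        exact (σLs x ((hT2 t.2).1.1.trans hx2) hx.1.2.2 t hx2).le.trans hx.2
    have B2 : y ≤ σ (sInf B) := by
      rcases B1.2.2.eq_or_lt with h | h
      · rw [h]; exact hy.2
      · refine σR _ B1.2.1 h (hGT _ B1.1) y ?_
        intro t ht
        obtain ⟨x, hx, hx2⟩ := exists_lt_of_csInf_lt Bn ht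
        exact hx.2.trans (σRs x hx.1.2.1 (hGT x hx.1.1) t hx2).le
    refine ⟨_, A1, _, B1, (hσ.le_iff_le A1 B1).1 (A2.trans B2), A2, B2, ?_⟩
    rw [eq_empty_iff_forall_notMem]
    rintro x ⟨hx, h3, h4⟩
    have hx' : x ∈ G ∩ Icc a b := ⟨hx, A1.2.1.trans h3.le, h4.le.trans B1.2.2⟩
    rcases le_total (σ x) y with h | h
    · exact absurd (le_csSup Ab ⟨hx', h⟩) (not_le.2 h3)
    · exact absurd (csInf_le Bb ⟨hx', h⟩) (not_le.2 h4))
  rw [σa, σb] at h1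
  refine ⟨ψ, h1, fun x hx => ?_⟩
  have hx' : x ∈ G ∩ Icc a b := ⟨Or.inl (subset_closure hx.1), hx.2.1.le, hx.2.2.le⟩
  rw [h2 x hx']
  exact hKW (σK x hx.2.1 hx.2.2.le).1

lemma Emb.widen_left {M W : Set ℝ} {a b p q p'} (ha : a ∉ closure M) (hab : a < b) (hp : p' ≤ p)
    (h : Emb M W a b p q) : Emb M W a b p' q := by
  have h1 := h.neg.widen_right (q' := -p') (by rw [closure_neg_preimage]; simpa using ha) (by linarith) (by linarith)
  have h2 := h1.neg
  simpa [neg_neg_preimage] using h2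

/-- uncountable target -/
lemma emb_uncountable {M W : Set ℝ} (hS : Setting M W) {a b p q : ℝ} (hab : a < b) (ha : a ∉ closure M)
    (hb : b ∉ closure M) (hW : ¬ (W ∩ Ioo p q).Countable) : Emb M W a b p q := by
  have h1 : ¬ (W ∩ Icc p q).Countable := fun h => hW (h.mono (inter_subset_inter_right _ Ioo_subset_Icc_self))
  obtain ⟨D, hD, hne, hsub⟩ := exists_perfect_nonempty_of_isClosed_of_not_countable (hS.closed.inter isClosed_Icc) h1
  have hc : IsCompact D := isCompact_Icc.of_isClosed_subset hD.closed (hsub.trans inter_subset_right)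
  have := emb_perfect hS hD.acc hc hne (hsub.trans inter_subset_left) hab ha hb
  exact (this.widen_right hb hab ((hsub (hc.sSup_mem hne)).2.2)).widen_left ha hab ((hsub (hc.sInf_mem hne)).2.1)

lemma exists_unc_step {W : Set ℝ} {z y ε : ℝ} (hε : 0 < ε) (hzy : z < y) (h : ¬ (W ∩ Ioo z y).Countable) :
    ∃ y', z < y' ∧ y' < y ∧ y' < z + ε ∧ ¬ (W ∩ Ioo y' y).Countable := by
  by_contra! hc
  refine h ?_
  obtain ⟨u, -, hu, hul⟩ := exists_seq_strictAnti_tendsto' (show z < min y (z+ε) from lt_min hzy (by linarith))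
  have : W ∩ Ioo z y ⊆ ⋃ n, W ∩ Ioo (u n) y := by
    rintro x ⟨hx, h1, h2⟩
    obtain ⟨n, hn⟩ := (hul.eventually (gt_mem_nhds h1)).exists
    exact mem_iUnion.2 ⟨n, hx, hn, h2⟩
  refine (countable_iUnion fun n => ?_).mono this
  exact hc _ (hu n).1 ((hu n).2.trans_le (min_le_left _ _)) ((hu n).2.trans_le (min_le_right _ _))

lemma exists_unc_seq {W : Set ℝ} {z b : ℝ} (hzb : z < b) (h : ∀ ε > 0, ¬ (W ∩ Ioo z (z+ε)).Countable) :
    ∃ y : ℕ → ℝ, y 0 = b ∧ Tendsto y atTop (𝓝 z) ∧ ∀ k, ¬ (W ∩ Ioo (y (k+1)) (y k)).Countable := by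
  have : ∀ (k : ℕ) (u : {u : ℝ // z < u}), ∃ v : {u : ℝ // z < u},
      v.1 < z + 1/((k:ℝ)+1) ∧ ¬ (W ∩ Ioo v.1 u.1).Countable := by
    intro k u
    have h1 := h (u.1 - z) (by linarith [u.2])
    rw [add_sub_cancel] at h1
    obtain ⟨y', a1, a2, a3, a4⟩ := exists_unc_step (ε := 1/((k:ℝ)+1)) (by positivity) u.2 h1
    exact ⟨⟨y', a1⟩, a3, a4⟩
  choose f hf1 hf2 using this
  let r : ℕ → {u : ℝ // z < u} := fun n => Nat.rec ⟨b, hzb⟩ (fun k q => f k q) n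
  have rs : ∀ n, r (n+1) = f n (r n) := fun n => rfl
  refine ⟨fun n => (r n).1, rfl, ?_, fun k => ?_⟩
  · rw [← tendsto_add_atTop_iff_nat 1]
    have h0 : Tendsto (fun n : ℕ => z + 1/((n:ℝ)+1)) atTop (𝓝 (z + 0)) :=
      tendsto_const_nhds.add tendsto_one_div_add_atTop_nhds_zero_nat
    rw [add_zero] at h0
    refine tendsto_of_tendsto_of_tendsto_of_le_of_le tendsto_const_nhds h0 (fun n => (r (n+1)).2.le) (fun n => ?_)
    simp only [rs]
    exact (hf1 n (r n)).le
  · simp only [rs]; exact hf2 k (r k)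

lemma half_right {M W : Set ℝ} (hS : Setting M W) (z : ℝ) :
    ∃ δ > 0, ∀ b, b ∉ closure M → z < b → b < z + δ → Emb M W z b z b := by
  by_cases hc : ∃ ε > 0, (W ∩ Ioo z (z+ε)).Countable
  · obtain ⟨ε, hε, hc⟩ := hc
    obtain ⟨δ, hδ, h⟩ := half_countable hS hε hc
    exact ⟨δ, hδ, fun b h1 h2 h3 => h b h1 h2 h3 b h2⟩
  · push Not at hc
    refine ⟨1, one_pos, fun b hb hzb _ => ?_⟩
    obtain ⟨r, r0, hr, hrx, hrc, hxr⟩ := exists_cuts hS hb hzb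
    obtain ⟨y, y0, hy, hyc⟩ := exists_unc_seq hzb hc
    have := Emb.glue_seq (M := M) (W := W) hr hrx hy (fun k h => hrc _ (subset_closure h)) (fun k =>
      emb_uncountable hS (hr (Nat.lt_succ_self k)) (hrc _) (hrc _) (hyc k))
    rwa [r0, y0] at this

lemma half_left {M W : Set ℝ} (hS : Setting M W) (z : ℝ) :
    ∃ δ > 0, ∀ b, b ∉ closure M → b < z → z - δ < b → Emb M W b z b z := by
  obtain ⟨δ, hδ, h⟩ := half_right hS.neg (-z)
  refine ⟨δ, hδ, fun b hb h1 h2 => ?_⟩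
  have := (h (-b) (by rw [closure_neg_preimage]; simpa using hb) (by linarith) (by linarith)).neg
  simpa [neg_neg_preimage] using this

lemma Emb.anti {M M' W : Set ℝ} {a b p q} (h : Emb M W a b p q) (hM : M' ⊆ M) : Emb M' W a b p q := by
  obtain ⟨ψ, h1, h2⟩ := h
  exact ⟨ψ, h1, fun x hx => h2 x ⟨hM hx.1, hx.2⟩⟩

def EmbF (M W : Set ℝ) (a b : ℝ) : Prop := ∃ M0 : Set ℝ, M0.Finite ∧ Emb (M \ M0) W a b a b

lemma EmbF.glue {M W : Set ℝ} {a b c} (hac : a ≤ c) (hcb : c ≤ b) (h1 : EmbF M W a c) (h2 : EmbF M W c b) :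
    EmbF M W a b := by
  obtain ⟨M1, f1, h1⟩ := h1
  obtain ⟨M2, f2, h2⟩ := h2
  refine ⟨insert c (M1 ∪ M2), (f1.union f2).insert c, ?_⟩
  refine Emb.glue hac hcb (fun h => absurd (mem_insert _ _) h.2) (h1.anti ?_) (h2.anti ?_)
  · exact diff_subset_diff_right (subset_union_left.trans (subset_insert _ _))
  · exact diff_subset_diff_right (subset_union_right.trans (subset_insert _ _))

lemma EmbF.of {M W : Set ℝ} {a b} (h : Emb M W a b a b) : EmbF M W a b := ⟨∅, finite_empty, by simpa using h⟩

theorem mark_theorem {M W : Set ℝ} (hS : Setting M W) : EmbF M W 0 1 := by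
  refine cousin (C := (closure M)ᶜ ∪ {0, 1}) one_pos (by simp) (by simp) ?_ ?_ ?_
  · intro u v _ huv _
    obtain ⟨c, h1, h2⟩ := hS.cut_dense huv
    exact ⟨c, h1, Or.inl h2⟩
  · intro u c v _ h1 h2 _ _ _ _ h3 h4
    exact h3.glue h1.le h2.le h4
  · intro y hy
    obtain ⟨δ, hδ, hR⟩ := half_right hS y
    obtain ⟨δ', hδ', hL⟩ := half_left hS y
    obtain ⟨ε, hε, e1, e2⟩ : ∃ ε > 0, (0 < y → ε ≤ y) ∧ (y < 1 → ε ≤ 1 - y) := by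
      by_cases h0 : 0 < y
      · by_cases h1 : y < 1
        · exact ⟨min y (1-y), lt_min h0 (by linarith), fun _ => min_le_left _ _, fun _ => min_le_right _ _⟩
        · exact ⟨y, h0, fun _ => le_rfl, fun h => absurd h h1⟩
      · exact ⟨1 - y, by linarith, fun h => absurd h h0, fun _ => le_rfl⟩
    refine ⟨min ε (min δ δ'), lt_min hε (lt_min hδ hδ'), fun c d hc hd h0c hd1 hcd h1 h2 hcy hyd => ?_⟩
    have m1 := min_le_left ε (min δ δ')
    have m2 := (min_le_right ε (min δ δ')).trans (min_le_left _ _)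
    have m3 := (min_le_right ε (min δ δ')).trans (min_le_right _ _)
    have left : c < y → EmbF M W c y := fun hlt => by
      refine EmbF.of (hL c ?_ hlt (by linarith))
      rcases hc with h | h | h
      · exact h
      · rw [h] at hlt h1; linarith [e1 hlt]
      · rw [mem_singleton_iff.1 h] at hlt; linarith [hy.2]
    have right : y < d → EmbF M W y d := fun hlt => by
      refine EmbF.of (hR d ?_ hlt (by linarith))
      rcases hd with h | h | h
      · exact h
      · rw [h] at hlt; linarith [hy.1]
      · rw [mem_singleton_iff.1 h] at hlt h2; linarith [e2 hlt]
    rcases hcy.eq_or_lt with h | h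
    · rw [h]; exact right (by linarith)
    · rcases hyd.eq_or_lt with h' | h'
      · rw [← h']; exact left h
      · exact (left h).glue hcy hyd (right h')

/-- injective choice -/
lemma exists_inj_choice {α : Type*} (A : ℕ → Set α) (h : ∀ j, (A j).Infinite) :
    ∃ n : ℕ → α, Function.Injective n ∧ ∀ j, n j ∈ A j := by
  classical
  have step : ∀ (j : ℕ) (S : Finset α), ∃ x, x ∈ A j ∧ x ∉ S := fun j S => (h j).exists_notMem_finset S
  choose f hf1 hf2 using step
  let S : ℕ → Finset α := fun j => Nat.rec ∅ (fun k T => insert (f k T) T) j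
  have Ss : ∀ j, S (j+1) = insert (f j (S j)) (S j) := fun j => rfl
  have Sm : Monotone S := monotone_nat_of_le_succ fun j => by rw [Ss]; exact Finset.subset_insert _ _
  have hlt : ∀ i j, i < j → f i (S i) ≠ f j (S j) := fun i j hij he => by
    have h1 : f i (S i) ∈ S (i+1) := by rw [Ss]; exact Finset.mem_insert_self _ _
    exact hf2 j (S j) (he ▸ Sm hij h1)
  refine ⟨fun j => f j (S j), fun i j hij => ?_, fun j => hf1 _ _⟩
  rcases lt_trichotomy i j with h | h | h
  · exact absurd hij (hlt _ _ h)
  · exact h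
  · exact absurd hij.symm (hlt _ _ h)

def INF (F : ℕ → Set (ℝ × ℝ)) (u v : ℝ) : Prop := {n | ∃ b ∈ F n, u < b.1 ∧ b.2 < v}.Infinite

lemma INF.mono {F : ℕ → Set (ℝ × ℝ)} {u v u' v'} (h : INF F u v) (hu : u' ≤ u) (hv : v ≤ v') : INF F u' v' := by
  refine Set.Infinite.mono ?_ h
  rintro n ⟨b, hb, h1, h2⟩
  exact ⟨b, hb, hu.trans_lt h1, h2.trans_le hv⟩

structure CL (A B : ℝ) (F : ℕ → Set (ℝ × ℝ)) (s t : ℕ → ℝ) : Prop where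
  hst : ∀ j, A ≤ s j ∧ s j < t j ∧ t j ≤ B
  hF : ∀ n, ∀ b ∈ F n, b.1 < b.2
  H : ∀ u v, {j | u ≤ s j ∧ t j ≤ v}.Infinite → INF F u v

def Cov (A B : ℝ) (F : ℕ → Set (ℝ × ℝ)) (s t : ℕ → ℝ) (J : Set ℕ) : Prop :=
  ∃ ψ, IsoOn ψ A B A B ∧ ∃ n : ℕ → ℕ, ∃ β : ℕ → ℝ × ℝ, InjOn n J ∧
    ∀ j ∈ J, β j ∈ F (n j) ∧ ψ (s j) ≤ (β j).1 ∧ (β j).2 ≤ ψ (t j)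

def FCov (A B : ℝ) (F : ℕ → Set (ℝ × ℝ)) (s t : ℕ → ℝ) (J : Set ℕ) : Prop :=
  ∃ L : Set (Set ℕ), L.Finite ∧ (∀ K ∈ L, Cov A B F s t K) ∧ (J \ ⋃₀ L).Finite

section
variable {A B : ℝ} {F : ℕ → Set (ℝ × ℝ)} {s t : ℕ → ℝ} {J J' : Set ℕ}

lemma Cov.fcov (h : Cov A B F s t J) : FCov A B F s t J :=
  ⟨{J}, finite_singleton _, by simpa using h, by simp⟩

lemma FCov.mono (h : FCov A B F s t J) (hJ : J' ⊆ J) : FCov A B F s t J' := by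
  obtain ⟨L, h1, h2, h3⟩ := h
  exact ⟨L, h1, h2, h3.subset (sdiff_subset_sdiff_left hJ)⟩

lemma FCov.union (h : FCov A B F s t J) (h' : FCov A B F s t J') : FCov A B F s t (J ∪ J') := by
  obtain ⟨L, h1, h2, h3⟩ := h
  obtain ⟨L', h1', h2', h3'⟩ := h'
  refine ⟨L ∪ L', h1.union h1', ?_, (h3.union h3').subset ?_⟩
  · rintro K (hK | hK)
    · exact h2 K hK
    · exact h2' K hK
  · rw [sUnion_union]
    rintro j ⟨hj | hj, hn⟩
    · exact Or.inl ⟨hj, fun h => hn (Or.inl h)⟩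
    · exact Or.inr ⟨hj, fun h => hn (Or.inr h)⟩

lemma FCov.of_finite (h : J.Finite) : FCov A B F s t J := ⟨∅, finite_empty, by simp, by simpa using h⟩

/-- reflected family -/
def reflF (F : ℕ → Set (ℝ × ℝ)) : ℕ → Set (ℝ × ℝ) := fun n => {b | (-b.2, -b.1) ∈ F n}

lemma reflF_reflF : reflF (reflF F) = F := by
  funext n; ext b; simp [reflF]

lemma INF.refl {u v} (h : INF F u v) : INF (reflF F) (-v) (-u) := by
  refine Set.Infinite.mono ?_ h
  rintro n ⟨b, hb, h1, h2⟩
  exact ⟨(-b.2, -b.1), by simpa [reflF] using hb, by simpa using h2, by simpa using h1⟩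

lemma INF_refl_iff {u v} : INF (reflF F) u v ↔ INF F (-v) (-u) := by
  constructor
  · intro h; have := h.refl; rwa [reflF_reflF] at this
  · intro h; have := h.refl; simpa using this

lemma CL.refl (h : CL A B F s t) : CL (-B) (-A) (reflF F) (fun j => -t j) (fun j => -s j) where
  hst j := ⟨by linarith [(h.hst j).2.2], by linarith [(h.hst j).2.1], by linarith [(h.hst j).1]⟩
  hF n b hb := by have := h.hF n _ hb; simp at this; exact this
  H u v hi := by
    rw [INF_refl_iff]
    refine h.H _ _ (hi.mono ?_)
    rintro j ⟨h1, h2⟩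
    exact ⟨by linarith, by linarith⟩

lemma Cov.refl (h : Cov A B F s t J) : Cov (-B) (-A) (reflF F) (fun j => -t j) (fun j => -s j) J := by
  obtain ⟨ψ, h1, n, β, h2, h3⟩ := h
  refine ⟨_, h1.neg, n, fun j => (-(β j).2, -(β j).1), h2, fun j hj => ?_⟩
  obtain ⟨a1, a2, a3⟩ := h3 j hj
  refine ⟨by simpa [reflF] using a1, ?_, ?_⟩
  · simp; linarith
  · simp; linarith

lemma FCov.refl (h : FCov A B F s t J) : FCov (-B) (-A) (reflF F) (fun j => -t j) (fun j => -s j) J := by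
  obtain ⟨L, h1, h2, h3⟩ := h
  exact ⟨L, h1, fun K hK => (h2 K hK).refl, h3⟩

lemma FCov.of_refl (h : FCov (-B) (-A) (reflF F) (fun j => -t j) (fun j => -s j) J) : FCov A B F s t J := by
  have := h.refl
  simpa [reflF_reflF] using this

/-- gluing isomorphisms of disjoint cells -/
lemma glue_cells {ι : Type*} {l r : ι → ℝ} (hlr : ∀ i, l i < r i) (hA : ∀ i, A ≤ l i) (hB : ∀ i, r i ≤ B)
    (hd : ∀ i k, i ≠ k → Disjoint (Ioo (l i) (r i)) (Ioo (l k) (r k))) {ψ : ι → ℝ → ℝ}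
    (h : ∀ i, IsoOn (ψ i) (l i) (r i) (l i) (r i)) :
    ∃ φ, IsoOn φ A B A B ∧ ∀ i, ∀ x ∈ Icc (l i) (r i), φ x = ψ i x := by
  classical
  let φ : ℝ → ℝ := fun x => if h : ∃ i, x ∈ Ioo (l i) (r i) then ψ h.choose x else x
  have uniq : ∀ i k x, x ∈ Ioo (l i) (r i) → x ∈ Ioo (l k) (r k) → i = k := fun i k x h1 h2 => by
    by_contra hne
    exact disjoint_left.1 (hd i k hne) h1 h2
  have φi : ∀ i, ∀ x ∈ Ioo (l i) (r i), φ x = ψ i x := fun i x hx => by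
    have he : ∃ i, x ∈ Ioo (l i) (r i) := ⟨i, hx⟩
    simp only [φ, dif_pos he]
    rw [uniq _ _ x he.choose_spec hx]
  have φn : ∀ x, (¬ ∃ i, x ∈ Ioo (l i) (r i)) → φ x = x := fun x hx => by simp only [φ, dif_neg hx]
  -- endpoints of cells are not in the interior of any cell
  have endl : ∀ i k, l i ∉ Ioo (l k) (r k) := fun i k hm => by
    have hlt : l i < min (r i) (r k) := lt_min (hlr i) hm.2
    have h1 : (l i + min (r i) (r k))/2 ∈ Ioo (l i) (r i) := ⟨by linarith, by linarith [min_le_left (r i) (r k)]⟩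
    have h2 : (l i + min (r i) (r k))/2 ∈ Ioo (l k) (r k) := ⟨by linarith [hm.1], by linarith [min_le_right (r i) (r k)]⟩
    have := uniq _ _ _ h1 h2
    rw [this] at hm; exact lt_irrefl _ hm.1
  have endr : ∀ i k, r i ∉ Ioo (l k) (r k) := fun i k hm => by
    have hlt : max (l i) (l k) < r i := max_lt (hlr i) hm.1
    have h1 : (r i + max (l i) (l k))/2 ∈ Ioo (l i) (r i) := ⟨by linarith [le_max_left (l i) (l k)], by linarith⟩
    have h2 : (r i + max (l i) (l k))/2 ∈ Ioo (l k) (r k) := ⟨by linarith [le_max_right (l i) (l k)], by linarith [hm.2]⟩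
    have := uniq _ _ _ h1 h2
    rw [this] at hm; exact lt_irrefl _ hm.2
  have φI : ∀ i, ∀ x ∈ Ioo (l i) (r i), φ x ∈ Ioo (l i) (r i) := fun i x hx => by
    rw [φi i x hx]; exact (h i).mapsTo_Ioo hx
  have up : ∀ x y, x < y → (¬ ∃ i, y ∈ Ioo (l i) (r i)) → φ x < y := fun x y hxy hy => by
    by_cases hx : ∃ i, x ∈ Ioo (l i) (r i)
    · obtain ⟨i, hi⟩ := hx
      refine (φI i x hi).2.trans_le (not_lt.1 fun h => hy ⟨i, hi.1.trans hxy, h⟩)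
    · rwa [φn x hx]
  have lo : ∀ x y, y < x → (¬ ∃ i, y ∈ Ioo (l i) (r i)) → y < φ x := fun x y hxy hy => by
    by_cases hx : ∃ i, x ∈ Ioo (l i) (r i)
    · obtain ⟨i, hi⟩ := hx
      refine lt_of_le_of_lt (not_lt.1 fun h => hy ⟨i, h, hxy.trans hi.2⟩) (φI i x hi).1
    · rwa [φn x hx]
  have strict : StrictMono φ := by
    intro x y hxy
    by_cases hy : ∃ i, y ∈ Ioo (l i) (r i)
    · obtain ⟨i, hi⟩ := hy
      by_cases hx : x ∈ Ioo (l i) (r i)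
      · rw [φi i x hx, φi i y hi]; exact (h i).mono (Ioo_subset_Icc_self hx) (Ioo_subset_Icc_self hi) hxy
      · have hxl : x ≤ l i := not_lt.1 fun h => hx ⟨h, hxy.trans hi.2⟩
        have h1 : φ x ≤ l i := by
          rcases hxl.eq_or_lt with h | h
          · rw [h, φn]; rintro ⟨k, hk⟩; exact endl i k hk
          · exact (up x _ h (by rintro ⟨k, hk⟩; exact endl i k hk)).le
        exact h1.trans_lt (φI i y hi).1
    · rw [φn y hy]; exact up x y hxy hy
  refine ⟨φ, ⟨strict.strictMonoOn _, ?_⟩, ?_⟩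
  · have nA : ¬ ∃ i, A ∈ Ioo (l i) (r i) := by rintro ⟨i, hi⟩; linarith [hA i, hi.1]
    have nB : ¬ ∃ i, B ∈ Ioo (l i) (r i) := by rintro ⟨i, hi⟩; linarith [hB i, hi.2]
    ext y
    constructor
    · rintro ⟨x, hx, rfl⟩
      constructor
      · rcases hx.1.eq_or_lt with h | h
        · rw [← h, φn A nA]
        · exact (lo x A h nA).le
      · rcases hx.2.eq_or_lt with h | h
        · rw [h, φn B nB]
        · exact (up x B h nB).le
    · intro hy
      by_cases hyc : ∃ i, y ∈ Ioo (l i) (r i)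
      · obtain ⟨i, hi⟩ := hyc
        have : y ∈ Icc (l i) (r i) := Ioo_subset_Icc_self hi
        rw [← (h i).surj] at this
        obtain ⟨x, hx, rfl⟩ := this
        have hx' : x ∈ Ioo (l i) (r i) := by
          refine ⟨lt_of_le_of_ne hx.1 ?_, lt_of_le_of_ne hx.2 ?_⟩
          · rintro rfl; rw [(h i).left (hlr i).le] at hi; exact lt_irrefl _ hi.1
          · rintro rfl; rw [(h i).right (hlr i).le] at hi; exact lt_irrefl _ hi.2
        exact ⟨x, ⟨(hA i).trans hx.1, hx.2.trans (hB i)⟩, φi i x hx'⟩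
      · exact ⟨y, hy, φn y hyc⟩
  · intro i x hx
    rcases hx.1.eq_or_lt with h1 | h1
    · rw [← h1, (h i).left (hlr i).le, φn]; rintro ⟨k, hk⟩; exact endl i k hk
    rcases hx.2.eq_or_lt with h2 | h2
    · rw [h2, (h i).right (hlr i).le, φn]; rintro ⟨k, hk⟩; exact endr i k hk
    exact φi i x ⟨h1, h2⟩

/-- push lemma -/
lemma push {l c : ℝ} (hlc : l < c) {J : Set ℕ} {s p : ℕ → ℝ} (hs : ∀ j ∈ J, l ≤ s j ∧ s j < c) (hp : ∀ j ∈ J, l < p j)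
    (hf : ∀ ε > 0, {j ∈ J | p j < s j - ε}.Finite) :
    ∃ φ, IsoOn φ l c l c ∧ ∀ j ∈ J, φ (s j) ≤ p j := by
  classical
  -- individual functions
  have ind : ∀ j, ∃ f : ℝ → ℝ, Continuous f ∧ StrictMono f ∧ f l = l ∧ f c = c ∧ (j ∈ J → f (s j) ≤ p j) ∧
      (∀ x ∈ Icc l c, f x ≤ x) ∧ ∀ x ∈ Icc l c, x - max 0 (if j ∈ J then s j - p j else 0) ≤ f x := by
    intro j
    by_cases hj : j ∈ J ∧ p j < s j
    · obtain ⟨hj, hps⟩ := hj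
      obtain ⟨h1, h2⟩ := hs j hj
      have h3 := hp j hj
      have d1 : 0 < s j - l := by linarith
      have d2 : 0 < c - s j := by linarith
      have k1 : 0 < (p j - l) / (s j - l) := div_pos (by linarith) d1
      have k2 : 0 < (c - p j) / (c - s j) := div_pos (by linarith) d2
      have k3 : (p j - l) / (s j - l) < 1 := by rw [div_lt_one d1]; linarith
      have k4 : 1 < (c - p j) / (c - s j) := by rw [one_lt_div d2]; linarith
      have m1 : (p j - l) / (s j - l) * (s j - l) = p j - l := div_mul_cancel₀ _ d1.ne'
      have m2 : (c - p j) / (c - s j) * (c - s j) = c - p j := div_mul_cancel₀ _ d2.ne'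
      set u := (p j - l) / (s j - l)
      set v := (c - p j) / (c - s j)
      refine ⟨fun x => max (l + u * (x - l)) (c - v * (c - x)), by fun_prop, ?_, ?_, ?_, ?_, ?_, ?_⟩
      · intro x y hxy
        refine max_lt_max ?_ ?_
        · nlinarith
        · nlinarith
      · simp only [sub_self, mul_zero, add_zero]
        rw [max_eq_left]; nlinarith
      · simp only [sub_self, mul_zero, sub_zero]
        rw [max_eq_right]; nlinarith
      · intro _
        refine max_le ?_ ?_ <;> nlinarith
      · rintro x ⟨hx1, hx2⟩
        refine max_le ?_ ?_ <;> nlinarith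
      · rintro x ⟨hx1, hx2⟩
        rw [if_pos hj, max_eq_right (by linarith)]
        by_cases hx : x ≤ s j
        · refine le_trans ?_ (le_max_left _ _); nlinarith
        · refine le_trans ?_ (le_max_right _ _); nlinarith
    · refine ⟨id, continuous_id, strictMono_id, rfl, rfl, fun h => ?_, fun x _ => le_rfl, fun x _ => ?_⟩
      · simp only [not_and, not_lt] at hj; exact hj h
      · simp
  choose f fc fm fl fr fs fle fge using ind
  -- finite minima
  have fin : ∀ S : Finset ℕ, ∃ g : ℝ → ℝ, Continuous g ∧ StrictMono g ∧ (∀ x, g x ≤ x) ∧ (∀ j ∈ S, ∀ x, g x ≤ f j x) ∧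
      ∀ x, g x = x ∨ ∃ j ∈ S, g x = f j x := by
    intro S
    induction S using Finset.induction_on with
    | empty => exact ⟨id, continuous_id, strictMono_id, fun x => le_rfl, by simp, fun x => Or.inl rfl⟩
    | insert a S ha ih =>
      obtain ⟨g, g1, g2, g3, g4, g5⟩ := ih
      refine ⟨fun x => min (f a x) (g x), (fc a).min g1, fun x y hxy => min_lt_min (fm a hxy) (g2 hxy),
        fun x => (min_le_right _ _).trans (g3 x), ?_, ?_⟩
      · intro j hj x
        rcases Finset.mem_insert.1 hj with rfl | hj
        · exact min_le_left _ _
        · exact (min_le_right _ _).trans (g4 j hj x)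
      · intro x
        rcases min_choice (f a x) (g x) with h | h
        · right; exact ⟨a, Finset.mem_insert_self _ _, h⟩
        · rcases g5 x with h' | ⟨j, hj, h'⟩
          · left; exact h.trans h'
          · right; exact ⟨j, Finset.mem_insert_of_mem hj, h.trans h'⟩
  let R : ℝ → Set ℝ := fun x => insert x (range fun j => f j x)
  let φ : ℝ → ℝ := fun x => sInf (R x)
  have Rn : ∀ x, (R x).Nonempty := fun x => insert_nonempty _ _
  have fin' : ∀ ε > 0, ∃ S : Finset ℕ, ∀ j ∉ S, ∀ x ∈ Icc l c, x - ε ≤ f j x := by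
    intro ε hε
    refine ⟨(hf ε hε).toFinset, fun j hj x hx => le_trans ?_ (fge j x hx)⟩
    have : max 0 (if j ∈ J then s j - p j else 0) ≤ ε := by
      refine max_le hε.le ?_
      split_ifs with hJ
      · simp only [Finite.mem_toFinset, mem_setOf_eq, not_and, not_lt] at hj
        linarith [hj hJ]
      · exact hε.le
    linarith
  have lbd : ∀ x ∈ Icc l c, ∀ j, l ≤ f j x := fun x hx j => by
    rw [← fl j]; exact (fm j).monotone hx.1
  have Rb : ∀ x ∈ Icc l c, BddBelow (R x) := fun x hx => ⟨l, by
    rintro y (rfl | ⟨j, rfl⟩)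
    · exact hx.1
    · exact lbd x hx j⟩
  have φle : ∀ x ∈ Icc l c, φ x ≤ x := fun x hx => csInf_le (Rb x hx) (mem_insert _ _)
  have φlej : ∀ x ∈ Icc l c, ∀ j, φ x ≤ f j x := fun x hx j => csInf_le (Rb x hx) (mem_insert_of_mem _ ⟨j, rfl⟩)
  have approx : ∀ ε > 0, ∃ g : ℝ → ℝ, Continuous g ∧ StrictMono g ∧ ∀ x ∈ Icc l c, φ x ≤ g x ∧ min (g x) (x - ε) ≤ φ x := by
    intro ε hε
    obtain ⟨S, hS⟩ := fin' ε hε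
    obtain ⟨g, g1, g2, g3, g4, g5⟩ := fin S
    refine ⟨g, g1, g2, fun x hx => ⟨?_, le_csInf (Rn x) ?_⟩⟩
    · rcases g5 x with h | ⟨j, _, h⟩
      · rw [h]; exact φle x hx
      · rw [h]; exact φlej x hx j
    · rintro y (rfl | ⟨j, rfl⟩)
      · exact (min_le_left _ _).trans (g3 _)
      · by_cases hj : j ∈ S
        · exact (min_le_left _ _).trans (g4 j hj x)
        · exact (min_le_right _ _).trans (hS j hj x hx)
  have φm : StrictMonoOn φ (Icc l c) := by
    intro x hx y hy hxy
    obtain ⟨g, g1, g2, g3⟩ := approx ((y-x)/2) (by linarith)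
    refine lt_of_lt_of_le (lt_min ?_ ?_) (g3 y hy).2
    · exact (g3 x hx).1.trans_lt (g2 hxy)
    · linarith [φle x hx]
  have φc : ContinuousOn φ (Icc l c) := by
    rw [Metric.continuousOn_iff]
    intro x hx ε hε
    obtain ⟨g, g1, g2, g3⟩ := approx (ε/4) (by linarith)
    obtain ⟨δ, hδ, hg⟩ := Metric.continuous_iff.1 g1 x (ε/4) (by linarith)
    refine ⟨min δ (ε/4), lt_min hδ (by linarith), fun y hy hyx => ?_⟩
    have h1 := hg y (hyx.trans_le (min_le_left _ _))
    have h2 := hyx.trans_le (min_le_right δ (ε/4))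
    rw [Real.dist_eq, abs_lt] at h1 h2 ⊢
    obtain ⟨p1, p2⟩ := g3 x hx
    obtain ⟨q1, q2⟩ := g3 y hy
    have e1 := φle x hx
    have e2 := φle y hy
    rcases min_choice (g x) (x - ε/4) with h | h <;> rcases min_choice (g y) (y - ε/4) with h' | h' <;>
      rw [h] at p2 <;> rw [h'] at q2 <;> constructor <;> linarith
  have φl : φ l = l := by
    refine le_antisymm (φle l ⟨le_rfl, hlc.le⟩) (le_csInf (Rn l) ?_)
    rintro y (rfl | ⟨j, rfl⟩)
    · exact le_rfl
    · exact (fl j).ge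
  have φr : φ c = c := by
    refine le_antisymm (φle c ⟨hlc.le, le_rfl⟩) (le_csInf (Rn c) ?_)
    rintro y (rfl | ⟨j, rfl⟩)
    · exact le_rfl
    · exact (fr j).ge
  refine ⟨φ, ⟨φm, ?_⟩, fun j hj => (φlej _ ⟨(hs j hj).1, (hs j hj).2.le⟩ j).trans (fs j hj)⟩
  refine Subset.antisymm ?_ ?_
  · rintro _ ⟨x, hx, rfl⟩
    have h1 := φm.monotoneOn ⟨le_rfl, hlc.le⟩ hx hx.1
    have h2 := φm.monotoneOn hx ⟨hlc.le, le_rfl⟩ hx.2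
    rw [φl] at h1; rw [φr] at h2
    exact ⟨h1, h2⟩
  · have := intermediate_value_Icc hlc.le φc
    rwa [φl, φr] at this

end

section
variable {F : ℕ → Set (ℝ × ℝ)}

/-- greedy chain towards the right end of a gap -/
lemma chain {c b : ℝ} (hcb : c < b) (hW : ∀ x ∈ Ico c b, ∃ ε > 0, ¬ INF F (x - ε) (x + ε)) :
    ∃ d : ℕ → ℝ, d 0 = c ∧ Monotone d ∧ (∀ i, d i ≤ b) ∧ (∀ i, d i < b → d i < d (i+1)) ∧
      (∀ i, d i < b → ¬ INF F (d i) (d (i+1)) ∨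
        (d (i+1) = b ∧ (∀ y < b, INF F y b) ∧ ∀ q < b, ¬ INF F (d i) q)) ∧
      (∀ i, d i < b → INF F (d i) (d (i+2)) ∨ d (i+2) = b) ∧
      (∀ z < b, ∃ i, z < d i) := by
  classical
  -- one step
  have step : ∀ p, p ∈ Ico c b → ∃ e, p < e ∧ e ≤ b ∧
      (¬ INF F p e ∨ (e = b ∧ (∀ y < b, INF F y b) ∧ ∀ q < b, ¬ INF F p q)) ∧
      (∀ x ≤ b, (∀ q < x, ¬ INF F p q) → (p + x)/2 < e) ∧
      ((∃ x η, 0 < η ∧ x + 3 * η ≤ b ∧ x - η < e ∧ e < x ∧ (∀ q, x < q → INF F p q) ∧ ¬ INF F e (x + 3 * η)) ∨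
        ((∀ q < b, ¬ INF F p q) ∧ (e = b ∨ ¬ INF F e b))) ∧ (¬ INF F p b → e = b) := by
    intro p hp
    by_cases hS : ∃ q < b, INF F p q
    · set S : Set ℝ := {q | INF F p q}
      obtain ⟨ε, hε, hε'⟩ := hW p hp
      have lb : ∀ q ∈ S, p + ε ≤ q := fun q hq => by
        by_contra hlt
        exact hε' (INF.mono hq (by linarith) (by linarith))
      have bdd : BddBelow S := ⟨_, lb⟩
      obtain ⟨q0, hq0, hq0'⟩ := hS
      have ne : S.Nonempty := ⟨q0, hq0'⟩
      set x := sInf S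
      have hxp : p + ε ≤ x := le_csInf ne lb
      have hxb : x < b := (csInf_le bdd hq0').trans_lt hq0
      have hx1 : ∀ q, x < q → INF F p q := fun q hq => by
        obtain ⟨q', h1, h2⟩ := exists_lt_of_csInf_lt ne hq
        exact INF.mono h1 le_rfl h2.le
      have hx2 : ∀ q < x, ¬ INF F p q := fun q hq h => (csInf_le bdd h).not_gt hq
      obtain ⟨δ, hδ, hδ'⟩ := hW x ⟨by linarith [hp.1], hxb⟩
      set η := min (δ/3) (min ((b - x)/3) ((x-p)/4))
      have hη : 0 < η := lt_min (by linarith) (lt_min (by linarith) (by linarith))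
      have e1 : η ≤ δ/3 := min_le_left _ _
      have e2 : η ≤ (b-x)/3 := (min_le_right _ _).trans (min_le_left _ _)
      have e3 : η ≤ (x-p)/4 := (min_le_right _ _).trans (min_le_right _ _)
      refine ⟨x - η/2, by linarith, by linarith, Or.inl (hx2 _ (by linarith)), ?_, Or.inl ⟨x, η, hη, by linarith, by linarith, by linarith, hx1, ?_⟩, fun h => absurd (hq0'.mono le_rfl hq0.le) h⟩
      · intro y _ hy2
        have : y ≤ x := by
          by_contra hlt
          push Not at hlt
          exact hy2 ((x+y)/2) (by linarith) (hx1 _ (by linarith))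
        linarith
      · intro h
        exact hδ' (INF.mono h (by linarith) (by linarith))
    · push Not at hS
      have hpb := hp.2
      by_cases h1 : INF F p b
      · by_cases h2 : ∀ y < b, INF F y b
        · exact ⟨b, hp.2, le_rfl, Or.inr ⟨rfl, h2, hS⟩, fun x hx _ => by linarith, Or.inr ⟨hS, Or.inl rfl⟩, fun _ => rfl⟩
        · push Not at h2
          obtain ⟨y, hy, hy'⟩ := h2
          set z := max y ((p+3*b)/4)
          have z1 : (p+3*b)/4 ≤ z := le_max_right _ _
          have z2 : z < b := max_lt hy (by linarith)
          refine ⟨z, by linarith, z2.le, Or.inl (hS z z2), fun x hx _ => by linarith, Or.inr ⟨hS, Or.inr ?_⟩, fun h => absurd h1 h⟩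
          exact fun h => hy' (INF.mono h (le_max_left _ _) le_rfl)
      · exact ⟨b, hp.2, le_rfl, Or.inl h1, fun x hx _ => by linarith, Or.inr ⟨hS, Or.inl rfl⟩, fun _ => rfl⟩
  choose! f f1 f2 f3 f4 f5 f6 using step
  let d : ℕ → ℝ := fun i => Nat.rec (motive := fun _ => ℝ) c (fun _ (p : ℝ) => if p < b then f p else b) i
  have d0 : d 0 = c := rfl
  have ds : ∀ i : ℕ, d (i+1) = if d i < b then f (d i) else b := fun i => rfl
  have dm : ∀ i, d i ∈ Icc c b := by
    intro i
    induction i with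
    | zero => exact ⟨le_rfl, hcb.le⟩
    | succ i ih =>
      rw [ds]
      split_ifs with h
      · exact ⟨ih.1.trans (f1 _ ⟨ih.1, h⟩).le, f2 _ ⟨ih.1, h⟩⟩
      · exact ⟨hcb.le, le_rfl⟩
  have dlt : ∀ i, d i < b → d i < d (i+1) := fun i h => by
    rw [ds, if_pos h]; exact f1 _ ⟨(dm i).1, h⟩
  have dstay : ∀ i, ¬ d i < b → d (i+1) = b := fun i h => by rw [ds, if_neg h]
  have dmono : Monotone d := monotone_nat_of_le_succ fun i => by
    by_cases h : d i < b
    · exact (dlt i h).le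
    · rw [dstay i h]; exact (dm i).2
  have P2 : ∀ i, d i < b → INF F (d i) (d (i+2)) ∨ d (i+2) = b := by
    intro i h
    have hi : d i ∈ Ico c b := ⟨(dm i).1, h⟩
    have e1 : d (i+1) = f (d i) := by rw [ds, if_pos h]
    by_cases h1 : d (i+1) < b
    · have hi1 : d (i+1) ∈ Ico c b := ⟨(dm (i+1)).1, h1⟩
      have e2 : d (i+2) = f (d (i+1)) := by rw [ds (i+1), if_pos h1]
      rcases f5 _ hi with ⟨x, η, hη, hb, g1, g2, g3, g4⟩ | ⟨g1, g2⟩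
      · rw [← e1] at g1 g2 g4
        left
        apply g3
        have := f4 _ hi1 (x + 3*η) hb (fun q hq h => g4 (INF.mono h le_rfl hq.le))
        rw [e2]; linarith
      · right
        rw [← e1] at g2
        have hno : ¬ INF F (d (i+1)) b := g2.resolve_left h1.ne
        rw [e2]; exact f6 _ hi1 hno
    · right; exact dstay (i+1) h1
  refine ⟨d, d0, dmono, fun i => (dm i).2, dlt, ?_, P2, ?_⟩
  · intro i h
    have := f3 _ ⟨(dm i).1, h⟩
    rw [ds, if_pos h]; exact this
  · intro z hz
    by_contra hno
    push Not at hno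
    have hlt : ∀ i, d i < b := fun i => (hno i).trans_lt hz
    have bdd : BddAbove (range d) := ⟨z, by rintro _ ⟨i, rfl⟩; exact hno i⟩
    have ht := tendsto_atTop_ciSup dmono bdd
    set y := ⨆ i, d i
    have hyz : y ≤ z := ciSup_le hno
    have hdy : ∀ i, d i ≤ y := fun i => le_ciSup bdd i
    obtain ⟨ε, hε, hε'⟩ := hW y ⟨d0 ▸ hdy 0, hyz.trans_lt hz⟩
    obtain ⟨i, hi⟩ := (ht.eventually (lt_mem_nhds (show y - ε < y by linarith))).exists
    rcases P2 i (hlt i) with h | h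
    · exact hε' (h.mono hi.le (by linarith [hdy (i+2)]))
    · exact (hlt (i+2)).ne h

variable {A B : ℝ} {s t : ℕ → ℝ}

/-- choice of a system of distinct blocks -/
lemma choose_blocks {J : Set ℕ} {u v : ℕ → ℝ} (h : ∀ j ∈ J, INF F (u j) (v j)) :
    ∃ n : ℕ → ℕ, ∃ β : ℕ → ℝ × ℝ, Function.Injective n ∧ ∀ j ∈ J, β j ∈ F (n j) ∧ u j < (β j).1 ∧ (β j).2 < v j := by
  classical
  obtain ⟨n, hn, hn'⟩ := exists_inj_choice (fun j => if j ∈ J then {n | ∃ b ∈ F n, u j < b.1 ∧ b.2 < v j} else univ)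
    (fun j => by
      split_ifs with hj
      · exact h j hj
      · exact infinite_univ)
  have : ∀ j, ∃ b : ℝ × ℝ, j ∈ J → b ∈ F (n j) ∧ u j < b.1 ∧ b.2 < v j := by
    intro j
    by_cases hj : j ∈ J
    · have := hn' j
      rw [if_pos hj] at this
      obtain ⟨b, hb⟩ := this
      exact ⟨b, fun _ => hb⟩
    · exact ⟨0, fun h => absurd h hj⟩
  choose β hβ using this
  exact ⟨n, β, hn, hβ⟩

/-- gluing per cell data -/
lemma cov_of_cells {J : Set ℕ} {l c r : ℕ → ℝ} (hb : ∀ j ∈ J, A ≤ l j ∧ l j < r j ∧ r j ≤ B ∧ l j ≤ s j ∧ s j ≤ r j ∧ l j ≤ t j ∧ t j ≤ r j)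
    (hd : ∀ j ∈ J, ∀ k ∈ J, (l j = l k ∧ c j = c k ∧ r j = r k) ∨ Disjoint (Ioo (l j) (r j)) (Ioo (l k) (r k)))
    {n : ℕ → ℕ} {β : ℕ → ℝ × ℝ} (hn : InjOn n J) (hβ : ∀ j ∈ J, β j ∈ F (n j))
    (h : ∀ j ∈ J, ∃ ψ, IsoOn ψ (l j) (r j) (l j) (r j) ∧ ∀ k ∈ J, l k = l j ∧ c k = c j ∧ r k = r j →
      ψ (s k) ≤ (β k).1 ∧ (β k).2 ≤ ψ (t k)) : Cov A B F s t J := by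
  let f : ℕ → ℝ × ℝ × ℝ := fun j => (l j, c j, r j)
  have hf : ∀ j k, f j = f k ↔ (l j = l k ∧ c j = c k ∧ r j = r k) := fun j k => by simp [f]
  have key : ∀ x : f '' J, ∃ ψ, IsoOn ψ x.1.1 x.1.2.2 x.1.1 x.1.2.2 ∧ ∀ k ∈ J, f k = x.1 →
      ψ (s k) ≤ (β k).1 ∧ (β k).2 ≤ ψ (t k) := by
    rintro ⟨_, j, hj, rfl⟩
    obtain ⟨ψ, h1, h2⟩ := h j hj
    exact ⟨ψ, h1, fun k hk hkj => h2 k hk ((hf k j).1 hkj)⟩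
  choose ψ h1 h2 using key
  obtain ⟨φ, hφ, hφ'⟩ := glue_cells (A := A) (B := B) (ι := f '' J) (l := fun x => x.1.1) (r := fun x => x.1.2.2) (ψ := ψ)
    (by rintro ⟨_, j, hj, rfl⟩; exact (hb j hj).2.1) (by rintro ⟨_, j, hj, rfl⟩; exact (hb j hj).1)
    (by rintro ⟨_, j, hj, rfl⟩; exact (hb j hj).2.2.1)
    (by
      rintro ⟨_, j, hj, rfl⟩ ⟨_, k, hk, rfl⟩ hne
      exact (hd j hj k hk).resolve_left (fun h => hne (Subtype.ext ((hf j k).2 h)))) h1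
  refine ⟨φ, hφ, n, β, hn, fun j hj => ⟨hβ j hj, ?_⟩⟩
  obtain ⟨-, -, -, b1, b2, b3, b4⟩ := hb j hj
  have e1 := hφ' ⟨f j, j, hj, rfl⟩ (s j) ⟨b1, b2⟩
  have e2 := hφ' ⟨f j, j, hj, rfl⟩ (t j) ⟨b3, b4⟩
  rw [e1, e2]
  exact h2 ⟨f j, j, hj, rfl⟩ j hj rfl

lemma finite_one_div (ε : ℝ) (hε : 0 < ε) : {j : ℕ | ε < 1 / ((j:ℝ) + 1)}.Finite := by
  have := tendsto_one_div_add_atTop_nhds_zero_nat (𝕜 := ℝ)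
  have := this.eventually (gt_mem_nhds hε)
  rw [← Nat.cofinite_eq_atTop] at this
  refine Set.Finite.subset this ?_
  intro j hj hj'
  have h1 : ε < 1 / ((j:ℝ) + 1) := hj
  have h2 : 1 / ((j:ℝ) + 1) < ε := hj'
  exact lt_asymm h1 h2

lemma central (h : CL A B F s t) {J : Set ℕ} {l c r : ℕ → ℝ}
    (hb : ∀ j ∈ J, A ≤ l j ∧ l j ≤ s j ∧ s j < c j ∧ c j < t j ∧ t j ≤ r j ∧ r j ≤ B)
    (hd : ∀ j ∈ J, ∀ k ∈ J, (l j = l k ∧ c j = c k ∧ r j = r k) ∨ Disjoint (Ioo (l j) (r j)) (Ioo (l k) (r k)))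
    (hinf : ∀ j ∈ J, {k ∈ J | l k = l j ∧ c k = c j ∧ r k = r j}.Infinite) : Cov A B F s t J := by
  classical
  let D : ℕ → Set ℝ := fun j => {δ | 0 ≤ δ ∧ INF F (max (l j) (s j - δ)) (min (r j) (t j + δ))}
  have Dne : ∀ j ∈ J, (D j).Nonempty := fun j hj => by
    obtain ⟨h1, h2, h3, h4, h5, h6⟩ := hb j hj
    refine ⟨r j - l j, by linarith, ?_⟩
    rw [max_eq_left (by linarith), min_eq_left (by linarith)]
    apply h.H
    refine (hinf j hj).mono ?_
    rintro k ⟨hk, e1, e2, e3⟩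
    obtain ⟨h1, h2, h3, h4, h5, h6⟩ := hb k hk
    exact ⟨by linarith, by linarith⟩
  have Db : ∀ j, BddBelow (D j) := fun j => ⟨0, fun δ hδ => hδ.1⟩
  let δ : ℕ → ℝ := fun j => sInf (D j) + 1/((j:ℝ)+1)
  have hδ : ∀ j ∈ J, INF F (max (l j) (s j - δ j)) (min (r j) (t j + δ j)) := fun j hj => by
    have : sInf (D j) < δ j := by
      have : (0:ℝ) < 1/((j:ℝ)+1) := by positivity
      simp only [δ]; linarith
    obtain ⟨d, hd1, hd2⟩ := exists_lt_of_csInf_lt (Dne j hj) this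
    exact hd1.2.mono (max_le_max le_rfl (by linarith)) (min_le_min le_rfl (by linarith))
  have fin0 : ∀ j ∈ J, ∀ ε > 0, {k ∈ J | (l k = l j ∧ c k = c j ∧ r k = r j) ∧ ε < sInf (D k)}.Finite := by
    intro j hj ε hε
    set K := {k ∈ J | (l k = l j ∧ c k = c j ∧ r k = r j) ∧ ε < sInf (D k)}
    let g : ℕ → ℤ × ℤ := fun k => (⌊s k / ε⌋, ⌊t k / ε⌋)
    refine Set.Finite.of_finite_fibers g ?_ ?_
    · refine (Set.Finite.prod (finite_Icc ⌊A/ε⌋ ⌊B/ε⌋) (finite_Icc ⌊A/ε⌋ ⌊B/ε⌋)).subset ?_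
      rintro _ ⟨k, hk, rfl⟩
      obtain ⟨h1, h2, h3⟩ := h.hst k
      have m : ∀ x y : ℝ, x ≤ y → ⌊x/ε⌋ ≤ ⌊y/ε⌋ := fun x y hxy => Int.floor_le_floor (by gcongr)
      exact ⟨⟨m _ _ h1, m _ _ (by linarith)⟩, ⟨m _ _ (by linarith), m _ _ h3⟩⟩
    · rintro _ ⟨k, hk, rfl⟩
      by_contra hinf'
      have hinf' : (K ∩ g ⁻¹' {g k}).Infinite := hinf'
      have : ε ∈ D k := by
        refine ⟨hε.le, h.H _ _ (hinf'.mono ?_)⟩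
        rintro i ⟨hi, hgi⟩
        simp only [mem_preimage, mem_singleton_iff, g, Prod.mk.injEq] at hgi
        have m : ∀ x y : ℝ, ⌊x/ε⌋ = ⌊y/ε⌋ → |x - y| < ε := fun x y hxy => by
          have := Int.abs_sub_lt_one_of_floor_eq_floor hxy
          rwa [← sub_div, abs_div, abs_of_pos hε, div_lt_one hε] at this
        have m1 := abs_lt.1 (m _ _ hgi.1)
        have m2 := abs_lt.1 (m _ _ hgi.2)
        obtain ⟨h1, h2, h3, h4, h5, h6⟩ := hb i hi.1
        obtain ⟨e1, e2, e3⟩ := hi.2.1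
        obtain ⟨e1', e2', e3'⟩ := hk.2.1
        exact ⟨max_le (by linarith) (by linarith), le_min (by linarith) (by linarith)⟩
      exact absurd (csInf_le (Db k) this) (not_le.2 hk.2.2)
  have fin1 : ∀ j ∈ J, ∀ ε > 0, {k ∈ J | (l k = l j ∧ c k = c j ∧ r k = r j) ∧ ε < δ k}.Finite := by
    intro j hj ε hε
    refine ((fin0 j hj (ε/2) (by linarith)).union (finite_one_div (ε/2) (by linarith))).subset ?_
    rintro k ⟨hk, hk', hk''⟩
    by_cases hlt : ε/2 < sInf (D k)
    · exact Or.inl ⟨hk, hk', hlt⟩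
    · right
      simp only [δ] at hk''
      show ε/2 < 1/((k:ℝ)+1)
      linarith
  obtain ⟨n, β, hn, hβ⟩ := choose_blocks hδ
  refine cov_of_cells (c := c) ?_ hd hn.injOn (fun j hj => (hβ j hj).1) ?_
  · intro j hj
    obtain ⟨h1, h2, h3, h4, h5, h6⟩ := hb j hj
    refine ⟨h1, ?_, h6, h2, ?_, ?_, h5⟩ <;> linarith
  · intro j hj
    obtain ⟨h1, h2, h3, h4, h5, h6⟩ := hb j hj
    obtain ⟨φ₁, i1, i1'⟩ := push (l := l j) (c := c j) (by linarith)
      (J := {k ∈ J | l k = l j ∧ c k = c j ∧ r k = r j}) (s := s) (p := fun k => (β k).1)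
      (by
        rintro k ⟨hk, e1, e2, e3⟩
        obtain ⟨h1, h2, h3, h4, h5, h6⟩ := hb k hk
        exact ⟨by linarith, by linarith⟩)
      (by
        rintro k ⟨hk, e1, e2, e3⟩
        rw [← e1]
        exact (le_max_left _ _).trans_lt (hβ k hk).2.1)
      (by
        intro ε hε
        refine (fin1 j hj ε hε).subset ?_
        rintro k ⟨⟨hk, e⟩, hk'⟩
        refine ⟨hk, e, ?_⟩
        have := (le_max_right _ _).trans_lt (hβ k hk).2.1
        linarith)
    obtain ⟨φ₂, i2, i2'⟩ := push (l := - r j) (c := - c j) (by linarith)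
      (J := {k ∈ J | l k = l j ∧ c k = c j ∧ r k = r j}) (s := fun k => - t k) (p := fun k => -(β k).2)
      (by
        rintro k ⟨hk, e1, e2, e3⟩
        obtain ⟨h1, h2, h3, h4, h5, h6⟩ := hb k hk
        exact ⟨by linarith, by linarith⟩)
      (by
        rintro k ⟨hk, e1, e2, e3⟩
        rw [← e3]
        have := (hβ k hk).2.2.trans_le (min_le_left _ _)
        linarith)
      (by
        intro ε hε
        refine (fin1 j hj ε hε).subset ?_
        rintro k ⟨⟨hk, e⟩, hk'⟩
        refine ⟨hk, e, ?_⟩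
        have := (hβ k hk).2.2.trans_le (min_le_right _ _)
        linarith)
    have i2n := i2.neg
    simp only [neg_neg] at i2n
    refine ⟨_, i1.glue (by linarith) (by linarith) i2n, fun k hk e => ?_⟩
    have q1 := i1' k ⟨hk, e⟩
    have q2 := i2' k ⟨hk, e⟩
    obtain ⟨h1', h2', h3', h4', h5', h6'⟩ := hb k hk
    obtain ⟨e1, e2, e3⟩ := e
    constructor
    · rw [if_pos (by linarith)]; exact q1
    · rw [if_neg (by linarith)]; linarith

end

lemma enum_locfin {S : Set ℝ} {b : ℝ} (hS : S.Infinite) (hb : ∀ x ∈ S, x < b) (hf : ∀ z < b, (S ∩ Iic z).Finite) :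
    ∃ x : ℕ → ℝ, StrictMono x ∧ range x = S ∧ Tendsto x atTop (𝓝 b) := by
  classical
  have minS : ∀ T ⊆ S, T.Nonempty → ∃ y ∈ T, ∀ z ∈ T, y ≤ z := by
    intro T hT ⟨w, hw⟩
    have : (T ∩ Iic w).Finite := (hf w (hb w (hT hw))).subset (inter_subset_inter_left _ hT)
    obtain ⟨y, hy, hy'⟩ := this.exists_minimalFor id _ ⟨w, hw, mem_Iic.2 le_rfl⟩
    refine ⟨y, hy.1, fun z hz => ?_⟩
    by_contra hlt
    push Not at hlt
    exact hlt.not_ge (hy' (j := z) ⟨hz, hlt.le.trans hy.2⟩ hlt.le)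
  obtain ⟨x0, hx0, hx0'⟩ := minS S le_rfl hS.nonempty
  have nxt : ∀ y, y ∈ S → ∃ y' ∈ S, y < y' ∧ ∀ z ∈ S, y < z → y' ≤ z := by
    intro y hy
    have : (S ∩ Ioi y).Nonempty := by
      by_contra hne
      rw [not_nonempty_iff_eq_empty] at hne
      apply hS
      refine (hf y (hb y hy)).subset fun z hz => ⟨hz, ?_⟩
      by_contra hlt
      have : z ∈ S ∩ Ioi y := ⟨hz, mem_Ioi.2 (not_le.1 hlt)⟩
      rw [hne] at this; exact this
    obtain ⟨y', h1, h2⟩ := minS (S ∩ Ioi y) inter_subset_left this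
    exact ⟨y', h1.1, h1.2, fun z hz hyz => h2 z ⟨hz, hyz⟩⟩
  choose! f f1 f2 f3 using nxt
  let x : ℕ → ℝ := fun m => Nat.rec (motive := fun _ => ℝ) x0 (fun _ y => f y) m
  have xs : ∀ m : ℕ, x (m+1) = f (x m) := fun m => rfl
  have xS : ∀ m, x m ∈ S := fun m => by
    induction m with
    | zero => exact hx0
    | succ m ih => rw [xs]; exact f1 _ ih
  have xm : StrictMono x := strictMono_nat_of_lt_succ fun m => by rw [xs]; exact f2 _ (xS m)
  have hr : range x = S := by
    apply subset_antisymm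
    · rintro _ ⟨m, rfl⟩; exact xS m
    · intro e he
      by_contra hne
      have hlt : ∀ m, x m < e := fun m => by
        induction m with
        | zero => exact lt_of_le_of_ne (hx0' e he) (fun h => hne ⟨0, h⟩)
        | succ m ih => exact lt_of_le_of_ne (by rw [xs]; exact f3 _ (xS m) e he ih) (fun h => hne ⟨m+1, h⟩)
      have : (range x).Finite := (hf e (hb e he)).subset (by rintro _ ⟨m, rfl⟩; exact ⟨xS m, (hlt m).le⟩)
      exact infinite_range_of_injective xm.injective this
  refine ⟨x, xm, hr, ?_⟩
  rw [tendsto_order]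
  constructor
  · intro z hz
    have : ∃ m, z < x m := by
      by_contra hno
      push Not at hno
      have : (range x).Finite := (hf z hz).subset (by rintro _ ⟨m, rfl⟩; exact ⟨xS m, hno m⟩)
      exact infinite_range_of_injective xm.injective this
    obtain ⟨m, hm⟩ := this
    filter_upwards [eventually_ge_atTop m] with k hk
    exact hm.trans_le (xm.monotone hk)
  · intro z hz
    exact Eventually.of_forall fun m => (hb _ (xS m)).trans hz

lemma iso_seq {c b : ℝ} {α γ P Q : ℕ → ℝ} (h1 : c < α 0) (h2 : ∀ m, α m < γ m) (h3 : ∀ m, γ m < α (m+1))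
    (k1 : c < P 0) (k2 : ∀ m, P m < Q m) (k3 : ∀ m, Q m < P (m+1)) (hα : Tendsto α atTop (𝓝 b)) (hP : Tendsto P atTop (𝓝 b)) :
    ∃ φ, IsoOn φ c b c b ∧ ∀ m, φ (α m) = P m ∧ φ (γ m) = Q m := by
  have αm : StrictMono α := strictMono_nat_of_lt_succ fun m => (h2 m).trans (h3 m)
  have Pm : StrictMono P := strictMono_nat_of_lt_succ fun m => (k2 m).trans (k3 m)
  have piece : ∀ m, ∃ ψ, IsoOn ψ (α m) (α (m+1)) (P m) (P (m+1)) ∧ ψ (γ m) = Q m := by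
    intro m
    obtain ⟨f, hf⟩ := IsoOn.linear (h2 m) (k2 m)
    obtain ⟨g, hg⟩ := IsoOn.linear (h3 m) (k3 m)
    refine ⟨_, hf.glue (h2 m).le (h3 m).le hg, ?_⟩
    simp only [le_refl, if_true]
    exact hf.right (h2 m).le
  choose ψ hψ hψ' using piece
  obtain ⟨f, hf⟩ := IsoOn.linear h1 k1
  obtain ⟨φ, hφ, -, hφ'⟩ := IsoOn.glue_seq (r := fun m => - α m) (y := fun m => - P m) (z := -b) (z' := -b)
    (ψ := fun m x => - ψ m (-x)) (fun i j hij => neg_lt_neg (αm hij)) hα.neg hP.neg (fun m => (hψ m).neg)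
  have hn := hφ.neg
  simp only [neg_neg] at hn
  have αb : ∀ m, α m < b := fun m => lt_of_lt_of_le (αm (Nat.lt_succ_self m)) (αm.monotone.ge_of_tendsto hα _)
  have φα : ∀ m, -φ (-α m) = P m := fun m => by
    rw [hφ' m (-α m) ⟨neg_lt_neg (αm (Nat.lt_succ_self m)), le_rfl⟩, neg_neg, neg_neg]
    exact (hψ m).left (αm (Nat.lt_succ_self m)).le
  have φγ : ∀ m, -φ (-γ m) = Q m := fun m => by
    rw [hφ' m (-γ m) ⟨neg_lt_neg (h3 m), neg_le_neg (h2 m).le⟩, neg_neg, neg_neg]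
    exact hψ' m
  refine ⟨_, hf.glue h1.le (αb 0).le hn, fun m => ⟨?_, ?_⟩⟩
  · by_cases hm : α m ≤ α 0
    · have : m = 0 := by
        by_contra hne
        exact absurd (αm (Nat.pos_of_ne_zero hne)) (not_lt.2 hm)
      subst this
      simp only [le_refl, if_true]
      exact hf.right h1.le
    · simp only [if_neg hm]; exact φα m
  · have : ¬ γ m ≤ α 0 := not_le.2 ((αm.monotone (Nat.zero_le m)).trans_lt (h2 m))
    simp only [if_neg this]; exact φγ m

lemma omega_cell {c b : ℝ} {J : Set ℕ} (hJ : J.Infinite) {s t : ℕ → ℝ}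
    (hst : ∀ j ∈ J, c ≤ s j ∧ s j < t j ∧ t j ≤ b) (hfin : ∀ z < b, {j ∈ J | t j ≤ z}.Finite) {β : ℕ → ℝ × ℝ}
    (hβ : ∀ j ∈ J, max c (b - 1/((j:ℝ)+1)) < (β j).1 ∧ (β j).1 < (β j).2 ∧ (β j).2 < b) :
    ∃ φ, IsoOn φ c b c b ∧ ∃ k : ℕ → ℕ, InjOn k J ∧ MapsTo k J J ∧
      ∀ j ∈ J, φ (s j) ≤ (β (k j)).1 ∧ (β (k j)).2 ≤ φ (t j) := by
  classical
  -- distinct points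
  obtain ⟨e, einj, he⟩ := exists_inj_choice
    (fun j => if j ∈ J then Ioo (max (s j) (t j - 1/((j:ℝ)+1))) (t j) else univ) (fun j => by
      split_ifs with hj
      · apply Ioo_infinite
        have : (0:ℝ) < 1/((j:ℝ)+1) := by positivity
        exact max_lt (hst j hj).2.1 (by linarith)
      · exact infinite_univ)
  have he' : ∀ j ∈ J, s j < e j ∧ t j - 1/((j:ℝ)+1) < e j ∧ e j < t j := fun j hj => by
    have := he j
    rw [if_pos hj] at this
    exact ⟨(le_max_left _ _).trans_lt this.1, (le_max_right _ _).trans_lt this.1, this.2⟩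
  obtain ⟨x, xm, xr, xt⟩ := enum_locfin (S := e '' J) (b := b) (hJ.image einj.injOn)
    (by rintro _ ⟨j, hj, rfl⟩; exact (he' j hj).2.2.trans_le (hst j hj).2.2)
    (by
      intro z hz
      refine Set.Finite.subset (((hfin ((z+b)/2) (by linarith)).union (finite_one_div ((b-z)/2) (by linarith))).image e) ?_
      rintro _ ⟨⟨j, hj, rfl⟩, hz'⟩
      refine ⟨j, ?_, rfl⟩
      by_cases h : t j ≤ (z+b)/2
      · exact Or.inl ⟨hj, h⟩
      · right
        have hz' : e j ≤ z := hz'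
        have := (he' j hj).2.1
        show (b-z)/2 < 1/((j:ℝ)+1)
        linarith)
  have hj : ∀ m, ∃ j ∈ J, e j = x m := fun m => by
    have : x m ∈ e '' J := xr ▸ mem_range_self m
    exact this
  choose jm jmJ jme using hj
  -- subsequence of blocks
  have far : ∀ z < b, ∃ j ∈ J, z < (β j).1 := by
    intro z hz
    obtain ⟨j, hj, hj'⟩ := (hJ.sdiff (finite_one_div (b - z) (by linarith))).nonempty
    refine ⟨j, hj, ?_⟩
    have h1 : ¬ (b - z < 1/((j:ℝ)+1)) := hj'
    have := (le_max_right _ _).trans_lt (hβ j hj).1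
    linarith
  have far' : ∀ (m : ℕ) (i : ℕ), ∃ j, j ∈ J ∧ b - 1/((m:ℝ)+1) < (β j).1 ∧ (i ∈ J → (β i).2 < (β j).1) := by
    intro m i
    have p : (0:ℝ) < 1/((m:ℝ)+1) := by positivity
    by_cases hi : i ∈ J
    · obtain ⟨j, hj, hj'⟩ := far (max (b - 1/((m:ℝ)+1)) (β i).2) (max_lt (by linarith) (hβ i hi).2.2)
      exact ⟨j, hj, (le_max_left _ _).trans_lt hj', fun _ => (le_max_right _ _).trans_lt hj'⟩
    · obtain ⟨j, hj, hj'⟩ := far (b - 1/((m:ℝ)+1)) (by linarith)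
      exact ⟨j, hj, hj', fun h => absurd h hi⟩
  choose g g1 g2 g3 using far'
  let κ : ℕ → ℕ := fun m => Nat.rec (motive := fun _ => ℕ) (g 0 0) (fun i y => g (i+1) y) m
  have κs : ∀ m : ℕ, κ (m+1) = g (m+1) (κ m) := fun m => rfl
  have κJ : ∀ m, κ m ∈ J := fun m => by
    cases m with
    | zero => exact g1 _ _
    | succ m => rw [κs]; exact g1 _ _
  have κb : ∀ m : ℕ, b - 1/((m:ℝ)+1) < (β (κ m)).1 := fun m => by
    cases m with
    | zero => exact g2 0 0
    | succ m => rw [κs]; exact g2 _ _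
  have κQ : ∀ m, (β (κ m)).2 < (β (κ (m+1))).1 := fun m => by rw [κs]; exact g3 _ _ (κJ m)
  have κt : Tendsto (fun m => (β (κ m)).1) atTop (𝓝 b) := by
    have l1 : Tendsto (fun m : ℕ => b - 1/((m:ℝ)+1)) atTop (𝓝 b) := by
      simpa using tendsto_const_nhds.sub (tendsto_one_div_add_atTop_nhds_zero_nat (𝕜 := ℝ))
    refine tendsto_of_tendsto_of_tendsto_of_le_of_le l1 tendsto_const_nhds (fun m => (κb m).le) (fun m => ?_)
    have := hβ _ (κJ m)
    exact (this.2.1.trans this.2.2).le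
  have κm : StrictMono (fun m => (β (κ m)).1) :=
    strictMono_nat_of_lt_succ fun m => (hβ _ (κJ m)).2.1.trans (κQ m)
  have κinj : Function.Injective κ := fun m m' h => κm.injective (by simp only [h])
  -- the intervals around x m
  let lo : ℕ → ℝ := fun m => if m = 0 then c else (x (m-1) + x m)/2
  let α : ℕ → ℝ := fun m => (max (s (jm m)) (lo m) + x m)/2
  let γ : ℕ → ℝ := fun m => (min (t (jm m)) ((x m + x (m+1))/2) + x m)/2
  have xlt : ∀ m, x m < x (m+1) := fun m => xm (Nat.lt_succ_self m)
  have hsx : ∀ m, s (jm m) < x m ∧ x m < t (jm m) := fun m => by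
    rw [← jme m]; exact ⟨(he' _ (jmJ m)).1, (he' _ (jmJ m)).2.2⟩
  have hcx : ∀ m, c < x m := fun m => (hst _ (jmJ m)).1.trans_lt (hsx m).1
  have lolt : ∀ m, lo m < x m := fun m => by
    simp only [lo]
    split_ifs with h
    · exact hcx m
    · have := xm (show m - 1 < m by omega)
      linarith
  have αx : ∀ m, max (s (jm m)) (lo m) < α m ∧ α m < x m := fun m => by
    have := max_lt (hsx m).1 (lolt m)
    simp only [α]; constructor <;> linarith
  have γx : ∀ m, x m < γ m ∧ γ m < min (t (jm m)) ((x m + x (m+1))/2) := fun m => by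
    have : x m < min (t (jm m)) ((x m + x (m+1))/2) := lt_min (hsx m).2 (by linarith [xlt m])
    simp only [γ]; constructor <;> linarith
  have a1 : ∀ m, γ m < α (m+1) := fun m => by
    have h1 := (γx m).2.trans_le (min_le_right _ _)
    have h2 := (le_max_right _ _).trans_lt (αx (m+1)).1
    simp only [lo, Nat.add_eq_zero_iff, one_ne_zero, and_false, if_false, Nat.add_sub_cancel] at h2
    linarith
  have αt : Tendsto α atTop (𝓝 b) := by
    rw [← tendsto_add_atTop_iff_nat 1]
    refine tendsto_of_tendsto_of_tendsto_of_le_of_le xt ((tendsto_add_atTop_iff_nat 1).2 xt) (fun m => ?_) (fun m => (αx (m+1)).2.le)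
    exact ((γx m).1.trans (a1 m)).le
  obtain ⟨φ, hφ, hφ'⟩ := iso_seq (c := c) (b := b) (α := α) (γ := γ) (P := fun m => (β (κ m)).1) (Q := fun m => (β (κ m)).2)
    (lt_of_le_of_lt (hst _ (jmJ 0)).1 ((le_max_left _ _).trans_lt (αx 0).1))
    (fun m => (αx m).2.trans (γx m).1) a1 ((le_max_left _ _).trans_lt (hβ _ (κJ 0)).1)
    (fun m => (hβ _ (κJ m)).2.1) κQ αt κt
  have hm : ∀ j, ∃ m, j ∈ J → x m = e j := fun j => by
    by_cases hj : j ∈ J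
    · have : e j ∈ range x := xr ▸ mem_image_of_mem e hj
      obtain ⟨m, hm⟩ := this
      exact ⟨m, fun _ => hm⟩
    · exact ⟨0, fun h => absurd h hj⟩
  choose μ hμ using hm
  have jμ : ∀ j ∈ J, jm (μ j) = j := fun j hj => einj (by rw [jme, hμ j hj])
  refine ⟨φ, hφ, fun j => κ (μ j), ?_, fun j _ => κJ _, fun j hj => ?_⟩
  · intro i hi j hj hij
    have := κinj hij
    rw [← jμ i hi, ← jμ j hj, this]
  · have e1 := αx (μ j)
    have e2 := γx (μ j)
    rw [jμ j hj] at e1 e2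
    have f1 := (le_max_left _ _).trans_lt e1.1
    have f2 := e2.2.trans_le (min_le_left _ _)
    have hs := hst j hj
    have hx := hsx (μ j)
    rw [jμ j hj] at hx
    constructor
    · rw [← (hφ' (μ j)).1]
      refine hφ.mono.monotoneOn ⟨hs.1, by linarith⟩ ⟨by linarith, by linarith [e1.2]⟩ f1.le
    · rw [← (hφ' (μ j)).2]
      refine hφ.mono.monotoneOn ⟨by linarith, by linarith⟩ ⟨by linarith, hs.2.2⟩ f2.le

section
variable {F : ℕ → Set (ℝ × ℝ)} {A B : ℝ} {s t : ℕ → ℝ}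

lemma omega (h : CL A B F s t) {J : Set ℕ} {c b : ℕ → ℝ}
    (hb : ∀ j ∈ J, A ≤ c j ∧ c j ≤ s j ∧ t j ≤ b j ∧ b j ≤ B)
    (hd : ∀ j ∈ J, ∀ k ∈ J, (c j = c k ∧ b j = b k) ∨ Disjoint (Ioo (c j) (b j)) (Ioo (c k) (b k)))
    (hI : ∀ j ∈ J, ∀ y < b j, INF F y (b j))
    (hfin : ∀ j ∈ J, ∀ z < b j, {k ∈ J | (c k = c j ∧ b k = b j) ∧ t k ≤ z}.Finite)
    (hinf : ∀ j ∈ J, {k ∈ J | c k = c j ∧ b k = b j}.Infinite) : Cov A B F s t J := by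
  classical
  have hcb : ∀ j ∈ J, c j < b j := fun j hj => by
    have := hb j hj; have := h.hst j; linarith
  obtain ⟨n, β, hn, hβ⟩ := choose_blocks (F := F) (J := J) (u := fun j => max (c j) (b j - 1/((j:ℝ)+1))) (v := b)
    (fun j hj => hI j hj _ (max_lt (hcb j hj) (by
      have : (0:ℝ) < 1/((j:ℝ)+1) := by positivity
      linarith)))
  have cell : ∀ x : ℝ × ℝ, ∃ φ : ℝ → ℝ, ∃ k : ℕ → ℕ, (∃ j ∈ J, c j = x.1 ∧ b j = x.2) → IsoOn φ x.1 x.2 x.1 x.2 ∧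
      InjOn k {k ∈ J | c k = x.1 ∧ b k = x.2} ∧ MapsTo k {k ∈ J | c k = x.1 ∧ b k = x.2} {k ∈ J | c k = x.1 ∧ b k = x.2} ∧
      ∀ j ∈ {k ∈ J | c k = x.1 ∧ b k = x.2}, φ (s j) ≤ (β (k j)).1 ∧ (β (k j)).2 ≤ φ (t j) := by
    intro x
    by_cases hx : ∃ j ∈ J, c j = x.1 ∧ b j = x.2
    · obtain ⟨j, hj, e1, e2⟩ := hx
      obtain ⟨c', b'⟩ := x
      simp only at e1 e2
      subst e1 e2
      obtain ⟨φ, h1, k, h2, h3, h4⟩ := omega_cell (c := c j) (b := b j) (hinf j hj) (s := s) (t := t) (β := β)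
        (by
          rintro k ⟨hk, e1, e2⟩
          have := hb k hk; have := h.hst k
          refine ⟨by linarith, by linarith, by linarith⟩)
        (fun z hz => (hfin j hj z hz).subset (by rintro k ⟨⟨hk, e⟩, hk'⟩; exact ⟨hk, e, hk'⟩))
        (by
          rintro k ⟨hk, e1, e2⟩
          have := hβ k hk
          rw [e1, e2] at this
          exact ⟨this.2.1, h.hF _ _ this.1, this.2.2⟩)
      exact ⟨φ, k, fun _ => ⟨h1, h2, h3, h4⟩⟩
    · exact ⟨id, id, fun h => absurd h hx⟩
  choose φ k hk using cell
  let κ : ℕ → ℕ := fun j => k (c j, b j) j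
  have hκ : ∀ j ∈ J, κ j ∈ J ∧ c (κ j) = c j ∧ b (κ j) = b j := fun j hj =>
    (hk (c j, b j) ⟨j, hj, rfl, rfl⟩).2.2.1 ⟨hj, rfl, rfl⟩
  have κinj : InjOn κ J := by
    intro i hi j hj hij
    have h1 := hκ i hi
    have h2 := hκ j hj
    rw [hij] at h1
    have e1 : c i = c j := h1.2.1.symm.trans h2.2.1
    have e2 : b i = b j := h1.2.2.symm.trans h2.2.2
    refine (hk (c j, b j) ⟨j, hj, rfl, rfl⟩).2.1 ⟨hi, e1, e2⟩ ⟨hj, rfl, rfl⟩ ?_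
    have : κ i = k (c j, b j) i := by simp only [κ, e1, e2]
    rw [← this, hij]
  refine cov_of_cells (l := c) (c := c) (r := b) (n := fun j => n (κ j)) (β := fun j => β (κ j)) ?_ ?_ ?_ ?_ ?_
  · intro j hj
    have := hb j hj; have := h.hst j
    refine ⟨?_, ?_, ?_, ?_, ?_, ?_, ?_⟩ <;> linarith
  · intro j hj k hk
    rcases hd j hj k hk with h | h
    · exact Or.inl ⟨h.1, h.1, h.2⟩
    · exact Or.inr h
  · exact fun i hi j hj hij => κinj hi hj (hn hij)
  · exact fun j hj => (hβ _ (hκ j hj).1).1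
  · intro j hj
    obtain ⟨h1, h2, h3, h4⟩ := hk (c j, b j) ⟨j, hj, rfl, rfl⟩
    refine ⟨φ (c j, b j), h1, fun i hi e => ?_⟩
    have := h4 i ⟨hi, e.1, e.2.2⟩
    have e' : κ i = k (c j, b j) i := by simp only [κ, e.1, e.2.2]
    rw [e']; exact this
end

section
variable {F : ℕ → Set (ℝ × ℝ)} {A B : ℝ} {s t : ℕ → ℝ}

lemma right_half (h : CL A B F s t) {J : Set ℕ} {a b : ℕ → ℝ}
    (hb : ∀ j ∈ J, A ≤ a j ∧ a j < b j ∧ b j ≤ B ∧ (a j + b j)/2 ≤ s j ∧ t j ≤ b j)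
    (hno : ∀ j ∈ J, ¬ INF F (s j) (t j))
    (hd : ∀ j ∈ J, ∀ k ∈ J, (a j = a k ∧ b j = b k) ∨ Disjoint (Ioo (a j) (b j)) (Ioo (a k) (b k)))
    (hW : ∀ j ∈ J, ∀ x ∈ Ioo (a j) (b j), ∃ ε > 0, ¬ INF F (x - ε) (x + ε)) :
    ∃ X ⊆ J, FCov A B F s t (J \ X) ∧ ∀ j ∈ X, {k ∈ X | a k = a j ∧ b k = b j}.Finite := by
  classical
  have ch : ∀ x : ℝ × ℝ, ∃ d : ℕ → ℝ, (∃ j ∈ J, a j = x.1 ∧ b j = x.2) → d 0 = (x.1 + x.2)/2 ∧ Monotone d ∧ (∀ i, d i ≤ x.2) ∧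
      (∀ i, d i < x.2 → d i < d (i+1)) ∧
      (∀ i, d i < x.2 → ¬ INF F (d i) (d (i+1)) ∨
        (d (i+1) = x.2 ∧ (∀ y < x.2, INF F y x.2) ∧ ∀ q < x.2, ¬ INF F (d i) q)) ∧
      (∀ i, d i < x.2 → INF F (d i) (d (i+2)) ∨ d (i+2) = x.2) ∧
      (∀ z < x.2, ∃ i, z < d i) := by
    intro x
    by_cases hx : ∃ j ∈ J, a j = x.1 ∧ b j = x.2
    · obtain ⟨j, hj, e1, e2⟩ := hx
      have hab := (hb j hj).2.1
      rw [e1, e2] at hab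
      obtain ⟨d, hd⟩ := chain (F := F) (c := (x.1 + x.2)/2) (b := x.2) (by linarith)
        (fun y hy => hW j hj y ⟨by rw [e1]; linarith [hy.1], by rw [e2]; exact hy.2⟩)
      exact ⟨d, fun _ => hd⟩
    · exact ⟨fun _ => 0, fun h => absurd h hx⟩
  choose D hD using ch
  let d : ℕ → ℕ → ℝ := fun j => D (a j, b j)
  have dsame : ∀ j k, a k = a j ∧ b k = b j → d k = d j := fun j k e => by simp only [d, e.1, e.2]
  have hD' := fun j (hj : j ∈ J) => hD (a j, b j) ⟨j, hj, rfl, rfl⟩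
  have d0 : ∀ j ∈ J, d j 0 = (a j + b j)/2 := fun j hj => (hD' j hj).1
  have dm : ∀ j ∈ J, Monotone (d j) := fun j hj => (hD' j hj).2.1
  have dle : ∀ j ∈ J, ∀ i, d j i ≤ b j := fun j hj => (hD' j hj).2.2.1
  have P1 := fun j (hj : j ∈ J) => (hD' j hj).2.2.2.2.1
  have P2 : ∀ j ∈ J, ∀ i, d j i < b j → INF F (d j i) (d j (i+2)) ∨ d j (i+2) = b j := fun j hj => (hD' j hj).2.2.2.2.2.1
  have P3 : ∀ j ∈ J, ∀ z < b j, ∃ i, z < d j i := fun j hj => (hD' j hj).2.2.2.2.2.2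
  have stj := fun j => (h.hst j).2.1
  have sb : ∀ j ∈ J, s j < b j := fun j hj => (stj j).trans_le (hb j hj).2.2.2.2
  have idx : ∀ j, ∃ i, j ∈ J → d j i ≤ s j ∧ s j < d j (i+1) := by
    intro j
    by_cases hj : j ∈ J
    · have ex := P3 j hj (s j) (sb j hj)
      have h1 := Nat.find_spec ex
      have h2 := fun m => Nat.find_min ex (m := m)
      set N := Nat.find ex
      have hN : N ≠ 0 := by
        intro h0
        rw [h0, d0 j hj] at h1
        linarith [(hb j hj).2.2.2.1]
      refine ⟨N - 1, fun _ => ⟨not_lt.1 (h2 (N-1) (by omega)), ?_⟩⟩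
      rwa [Nat.sub_add_cancel (Nat.pos_of_ne_zero hN)]
    · exact ⟨0, fun h => absurd h hj⟩
  choose ix hix using idx
  let C : ℕ → Set ℕ := fun r => {j ∈ J | d j (ix j + 1) < t j ∧ ix j % 3 = r}
  let same : ℕ → ℕ → Prop := fun j k => d k (ix k) = d j (ix j) ∧ d k (ix k + 1) = d j (ix j + 1) ∧ d k (ix k + 3) = d j (ix j + 3)
  let CI : ℕ → Set ℕ := fun r => {j ∈ C r | {k ∈ C r | same j k}.Infinite}
  have tle : ∀ r, ∀ j ∈ C r, t j ≤ d j (ix j + 3) := by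
    rintro r j ⟨hj, hlt, -⟩
    by_contra hgt
    push Not at hgt
    have htb := (hb j hj).2.2.2.2
    rcases P2 j hj (ix j + 1) (hlt.trans_le htb) with h1 | h1
    · exact hno j hj (h1.mono (hix j hj).2.le hgt.le)
    · have h1 : d j (ix j + 3) = b j := h1
      linarith
  have CIcov : ∀ r, Cov A B F s t (CI r) := by
    intro r
    refine central h (l := fun j => d j (ix j)) (c := fun j => d j (ix j + 1)) (r := fun j => d j (ix j + 3)) ?_ ?_ ?_
    · rintro j ⟨hj, -⟩
      have hjJ := hj.1
      have hd0 := dm j hjJ (Nat.zero_le (ix j))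
      rw [d0 j hjJ] at hd0
      obtain ⟨b1, b2, b3, b4, b5⟩ := hb j hjJ
      exact ⟨by linarith, (hix j hjJ).1, (hix j hjJ).2, hj.2.1, tle r j hj, (dle j hjJ _).trans b3⟩
    · rintro j ⟨hj, -⟩ k ⟨hk, -⟩
      rcases hd j hj.1 k hk.1 with e | e
      · have e' : d j = d k := dsame k j e
        have hmod : ix j % 3 = ix k % 3 := hj.2.2.trans hk.2.2.symm
        rcases lt_trichotomy (ix j) (ix k) with hlt | heq | hlt
        · right
          have : d j (ix j + 3) ≤ d k (ix k) := by rw [e']; exact dm k hk.1 (by omega)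
          rw [disjoint_left]
          rintro x hx hx'
          linarith [hx.2, hx'.1]
        · left; simp only [e', heq, and_self]
        · right
          have : d k (ix k + 3) ≤ d j (ix j) := by rw [← e']; exact dm j hj.1 (by omega)
          rw [disjoint_left]
          rintro x hx hx'
          linarith [hx'.2, hx.1]
      · right
        have sub : ∀ j ∈ J, Ioo (d j (ix j)) (d j (ix j + 3)) ⊆ Ioo (a j) (b j) := by
          intro j hjJ x hx
          have hd0 := dm j hjJ (Nat.zero_le (ix j))
          rw [d0 j hjJ] at hd0
          have := (hb j hjJ).2.1
          exact ⟨by linarith [hx.1], hx.2.trans_le (dle j hjJ _)⟩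
        exact e.mono (sub j hj.1) (sub k hk.1)
    · rintro j ⟨hj, hi⟩
      refine hi.mono ?_
      rintro k ⟨hk, e⟩
      refine ⟨⟨hk, ?_⟩, e⟩
      have : {i ∈ C r | same k i} = {i ∈ C r | same j i} := by
        ext i
        simp only [same, mem_setOf_eq, e.1, e.2.1, e.2.2]
      rw [this]; exact hi
  let X0 : Set ℕ := J \ (CI 0 ∪ CI 1 ∪ CI 2)
  let Fi : ℕ → ℕ → Set ℕ := fun j i => {k ∈ X0 | (a k = a j ∧ b k = b j) ∧ ix k = i}
  have FiP : ∀ j ∈ J, ∀ i, (Fi j i).Finite ∨ ((∀ y < b j, INF F y (b j)) ∧ ∀ z < b j, (Fi j i ∩ {k | t k ≤ z}).Finite) := by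
    intro j hj i
    -- second part
    have part2 : {k ∈ Fi j i | d k (ix k + 1) < t k}.Finite := by
      rcases eq_empty_or_nonempty {k ∈ Fi j i | d k (ix k + 1) < t k} with he | ⟨k0, ⟨⟨hk0J, hk0n⟩, hk0e, hk0i⟩, hk0t⟩
      · rw [he]; exact finite_empty
      · set r := ix k0 % 3
        have hr : r = 0 ∨ r = 1 ∨ r = 2 := by omega
        have hC : k0 ∈ C r := ⟨hk0J, hk0t, rfl⟩
        have hnI : k0 ∉ CI r := by
          intro hI
          apply hk0n
          rcases hr with h | h | h <;> rw [h] at hI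
          · exact Or.inl (Or.inl hI)
          · exact Or.inl (Or.inr hI)
          · exact Or.inr hI
        have : {k ∈ C r | same k0 k}.Finite := by
          by_contra hinf
          exact hnI ⟨hC, hinf⟩
        refine this.subset ?_
        rintro k ⟨⟨⟨hkJ, hkn⟩, hke, hki⟩, hkt⟩
        have e1 : d k = d k0 := (dsame j k hke).trans (dsame j k0 hk0e).symm
        have e2 : ix k = ix k0 := hki.trans hk0i.symm
        refine ⟨⟨hkJ, hkt, by rw [e2]⟩, ?_⟩
        simp only [same, e1, e2, and_self]
    have split : ∀ k ∈ Fi j i, d k (ix k + 1) < t k ∨ (d j i ≤ s k ∧ t k ≤ d j (i+1)) := by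
      rintro k ⟨⟨hkJ, hkn⟩, hke, hki⟩
      by_cases hlt : d k (ix k + 1) < t k
      · exact Or.inl hlt
      · right
        have := (hix k hkJ).1
        have hlt := not_lt.1 hlt
        rw [dsame j k hke, hki] at this hlt
        exact ⟨this, hlt⟩
    rcases eq_empty_or_nonempty (Fi j i) with he | ⟨k0, ⟨hk0J, hk0n⟩, hk0e, hk0i⟩
    · left; rw [he]; exact finite_empty
    have hlt : d j i < b j := by
      have := (hix k0 hk0J).1
      rw [dsame j k0 hk0e, hk0i] at this
      rw [← hk0e.2]
      exact this.trans_lt (sb k0 hk0J)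
    rcases P1 j hj i hlt with hP | ⟨e1, e2, e3⟩
    · left
      have : {k | d j i ≤ s k ∧ t k ≤ d j (i+1)}.Finite := by
        by_contra hinf; exact hP (h.H _ _ hinf)
      refine (part2.union this).subset ?_
      intro k hk
      rcases split k hk with h1 | h1
      · exact Or.inl ⟨hk, h1⟩
      · exact Or.inr h1
    · right
      refine ⟨e2, fun z hz => ?_⟩
      have : {k | d j i ≤ s k ∧ t k ≤ z}.Finite := by
        by_contra hinf; exact e3 z hz (h.H _ _ hinf)
      refine (part2.union this).subset ?_
      rintro k ⟨hk, hkz⟩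
      rcases split k hk with h1 | h1
      · exact Or.inl ⟨hk, h1⟩
      · exact Or.inr ⟨h1.1, hkz⟩
  have Xfin : ∀ j ∈ J, ∀ z < b j, {k ∈ X0 | (a k = a j ∧ b k = b j) ∧ t k ≤ z}.Finite := by
    intro j hj z hz
    obtain ⟨m, hm⟩ := P3 j hj z hz
    have : (⋃ i ∈ Finset.range m, (Fi j i ∩ {k | t k ≤ z})).Finite := by
      refine Set.Finite.biUnion (Finset.finite_toSet _) fun i _ => ?_
      rcases FiP j hj i with h1 | h1
      · exact h1.subset inter_subset_left
      · exact h1.2 z hz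
    refine this.subset ?_
    rintro k ⟨hk, hke, hkz⟩
    rw [mem_iUnion₂]
    refine ⟨ix k, ?_, ⟨hk, hke, rfl⟩, hkz⟩
    rw [Finset.mem_range]
    by_contra hge
    have h1 := dm j hj (not_lt.1 hge)
    have h2 := (hix k hk.1).1
    rw [dsame j k hke] at h2
    have h3 := stj k
    have hkz : t k ≤ z := hkz
    linarith
  have XI : ∀ j ∈ J, {k ∈ X0 | a k = a j ∧ b k = b j}.Infinite → ∀ y < b j, INF F y (b j) := by
    intro j hj hinf
    by_contra hno'
    have hno'' := hno'
    push Not at hno''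
    obtain ⟨y, hy, hy'⟩ := hno''
    apply hinf
    obtain ⟨m, hm⟩ := P3 j hj y hy
    have hm2 : d j (m+2) = b j := by
      rcases (dle j hj m).eq_or_lt with h1 | h1
      · exact le_antisymm (dle j hj _) (h1 ▸ dm j hj (Nat.le_add_right m 2))
      · exact (P2 j hj m h1).resolve_left fun h2 => hy' (h2.mono hm.le (dle j hj _))
    have : (⋃ i ∈ Finset.range (m+2), Fi j i).Finite := by
      refine Set.Finite.biUnion (Finset.finite_toSet _) fun i _ => ?_
      exact (FiP j hj i).resolve_right fun h1 => hno' h1.1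
    refine this.subset ?_
    rintro k ⟨hk, hke⟩
    rw [mem_iUnion₂]
    refine ⟨ix k, ?_, hk, hke, rfl⟩
    rw [Finset.mem_range]
    by_contra hge
    have h1 := dm j hj (not_lt.1 hge)
    have h2 := (hix k hk.1).1
    rw [dsame j k hke] at h2
    have h3 := sb k hk.1
    rw [hke.2] at h3
    linarith
  let Ω : Set ℕ := {j ∈ X0 | {k ∈ X0 | a k = a j ∧ b k = b j}.Infinite}
  have Ωcov : Cov A B F s t Ω := by
    refine omega h (c := fun j => (a j + b j)/2) (b := b) ?_ ?_ ?_ ?_ ?_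
    · rintro j ⟨⟨hj, -⟩, -⟩
      obtain ⟨b1, b2, b3, b4, b5⟩ := hb j hj
      exact ⟨by linarith, b4, b5, b3⟩
    · rintro j ⟨⟨hj, -⟩, -⟩ k ⟨⟨hk, -⟩, -⟩
      rcases hd j hj k hk with e | e
      · left; simp only [e.1, e.2, and_self]
      · right
        have sub : ∀ j ∈ J, Ioo ((a j + b j)/2) (b j) ⊆ Ioo (a j) (b j) := by
          intro j hjJ x hx
          have := (hb j hjJ).2.1
          exact ⟨by linarith [hx.1], hx.2⟩
        exact e.mono (sub j hj) (sub k hk)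
    · rintro j ⟨⟨hj, -⟩, hi⟩
      exact XI j hj hi
    · rintro j ⟨⟨hj, -⟩, hi⟩ z hz
      refine (Xfin j hj z hz).subset ?_
      rintro k ⟨⟨hk, -⟩, ⟨e1, e2⟩, e3⟩
      exact ⟨hk, ⟨by linarith, e2⟩, e3⟩
    · rintro j ⟨hj, hi⟩
      refine hi.mono ?_
      rintro k ⟨hk, e⟩
      refine ⟨⟨hk, ?_⟩, by rw [e.1, e.2], e.2⟩
      rw [e.1, e.2]; exact hi
  refine ⟨X0 \ Ω, fun j hj => hj.1.1, ?_, ?_⟩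
  · refine ((((CIcov 0).fcov.union (CIcov 1).fcov).union (CIcov 2).fcov).union Ωcov.fcov).mono ?_
    rintro j ⟨hj, hjn⟩
    by_cases h1 : j ∈ CI 0 ∪ CI 1 ∪ CI 2
    · exact Or.inl h1
    · right
      by_contra h2
      exact hjn ⟨⟨hj, h1⟩, h2⟩
  · rintro j ⟨hj, hjn⟩
    have : {k ∈ X0 | a k = a j ∧ b k = b j}.Finite := by
      by_contra hinf
      exact hjn ⟨hj, hinf⟩
    exact this.subset fun k hk => ⟨hk.1.1, hk.2⟩
end

section
variable {F : ℕ → Set (ℝ × ℝ)} {A B : ℝ} {s t : ℕ → ℝ}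

lemma left_half (h : CL A B F s t) {J : Set ℕ} {a b : ℕ → ℝ}
    (hb : ∀ j ∈ J, A ≤ a j ∧ a j < b j ∧ b j ≤ B ∧ a j ≤ s j ∧ t j ≤ (a j + b j)/2)
    (hno : ∀ j ∈ J, ¬ INF F (s j) (t j))
    (hd : ∀ j ∈ J, ∀ k ∈ J, (a j = a k ∧ b j = b k) ∨ Disjoint (Ioo (a j) (b j)) (Ioo (a k) (b k)))
    (hW : ∀ j ∈ J, ∀ x ∈ Ioo (a j) (b j), ∃ ε > 0, ¬ INF F (x - ε) (x + ε)) :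
    ∃ X ⊆ J, FCov A B F s t (J \ X) ∧ ∀ j ∈ X, {k ∈ X | a k = a j ∧ b k = b j}.Finite := by
  obtain ⟨X, hX, h1, h2⟩ := right_half h.refl (J := J) (a := fun j => - b j) (b := fun j => - a j)
    (by
      intro j hj
      obtain ⟨b1, b2, b3, b4, b5⟩ := hb j hj
      refine ⟨?_, ?_, ?_, ?_, ?_⟩ <;> linarith)
    (by
      intro j hj
      rw [INF_refl_iff, neg_neg, neg_neg]; exact hno j hj)
    (by
      intro j hj k hk
      rcases hd j hj k hk with e | e
      · left; simp [e.1, e.2]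
      · right
        rw [disjoint_left] at e ⊢
        intro x hx hx'
        exact e (a := -x) ⟨by linarith [hx.2], by linarith [hx.1]⟩ ⟨by linarith [hx'.2], by linarith [hx'.1]⟩)
    (by
      intro j hj x hx
      obtain ⟨ε, hε, hε'⟩ := hW j hj (-x) ⟨by linarith [hx.2], by linarith [hx.1]⟩
      refine ⟨ε, hε, fun hi => hε' ?_⟩
      rw [INF_refl_iff] at hi
      exact hi.mono (by linarith) (by linarith))
  refine ⟨X, hX, h1.of_refl, fun j hj => (h2 j hj).subset ?_⟩
  rintro k ⟨hk, e1, e2⟩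
  exact ⟨hk, by simp [e2], by simp [e1]⟩

lemma center_part (h : CL A B F s t) {J : Set ℕ} {a b : ℕ → ℝ}
    (hb : ∀ j ∈ J, A ≤ a j ∧ a j ≤ s j ∧ s j < (a j + b j)/2 ∧ (a j + b j)/2 < t j ∧ t j ≤ b j ∧ b j ≤ B)
    (hd : ∀ j ∈ J, ∀ k ∈ J, (a j = a k ∧ b j = b k) ∨ Disjoint (Ioo (a j) (b j)) (Ioo (a k) (b k))) :
    ∃ X ⊆ J, FCov A B F s t (J \ X) ∧ ∀ j ∈ X, {k ∈ X | a k = a j ∧ b k = b j}.Finite := by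
  let X := {j ∈ J | {k ∈ J | a k = a j ∧ b k = b j}.Finite}
  refine ⟨X, fun j hj => hj.1, Cov.fcov ?_, fun j hj => hj.2.subset fun k hk => ⟨hk.1.1, hk.2⟩⟩
  refine central h (l := a) (c := fun j => (a j + b j)/2) (r := b) (fun j hj => hb j hj.1) ?_ ?_
  · intro j hj k hk
    rcases hd j hj.1 k hk.1 with e | e
    · left; simp [e.1, e.2]
    · exact Or.inr e
  · rintro j ⟨hj, hjn⟩
    have hi : {k ∈ J | a k = a j ∧ b k = b j}.Infinite := fun hf => hjn ⟨hj, hf⟩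
    refine hi.mono ?_
    rintro k ⟨hk, e⟩
    refine ⟨⟨hk, fun hkX => hi ?_⟩, e.1, by rw [e.1, e.2], e.2⟩
    have := hkX.2
    rwa [e.1, e.2] at this

/-- all nbhds are infinite -/
def WW (F : ℕ → Set (ℝ × ℝ)) : Set ℝ := {x | ∀ ε > 0, INF F (x - ε) (x + ε)}

lemma WW_closed : IsClosed (WW F) := by
  rw [← isOpen_compl_iff, Metric.isOpen_iff]
  intro x hx
  have hx : ¬ ∀ ε > 0, INF F (x - ε) (x + ε) := hx
  push Not at hx
  obtain ⟨ε, hε, hε'⟩ := hx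
  refine ⟨ε/2, by linarith, fun y hy hyW => hε' ?_⟩
  rw [Metric.mem_ball, Real.dist_eq, abs_lt] at hy
  exact (hyW (ε/2) (by linarith)).mono (by linarith) (by linarith)

lemma INF_of_mem_WW {x u v : ℝ} (hx : x ∈ WW F) (h : x ∈ Ioo u v) : INF F u v := by
  have := hx (min (x - u) (v - x)) (lt_min (by linarith [h.1]) (by linarith [h.2]))
  exact this.mono (by linarith [min_le_left (x-u) (v-x)]) (by linarith [min_le_right (x-u) (v-x)])

lemma exists_gap {W : Set ℝ} (hW : IsClosed W) (hA : A ∈ W) (hB : B ∈ W) {s t : ℝ} (h1 : A ≤ s) (h2 : s < t) (h3 : t ≤ B)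
    (hd : ∀ x ∈ Ioo s t, x ∉ W) : ∃ a b, A ≤ a ∧ a ≤ s ∧ t ≤ b ∧ b ≤ B ∧ a ∈ W ∧ b ∈ W ∧ ∀ x ∈ Ioo a b, x ∉ W := by
  have c1 : IsCompact (W ∩ Icc A s) := isCompact_Icc.inter_left hW
  have c2 : IsCompact (W ∩ Icc t B) := isCompact_Icc.inter_left hW
  have m1 := c1.sSup_mem ⟨A, hA, le_rfl, h1⟩
  have m2 := c2.sInf_mem ⟨B, hB, h3, le_rfl⟩
  refine ⟨_, _, m1.2.1, m1.2.2, m2.2.1, m2.2.2, m1.1, m2.1, fun x hx hxW => ?_⟩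
  by_cases hxs : x ≤ s
  · exact absurd (le_csSup c1.bddAbove ⟨hxW, m1.2.1.trans hx.1.le, hxs⟩) (not_le.2 hx.1)
  by_cases hxt : t ≤ x
  · exact absurd (csInf_le c2.bddBelow ⟨hxW, hxt, hx.2.le.trans m2.2.2⟩) (not_le.2 hx.2)
  · exact hd x ⟨not_le.1 hxs, not_le.1 hxt⟩ hxW

lemma accR_marks {W : Set ℝ} {m a b : ℕ → ℝ} {X : Set ℕ} (hm : ∀ j ∈ X, a j < m j ∧ m j < b j)
    (ha : ∀ j ∈ X, a j = A ∨ a j ∈ W) (hA : ∀ j ∈ X, A ≤ a j)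
    (hd : ∀ j ∈ X, ∀ k ∈ X, (a j = a k ∧ b j = b k) ∨ Disjoint (Ioo (a j) (b j)) (Ioo (a k) (b k)))
    (hf : ∀ j ∈ X, {k ∈ X | a k = a j ∧ b k = b j}.Finite) (x : ℝ) (hx : AccR (m '' X) x) : AccR W x := by
  intro ε hε
  by_contra hne
  rw [not_nonempty_iff_eq_empty] at hne
  have hno : ∀ y ∈ W, y ∉ Ioo x (x+ε) := fun y hy hy' => by
    have : y ∈ W ∩ Ioo x (x+ε) := ⟨hy, hy'⟩
    rw [hne] at this; exact this
  have hAx : A ≤ x := by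
    by_contra hlt
    push Not at hlt
    obtain ⟨_, ⟨j, hj, rfl⟩, h1⟩ := hx (A - x) (by linarith)
    linarith [h1.2, hA j hj, hm j hj]
  have hax : ∀ j ∈ X, m j ∈ Ioo x (x+ε) → a j ≤ x := fun j hj hmj => by
    rcases ha j hj with h | h
    · rw [h]; exact hAx
    · by_contra hlt
      exact hno _ h ⟨not_le.1 hlt, (hm j hj).1.trans hmj.2⟩
  obtain ⟨_, ⟨j0, hj0, rfl⟩, h0⟩ := hx ε hε
  -- all marks close to x lie in the gap of j0
  have hsame : ∀ j ∈ X, m j ∈ Ioo x (m j0) → a j = a j0 ∧ b j = b j0 := by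
    intro j hj hmj
    refine (hd j hj j0 hj0).resolve_right fun hdis => ?_
    have h1 := hax j hj ⟨hmj.1, hmj.2.trans h0.2⟩
    have h2 := hax j0 hj0 h0
    exact disjoint_left.1 hdis (hm j hj) ⟨h2.trans_lt hmj.1, hmj.2.trans (hm j0 hj0).2⟩
  have fin : (m '' {k ∈ X | a k = a j0 ∧ b k = b j0}).Finite := (hf j0 hj0).image m
  have fin2 : ((m '' {k ∈ X | a k = a j0 ∧ b k = b j0}) ∩ Ioi x).Finite := fin.subset inter_subset_left
  obtain ⟨y, hy, hy'⟩ := fin2.exists_minimalFor id _ ⟨m j0, ⟨j0, ⟨hj0, rfl, rfl⟩, rfl⟩, mem_Ioi.2 h0.1⟩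
  have hyx : x < y := hy.2
  have hyj0 : y ≤ m j0 := by
    by_contra hlt
    push Not at hlt
    exact hlt.not_ge (hy' (j := m j0) ⟨⟨j0, ⟨hj0, rfl, rfl⟩, rfl⟩, mem_Ioi.2 h0.1⟩ hlt.le)
  obtain ⟨_, ⟨j, hj, rfl⟩, h1⟩ := hx (y - x) (by linarith)
  have hjy : m j < y := by linarith [h1.2]
  have := hsame j hj ⟨h1.1, hjy.trans_le hyj0⟩
  exact hjy.not_ge (hy' (j := m j) ⟨⟨j, ⟨hj, this⟩, rfl⟩, mem_Ioi.2 h1.1⟩ hjy.le)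

theorem CL.main (h : CL 0 1 F s t) : FCov 0 1 F s t univ := by
  classical
  let J0 : Set ℕ := {j | INF F (s j) (t j)}
  have c0 : Cov 0 1 F s t J0 := by
    obtain ⟨n, β, hn, hβ⟩ := choose_blocks (F := F) (J := J0) (u := s) (v := t) (fun j hj => hj)
    exact ⟨_, IsoOn.id 0 1, n, β, hn.injOn, fun j hj => ⟨(hβ j hj).1, (hβ j hj).2.1.le, (hβ j hj).2.2.le⟩⟩
  let W : Set ℝ := WW F ∪ {0, 1}
  have Wc : IsClosed W := WW_closed.union (Set.Finite.isClosed (by simp))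
  have gap : ∀ j, ∃ a b, j ∉ J0 → 0 ≤ a ∧ a ≤ s j ∧ t j ≤ b ∧ b ≤ 1 ∧ a ∈ W ∧ b ∈ W ∧ ∀ x ∈ Ioo a b, x ∉ W := by
    intro j
    by_cases hj : j ∈ J0
    · exact ⟨0, 0, fun h => absurd hj h⟩
    · obtain ⟨h1, h2, h3⟩ := h.hst j
      obtain ⟨a, b, hab⟩ := exists_gap (W := W) Wc (A := 0) (B := 1) (by simp [W]) (by simp [W]) h1 h2 h3 (by
        rintro x hx (hxW | hxW)
        · exact hj (INF_of_mem_WW hxW hx)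
        · rcases hxW with rfl | hxW
          · linarith [hx.1]
          · rw [mem_singleton_iff] at hxW; linarith [hx.2])
      exact ⟨a, b, fun _ => hab⟩
  choose a b hab using gap
  have hd : ∀ j ∉ J0, ∀ k ∉ J0, (a j = a k ∧ b j = b k) ∨ Disjoint (Ioo (a j) (b j)) (Ioo (a k) (b k)) := by
    intro j hj k hk
    rw [or_iff_not_imp_right, not_disjoint_iff]
    rintro ⟨x, hx, hx'⟩
    obtain ⟨-, -, -, -, a1, b1, n1⟩ := hab j hj
    obtain ⟨-, -, -, -, a2, b2, n2⟩ := hab k hk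
    constructor
    · apply le_antisymm
      · by_contra hlt
        exact n2 _ ⟨not_le.1 hlt, hx.1.trans hx'.2⟩ a1
      · by_contra hlt
        exact n1 _ ⟨not_le.1 hlt, hx'.1.trans hx.2⟩ a2
    · apply le_antisymm
      · by_contra hlt
        exact n1 _ ⟨hx.1.trans hx'.2, not_le.1 hlt⟩ b2
      · by_contra hlt
        exact n2 _ ⟨hx'.1.trans hx.2, not_le.1 hlt⟩ b1
  have hW : ∀ j ∉ J0, ∀ x ∈ Ioo (a j) (b j), ∃ ε > 0, ¬ INF F (x - ε) (x + ε) := by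
    intro j hj x hx
    have h1 := (hab j hj).2.2.2.2.2.2 x hx
    by_contra hno
    push Not at hno
    exact h1 (Or.inl hno)
  have stj := fun j => (h.hst j).2.1
  obtain ⟨Xr, r1, r2, r3⟩ := right_half h (J := {j | j ∉ J0 ∧ (a j + b j)/2 ≤ s j}) (a := a) (b := b)
    (by
      rintro j ⟨hj, hj'⟩
      obtain ⟨g1, g2, g3, g4, -⟩ := hab j hj
      have := stj j
      refine ⟨?_, ?_, ?_, ?_, ?_⟩ <;> linarith)
    (fun j hj => hj.1) (fun j hj k hk => hd j hj.1 k hk.1) (fun j hj => hW j hj.1)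
  obtain ⟨Xl, l1, l2, l3⟩ := left_half h (J := {j | j ∉ J0 ∧ t j ≤ (a j + b j)/2}) (a := a) (b := b)
    (by
      rintro j ⟨hj, hj'⟩
      obtain ⟨g1, g2, g3, g4, -⟩ := hab j hj
      have := stj j
      refine ⟨?_, ?_, ?_, ?_, ?_⟩ <;> linarith)
    (fun j hj => hj.1) (fun j hj k hk => hd j hj.1 k hk.1) (fun j hj => hW j hj.1)
  obtain ⟨Xc, m1, m2, m3⟩ := center_part h (J := {j | j ∉ J0 ∧ s j < (a j + b j)/2 ∧ (a j + b j)/2 < t j}) (a := a) (b := b)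
    (by
      rintro j ⟨hj, hj', hj''⟩
      obtain ⟨g1, g2, g3, g4, -⟩ := hab j hj
      exact ⟨g1, g2, hj', hj'', g3, g4⟩)
    (fun j hj k hk => hd j hj.1 k hk.1)
  let X := Xr ∪ Xl ∪ Xc
  have XJ : ∀ j ∈ X, j ∉ J0 := by
    rintro j ((hj | hj) | hj)
    · exact (r1 hj).1
    · exact (l1 hj).1
    · exact (m1 hj).1
  have Xf : ∀ j ∈ X, {k ∈ X | a k = a j ∧ b k = b j}.Finite := by
    have aux : ∀ Y : Set ℕ, (∀ j ∈ Y, {k ∈ Y | a k = a j ∧ b k = b j}.Finite) → ∀ j, {k ∈ Y | a k = a j ∧ b k = b j}.Finite := by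
      intro Y hY j
      rcases eq_empty_or_nonempty {k ∈ Y | a k = a j ∧ b k = b j} with he | ⟨k0, hk0, e⟩
      · rw [he]; exact finite_empty
      · refine (hY k0 hk0).subset ?_
        rintro k ⟨hk, e'⟩
        exact ⟨hk, e'.1.trans e.1.symm, e'.2.trans e.2.symm⟩
    intro j _
    refine (((aux Xr r3 j).union (aux Xl l3 j)).union (aux Xc m3 j)).subset ?_
    rintro k ⟨(hk | hk) | hk, e⟩
    · exact Or.inl (Or.inl ⟨hk, e⟩)
    · exact Or.inl (Or.inr ⟨hk, e⟩)
    · exact Or.inr ⟨hk, e⟩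
  -- marks
  obtain ⟨m, minj, hm⟩ := exists_inj_choice (fun j => Ioo (s j) (t j)) (fun j => Ioo_infinite (stj j))
  have mab : ∀ j ∈ X, a j < m j ∧ m j < b j := fun j hj => by
    obtain ⟨g1, g2, g3, g4, -⟩ := hab j (XJ j hj)
    exact ⟨g2.trans_lt (hm j).1, (hm j).2.trans_le g3⟩
  have hS : Setting (m '' X) (WW F) := by
    refine ⟨WW_closed, ?_, ?_, ?_⟩
    · rintro _ ⟨j, hj, rfl⟩ hW'
      exact (hab j (XJ j hj)).2.2.2.2.2.2 _ (mab j hj) (Or.inl hW')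
    · intro x hx
      refine accR_marks (A := 0) (m := m) (a := a) (b := b) (X := X) mab ?_ (fun j hj => (hab j (XJ j hj)).1)
        (fun j hj k hk => hd j (XJ j hj) k (XJ k hk)) Xf x hx
      intro j hj
      obtain ⟨g1, g2, g3, g4, g5, g6, -⟩ := hab j (XJ j hj)
      rcases g5 with g | g | g
      · exact Or.inr g
      · exact Or.inl g
      · rw [mem_singleton_iff] at g
        have := mab j hj; linarith
    · intro x hx
      have hx' : AccR ((fun j => - m j) '' X) (-x) := by
        have : (fun j => - m j) '' X = Neg.neg ⁻¹' (m '' X) := by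
          ext y; simp [neg_eq_iff_eq_neg]
        rw [this, accR_neg, neg_neg]; exact hx
      have := accR_marks (W := Neg.neg ⁻¹' (WW F)) (A := -1) (m := fun j => - m j) (a := fun j => - b j) (b := fun j => - a j) (X := X)
        (fun j hj => ⟨by linarith [(mab j hj).2], by linarith [(mab j hj).1]⟩) ?_
        (fun j hj => by linarith [(hab j (XJ j hj)).2.2.2.1]) ?_ ?_ (-x) hx'
      · rw [accR_neg, neg_neg] at this; exact this
      · intro j hj
        obtain ⟨g1, g2, g3, g4, g5, g6, -⟩ := hab j (XJ j hj)
        rcases g6 with g | g | g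
        · right; simpa using g
        · have := mab j hj; linarith
        · rw [mem_singleton_iff] at g; left; rw [g]
      · intro j hj k hk
        rcases hd j (XJ j hj) k (XJ k hk) with e | e
        · left; simp [e.1, e.2]
        · right
          rw [disjoint_left] at e ⊢
          intro x hx hx'
          exact e (a := -x) ⟨by linarith [hx.2], by linarith [hx.1]⟩ ⟨by linarith [hx'.2], by linarith [hx'.1]⟩
      · intro j hj
        refine (Xf j hj).subset ?_
        rintro k ⟨hk, e1, e2⟩
        exact ⟨hk, neg_injective e2, neg_injective e1⟩
  obtain ⟨M0, hM0, ψ, hψ, hψ'⟩ := mark_theorem hS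
  have finX : {j ∈ X | m j ∈ M0}.Finite := (hM0.preimage minj.injOn).subset fun j hj => hj.2
  have cX : Cov 0 1 F s t {j ∈ X | m j ∉ M0} := by
    obtain ⟨n, β, hn, hβ⟩ := choose_blocks (F := F) (J := {j ∈ X | m j ∉ M0}) (u := fun j => ψ (s j)) (v := fun j => ψ (t j)) (by
      rintro j ⟨hj, hjM⟩
      obtain ⟨h1, h2, h3⟩ := h.hst j
      have hmj := hm j
      have i0 : m j ∈ Ioo (0:ℝ) 1 := ⟨h1.trans_lt hmj.1, hmj.2.trans_le h3⟩
      refine INF_of_mem_WW (hψ' (m j) ⟨⟨⟨j, hj, rfl⟩, hjM⟩, i0⟩) ⟨?_, ?_⟩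
      · exact hψ.mono ⟨h1, by linarith⟩ (Ioo_subset_Icc_self i0) hmj.1
      · exact hψ.mono (Ioo_subset_Icc_self i0) ⟨by linarith, h3⟩ hmj.2)
    exact ⟨ψ, hψ, n, β, hn.injOn, fun j hj => ⟨(hβ j hj).1, (hβ j hj).2.1.le, (hβ j hj).2.2.le⟩⟩
  refine (((((c0.fcov.union r2).union l2).union m2).union cX.fcov).union (FCov.of_finite finX)).mono ?_
  intro j _
  by_cases hj : j ∈ J0
  · exact Or.inl (Or.inl (Or.inl (Or.inl (Or.inl hj))))
  by_cases hX : j ∈ X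
  · by_cases hM : m j ∈ M0
    · exact Or.inr ⟨hX, hM⟩
    · exact Or.inl (Or.inr ⟨hX, hM⟩)
  · have nr : j ∉ Xr := fun h => hX (Or.inl (Or.inl h))
    have nl : j ∉ Xl := fun h => hX (Or.inl (Or.inr h))
    have nc : j ∉ Xc := fun h => hX (Or.inr h)
    by_cases h1 : (a j + b j)/2 ≤ s j
    · exact Or.inl (Or.inl (Or.inl (Or.inl (Or.inr ⟨⟨hj, h1⟩, nr⟩))))
    by_cases h2 : t j ≤ (a j + b j)/2
    · exact Or.inl (Or.inl (Or.inl (Or.inr ⟨⟨hj, h2⟩, nl⟩)))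
    · exact Or.inl (Or.inl (Or.inr ⟨⟨hj, not_le.1 h1, not_le.1 h2⟩, nc⟩))
end

section
open scoped InnerProductSpace
set_option linter.unusedSectionVars false
open ContinuousNest
open ContinuousLinearMap (adjoint_inner_left adjoint_inner_right opNorm_le_bound adjoint)
open TopologicalSpace (SeparableSpace)

section

namespace ContinuousNest
variable (M N : ContinuousNest H)

lemma inner_left {t : ℝ} (ht : t ∈ Icc (0:ℝ) 1) (x y : H) :
    ⟪N.N t x, y⟫_ℂ = ⟪x, N.N t y⟫_ℂ := by
  have := N.selfAdjoint t ht
  rw [ContinuousLinearMap.isSelfAdjoint_iff_isSymmetric] at this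
  exact this x y

lemma NN {t : ℝ} (ht : t ∈ Icc (0:ℝ) 1) (x : H) : N.N t (N.N t x) = N.N t x := by
  have := N.idem t ht
  have h2 := congrArg (fun T : H →L[ℂ] H => T x) this
  simpa using h2

lemma NN_ge {s t : ℝ} (hs : s ∈ Icc (0:ℝ) 1) (ht : t ∈ Icc (0:ℝ) 1) (h : s ≤ t) (x : H) :
    N.N t (N.N s x) = N.N s x := by
  rcases h.eq_or_lt with rfl | h
  · exact N.NN hs x
  · have h1 := (N.range_lt s t hs ht h).le
    have h2 : N.N s x ∈ LinearMap.range (N.N t).toLinearMap := h1 ⟨x, rfl⟩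
    obtain ⟨y, hy⟩ := h2
    have hy' : N.N t y = N.N s x := hy
    rw [← hy', N.NN ht]

lemma NN_le {s t : ℝ} (hs : s ∈ Icc (0:ℝ) 1) (ht : t ∈ Icc (0:ℝ) 1) (h : s ≤ t) (x : H) :
    N.N s (N.N t x) = N.N s x := by
  refine ext_inner_right ℂ fun y => ?_
  rw [N.inner_left hs, N.inner_left ht, N.NN_ge hs ht h, N.inner_left hs]

lemma norm_le {t : ℝ} (ht : t ∈ Icc (0:ℝ) 1) (x : H) : ‖N.N t x‖ ≤ ‖x‖ := by
  by_contra hc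
  push Not at hc
  have h1 : ‖N.N t x‖ ^ 2 = RCLike.re ⟪N.N t x, x⟫_ℂ := by
    rw [N.inner_left ht, ← N.NN ht x, ← N.inner_left ht, N.NN ht, inner_self_eq_norm_sq]
  have h2 := (RCLike.re_le_norm ⟪N.N t x, x⟫_ℂ).trans (norm_inner_le_norm _ _)
  nlinarith [norm_nonneg x, norm_nonneg (N.N t x)]

lemma opNorm_le {t : ℝ} (ht : t ∈ Icc (0:ℝ) 1) : ‖N.N t‖ ≤ 1 :=
  opNorm_le_bound _ zero_le_one (by simpa using fun x => N.norm_le ht x)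

lemma mem_mono {s t : ℝ} (hs : s ∈ Icc (0:ℝ) 1) (ht : t ∈ Icc (0:ℝ) 1) (h : s ≤ t) {x : H}
    (hx : N.N s x = x) : N.N t x = x := by
  rw [← hx, N.NN_ge hs ht h]

lemma perp_mono {s t : ℝ} (hs : s ∈ Icc (0:ℝ) 1) (ht : t ∈ Icc (0:ℝ) 1) (h : s ≤ t) {x : H}
    (hx : N.N t x = 0) : N.N s x = 0 := by
  rw [← N.NN_le hs ht h, hx, map_zero]

/-- Operators mapping the nest `M` into the nest `N`. -/
def Tri (T : H →L[ℂ] H) : Prop :=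
  ∀ t ∈ Icc (0:ℝ) 1, ∀ x, N.N t (T (M.N t x)) = T (M.N t x)

end ContinuousNest

variable {M N L : ContinuousNest H}

lemma mem_alg_iff {T : H →L[ℂ] H} : T ∈ N.alg ↔ Tri N N T := by
  refine forall_congr' fun t => forall_congr' fun ht => ?_
  rw [ContinuousLinearMap.ext_iff]
  refine forall_congr' fun x => ?_
  simp only [mul_apply_eq_comp, ContinuousLinearMap.sub_apply, ContinuousLinearMap.one_apply, ContinuousLinearMap.zero_apply]
  rw [sub_eq_zero, eq_comm]

namespace ContinuousNest.Tri
variable {S T : H →L[ℂ] H}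

lemma mem (h : Tri M N T) {t : ℝ} (ht : t ∈ Icc (0:ℝ) 1) {x : H} (hx : M.N t x = x) :
    N.N t (T x) = T x := by
  have := h t ht x
  rwa [hx] at this

lemma of_mem (h : ∀ t ∈ Icc (0:ℝ) 1, ∀ x, M.N t x = x → N.N t (T x) = T x) : Tri M N T :=
  fun t ht x => h t ht _ (M.NN ht x)

lemma perp (h : Tri M N T) {t : ℝ} (ht : t ∈ Icc (0:ℝ) 1) {y : H} (hy : N.N t y = 0) :
    M.N t (adjoint T y) = 0 := by
  refine ext_inner_right ℂ fun x => ?_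
  rw [M.inner_left ht, adjoint_inner_left, ← h t ht, ← N.inner_left ht, hy]
  simp

lemma add (hS : Tri M N S) (hT : Tri M N T) : Tri M N (S + T) := fun t ht x => by
  simp [hS t ht x, hT t ht x]

lemma sub (hS : Tri M N S) (hT : Tri M N T) : Tri M N (S - T) := fun t ht x => by
  simp [hS t ht x, hT t ht x]

lemma smul (c : ℂ) (hS : Tri M N S) : Tri M N (c • S) := fun t ht x => by
  simp [hS t ht x]

lemma zero : Tri M N 0 := fun t ht x => by simp

lemma one : Tri N N 1 := fun t ht x => by simp [N.NN ht]

lemma mul (hS : Tri N L S) (hT : Tri M N T) : Tri M L (S * T) :=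
  of_mem fun t ht x hx => by
    simpa using hS.mem ht (hT.mem ht hx)

lemma sum {ι : Type*} {s : Finset ι} {T : ι → H →L[ℂ] H} (h : ∀ i ∈ s, Tri M N (T i)) :
    Tri M N (∑ i ∈ s, T i) := fun t ht x => by
  simp only [sum_apply, map_sum]
  exact Finset.sum_congr rfl fun i hi => h i hi t ht x

lemma hasSum {ι : Type*} {T : ι → H →L[ℂ] H} {S : H →L[ℂ] H}
    (h : ∀ i, Tri M N (T i)) (hS : ∀ x, HasSum (fun i => T i x) (S x)) : Tri M N S := by
  intro t ht x
  have h1 := (hS (M.N t x)).mapL (N.N t)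
  have h2 := hS (M.N t x)
  refine h1.unique ?_
  simpa only [h _ t ht x] using h2

lemma of_tendsto {T : ℕ → H →L[ℂ] H} {S : H →L[ℂ] H}
    (h : ∀ i, Tri M N (T i)) (hS : Tendsto T atTop (𝓝 S)) : Tri M N S := by
  intro t ht x
  have h1 : ∀ y, Tendsto (fun i => T i y) atTop (𝓝 (S y)) := fun y =>
    ((ContinuousLinearMap.apply ℂ H y).continuous.tendsto S).comp hS
  have h2 := ((N.N t).continuous.tendsto _).comp (h1 (M.N t x))
  refine tendsto_nhds_unique h2 ?_
  simpa only [Function.comp_def, h _ t ht x] using h1 (M.N t x)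

end ContinuousNest.Tri

/-- The rank one operator `z ↦ ⟪y, z⟫_ℂ x`. -/
noncomputable def rk (x y : H) : H →L[ℂ] H := InnerProductSpace.rankOne ℂ x y

@[simp] lemma rk_apply (x y z : H) : rk x y z = ⟪y, z⟫_ℂ • x := by
  simp [rk]

lemma mul_rk (A : H →L[ℂ] H) (x y : H) : A * rk x y = rk (A x) y := by
  ext z; simp

lemma rk_mul (A : H →L[ℂ] H) (x y : H) :
    rk x y * A = rk x (adjoint A y) := by
  ext z; simp [adjoint_inner_left]

lemma rk_mul_rk (x y u v : H) : rk x y * rk u v = ⟪y, u⟫_ℂ • rk x v := by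
  ext z
  simp only [mul_apply_eq_comp, rk_apply, ContinuousLinearMap.smul_apply,
    inner_smul_right, smul_smul, mul_comm]

lemma rk_tri {x y : H} (h : ∀ t ∈ Icc (0:ℝ) 1, N.N t x = x ∨ M.N t y = 0) : Tri M N (rk x y) := by
  intro t ht z
  rcases h t ht with h | h
  · simp [h]
  · simp [← M.inner_left ht, h]

lemma rk_tri' {x y : H} {q : ℝ} (hq : q ∈ Icc (0:ℝ) 1) (hx : N.N q x = x) (hy : M.N q y = 0) :
    Tri M N (rk x y) := by
  refine rk_tri fun t ht => ?_
  rcases le_total q t with h | h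
  · exact Or.inl (N.mem_mono hq ht h hx)
  · exact Or.inr (M.perp_mono ht hq h hy)

/-- Bessel families. -/
def Bess {ι : Type*} (x : ι → H) (C : ℝ) : Prop :=
  ∀ (z : H) (s : Finset ι), ∑ k ∈ s, ‖⟪x k, z⟫_ℂ‖ ^ 2 ≤ C ^ 2 * ‖z‖ ^ 2

lemma Bess.synth {ι : Type*} {x : ι → H} {C : ℝ} (h : Bess x C) (s : Finset ι) (c : ι → ℂ) :
    ‖∑ k ∈ s, c k • x k‖ ^ 2 ≤ C ^ 2 * ∑ k ∈ s, ‖c k‖ ^ 2 := by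
  set v := ∑ k ∈ s, c k • x k with hv
  have h1 : ‖v‖ ^ 2 ≤ ∑ k ∈ s, ‖c k‖ * ‖⟪x k, v⟫_ℂ‖ := by
    have : (⟪v, v⟫_ℂ : ℂ) = ∑ k ∈ s, (starRingEnd ℂ) (c k) * ⟪x k, v⟫_ℂ := by
      conv_lhs => rw [hv, sum_inner]
      simp only [inner_smul_left]
      rfl
    have h2 : ‖v‖ ^ 2 = ‖(⟪v, v⟫_ℂ : ℂ)‖ := by
      rw [inner_self_eq_norm_sq_to_K]; simp
    rw [h2, this]
    refine (norm_sum_le _ _).trans (Finset.sum_le_sum fun k _ => ?_)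
    simp
  have h2 := Finset.sum_mul_sq_le_sq_mul_sq s (fun k => ‖c k‖) (fun k => ‖⟪x k, v⟫_ℂ‖)
  have h3 := h v s
  have h4 : 0 ≤ ∑ k ∈ s, ‖c k‖ ^ 2 := Finset.sum_nonneg fun _ _ => by positivity
  rcases eq_or_ne ‖v‖ 0 with h0 | h0
  · rw [h0]; simp only [ne_eq, OfNat.ofNat_ne_zero, not_false_eq_true, zero_pow]; positivity
  have h5 : 0 < ‖v‖ ^ 2 := by positivity
  have h6 : (‖v‖ ^ 2) ^ 2 ≤ (∑ k ∈ s, ‖c k‖ * ‖⟪x k, v⟫_ℂ‖) ^ 2 := by gcongr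
  have h7 : (‖v‖ ^ 2) ^ 2 ≤ (∑ k ∈ s, ‖c k‖ ^ 2) * (C ^ 2 * ‖v‖ ^ 2) :=
    h6.trans (h2.trans (mul_le_mul_of_nonneg_left h3 h4))
  by_contra hc
  push Not at hc
  nlinarith

/-- A pointwise unconditionally summable series of operators. -/
lemma exists_strong_sum {ι : Type*} (T : ι → H →L[ℂ] H) (C : ℝ) (b : H → ι → ℝ)
    (hC : 0 ≤ C)
    (h1 : ∀ z s, ‖∑ j ∈ s, T j z‖ ^ 2 ≤ ∑ j ∈ s, b z j) (hb : ∀ z j, 0 ≤ b z j)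
    (h2 : ∀ z (s : Finset ι), ∑ j ∈ s, b z j ≤ C ^ 2 * ‖z‖ ^ 2) :
    ∃ S : H →L[ℂ] H, (∀ z, HasSum (fun j => T j z) (S z)) ∧ ‖S‖ ≤ C := by
  have hsm : ∀ z, Summable (b z) := fun z => summable_of_sum_le (hb z) (h2 z)
  have hs : ∀ z, Summable (fun j => T j z) := by
    intro z
    rw [summable_iff_vanishing_norm]
    intro ε hε
    obtain ⟨s, hs⟩ := summable_iff_vanishing_norm.1 (hsm z) (ε ^ 2) (by positivity)
    refine ⟨s, fun t ht => ?_⟩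
    have := hs t ht
    rw [Real.norm_eq_abs] at this
    have h3 := (h1 z t).trans (le_abs_self _)
    exact lt_of_pow_lt_pow_left₀ 2 hε.le (h3.trans_lt this)
  have hle : ∀ z, ‖∑' j, T j z‖ ≤ C * ‖z‖ := by
    intro z
    refine le_of_tendsto ((hs z).hasSum.norm) (Eventually.of_forall fun s => ?_)
    have := (h1 z s).trans (h2 z s)
    rw [← mul_pow] at this
    exact le_of_sq_le_sq this (by positivity)
  refine ⟨LinearMap.mkContinuous
    { toFun := fun z => ∑' j, T j z
      map_add' := fun x y => by
        simp only [map_add]; exact (hs x).tsum_add (hs y)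
      map_smul' := fun c x => by
        simp only [map_smul, RingHom.id_apply]; exact (hs x).tsum_const_smul c } C hle, ?_, ?_⟩
  · intro z; exact (hs z).hasSum
  · exact LinearMap.mkContinuous_norm_le _ hC _

lemma exists_syn {ι : Type*} {x y : ι → H} {C D : ℝ} (hC : 0 ≤ C) (hD : 0 ≤ D) (hx : Bess x C)
    (hy : Bess y D) :
    ∃ S : H →L[ℂ] H, (∀ z, HasSum (fun j => rk (x j) (y j) z) (S z)) ∧ ‖S‖ ≤ C * D := by
  refine exists_strong_sum (fun j => rk (x j) (y j)) (C * D) (fun z j => C ^ 2 * ‖⟪y j, z⟫_ℂ‖ ^ 2)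
    (by positivity) ?_ (fun z j => by positivity) ?_
  · intro z s
    simp only [rk_apply]
    rw [← Finset.mul_sum]
    exact hx.synth s _
  · intro z s
    rw [← Finset.mul_sum, mul_pow, mul_assoc]
    exact mul_le_mul_of_nonneg_left (hy z s) (by positivity)

/-- `S` is the strong sum of `x j ⊗ y j`. -/
def IsSyn {ι : Type*} (x y : ι → H) (S : H →L[ℂ] H) : Prop :=
  ∀ z, HasSum (fun j => rk (x j) (y j) z) (S z)

namespace IsSyn
variable {ι : Type*} {x y : ι → H} {S : H →L[ℂ] H}

lemma unique {S' : H →L[ℂ] H} (h : IsSyn x y S) (h' : IsSyn x y S') : S = S' := by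
  ext z; exact (h z).unique (h' z)

lemma tri (h : IsSyn x y S) (h' : ∀ j, Tri M N (rk (x j) (y j))) : Tri M N S :=
  Tri.hasSum h' h

end IsSyn

/-- restriction of orthonormal families to Bessel -/
lemma Orthonormal.bess {ι : Type*} {x : ι → H} (h : Orthonormal ℂ x) : Bess x 1 := by
  intro z s
  simpa using h.sum_inner_products_le z

end

section

namespace ContinuousNest
variable (M N : ContinuousNest H)

lemma exists_unit {a b : ℝ} (ha : 0 ≤ a) (hab : a < b) (hb : b ≤ 1) :
    ∃ v : H, N.N b v = v ∧ N.N a v = 0 ∧ v ≠ 0 := by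
  have hA : a ∈ Icc (0:ℝ) 1 := ⟨ha, by linarith⟩
  have hB : b ∈ Icc (0:ℝ) 1 := ⟨by linarith, hb⟩
  obtain ⟨x, ⟨y, hy⟩, hx⟩ := SetLike.exists_of_lt (N.range_lt a b hA hB hab)
  have hy : N.N b y = x := hy
  refine ⟨x - N.N a x, ?_, ?_, ?_⟩
  · rw [map_sub, N.NN_ge hA hB hab.le, ← hy, N.NN hB]
  · rw [map_sub, N.NN hA, sub_self]
  · intro h
    exact hx ⟨x, (sub_eq_zero.1 h).symm⟩

lemma exists_unit_perp {a b : ℝ} (ha : 0 ≤ a) (hab : a < b) (hb : b ≤ 1) (S : Finset H) :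
    ∃ v : H, N.N b v = v ∧ N.N a v = 0 ∧ ‖v‖ = 1 ∧ ∀ w ∈ S, ⟪w, v⟫_ℂ = 0 := by
  classical
  set d := S.card
  have hA : a ∈ Icc (0:ℝ) 1 := ⟨ha, by linarith⟩
  have hB : b ∈ Icc (0:ℝ) 1 := ⟨by linarith, hb⟩
  let τ : ℕ → ℝ := fun i => a + (b - a) * (i / (d + 1))
  have hd : (0:ℝ) < d + 1 := by positivity
  have hτm : ∀ i j : ℕ, i < j → τ i < τ j := by
    intro i j hij
    have : (i:ℝ) / (d + 1) < j / (d + 1) := by gcongr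
    simp only [τ]
    nlinarith
  have hτ0 : ∀ i, a ≤ τ i := fun i => by
    have : (0:ℝ) ≤ (b - a) * (i / (d + 1)) := mul_nonneg (by linarith) (by positivity)
    simp only [τ]; linarith
  have hτ1 : ∀ i, i ≤ d + 1 → τ i ≤ b := fun i hi => by
    have h1 : (i:ℝ) / (d + 1) ≤ 1 := by
      rw [div_le_one hd]; exact_mod_cast hi
    simp only [τ]
    nlinarith
  have hτI : ∀ i, i ≤ d + 1 → τ i ∈ Icc (0:ℝ) 1 := fun i hi =>
    ⟨ha.trans (hτ0 i), (hτ1 i hi).trans hb⟩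
  have hex : ∀ i : Fin (d + 1), ∃ v : H, N.N (τ (i + 1)) v = v ∧ N.N (τ i) v = 0 ∧ v ≠ 0 := fun i =>
    N.exists_unit (hτI i (by omega)).1 (hτm _ _ (by omega)) (hτI (i + 1) (by omega)).2
  choose v hv1 hv2 hv3 using hex
  have horth : ∀ i j : Fin (d + 1), i < j → ⟪v i, v j⟫_ℂ = 0 := by
    intro i j hij
    have hij' : (i:ℕ) + 1 ≤ j := hij
    have h1 : τ (i + 1) ≤ τ j := by
      rcases hij'.eq_or_lt with h | h
      · rw [h]
      · exact (hτm _ _ h).le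
    have h2 : N.N (τ j) (v i) = v i :=
      N.mem_mono (hτI _ (by omega)) (hτI _ (by omega)) h1 (hv1 i)
    rw [← h2, N.inner_left (hτI _ (by omega)), hv2, inner_zero_right]
  have hli : LinearIndependent ℂ v := by
    refine linearIndependent_of_ne_zero_of_inner_eq_zero hv3 ?_
    intro i j hij
    rcases lt_or_gt_of_ne hij with h | h
    · exact horth i j h
    · rw [← inner_conj_symm, horth j i h, map_zero]
  let Φ : (Fin (d + 1) → ℂ) →ₗ[ℂ] (S → ℂ) :=
    LinearMap.pi fun w => ((innerSL ℂ (w : H)).toLinearMap).comp (Fintype.linearCombination ℂ v)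
  have hker : LinearMap.ker Φ ≠ ⊥ := by
    apply LinearMap.ker_ne_bot_of_finrank_lt
    simp [d]
  obtain ⟨c, hc, hc0⟩ := Submodule.exists_mem_ne_zero_of_ne_bot hker
  set x := Fintype.linearCombination ℂ v c with hx
  have hx0 : x ≠ 0 := by
    intro h
    apply hc0
    have := (Fintype.linearIndependent_iff.1 hli) c (by
      rw [← h, hx, Fintype.linearCombination_apply])
    ext i; exact this i
  have hxe : x = ∑ i, c i • v i := by rw [hx, Fintype.linearCombination_apply]
  have hxb : N.N b x = x := by
    rw [hxe, map_sum]
    refine Finset.sum_congr rfl fun i _ => ?_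
    rw [map_smul, N.mem_mono (hτI _ (by omega)) hB (hτ1 _ (by omega)) (hv1 i)]
  have hxa : N.N a x = 0 := by
    rw [hxe, map_sum]
    refine Finset.sum_eq_zero fun i _ => ?_
    rw [map_smul, N.perp_mono hA (hτI _ (by omega)) (hτ0 _) (hv2 i), smul_zero]
  have hn : ‖x‖ ≠ 0 := norm_ne_zero_iff.2 hx0
  refine ⟨((‖x‖⁻¹ : ℝ) : ℂ) • x, ?_, ?_, ?_, ?_⟩
  · rw [map_smul, hxb]
  · rw [map_smul, hxa, smul_zero]
  · rw [norm_smul]; simp [hn]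
  · intro w hw
    have : Φ c ⟨w, hw⟩ = 0 := by
      rw [LinearMap.mem_ker.1 hc]; rfl
    have h2 : ⟪w, x⟫_ℂ = 0 := this
    rw [inner_smul_right, h2, mul_zero]

/-- Orthonormal vectors in prescribed intervals. -/
lemma exists_orthonormal {ι : Type*} [Countable ι] (p q : ι → ℝ)
    (hpq : ∀ i, 0 ≤ p i ∧ p i < q i ∧ q i ≤ 1) :
    ∃ h : ι → H, Orthonormal ℂ h ∧ ∀ i, N.N (q i) (h i) = h i ∧ N.N (p i) (h i) = 0 := by
  classical
  obtain ⟨φ, hφ⟩ := exists_injective_nat ι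
  -- sequence version
  have hseq : ∀ p q : ℕ → ℝ, (∀ i, 0 ≤ p i ∧ p i < q i ∧ q i ≤ 1) →
      ∃ h : ℕ → H, Orthonormal ℂ h ∧ ∀ i, N.N (q i) (h i) = h i ∧ N.N (p i) (h i) = 0 := by
    intro p q hpq
    have hex : ∀ (i : ℕ) (S : Finset H), ∃ v : H, N.N (q i) v = v ∧ N.N (p i) v = 0 ∧ ‖v‖ = 1 ∧
        ∀ w ∈ S, ⟪w, v⟫_ℂ = 0 := fun i S =>
      N.exists_unit_perp (hpq i).1 (hpq i).2.1 (hpq i).2.2 S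
    choose f hf1 hf2 hf3 hf4 using hex
    let S : ℕ → Finset H := fun n => Nat.rec (motive := fun _ => Finset H) ∅
      (fun k s => insert (f k s) s) n
    have hS : ∀ n, S (n + 1) = insert (f n (S n)) (S n) := fun n => rfl
    have hmono : Monotone S := monotone_nat_of_le_succ fun n => by
      rw [hS]; exact Finset.subset_insert _ _
    have hmem : ∀ i j, i < j → f i (S i) ∈ S j := fun i j hij => by
      apply hmono (show i + 1 ≤ j from hij)
      rw [hS]; exact Finset.mem_insert_self _ _
    refine ⟨fun i => f i (S i), ⟨fun i => hf3 i _, ?_⟩, fun i => ⟨hf1 i _, hf2 i _⟩⟩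
    intro i j hij
    rcases lt_or_gt_of_ne hij with h | h
    · exact hf4 _ _ _ (hmem i j h)
    · have := hf4 i (S i) _ (hmem j i h)
      change ⟪f i (S i), f j (S j)⟫_ℂ = 0
      rw [← inner_conj_symm, this, map_zero]
  by_cases hne : Nonempty ι
  · obtain ⟨h, h1, h2⟩ := hseq (fun n => p (Function.invFun φ n)) (fun n => q (Function.invFun φ n))
      (fun n => hpq _)
    refine ⟨h ∘ φ, h1.comp _ hφ, fun i => ?_⟩
    have := h2 (φ i)
    rwa [Function.leftInverse_invFun hφ i] at this
  · rw [not_nonempty_iff] at hne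
    exact ⟨fun i => hne.elim i, ⟨fun i => hne.elim i, fun i => hne.elim i⟩, fun i => hne.elim i⟩

end ContinuousNest
end

section

namespace ContinuousNest
variable (M : ContinuousNest H)

lemma inner_N_self {t : ℝ} (ht : t ∈ Icc (0:ℝ) 1) (g : H) :
    ⟪M.N t g, g⟫_ℂ = ((‖M.N t g‖ ^ 2 : ℝ) : ℂ) := by
  rw [M.inner_left ht, ← M.NN ht, ← M.inner_left ht, M.NN ht, inner_self_eq_norm_sq_to_K]
  norm_cast

lemma inner_N_N {s t : ℝ} (hs : s ∈ Icc (0:ℝ) 1) (ht : t ∈ Icc (0:ℝ) 1) (h : s ≤ t) (g : H) :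
    ⟪M.N t g, M.N s g⟫_ℂ = ((‖M.N s g‖ ^ 2 : ℝ) : ℂ) := by
  rw [← M.inner_left hs, M.NN_le hs ht h, M.inner_N_self hs]

lemma norm_diff_sq {s t : ℝ} (hs : s ∈ Icc (0:ℝ) 1) (ht : t ∈ Icc (0:ℝ) 1) (h : s ≤ t) (g : H) :
    ‖M.N t g - M.N s g‖ ^ 2 = ‖M.N t g‖ ^ 2 - ‖M.N s g‖ ^ 2 := by
  have := norm_sub_sq (𝕜 := ℂ) (M.N t g) (M.N s g)
  rw [this, M.inner_N_N hs ht h]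
  have h2 : RCLike.re (((‖M.N s g‖ ^ 2 : ℝ) : ℂ)) = ‖M.N s g‖ ^ 2 := Complex.ofReal_re _
  rw [h2]; ring

lemma norm_diff_sq' {s t : ℝ} (hs : s ∈ Icc (0:ℝ) 1) (ht : t ∈ Icc (0:ℝ) 1) (g : H) :
    ‖M.N t g - M.N s g‖ ^ 2 = |‖M.N t g‖ ^ 2 - ‖M.N s g‖ ^ 2| := by
  rcases le_total s t with h | h
  · rw [← M.norm_diff_sq hs ht h, abs_of_nonneg (by positivity)]
  · rw [norm_sub_rev, abs_sub_comm, ← M.norm_diff_sq ht hs h, abs_of_nonneg (by positivity)]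

/-- approximate identity on one cyclic subspace -/
lemma exists_AI_cyclic (g : H) (hg : g ≠ 0) (r : ℕ) :
    ∃ (e e' : Fin r → H) (p q : Fin r → ℝ), (∀ i, 0 ≤ p i ∧ p i < q i ∧ q i ≤ 1) ∧
      Orthonormal ℂ e ∧ Orthonormal ℂ e' ∧ (∀ i, M.N (q i) (e i) = 0) ∧
      (∀ i, M.N (p i) (e' i) = e' i) ∧
      (∀ i, e i ∈ Submodule.span ℂ ((fun t => M.N t g) '' Icc (0:ℝ) 1)) ∧
      (∀ i, e' i ∈ Submodule.span ℂ ((fun t => M.N t g) '' Icc (0:ℝ) 1)) ∧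
      ∀ s ∈ Icc (0:ℝ) 1, ‖M.N s g - ∑ i, ⟪e i, M.N s g⟫_ℂ • e' i‖ ≤ 4 * (‖g‖ / √(r + 2)) := by
  set R : ℝ := r + 2 with hR
  have hR0 : 0 < R := by positivity
  have hgn : 0 < ‖g‖ := norm_pos_iff.2 hg
  set c : ℝ := ‖g‖ / √R with hc
  have hc0 : 0 < c := by positivity
  have hc2 : c ^ 2 = ‖g‖ ^ 2 / R := by rw [hc, div_pow, Real.sq_sqrt hR0.le]
  have hcont : ContinuousOn (fun t => ‖M.N t g‖ ^ 2) (Icc (0:ℝ) 1) := (M.contOn g).norm.pow 2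
  have hivt := intermediate_value_Icc (zero_le_one' ℝ) hcont
  have hex : ∀ i : ℕ, ∃ t ∈ Icc (0:ℝ) 1, i ≤ r + 2 → ‖M.N t g‖ ^ 2 = i * c ^ 2 := by
    intro i
    by_cases hi : i ≤ r + 2
    · have h1 : (i:ℝ) ≤ R := by rw [hR]; exact_mod_cast hi
      have : (i:ℝ) * c ^ 2 ∈ Icc (‖M.N 0 g‖ ^ 2) (‖M.N 1 g‖ ^ 2) := by
        rw [M.N_zero, M.N_one]
        simp only [zero_apply, norm_zero, one_apply_eq_self]
        refine ⟨by rw [zero_pow two_ne_zero]; positivity, ?_⟩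
        have : R * c ^ 2 = ‖g‖ ^ 2 := by rw [hc2]; field_simp
        rw [← this]; gcongr
      obtain ⟨t, ht, h2⟩ := hivt this
      exact ⟨t, ht, fun _ => h2⟩
    · exact ⟨0, by simp, fun h => absurd h hi⟩
  choose t htI ht using hex
  have hphimono : ∀ a ∈ Icc (0:ℝ) 1, ∀ b ∈ Icc (0:ℝ) 1, a ≤ b → ‖M.N a g‖ ^ 2 ≤ ‖M.N b g‖ ^ 2 := by
    intro a ha b hb hab
    have := M.norm_diff_sq ha hb hab g
    nlinarith [sq_nonneg ‖M.N b g - M.N a g‖]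
  have htlt : ∀ i j, i < j → j ≤ r + 2 → t i < t j := by
    intro i j hij hj
    by_contra hcon
    push Not at hcon
    have := hphimono _ (htI j) _ (htI i) hcon
    rw [ht i (by omega), ht j hj] at this
    have h2 : (i:ℝ) < j := by exact_mod_cast hij
    have : (0:ℝ) < c ^ 2 := by positivity
    nlinarith
  have htle : ∀ i j, i ≤ j → j ≤ r + 2 → t i ≤ t j := by
    intro i j hij hj
    rcases hij.eq_or_lt with h | h
    · rw [h]
    · exact (htlt i j h hj).le
  let w : ℕ → H := fun i => M.N (t (i + 1)) g - M.N (t i) g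
  have hwn : ∀ i, i < r + 2 → ‖w i‖ ^ 2 = c ^ 2 := by
    intro i hi
    simp only [w]
    rw [M.norm_diff_sq (htI _) (htI _) (htle _ _ (by omega) (by omega)), ht _ (by omega),
      ht _ (by omega)]
    push_cast; ring
  have hwn' : ∀ i, i < r + 2 → ‖w i‖ = c := fun i hi => by
    have := hwn i hi
    exact (sq_eq_sq₀ (norm_nonneg _) hc0.le).1 this
  -- inner products with cyclic vectors
  have hin1 : ∀ i l, l ≤ i → i < r + 2 → M.N (t l) (w i) = 0 := by
    intro i l hl hi
    simp only [w, map_sub]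
    rw [M.NN_le (htI _) (htI _) (htle _ _ (by omega) (by omega)),
      M.NN_le (htI _) (htI _) (htle _ _ (by omega) (by omega)), sub_self]
  have hin2 : ∀ i l, i < l → l ≤ r + 2 → M.N (t l) (w i) = w i := by
    intro i l hl hi
    simp only [w, map_sub]
    rw [M.NN_ge (htI _) (htI _) (htle _ _ (by omega) (by omega)),
      M.NN_ge (htI _) (htI _) (htle _ _ (by omega) (by omega))]
  have hwg : ∀ i, i < r + 2 → ⟪w i, g⟫_ℂ = ((c ^ 2 : ℝ) : ℂ) := by
    intro i hi
    simp only [w, inner_sub_left]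
    rw [M.inner_N_self (htI _), M.inner_N_self (htI _), ht _ (by omega), ht _ (by omega)]
    push_cast; ring
  have horth : ∀ i j, i < j → j < r + 2 → ⟪w i, w j⟫_ℂ = 0 := by
    intro i j hij hj
    rw [← hin2 i j hij (by omega), M.inner_left (htI _), hin1 j j le_rfl hj, inner_zero_right]
  have horth' : ∀ i j, i ≠ j → i < r + 2 → j < r + 2 → ⟪w i, w j⟫_ℂ = 0 := by
    intro i j hij hi hj
    rcases lt_or_gt_of_ne hij with h | h
    · exact horth i j h hj
    · rw [← inner_conj_symm, horth j i h hi, map_zero]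
  let b : ℂ := ((c⁻¹ : ℝ) : ℂ)
  have hb : ‖b‖ * c = 1 := by simp [b, abs_of_pos hc0, hc0.ne']
  have hon : ∀ f : Fin r → ℕ, Function.Injective f → (∀ i, f i < r + 2) →
      Orthonormal ℂ (fun i => b • w (f i)) := by
    intro f hf hf2
    refine ⟨fun i => by rw [norm_smul, hwn' _ (hf2 i), hb], fun i j hij => ?_⟩
    change ⟪b • w (f i), b • w (f j)⟫_ℂ = 0
    rw [inner_smul_left, inner_smul_right, horth' _ _ (hf.ne hij) (hf2 i) (hf2 j)]; simp
  have hspan : ∀ i, b • w i ∈ Submodule.span ℂ ((fun t => M.N t g) '' Icc (0:ℝ) 1) := by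
    intro i
    exact Submodule.smul_mem _ _ (Submodule.sub_mem _ (Submodule.subset_span ⟨_, htI _, rfl⟩)
      (Submodule.subset_span ⟨_, htI _, rfl⟩))
  have hon1 := hon (fun i => i + 2) (fun i j h => by ext; simpa using h) (fun i => by omega)
  have hon2 := hon (fun i => i) (fun i j h => by ext; simpa using h) (fun i => by omega)
  refine ⟨fun i => b • w (i + 2), fun i => b • w i, fun i => t (i + 1), fun i => t (i + 2), ?_,
    hon1, hon2, ?_, ?_, fun i => hspan _, fun i => hspan _, ?_⟩
  · intro i
    exact ⟨(htI _).1, htlt _ _ (by omega) (by omega), (htI _).2⟩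
  · intro i
    rw [map_smul, hin1 _ _ le_rfl (by omega), smul_zero]
  · intro i
    change M.N (t (i + 1)) (b • w i) = b • w i
    rw [map_smul, hin2 _ _ (by omega) (by omega)]
  -- the estimate
  obtain ⟨S, hS, hSn⟩ := exists_syn zero_le_one zero_le_one hon2.bess hon1.bess
  have hSe : ∀ z, ∑ i : Fin r, ⟪b • w (i + 2), z⟫_ℂ • (b • w i) = S z := by
    intro z
    have h1 := hasSum_fintype (fun i : Fin r => rk (b • w i) (b • w (i + 2)) z)
    simpa using h1.unique (hS z)
  have h00 : M.N (t 0) g = 0 := by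
    have := ht 0 (by omega)
    simpa using this
  have htel : ∀ l, M.N (t l) g = ∑ i ∈ Finset.range l, w i := by
    intro l
    rw [Finset.sum_range_sub (fun i => M.N (t i) g), h00, sub_zero]
  have hSl : ∀ l, l ≤ r + 2 → S (M.N (t l) g) = M.N (t (l - 2)) g := by
    intro l hl
    rw [← hSe, Fin.sum_univ_eq_sum_range (fun i => ⟪b • w (i + 2), M.N (t l) g⟫_ℂ • (b • w i)) r,
      htel (l - 2)]
    have hsub : Finset.range (l - 2) ⊆ Finset.range r := by
      intro i; simp only [Finset.mem_range]; omega
    rw [← Finset.sum_subset hsub]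
    · refine Finset.sum_congr rfl fun i hi => ?_
      simp only [Finset.mem_range] at hi
      rw [inner_smul_left, ← M.inner_left (htI _), hin2 _ _ (by omega) (by omega),
        hwg _ (by omega), smul_smul]
      have : (starRingEnd ℂ) b * ((c ^ 2 : ℝ) : ℂ) * b = 1 := by
        simp only [b, Complex.conj_ofReal]
        norm_cast
        field_simp
      rw [this, one_smul]
    · intro i hi hi2
      simp only [Finset.mem_range] at hi hi2
      rw [inner_smul_left, ← M.inner_left (htI _), hin1 _ _ (by omega) (by omega)]
      simp
  intro s hs
  rw [hSe]
  have hφs : ‖M.N s g‖ ^ 2 ≤ R * c ^ 2 := by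
    have : R * c ^ 2 = ‖g‖ ^ 2 := by rw [hc2]; field_simp
    rw [this]; gcongr; exact M.norm_le hs g
  set l := ⌊‖M.N s g‖ ^ 2 / c ^ 2⌋₊ with hl
  have hc2' : 0 < c ^ 2 := by positivity
  have hl1 : (l:ℝ) ≤ ‖M.N s g‖ ^ 2 / c ^ 2 := Nat.floor_le (by positivity)
  have hl2 : ‖M.N s g‖ ^ 2 / c ^ 2 < l + 1 := Nat.lt_floor_add_one _
  rw [le_div_iff₀ hc2'] at hl1
  rw [div_lt_iff₀ hc2'] at hl2
  have hlr : l ≤ r + 2 := by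
    have : (l:ℝ) * c ^ 2 ≤ R * c ^ 2 := hl1.trans hφs
    have := le_of_mul_le_mul_right this hc2'
    rw [hR] at this
    exact_mod_cast this
  have hd1 : ‖M.N s g - M.N (t l) g‖ ≤ c := by
    refine le_of_sq_le_sq ?_ hc0.le
    rw [M.norm_diff_sq' (htI l) hs, ht l hlr, abs_le]
    constructor <;> nlinarith
  have hd2 : ‖M.N (t l) g - M.N (t (l - 2)) g‖ ≤ 2 * c := by
    refine le_of_sq_le_sq ?_ (by positivity)
    rw [M.norm_diff_sq (htI _) (htI _) (htle _ _ (by omega) hlr), ht l hlr, ht _ (by omega)]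
    have : (l:ℝ) ≤ ((l - 2 : ℕ) : ℝ) + 2 := by
      have : l ≤ l - 2 + 2 := by omega
      exact_mod_cast this
    nlinarith
  have hd3 : ‖S (M.N (t l) g) - S (M.N s g)‖ ≤ c := by
    rw [← map_sub]
    refine (S.le_opNorm _).trans ?_
    rw [norm_sub_rev] at hd1
    have : ‖S‖ ≤ 1 := by simpa using hSn
    calc _ ≤ 1 * c := by gcongr
      _ = c := one_mul c
  have : M.N s g - S (M.N s g) = (M.N s g - M.N (t l) g) + (M.N (t l) g - M.N (t (l - 2)) g) +
      (S (M.N (t l) g) - S (M.N s g)) := by rw [hSl l hlr]; abel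
  rw [this]
  refine (norm_add₃_le).trans ?_
  linarith

end ContinuousNest

/-- adjoints of contractions -/
lemma adjoint_close {T : H →L[ℂ] H} (hT : ‖T‖ ≤ 1) (f : H) :
    ‖f - adjoint T f‖ ^ 2 ≤ 2 * ‖f‖ * ‖f - T f‖ := by
  rw [norm_sub_sq (𝕜 := ℂ), adjoint_inner_right]
  have h1 : ‖adjoint T f‖ ≤ ‖f‖ := by
    refine ((adjoint T).le_opNorm f).trans ?_
    rw [LinearIsometryEquiv.norm_map]
    nlinarith [norm_nonneg f]
  have h2 : ‖adjoint T f‖ ^ 2 ≤ ‖f‖ ^ 2 := by gcongr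
  have h3 : RCLike.re ⟪f - T f, f⟫_ℂ ≤ ‖f - T f‖ * ‖f‖ := re_inner_le_norm _ _
  rw [inner_sub_left, map_sub, inner_self_eq_norm_sq] at h3
  linarith

end

section

namespace ContinuousNest
variable (M : ContinuousNest H)

/-- the cyclic set of a family of vectors -/
def cyc {d : ℕ} (g : Fin d → H) : Set H := {x | ∃ i, ∃ t ∈ Icc (0:ℝ) 1, x = M.N t (g i)}

lemma cyc_decomp (F : Finset H) : ∃ (d : ℕ) (g : Fin d → H), (∀ i, g i ≠ 0) ∧
    (∀ i j, i ≠ j → ∀ s ∈ Icc (0:ℝ) 1, ∀ t ∈ Icc (0:ℝ) 1, ⟪M.N s (g i), M.N t (g j)⟫_ℂ = 0) ∧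
    ∀ f ∈ F, f ∈ (Submodule.span ℂ (M.cyc g)).topologicalClosure := by
  classical
  induction F using Finset.induction_on with
  | empty => exact ⟨0, fun i => 0, fun i => i.elim0, fun i => i.elim0, by simp⟩
  | insert f F hf ih =>
    obtain ⟨d, g, h1, h2, h3⟩ := ih
    set V := (Submodule.span ℂ (M.cyc g)).topologicalClosure with hV
    haveI : CompleteSpace V := (Submodule.isClosed_topologicalClosure _).completeSpace_coe
    by_cases hfV : f ∈ V
    · refine ⟨d, g, h1, h2, ?_⟩
      intro x hx
      rcases Finset.mem_insert.1 hx with rfl | hx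
      · exact hfV
      · exact h3 x hx
    set y := f - V.starProjection f with hy
    have hyV : ∀ v ∈ V, ⟪y, v⟫_ℂ = 0 := fun v hv => V.starProjection_inner_eq_zero f v hv
    have hy0 : y ≠ 0 := by
      intro h
      apply hfV
      rw [sub_eq_zero.1 h]
      exact V.starProjection_apply_mem f
    have hyg : ∀ j, ∀ s ∈ Icc (0:ℝ) 1, ∀ t ∈ Icc (0:ℝ) 1, ⟪M.N s y, M.N t (g j)⟫_ℂ = 0 := by
      intro j s hs t ht
      rw [M.inner_left hs]
      apply hyV
      apply Submodule.le_topologicalClosure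
      apply Submodule.subset_span
      rcases le_total s t with h | h
      · exact ⟨j, s, hs, M.NN_le hs ht h _⟩
      · exact ⟨j, t, ht, M.NN_ge ht hs h _⟩
    have hle : V ≤ (Submodule.span ℂ (M.cyc (Fin.cons y g : Fin (d + 1) → H))).topologicalClosure := by
      apply Submodule.topologicalClosure_mono
      apply Submodule.span_mono
      rintro x ⟨i, t, ht, rfl⟩
      exact ⟨i.succ, t, ht, by simp⟩
    refine ⟨d + 1, Fin.cons y g, ?_, ?_, ?_⟩
    · intro i
      refine Fin.cases ?_ ?_ i
      · simpa using hy0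
      · intro i; simpa using h1 i
    · intro i j
      refine Fin.cases ?_ (fun i => ?_) i
      · refine Fin.cases ?_ (fun j => ?_) j
        · intro h; exact absurd rfl h
        · intro _ s hs t ht
          simpa using hyg j s hs t ht
      · refine Fin.cases ?_ (fun j => ?_) j
        · intro _ s hs t ht
          rw [inner_eq_zero_symm]
          simpa using hyg i t ht s hs
        · intro hij s hs t ht
          simpa using h2 i j (fun h => hij (by rw [h])) s hs t ht
    · intro x hx
      rcases Finset.mem_insert.1 hx with rfl | hx
      · have : x = y + V.starProjection x := by rw [hy]; abel
        rw [this]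
        refine Submodule.add_mem _ ?_ (hle (V.starProjection_apply_mem x))
        apply Submodule.le_topologicalClosure
        apply Submodule.subset_span
        exact ⟨0, 1, by simp, by simp [M.N_one]⟩
      · exact hle (h3 x hx)

/-- Approximate identity made of finite rank contractions in the nest algebra. -/
lemma exists_AI (F : Finset H) {ε : ℝ} (hε : 0 < ε) :
    ∃ (k : ℕ) (e e' : Fin k → H) (p q : Fin k → ℝ), (∀ i, 0 ≤ p i ∧ p i < q i ∧ q i ≤ 1) ∧
      Orthonormal ℂ e ∧ Orthonormal ℂ e' ∧ (∀ i, M.N (q i) (e i) = 0) ∧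
      (∀ i, M.N (p i) (e' i) = e' i) ∧
      ∀ f ∈ F, ‖f - ∑ i, ⟪e i, f⟫_ℂ • e' i‖ ≤ ε := by
  obtain ⟨d, g, h1, h2, h3⟩ := M.cyc_decomp F
  have hex := fun (i : Fin d) (r : ℕ) => M.exists_AI_cyclic (g i) (h1 i) r
  choose e e' p q hpq he he' heq hep hes hes' hest using hex
  -- orthogonality between different cyclic subspaces
  have hspan : ∀ i j, i ≠ j → ∀ x ∈ Submodule.span ℂ ((fun t => M.N t (g i)) '' Icc (0:ℝ) 1),
      ∀ y ∈ Submodule.span ℂ ((fun t => M.N t (g j)) '' Icc (0:ℝ) 1), ⟪x, y⟫_ℂ = 0 := by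
    intro i j hij x hx y hy
    have : Submodule.span ℂ ((fun t => M.N t (g i)) '' Icc (0:ℝ) 1) ⟂
      Submodule.span ℂ ((fun t => M.N t (g j)) '' Icc (0:ℝ) 1) := by
      rw [Submodule.isOrtho_span]
      rintro _ ⟨s, hs, rfl⟩ _ ⟨t, ht, rfl⟩
      exact h2 i j hij s hs t ht
    exact Submodule.isOrtho_iff_inner_eq.1 this x hx y hy
  have hON : ∀ (r : ℕ) (e : ∀ i : Fin d, ∀ r, Fin r → H), (∀ i, Orthonormal ℂ (e i r)) →
      (∀ i k, e i r k ∈ Submodule.span ℂ ((fun t => M.N t (g i)) '' Icc (0:ℝ) 1)) →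
      Orthonormal ℂ (fun x : Fin d × Fin r => e x.1 r x.2) := by
    intro r e ho hs
    refine ⟨fun x => (ho x.1).1 x.2, ?_⟩
    rintro ⟨i, k⟩ ⟨j, l⟩ hne
    change ⟪e i r k, e j r l⟫_ℂ = 0
    by_cases hij : i = j
    · subst hij
      exact (ho i).2 (fun h => hne (by rw [h]))
    · exact hspan i j hij _ (hs i k) _ (hs j l)
  have ho1 : ∀ r, Orthonormal ℂ (fun x : Fin d × Fin r => e x.1 r x.2) := fun r =>
    hON r e (fun i => he i r) (fun i k => hes i r k)
  have ho2 : ∀ r, Orthonormal ℂ (fun x : Fin d × Fin r => e' x.1 r x.2) := fun r =>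
    hON r e' (fun i => he' i r) (fun i k => hes' i r k)
  have hsyn := fun r => exists_syn zero_le_one zero_le_one (ho2 r).bess (ho1 r).bess
  choose S hS hSn using hsyn
  have hSn' : ∀ r, ‖S r‖ ≤ 1 := fun r => by simpa using hSn r
  have hSe : ∀ r z, S r z = ∑ x : Fin d × Fin r, ⟪e x.1 r x.2, z⟫_ℂ • e' x.1 r x.2 := by
    intro r z
    have h1 := hasSum_fintype (fun x : Fin d × Fin r => rk (e' x.1 r x.2) (e x.1 r x.2) z)
    simpa using (hS r z).unique h1
  have hScyc : ∀ x ∈ M.cyc g, Tendsto (fun r => S r x) atTop (𝓝 x) := by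
    rintro x ⟨i, s, hs, rfl⟩
    have hval : ∀ r, S r (M.N s (g i)) = ∑ k : Fin r, ⟪e i r k, M.N s (g i)⟫_ℂ • e' i r k := by
      intro r
      rw [hSe, Fintype.sum_prod_type, Finset.sum_eq_single i]
      · intro j _ hj
        refine Finset.sum_eq_zero fun k _ => ?_
        rw [hspan j i hj _ (hes j r k) _ (Submodule.subset_span ⟨s, hs, rfl⟩), zero_smul]
      · simp
    rw [tendsto_iff_norm_sub_tendsto_zero]
    have hlim : Tendsto (fun r : ℕ => 4 * (‖g i‖ / √((r:ℝ) + 2))) atTop (𝓝 0) := by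
      have : Tendsto (fun r : ℕ => √((r:ℝ) + 2)) atTop atTop :=
        Real.tendsto_sqrt_atTop.comp (tendsto_atTop_add_const_right _ _ tendsto_natCast_atTop_atTop)
      simpa using (Tendsto.const_div_atTop this ‖g i‖).const_mul 4
    refine squeeze_zero (fun _ => norm_nonneg _) (fun r => ?_) hlim
    rw [hval, norm_sub_rev]
    exact hest i r s hs
  have hSspan : ∀ x ∈ Submodule.span ℂ (M.cyc g), Tendsto (fun r => S r x) atTop (𝓝 x) := by
    intro x hx
    induction hx using Submodule.span_induction with
    | mem x hx => exact hScyc x hx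
    | zero => simp
    | add x y _ _ hx hy => simpa using hx.add hy
    | smul c x _ hx => simpa using hx.const_smul c
  have hScl : ∀ x ∈ (Submodule.span ℂ (M.cyc g)).topologicalClosure,
      Tendsto (fun r => S r x) atTop (𝓝 x) := by
    intro x hx
    have hx' : x ∈ closure (Submodule.span ℂ (M.cyc g) : Set H) := hx
    rw [Metric.tendsto_atTop]
    intro η hη
    obtain ⟨y, hy, hxy⟩ := Metric.mem_closure_iff.1 hx' (η / 3) (by positivity)
    obtain ⟨n, hn⟩ := Metric.tendsto_atTop.1 (hSspan y hy) (η / 3) (by positivity)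
    refine ⟨n, fun r hr => ?_⟩
    have h1 : dist (S r x) (S r y) ≤ dist x y := by
      rw [dist_eq_norm, dist_eq_norm, ← map_sub]
      refine ((S r).le_opNorm _).trans ?_
      nlinarith [hSn' r, norm_nonneg (x - y)]
    have := hn r hr
    have h2 := dist_triangle4 (S r x) (S r y) y x
    rw [dist_comm y x] at h2
    linarith
  have hev : ∀ᶠ r in atTop, ∀ f ∈ F, ‖f - S r f‖ ≤ ε := by
    rw [Filter.eventually_all_finset]
    intro f hf
    have := (Metric.tendsto_atTop.1 (hScl f (h3 f hf)) ε hε)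
    obtain ⟨n, hn⟩ := this
    filter_upwards [eventually_ge_atTop n] with r hr
    have := hn r hr
    rw [dist_eq_norm, norm_sub_rev] at this
    exact this.le
  obtain ⟨r, hr⟩ := hev.exists
  let φ := (Fintype.equivFin (Fin d × Fin r)).symm
  refine ⟨_, fun i => e (φ i).1 r (φ i).2, fun i => e' (φ i).1 r (φ i).2, fun i => p (φ i).1 r (φ i).2,
    fun i => q (φ i).1 r (φ i).2, fun i => hpq _ _ _, (ho1 r).comp φ φ.injective,
    (ho2 r).comp φ φ.injective, fun i => heq _ _ _, fun i => hep _ _ _, ?_⟩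
  intro f hf
  have := hr f hf
  rw [hSe] at this
  rw [φ.sum_comp (fun x : Fin d × Fin r => ⟪e x.1 r x.2, f⟫_ℂ • e' x.1 r x.2)]
  exact this

end ContinuousNest
end

section

/-- Lacunary system of finite rank contractions in the nest algebra. -/
structure Lac (M : ContinuousNest H) {ι : Type} (X : ι → H →L[ℂ] H) (η : ℝ) where
  W : ℕ → Submodule ℂ H
  fd : ∀ n, FiniteDimensional ℂ (W n)
  W0 : W 0 = ⊥
  mono : Monotone W
  dense : ∀ x : H, ∀ ε > 0, ∃ n, ∃ w ∈ W n, ‖x - w‖ < ε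
  maps : ∀ i n, ∀ w ∈ W n, X i w ∈ W (n + 1)
  k : ℕ → ℕ
  e : ∀ n, Fin (k n) → H
  e' : ∀ n, Fin (k n) → H
  p : ∀ n, Fin (k n) → ℝ
  q : ∀ n, Fin (k n) → ℝ
  hpq : ∀ n i, 0 ≤ p n i ∧ p n i < q n i ∧ q n i ≤ 1
  he : ∀ n, Orthonormal ℂ (e n)
  he' : ∀ n, Orthonormal ℂ (e' n)
  heq : ∀ n i, M.N (q n i) (e n i) = 0
  hep : ∀ n i, M.N (p n i) (e' n i) = e' n i
  heW : ∀ n i, e n i ∈ W (n + 1)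
  heW' : ∀ n i, e' n i ∈ W (n + 1)
  T : ℕ → H →L[ℂ] H
  T0 : T 0 = 0
  hT : ∀ n, T (n + 1) = ∑ i, rk (e' n i) (e n i)
  Tn : ∀ n, ‖T n‖ ≤ 1
  cl : ∀ n, ∀ w ∈ W n, ‖w - T (n + 1) w‖ ≤ η * (1 / 4) ^ n * ‖w‖
  cl' : ∀ n, ∀ w ∈ W n, ‖w - adjoint (T (n + 1)) w‖ ≤ η * (1 / 4) ^ n * ‖w‖

lemma norm_sum_rk_le {ι : Type*} [Fintype ι] {e e' : ι → H} (he : Orthonormal ℂ e)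
    (he' : Orthonormal ℂ e') : ‖∑ i, rk (e' i) (e i)‖ ≤ 1 := by
  obtain ⟨S, hS, hSn⟩ := exists_syn zero_le_one zero_le_one he'.bess he.bess
  have : ∑ i, rk (e' i) (e i) = S := by
    ext z
    have h1 := hasSum_fintype (fun i => rk (e' i) (e i) z)
    rw [(hS z).unique h1, sum_apply]
  rw [this]; simpa using hSn

lemma lac_step (M : ContinuousNest H) (W : Submodule ℂ H) [FiniteDimensional ℂ W] {ε : ℝ}
    (hε : 0 < ε) :
    ∃ (k : ℕ) (e e' : Fin k → H) (p q : Fin k → ℝ), (∀ i, 0 ≤ p i ∧ p i < q i ∧ q i ≤ 1) ∧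
      Orthonormal ℂ e ∧ Orthonormal ℂ e' ∧ (∀ i, M.N (q i) (e i) = 0) ∧
      (∀ i, M.N (p i) (e' i) = e' i) ∧
      (∀ w ∈ W, ‖w - (∑ i, rk (e' i) (e i)) w‖ ≤ ε * ‖w‖) ∧
      (∀ w ∈ W, ‖w - adjoint (∑ i, rk (e' i) (e i)) w‖ ≤ ε * ‖w‖) := by
  classical
  let b := stdOrthonormalBasis ℂ W
  let d := Module.finrank ℂ W
  let F : Finset H := Finset.univ.image (fun i => (b i : H))
  set ε1 := min ε (ε ^ 2 / 2) with hε1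
  have hε1p : 0 < ε1 := lt_min hε (by positivity)
  obtain ⟨k, e, e', p, q, h1, h2, h3, h4, h5, h6⟩ := M.exists_AI F
    (show 0 < ε1 / (d + 1) by positivity)
  have hn := norm_sum_rk_le h2 h3
  set T := ∑ i, rk (e' i) (e i) with hT
  have hTb : ∀ i, ‖(b i : H) - T (b i)‖ ≤ ε1 / (d + 1) := by
    intro i
    have := h6 (b i) (Finset.mem_image_of_mem _ (Finset.mem_univ i))
    simpa [hT, sum_apply] using this
  have hcl : ∀ w ∈ W, ‖w - T w‖ ≤ ε1 * ‖w‖ := by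
    intro w hw
    have hrep : w = ∑ i, ⟪(b i : H), w⟫_ℂ • (b i : H) := by
      have := b.sum_repr' ⟨w, hw⟩
      have h2 := congrArg (Subtype.val) this
      simp only [Submodule.coe_inner, Submodule.coe_sum, Submodule.coe_smul] at h2
      exact h2.symm
    have : w - T w = ∑ i, ⟪(b i : H), w⟫_ℂ • ((b i : H) - T (b i)) := by
      conv_lhs => rw [hrep]
      rw [map_sum, ← Finset.sum_sub_distrib]
      refine Finset.sum_congr rfl fun i _ => ?_
      rw [map_smul, smul_sub]
    rw [this]
    refine (norm_sum_le _ _).trans ?_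
    have hb : ∀ i ∈ (Finset.univ : Finset (Fin d)),
        ‖⟪(b i : H), w⟫_ℂ • ((b i : H) - T (b i))‖ ≤ ‖w‖ * (ε1 / (d + 1)) := by
      intro i _
      rw [norm_smul]
      have h1 : ‖⟪(b i : H), w⟫_ℂ‖ ≤ ‖w‖ := by
        refine (norm_inner_le_norm _ _).trans ?_
        have : ‖(b i : H)‖ = 1 := b.orthonormal.1 i
        rw [this, one_mul]
      exact mul_le_mul h1 (hTb i) (norm_nonneg _) (norm_nonneg _)
    refine (Finset.sum_le_sum hb).trans ?_
    rw [Finset.sum_const, Finset.card_univ, Fintype.card_fin, nsmul_eq_mul]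
    have : (d:ℝ) * (‖w‖ * (ε1 / (d + 1))) = (ε1 * ‖w‖) * (d / (d + 1)) := by ring
    rw [this]
    have h2 : (d:ℝ) / (d + 1) ≤ 1 := by
      rw [div_le_one (by positivity)]; linarith
    exact mul_le_of_le_one_right (by positivity) h2
  refine ⟨k, e, e', p, q, h1, h2, h3, h4, h5, ?_, ?_⟩
  · intro w hw
    refine (hcl w hw).trans ?_
    gcongr; exact min_le_left _ _
  · intro w hw
    refine le_of_sq_le_sq ?_ (by positivity)
    refine (adjoint_close hn w).trans ?_
    have := hcl w hw
    have h2 : ε1 ≤ ε ^ 2 / 2 := min_le_right _ _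
    calc 2 * ‖w‖ * ‖w - T w‖ ≤ 2 * ‖w‖ * (ε ^ 2 / 2 * ‖w‖) := by
          gcongr
          exact this.trans (by gcongr)
      _ = (ε * ‖w‖) ^ 2 := by ring

theorem exists_lac [SeparableSpace H] (M : ContinuousNest H) {ι : Type} [Finite ι]
    (X : ι → H →L[ℂ] H) {η : ℝ} (hη : 0 < η) : Nonempty (Lac M X η) := by
  have hstep : ∀ (n : ℕ) (W : {W : Submodule ℂ H // FiniteDimensional ℂ W}), _ := fun n W =>
    haveI := W.2
    lac_step M W.1 (show 0 < η * (1 / 4) ^ n by positivity)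
  choose k e e' p q h1 h2 h3 h4 h5 h6 h7 using hstep
  haveI : Nonempty H := ⟨0⟩
  let dn : ℕ → H := TopologicalSpace.denseSeq H
  let step : ℕ → {W : Submodule ℂ H // FiniteDimensional ℂ W} →
      {W : Submodule ℂ H // FiniteDimensional ℂ W} := fun n W =>
    ⟨W.1 ⊔ Submodule.span ℂ {dn n} ⊔ Submodule.span ℂ (range (e n W)) ⊔
      Submodule.span ℂ (range (e' n W)) ⊔ ⨆ i, W.1.map (X i).toLinearMap, by
      haveI := W.2
      haveI := FiniteDimensional.span_of_finite ℂ (finite_range (e n W))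
      haveI := FiniteDimensional.span_of_finite ℂ (finite_range (e' n W))
      infer_instance⟩
  let WW : ℕ → {W : Submodule ℂ H // FiniteDimensional ℂ W} := fun n =>
    Nat.rec (motive := fun _ => {W : Submodule ℂ H // FiniteDimensional ℂ W})
      ⟨⊥, inferInstance⟩ step n
  have hWW : ∀ n, WW (n + 1) = step n (WW n) := fun n => rfl
  have hW : ∀ n, (WW (n + 1)).1 = (WW n).1 ⊔ Submodule.span ℂ {dn n} ⊔
      Submodule.span ℂ (range (e n (WW n))) ⊔
      Submodule.span ℂ (range (e' n (WW n))) ⊔ ⨆ i, (WW n).1.map (X i).toLinearMap := fun n => rfl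
  let T : ℕ → H →L[ℂ] H := fun n => Nat.casesOn n 0
    (fun n => ∑ i, rk (e' n (WW n) i) (e n (WW n) i))
  have hle1 : ∀ n, (WW n).1 ≤ (WW (n + 1)).1 := fun n => by
    rw [hW]; exact le_sup_of_le_left (le_sup_of_le_left (le_sup_of_le_left le_sup_left))
  have hle2 : ∀ n, Submodule.span ℂ {dn n} ≤ (WW (n + 1)).1 := fun n => by
    rw [hW]; exact le_sup_of_le_left (le_sup_of_le_left (le_sup_of_le_left le_sup_right))
  have hle3 : ∀ n, Submodule.span ℂ (range (e n (WW n))) ≤ (WW (n + 1)).1 := fun n => by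
    rw [hW]; exact le_sup_of_le_left (le_sup_of_le_left le_sup_right)
  have hle4 : ∀ n, Submodule.span ℂ (range (e' n (WW n))) ≤ (WW (n + 1)).1 := fun n => by
    rw [hW]; exact le_sup_of_le_left le_sup_right
  have hle5 : ∀ n i, (WW n).1.map (X i).toLinearMap ≤ (WW (n + 1)).1 := fun n i => by
    rw [hW]; exact le_sup_of_le_right (le_iSup (fun i => (WW n).1.map (X i).toLinearMap) i)
  exact ⟨{
    W := fun n => (WW n).1
    fd := fun n => (WW n).2
    W0 := rfl
    mono := monotone_nat_of_le_succ hle1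
    dense := by
      intro x ε hε
      obtain ⟨y, ⟨n, rfl⟩, hy⟩ := Metric.mem_closure_iff.1
        (TopologicalSpace.denseRange_denseSeq H x) ε hε
      exact ⟨n + 1, dn n, hle2 n (Submodule.mem_span_singleton_self _), by
        rwa [dist_eq_norm] at hy⟩
    maps := fun i n w hw => hle5 n i ⟨w, hw, rfl⟩
    k := fun n => k n (WW n)
    e := fun n => e n (WW n)
    e' := fun n => e' n (WW n)
    p := fun n => p n (WW n)
    q := fun n => q n (WW n)
    hpq := fun n i => h1 _ _ _
    he := fun n => h2 _ _
    he' := fun n => h3 _ _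
    heq := fun n i => h4 _ _ _
    hep := fun n i => h5 _ _ _
    heW := fun n i => hle3 n (Submodule.subset_span ⟨i, rfl⟩)
    heW' := fun n i => hle4 n (Submodule.subset_span ⟨i, rfl⟩)
    T := T
    T0 := rfl
    hT := fun n => rfl
    Tn := by
      intro n
      cases n with
      | zero => simp [T]
      | succ n => exact norm_sum_rk_le (h2 _ _) (h3 _ _)
    cl := fun n w hw => h6 n (WW n) w hw
    cl' := fun n w hw => h7 n (WW n) w hw }⟩

end

section

lemma adjoint_rk (x y : H) : adjoint (rk x y) = rk y x := by
  refine ContinuousLinearMap.ext fun z => ext_inner_right ℂ fun w => ?_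
  rw [adjoint_inner_left, rk_apply, rk_apply, inner_smul_left, inner_smul_right,
    inner_conj_symm]
  ring

lemma adjoint_mul' (A B : H →L[ℂ] H) : adjoint (A * B) = adjoint B * adjoint A :=
  ContinuousLinearMap.adjoint_comp A B

lemma sum_shift_le {f : ℕ → ℝ} (hf : Monotone f) {B : ℝ} (h0 : ∀ n, 0 ≤ f n) (hB : ∀ n, f n ≤ B)
    (m K : ℕ) : ∑ n ∈ Finset.range K, (f (n + m) - f n) ≤ m * B := by
  induction m with
  | zero => simp
  | succ m ih =>
    have : ∀ n, f (n + (m + 1)) - f n = (f (n + 1 + m) - f (n + m)) + (f (n + m) - f n) := by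
      intro n; rw [show n + (m + 1) = n + 1 + m by ring]; ring
    simp only [this]
    rw [Finset.sum_add_distrib, Finset.sum_range_sub (fun n => f (n + m))]
    push_cast
    linarith [h0 (0 + m), hB (K + m)]

namespace Lac
variable {M : ContinuousNest H} {ι : Type} {X : ι → H →L[ℂ] H} {η : ℝ} (L : Lac M X η)

instance instFD (n : ℕ) : FiniteDimensional ℂ (L.W n) := L.fd n

/-- The projection on `W n`. -/
noncomputable def P (n : ℕ) : H →L[ℂ] H := (L.W n).starProjection

lemma P_mem (n : ℕ) (x : H) : L.P n x ∈ L.W n := (L.W n).starProjection_apply_mem x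

lemma P_eq {n : ℕ} {x : H} (h : x ∈ L.W n) : L.P n x = x :=
  (L.W n).starProjection_eq_self_iff.2 h

lemma P_norm (n : ℕ) (x : H) : ‖L.P n x‖ ≤ ‖x‖ := (L.W n).norm_starProjection_apply_le x

lemma P_inner (n : ℕ) (x y : H) : ⟪L.P n x, y⟫_ℂ = ⟪x, L.P n y⟫_ℂ :=
  (L.W n).inner_starProjection_left_eq_right x y

lemma P_P {m n : ℕ} (h : m ≤ n) (x : H) : L.P m (L.P n x) = L.P m x := by
  refine ext_inner_right ℂ fun y => ?_
  rw [P_inner, P_inner, L.P_eq (L.mono h (L.P_mem m y)), ← P_inner]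

lemma P_diff {m n : ℕ} (h : m ≤ n) (x : H) :
    ‖L.P n x - L.P m x‖ ^ 2 = ‖L.P n x‖ ^ 2 - ‖L.P m x‖ ^ 2 := by
  have h1 : ⟪L.P n x, L.P m x⟫_ℂ = ⟪L.P m x, L.P m x⟫_ℂ := by
    rw [P_inner, L.P_eq (L.mono h (L.P_mem m x)), ← L.P_eq (L.P_mem m x), ← P_inner,
      L.P_eq (L.P_mem m x)]
  rw [norm_sub_sq (𝕜 := ℂ), h1, inner_self_eq_norm_sq]; ring

lemma T_mem (n : ℕ) (x : H) : L.T n x ∈ L.W n := by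
  cases n with
  | zero => rw [L.T0]; simp
  | succ n =>
    rw [L.hT, sum_apply]
    exact Submodule.sum_mem _ fun i _ => by
      rw [rk_apply]; exact Submodule.smul_mem _ _ (L.heW' n i)

lemma Ta_mem (n : ℕ) (x : H) : adjoint (L.T n) x ∈ L.W n := by
  cases n with
  | zero => rw [L.T0]; simp
  | succ n =>
    rw [L.hT, map_sum, sum_apply]
    exact Submodule.sum_mem _ fun i _ => by
      rw [adjoint_rk, rk_apply]; exact Submodule.smul_mem _ _ (L.heW n i)

lemma T_P {m n : ℕ} (h : n ≤ m) (x : H) : L.T n (L.P m x) = L.T n x := by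
  refine ext_inner_right ℂ fun y => ?_
  rw [← adjoint_inner_right, P_inner, L.P_eq (L.mono h (L.Ta_mem n y)),
    adjoint_inner_right]

lemma Ta_P {m n : ℕ} (h : n ≤ m) (x : H) : adjoint (L.T n) (L.P m x) = adjoint (L.T n) x := by
  refine ext_inner_right ℂ fun y => ?_
  rw [adjoint_inner_left, P_inner, L.P_eq (L.mono h (L.T_mem n y)),
    adjoint_inner_left]

lemma Tri_T (n : ℕ) : Tri M M (L.T n) := by
  cases n with
  | zero => rw [L.T0]; exact Tri.zero
  | succ n =>
    rw [L.hT]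
    refine Tri.sum fun i _ => ?_
    have := L.hpq n i
    refine rk_tri' (q := L.q n i) ⟨by linarith, this.2.2⟩ ?_ (L.heq n i)
    exact M.mem_mono ⟨this.1, by linarith⟩ ⟨by linarith, this.2.2⟩ this.2.1.le (L.hep n i)

lemma T_norm (n : ℕ) (x : H) : ‖L.T n x‖ ≤ ‖x‖ := by
  refine ((L.T n).le_opNorm x).trans ?_
  nlinarith [L.Tn n, norm_nonneg x]

lemma Tan (n : ℕ) : ‖adjoint (L.T n)‖ ≤ 1 := by
  rw [LinearIsometryEquiv.norm_map]; exact L.Tn n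

lemma Ta_norm (n : ℕ) (x : H) : ‖adjoint (L.T n) x‖ ≤ ‖x‖ := by
  refine ((adjoint (L.T n)).le_opNorm x).trans ?_
  nlinarith [L.Tan n, norm_nonneg x]

lemma close (hη : 0 ≤ η) {n m : ℕ} (hm : m ≤ n - 1) {w : H} (hw : w ∈ L.W m) :
    ‖w - L.T n w‖ ≤ 4 * η * (1 / 4) ^ n * ‖w‖ := by
  cases n with
  | zero =>
    have hm0 : m = 0 := by omega
    rw [hm0, L.W0] at hw
    simp at hw
    simp [hw]
  | succ n =>
    have := L.cl n w (L.mono (by omega) hw)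
    rw [pow_succ]
    linarith

lemma closea (hη : 0 ≤ η) {n m : ℕ} (hm : m ≤ n - 1) {w : H} (hw : w ∈ L.W m) :
    ‖w - adjoint (L.T n) w‖ ≤ 4 * η * (1 / 4) ^ n * ‖w‖ := by
  cases n with
  | zero =>
    have hm0 : m = 0 := by omega
    rw [hm0, L.W0] at hw
    simp at hw
    simp [hw]
  | succ n =>
    have := L.cl' n w (L.mono (by omega) hw)
    rw [pow_succ]
    linarith

lemma TT (hη : 0 ≤ η) {n m : ℕ} (h : n ≤ m - 1) : ‖L.T n - L.T m * L.T n‖ ≤ 4 * η * (1 / 4) ^ m := by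
  refine opNorm_le_bound _ (by positivity) fun x => ?_
  refine (L.close hη h (L.T_mem n x)).trans ?_
  gcongr
  exact L.T_norm n x

lemma TT' (hη : 0 ≤ η) {n m : ℕ} (h : n ≤ m - 1) : ‖L.T n - L.T n * L.T m‖ ≤ 4 * η * (1 / 4) ^ m := by
  rw [← LinearIsometryEquiv.norm_map adjoint, map_sub, adjoint_mul']
  refine opNorm_le_bound _ (by positivity) fun x => ?_
  refine (L.closea hη h (L.Ta_mem n x)).trans ?_
  gcongr
  exact L.Ta_norm n x

lemma tendsto_T (hη : 0 ≤ η) (x : H) : Tendsto (fun n => L.T n x) atTop (𝓝 x) := by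
  rw [Metric.tendsto_atTop]
  intro ε hε
  obtain ⟨n, w, hw, hxw⟩ := L.dense x (ε / 3) (by positivity)
  have hl : Tendsto (fun k : ℕ => 4 * η * (1 / 4 : ℝ) ^ k * ‖w‖) atTop (𝓝 0) := by
    have := (tendsto_pow_atTop_nhds_zero_of_lt_one (show (0:ℝ) ≤ 1/4 by norm_num) (by norm_num))
    simpa using (this.const_mul (4 * η)).mul_const ‖w‖
  obtain ⟨K, hK⟩ := ((hl.eventually (gt_mem_nhds (show (0:ℝ) < ε / 3 by positivity))).and
    (eventually_ge_atTop (n + 1))).exists_forall_of_atTop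
  refine ⟨K, fun k hk => ?_⟩
  obtain ⟨h1, h2⟩ := hK k hk
  have h3 := L.close hη (n := k) (m := n) (by omega) hw
  have h4 : ‖L.T k (w - x)‖ ≤ ‖w - x‖ := L.T_norm _ _
  rw [norm_sub_rev w x, map_sub] at h4
  rw [dist_eq_norm]
  have : L.T k x - x = - (L.T k w - L.T k x) - (w - L.T k w) - (x - w) := by abel
  rw [this]
  have h5 := norm_sub_le (- (L.T k w - L.T k x) - (w - L.T k w)) (x - w)
  have h6 := norm_sub_le (- (L.T k w - L.T k x)) (w - L.T k w)
  rw [norm_neg] at h6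
  linarith

lemma sum_P_le (w : ℕ) (x : H) (s : Finset ℕ) :
    ∑ n ∈ s, ‖L.P (n + w) x - L.P (n - w) x‖ ^ 2 ≤ (2 * w : ℕ) * ‖x‖ ^ 2 := by
  obtain ⟨K, hK⟩ := s.exists_nat_subset_range
  refine (Finset.sum_le_sum_of_subset_of_nonneg hK fun _ _ _ => by positivity).trans ?_
  have hmono : Monotone (fun n => ‖L.P (n - w) x‖ ^ 2) := by
    intro m n h
    have := L.P_diff (show m - w ≤ n - w by omega) x
    simp only
    nlinarith [sq_nonneg ‖L.P (n - w) x - L.P (m - w) x‖]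
  have := sum_shift_le hmono (B := ‖x‖ ^ 2) (fun n => by positivity)
    (fun n => by gcongr; exact L.P_norm _ _) (2 * w) K
  refine le_of_eq_of_le (Finset.sum_congr rfl fun n _ => ?_) this
  rw [L.P_diff (by omega), show n + 2 * w - w = n + w by omega]

/-- Quasi-orthogonality. -/
lemma quasi (w : ℕ) (R : ℕ → H →L[ℂ] H) {a b : ℝ} (ha : 0 ≤ a) (hb : 0 ≤ b) (hR : ∀ n x, ‖R n x‖ ≤ a * ‖x‖)
    (hP : ∀ n x, R n (L.P (n + w) x) = R n x)
    (hW : ∀ n, ∀ v ∈ L.W (n - w), ‖R n v‖ ≤ b * (1 / 4) ^ n * ‖v‖) (x : H) (s : Finset ℕ) :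
    ∑ n ∈ s, ‖R n x‖ ^ 2 ≤ (4 * w * a ^ 2 + 4 * b ^ 2) * ‖x‖ ^ 2 := by
  have h1 : ∀ n, ‖R n x‖ ^ 2 ≤ 2 * a ^ 2 * ‖L.P (n + w) x - L.P (n - w) x‖ ^ 2 +
      2 * b ^ 2 * ‖x‖ ^ 2 * (1 / 16) ^ n := by
    intro n
    have e : R n x = R n (L.P (n + w) x - L.P (n - w) x) + R n (L.P (n - w) x) := by
      rw [map_sub, hP]; abel
    have h2 := hR n (L.P (n + w) x - L.P (n - w) x)
    have h3 : ‖R n (L.P (n - w) x)‖ ≤ b * (1 / 4) ^ n * ‖x‖ :=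
      (hW n _ (L.P_mem _ x)).trans (by gcongr; exact L.P_norm _ _)
    have h4 : ‖R n x‖ ≤ a * ‖L.P (n + w) x - L.P (n - w) x‖ + b * (1 / 4) ^ n * ‖x‖ := by
      rw [e]; exact (norm_add_le _ _).trans (add_le_add h2 h3)
    have h5 : ((1:ℝ) / 4) ^ n * (1 / 4) ^ n = (1 / 16) ^ n := by
      rw [← mul_pow]; norm_num
    set α := a * ‖L.P (n + w) x - L.P (n - w) x‖
    set β := b * (1 / 4) ^ n * ‖x‖
    have h6 : β ^ 2 = b ^ 2 * ‖x‖ ^ 2 * (1 / 16) ^ n := by rw [← h5]; ring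
    have h7 : ‖R n x‖ ^ 2 ≤ (α + β) ^ 2 := by gcongr
    have h8 : α ^ 2 = a ^ 2 * ‖L.P (n + w) x - L.P (n - w) x‖ ^ 2 := by ring
    nlinarith [sq_nonneg (α - β)]
  refine (Finset.sum_le_sum fun n _ => h1 n).trans ?_
  rw [Finset.sum_add_distrib, ← Finset.mul_sum, ← Finset.mul_sum]
  have h2 := L.sum_P_le w x s
  have h3 : ∑ n ∈ s, ((1:ℝ) / 16) ^ n ≤ 2 := by
    refine (Summable.sum_le_tsum s (fun _ _ => by positivity)
      (summable_geometric_of_lt_one (by norm_num) (by norm_num))).trans ?_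
    rw [tsum_geometric_of_lt_one (by norm_num) (by norm_num)]; norm_num
  have h4 : 2 * a ^ 2 * ∑ n ∈ s, ‖L.P (n + w) x - L.P (n - w) x‖ ^ 2 ≤ 2 * a ^ 2 * ((2 * w : ℕ) * ‖x‖ ^ 2) := by
    gcongr
  push_cast at h4
  have h5 : 2 * b ^ 2 * ‖x‖ ^ 2 * ∑ n ∈ s, ((1:ℝ) / 16) ^ n ≤ 2 * b ^ 2 * ‖x‖ ^ 2 * 2 := by gcongr
  linarith

end Lac
end

section

lemma bess_sigma {κ : ℕ → Type*} [∀ n, Fintype (κ n)] {f : ∀ n, κ n → H} (hf : ∀ n, Orthonormal ℂ (f n))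
    {g : ∀ n, κ n → H} {R : ℕ → H →L[ℂ] H} (hg : ∀ n i z, ⟪g n i, z⟫_ℂ = ⟪f n i, R n z⟫_ℂ)
    {C : ℝ} (hR : ∀ z (s : Finset ℕ), ∑ n ∈ s, ‖R n z‖ ^ 2 ≤ C ^ 2 * ‖z‖ ^ 2) :
    Bess (fun x : (Σ n, κ n) => g x.1 x.2) C := by
  classical
  intro z s
  have hs : s ⊆ (s.image Sigma.fst).sigma (fun _ => Finset.univ) := by
    intro x hx
    simp only [Finset.mem_sigma, Finset.mem_univ, and_true]
    exact Finset.mem_image_of_mem _ hx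
  refine (Finset.sum_le_sum_of_subset_of_nonneg hs fun _ _ _ => by positivity).trans ?_
  rw [Finset.sum_sigma]
  refine (Finset.sum_le_sum fun n _ => ?_).trans (hR z _)
  simp only [hg]
  exact (hf n).sum_inner_products_le (R n z)

/-- Bounded inverse in the triangular algebra. -/
lemma ContinuousNest.Tri.inverse {M : ContinuousNest H} {G : H →L[ℂ] H} (hG : Tri M M G) (h : ‖1 - G‖ < 1) :
    ∃ G' : H →L[ℂ] H, Tri M M G' ∧ G' * G = 1 ∧ G * G' = 1 := by
  have h1 := summable_geometric_of_norm_lt_one h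
  have e : G = 1 - (1 - G) := by abel
  refine ⟨∑' n, (1 - G) ^ n, ?_, ?_, ?_⟩
  · have h2 := h1.hasSum.tendsto_sum_nat
    refine Tri.of_tendsto (fun n => Tri.sum fun i hi => ?_) h2
    clear hi
    induction i with
    | zero => simpa using Tri.one
    | succ i ih => rw [pow_succ]; exact ih.mul (Tri.one.sub hG)
  · have := geom_series_mul_neg (1 - G) h
    rwa [← e] at this
  · have := mul_neg_geom_series (1 - G) h
    rwa [← e] at this

namespace Lac
variable {M : ContinuousNest H} {ι : Type} {X : ι → H →L[ℂ] H} {η : ℝ} (L : Lac M X η)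

lemma one_sub_norm (n : ℕ) : ‖1 - L.T n‖ ≤ 2 := by
  have := norm_sub_le (1 : H →L[ℂ] H) (L.T n)
  have h2 : ‖(1 : H →L[ℂ] H)‖ ≤ 1 := ContinuousLinearMap.norm_id_le
  linarith [L.Tn n]

lemma one_sub_norma (n : ℕ) : ‖1 - adjoint (L.T n)‖ ≤ 2 := by
  have := norm_sub_le (1 : H →L[ℂ] H) (adjoint (L.T n))
  have h2 : ‖(1 : H →L[ℂ] H)‖ ≤ 1 := ContinuousLinearMap.norm_id_le
  linarith [L.Tan n]

lemma key_err (hη : 0 ≤ η) (n : ℕ) :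
    ‖(1 - L.T (n - 1)) * L.T (n + 1) * (1 - L.T n) - (L.T (n + 1) - L.T n)‖ ≤ 7 * η * (1 / 4) ^ n := by
  have h1 := L.TT hη (n := n) (m := n + 1) (by omega)
  have h2 := L.TT' hη (n := n - 1) (m := n + 1) (by omega)
  have h3 := L.TT' hη (n := n - 1) (m := n) (by omega)
  have h4 : ‖(1 - L.T (n - 1)) * (L.T n - L.T (n + 1) * L.T n)‖ ≤
      2 * (4 * η * (1 / 4) ^ (n + 1)) :=
    (norm_mul_le _ _).trans (mul_le_mul (L.one_sub_norm _) h1 (norm_nonneg _) (by norm_num))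
  have e : (1 - L.T (n - 1)) * L.T (n + 1) * (1 - L.T n) - (L.T (n + 1) - L.T n) =
      (1 - L.T (n - 1)) * (L.T n - L.T (n + 1) * L.T n) +
      (L.T (n - 1) - L.T (n - 1) * L.T (n + 1)) - (L.T (n - 1) - L.T (n - 1) * L.T n) := by
    noncomm_ring
  rw [e]
  refine (norm_sub_le _ _).trans ?_
  have := norm_add_le ((1 - L.T (n - 1)) * (L.T n - L.T (n + 1) * L.T n))
    (L.T (n - 1) - L.T (n - 1) * L.T (n + 1))
  rw [pow_succ] at *
  linarith

/-- The vectors `y`. -/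
noncomputable def y (x : Σ n, Fin (L.k n)) : H := adjoint (1 - L.T x.1) (L.e x.1 x.2)
/-- The vectors `x`. -/
noncomputable def x (x : Σ n, Fin (L.k n)) : H := (1 - L.T (x.1 - 1)) (L.e' x.1 x.2)

lemma y_perp (k : Σ n, Fin (L.k n)) : M.N (L.q k.1 k.2) (L.y k) = 0 := by
  have h := L.hpq k.1 k.2
  exact (Tri.one.sub (L.Tri_T k.1)).perp ⟨by linarith, h.2.2⟩ (L.heq k.1 k.2)

lemma x_mem (k : Σ n, Fin (L.k n)) : M.N (L.p k.1 k.2) (L.x k) = L.x k := by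
  have h := L.hpq k.1 k.2
  exact (Tri.one.sub (L.Tri_T (k.1 - 1))).mem ⟨by linarith, by linarith⟩ (L.hep k.1 k.2)

lemma bess_y (hη : 0 ≤ η) (h1 : η ≤ 1) : Bess L.y 10 := by
  refine bess_sigma (f := L.e) L.he (g := fun n i => L.y ⟨n, i⟩)
    (R := fun n => L.P (n + 1) * (1 - L.T n)) ?_ ?_
  · intro n i z
    rw [mul_apply_eq_comp, ← P_inner, L.P_eq (L.heW n i), y, adjoint_inner_left]
  · intro z s
    refine (L.quasi 2 (fun n => L.P (n + 1) * (1 - L.T n)) (a := 2) (b := 4) (by norm_num)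
      (by norm_num) ?_ ?_ ?_ z s).trans ?_
    · intro n x
      refine (L.P_norm _ _).trans (((1 - L.T n).le_opNorm x).trans ?_)
      gcongr; exact L.one_sub_norm n
    · intro n x
      simp only [mul_apply_eq_comp, sub_apply, one_apply_eq_self, map_sub]
      rw [L.P_P (by omega), L.T_P (by omega)]
    · intro n w hw
      refine (L.P_norm _ _).trans ((L.close hη (n := n) (by omega) hw).trans ?_)
      gcongr; linarith
    · gcongr; norm_num

lemma bess_x (hη : 0 ≤ η) (h1 : η ≤ 1 / 4) : Bess L.x 10 := by
  refine bess_sigma (f := L.e') L.he' (g := fun n i => L.x ⟨n, i⟩)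
    (R := fun n => L.P (n + 1) * (1 - adjoint (L.T (n - 1)))) ?_ ?_
  · intro n i z
    rw [mul_apply_eq_comp, ← P_inner, L.P_eq (L.heW' n i), x]
    simp only [sub_apply, one_apply_eq_self, inner_sub_left, inner_sub_right,
      adjoint_inner_right]
  · intro z s
    refine (L.quasi 2 (fun n => L.P (n + 1) * (1 - adjoint (L.T (n - 1)))) (a := 2) (b := 4)
      (by norm_num) (by norm_num) ?_ ?_ ?_ z s).trans ?_
    · intro n x
      refine (L.P_norm _ _).trans (((1 - adjoint (L.T (n - 1))).le_opNorm x).trans ?_)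
      gcongr; exact L.one_sub_norma _
    · intro n x
      simp only [mul_apply_eq_comp, sub_apply, one_apply_eq_self, map_sub]
      rw [L.P_P (by omega), L.Ta_P (by omega)]
    · intro n w hw
      refine (L.P_norm _ _).trans ((L.closea hη (n := n - 1) (by omega) hw).trans ?_)
      refine mul_le_mul_of_nonneg_right ?_ (norm_nonneg _)
      cases n with
      | zero => simp; linarith
      | succ n =>
        rw [pow_succ, Nat.add_sub_cancel]
        have : (0:ℝ) ≤ (1 / 4) ^ n := by positivity
        nlinarith
    · gcongr; norm_num

lemma norm_G (hη : 0 ≤ η) {G : H →L[ℂ] H} (hG : IsSyn L.x L.y G) : ‖1 - G‖ ≤ 10 * η := by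
  refine opNorm_le_bound _ (by positivity) fun z => ?_
  have h1 : HasSum (fun n => ((1 - L.T (n - 1)) * L.T (n + 1) * (1 - L.T n)) z) (G z) := by
    refine (hG z).sigma fun n => ?_
    convert hasSum_fintype (fun i => rk (L.x ⟨n, i⟩) (L.y ⟨n, i⟩) z) using 1
    simp only [mul_apply_eq_comp, L.hT, sum_apply, map_sum, rk_apply, map_smul]
    refine Finset.sum_congr rfl fun i _ => ?_
    simp only [x, y, adjoint_inner_left]
  have h2 := h1.tendsto_sum_nat
  have h3 : Tendsto (fun n => ∑ i ∈ Finset.range n, (L.T (i + 1) - L.T i) z) atTop (𝓝 z) := by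
    refine (L.tendsto_T hη z).congr fun n => ?_
    rw [← sum_apply, Finset.sum_range_sub, L.T0, sub_zero]
  have h4 := (h2.sub h3).norm
  have e : ‖(1 - G) z‖ = ‖G z - z‖ := by rw [norm_sub_rev]; rfl
  rw [e]
  refine le_of_tendsto' h4 fun n => ?_
  rw [← Finset.sum_sub_distrib]
  refine (norm_sum_le _ _).trans ?_
  have h5 : ∀ i, ‖((1 - L.T (i - 1)) * L.T (i + 1) * (1 - L.T i)) z - (L.T (i + 1) - L.T i) z‖ ≤
      7 * η * ‖z‖ * (1 / 4) ^ i := fun i => by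
    rw [← sub_apply]
    refine (ContinuousLinearMap.le_opNorm _ _).trans ?_
    have := mul_le_mul_of_nonneg_right (L.key_err hη i) (norm_nonneg z)
    linarith
  refine (Finset.sum_le_sum fun i _ => h5 i).trans ?_
  rw [← Finset.mul_sum]
  have h6 : ∑ i ∈ Finset.range n, ((1:ℝ) / 4) ^ i ≤ 4 / 3 := by
    refine (Summable.sum_le_tsum _ (fun _ _ => by positivity)
      (summable_geometric_of_lt_one (by norm_num) (by norm_num))).trans ?_
    rw [tsum_geometric_of_lt_one (by norm_num) (by norm_num)]; norm_num
  have := mul_le_mul_of_nonneg_left h6 (show 0 ≤ 7 * η * ‖z‖ by positivity)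
  nlinarith [mul_nonneg hη (norm_nonneg z)]

end Lac

/-- A system of infinitely many orthogonal embeddings of the nest `M` into the nest `N`. -/
structure NEmb (M N : ContinuousNest H) where
  A : ℕ → H →L[ℂ] H
  B : ℕ → H →L[ℂ] H
  C : ℝ
  hC : 0 ≤ C
  hA : ∀ j, Tri M N (A j)
  hB : ∀ j, Tri N M (B j)
  BA : ∀ i j, B i * A j = if i = j then 1 else 0
  orth : ∀ i j, i ≠ j → ∀ z w, ⟪A i z, A j w⟫_ℂ = 0
  An : ∀ j, ‖A j‖ ≤ C
  Bn : ∀ ζ (s : Finset ℕ), ∑ j ∈ s, ‖B j ζ‖ ^ 2 ≤ C ^ 2 * ‖ζ‖ ^ 2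

theorem exists_emb [SeparableSpace H] (M N : ContinuousNest H) : Nonempty (NEmb M N) := by
  classical
  obtain ⟨L⟩ := exists_lac M (fun i : Empty => (0 : H →L[ℂ] H)) (show (0:ℝ) < 1 / 50 by norm_num)
  have hη : (0:ℝ) ≤ 1 / 50 := by norm_num
  have hx := L.bess_x hη (by norm_num)
  have hy := L.bess_y hη (by norm_num)
  obtain ⟨h, ho, hh⟩ := N.exists_orthonormal (ι := ℕ × (Σ n, Fin (L.k n)))
    (fun a => L.p a.2.1 a.2.2) (fun a => L.q a.2.1 a.2.2) (fun a => L.hpq _ _)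
  have hoj : ∀ j, Orthonormal ℂ (fun k => h (j, k)) := fun j =>
    ho.comp (fun k => (j, k)) (fun a b hab => (Prod.mk.inj hab).2)
  have c10 : (0:ℝ) ≤ 10 := by norm_num
  choose A hA hAn using fun j => exists_syn zero_le_one c10 (hoj j).bess hy
  choose B hB hBn using fun j => exists_syn c10 zero_le_one hx (hoj j).bess
  obtain ⟨G, hG, -⟩ := exists_syn c10 c10 hx hy
  have hqm : ∀ k : (Σ n, Fin (L.k n)), L.q k.1 k.2 ∈ Icc (0:ℝ) 1 := fun k => by
    have := L.hpq k.1 k.2; exact ⟨by linarith, this.2.2⟩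
  have hpm : ∀ k : (Σ n, Fin (L.k n)), L.p k.1 k.2 ∈ Icc (0:ℝ) 1 := fun k => by
    have := L.hpq k.1 k.2; exact ⟨by linarith, by linarith⟩
  have hAt : ∀ j, Tri M N (A j) := fun j =>
    Tri.hasSum (fun k => rk_tri' (hqm k) (hh (j, k)).1 (L.y_perp k)) (hA j)
  have hBt : ∀ j, Tri N M (B j) := fun j =>
    Tri.hasSum (fun k => rk_tri' (hpm k) (L.x_mem k) (hh (j, k)).2) (hB j)
  have hGt : Tri M M G := Tri.hasSum (fun k => rk_tri' (hqm k)
    (M.mem_mono (hpm k) (hqm k) (L.hpq k.1 k.2).2.1.le (L.x_mem k)) (L.y_perp k)) hG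
  have hGn := L.norm_G hη hG
  obtain ⟨G', hG't, hG'1, -⟩ := hGt.inverse (by linarith)
  have hin : ∀ i k j w, ⟪h (i, k), A j w⟫_ℂ = if i = j then ⟪L.y k, w⟫_ℂ else 0 := by
    intro i k j w
    have h1 := (hA j w).mapL (innerSL ℂ (h (i, k)))
    simp only [rk_apply, innerSL_apply_apply, inner_smul_right, orthonormal_iff_ite.1 ho] at h1
    refine h1.unique ?_
    have h2 := hasSum_single (f := fun l => ⟪L.y l, w⟫_ℂ * (if (i, k) = (j, l) then (1:ℂ) else 0)) k
      (by intro l hl; simp [hl.symm])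
    have e : (if i = j then ⟪L.y k, w⟫_ℂ else 0) =
        ⟪L.y k, w⟫_ℂ * (if (i, k) = (j, k) then (1:ℂ) else 0) := by
      by_cases hij : i = j
      · simp [hij]
      · simp [hij]
    rw [e]
    convert h2
  have hBA : ∀ i j, B i * A j = if i = j then G else 0 := by
    intro i j
    ext w
    have h1 := hB i (A j w)
    simp only [rk_apply, hin] at h1
    refine h1.unique ?_
    by_cases hij : i = j
    · simpa [hij] using hG w
    · simp only [hij, if_false, zero_smul, zero_apply]; exact hasSum_zero
  have hBs : ∀ ζ (s : Finset ℕ), ∑ j ∈ s, ‖B j ζ‖ ^ 2 ≤ 10 ^ 2 * ‖ζ‖ ^ 2 := by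
    intro ζ s
    have h1 : Tendsto (fun t : Finset (Σ n, Fin (L.k n)) =>
        ∑ j ∈ s, ‖∑ k ∈ t, rk (L.x k) (h (j, k)) ζ‖ ^ 2) atTop (𝓝 (∑ j ∈ s, ‖B j ζ‖ ^ 2)) :=
      tendsto_finsetSum _ fun j _ => ((hB j ζ).norm).pow 2
    refine le_of_tendsto' h1 fun t => ?_
    have h2 : ∀ j, ‖∑ k ∈ t, rk (L.x k) (h (j, k)) ζ‖ ^ 2 ≤
        10 ^ 2 * ∑ k ∈ t, ‖⟪h (j, k), ζ⟫_ℂ‖ ^ 2 := by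
      intro j
      simp only [rk_apply]
      exact hx.synth t _
    refine (Finset.sum_le_sum fun j _ => h2 j).trans ?_
    rw [← Finset.mul_sum, ← Finset.sum_product' s t (fun j k => ‖⟪h (j, k), ζ⟫_ℂ‖ ^ 2)]
    have := ho.sum_inner_products_le ζ (s := s ×ˢ t)
    gcongr
  refine ⟨⟨A, fun j => G' * B j, max 10 (‖G'‖ * 10), by positivity, hAt, fun j => hG't.mul (hBt j),
    ?_, ?_, ?_, ?_⟩⟩
  · intro i j
    rw [mul_assoc, hBA]
    split_ifs
    · exact hG'1
    · simp
  · intro i j hij z w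
    have h1 := (hA i z).mapL (innerSL ℂ (A j w))
    simp only [rk_apply, innerSL_apply_apply, inner_smul_right] at h1
    have h2 : ∀ k, ⟪A j w, h (i, k)⟫_ℂ = 0 := fun k => by
      rw [← inner_conj_symm, hin]; simp [hij]
    simp only [h2, mul_zero] at h1
    rw [← inner_conj_symm, h1.unique hasSum_zero]; simp
  · intro j
    refine (hAn j).trans ?_
    simp
  · intro ζ s
    have h1 : ∀ j, ‖(G' * B j) ζ‖ ^ 2 ≤ ‖G'‖ ^ 2 * ‖B j ζ‖ ^ 2 := fun j => by
      rw [← mul_pow]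
      gcongr
      exact G'.le_opNorm _
    refine (Finset.sum_le_sum fun j _ => h1 j).trans ?_
    rw [← Finset.mul_sum]
    refine (mul_le_mul_of_nonneg_left (hBs ζ s) (by positivity)).trans ?_
    rw [← mul_assoc, ← mul_pow]
    gcongr
    exact le_max_right _ _

end

section

namespace NEmb
variable {M N : ContinuousNest H} (E : NEmb M N)

lemma norm_sum_sq {σ : ℕ → ℕ} (hσ : σ.Injective) (w : ℕ → H) (s : Finset ℕ) :
    ‖∑ j ∈ s, E.A (σ j) (w j)‖ ^ 2 = ∑ j ∈ s, ‖E.A (σ j) (w j)‖ ^ 2 := by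
  have h : (⟪∑ j ∈ s, E.A (σ j) (w j), ∑ j ∈ s, E.A (σ j) (w j)⟫_ℂ : ℂ) =
      ∑ j ∈ s, ⟪E.A (σ j) (w j), E.A (σ j) (w j)⟫_ℂ := by
    rw [sum_inner]
    refine Finset.sum_congr rfl fun j hj => ?_
    rw [inner_sum]
    exact Finset.sum_eq_single_of_mem j hj fun i _ hij =>
      E.orth _ _ (fun h => hij (hσ h).symm) _ _
  simp only [inner_self_eq_norm_sq_to_K] at h
  exact_mod_cast h

lemma exists_W {σ τ : ℕ → ℕ} (hσ : σ.Injective) (hτ : τ.Injective) :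
    ∃ S : H →L[ℂ] H, Tri N N S ∧ ∀ z, HasSum (fun j => E.A (σ j) (E.B (τ j) z)) (S z) := by
  classical
  have h1 : ∀ z (s : Finset ℕ), ‖∑ j ∈ s, (E.A (σ j) * E.B (τ j)) z‖ ^ 2 ≤
      ∑ j ∈ s, E.C ^ 2 * ‖E.B (τ j) z‖ ^ 2 := by
    intro z s
    simp only [mul_apply_eq_comp]
    rw [E.norm_sum_sq hσ]
    refine Finset.sum_le_sum fun j _ => ?_
    rw [← mul_pow]
    gcongr
    exact ((E.A _).le_opNorm _).trans (by gcongr; exact E.An _)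
  have h2 : ∀ z (s : Finset ℕ), ∑ j ∈ s, E.C ^ 2 * ‖E.B (τ j) z‖ ^ 2 ≤
      (E.C * E.C) ^ 2 * ‖z‖ ^ 2 := by
    intro z s
    rw [← Finset.mul_sum, ← Finset.sum_image (f := fun i => ‖E.B i z‖ ^ 2) (hτ.injOn)]
    refine (mul_le_mul_of_nonneg_left (E.Bn z _) (by positivity)).trans (le_of_eq (by ring))
  obtain ⟨S, hS, -⟩ := exists_strong_sum (fun j => E.A (σ j) * E.B (τ j)) (E.C * E.C)
    (fun z j => E.C ^ 2 * ‖E.B (τ j) z‖ ^ 2) (mul_nonneg E.hC E.hC) h1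
    (fun z j => by positivity) h2
  exact ⟨S, Tri.hasSum (fun j => (E.hA _).mul (E.hB _)) hS, hS⟩

lemma exists_U : ∃ U U' : H →L[ℂ] H, Tri N N U ∧ Tri N N U' ∧ U' * U = 1 ∧
    U * U' = 1 - E.A 0 * E.B 0 ∧ E.B 0 * U = 0 ∧ U' * E.A 0 = 0 := by
  have inj : Function.Injective (fun j : ℕ => j + 1) := add_left_injective 1
  obtain ⟨P, hPt, hP⟩ := E.exists_W Function.injective_id Function.injective_id
  obtain ⟨V, hVt, hV⟩ := E.exists_W inj Function.injective_id
  obtain ⟨V', hV't, hV'⟩ := E.exists_W Function.injective_id inj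
  simp only [id] at hP hV hV'
  have BA : ∀ i j z, E.B i (E.A j z) = if i = j then z else 0 := fun i j z => by
    rw [← mul_apply_eq_comp, E.BA]; split_ifs <;> rfl
  have hPA : ∀ i z, P (E.A i z) = E.A i z := fun i z => by
    refine (hP (E.A i z)).unique ?_
    have := hasSum_single (f := fun j => E.A j (E.B j (E.A i z))) i
      (by intro j hj; simp [BA, hj])
    simpa [BA] using this
  have hVA : ∀ i z, V (E.A i z) = E.A (i + 1) z := fun i z => by
    refine (hV (E.A i z)).unique ?_
    have := hasSum_single (f := fun j => E.A (j + 1) (E.B j (E.A i z))) i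
      (by intro j hj; simp [BA, hj])
    simpa [BA] using this
  have hV'A : ∀ i z, V' (E.A (i + 1) z) = E.A i z := fun i z => by
    refine (hV' (E.A (i + 1) z)).unique ?_
    have := hasSum_single (f := fun j => E.A j (E.B (j + 1) (E.A (i + 1) z))) i
      (by intro j hj; simp [BA, hj])
    simpa [BA] using this
  have hV'0 : ∀ z, V' (E.A 0 z) = 0 := fun z => by
    refine (hV' (E.A 0 z)).unique ?_
    simp only [BA, Nat.succ_ne_zero, if_false, map_zero]; exact hasSum_zero
  have hBP : ∀ z, E.B 0 (P z) = E.B 0 z := fun z => by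
    have h1 := (hP z).mapL (E.B 0)
    refine h1.unique ?_
    simp only [BA]
    have := hasSum_single (f := fun j => if 0 = j then E.B j z else 0) 0
      (by intro j hj; simp [hj.symm])
    simpa using this
  have hBV : ∀ z, E.B 0 (V z) = 0 := fun z => by
    have h1 := (hV z).mapL (E.B 0)
    refine h1.unique ?_
    simp only [BA, (Nat.succ_ne_zero _).symm, if_false]; exact hasSum_zero
  have hPP : P * P = P := by
    ext z; have := (hP z).mapL P; simp only [hPA] at this; exact this.unique (hP z)
  have hPV : P * V = V := by
    ext z; have := (hV z).mapL P; simp only [hPA] at this; exact this.unique (hV z)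
  have hPV' : P * V' = V' := by
    ext z; have := (hV' z).mapL P; simp only [hPA] at this; exact this.unique (hV' z)
  have hVP : V * P = V := by
    ext z; have := (hP z).mapL V; simp only [hVA] at this; exact this.unique (hV z)
  have hV'V : V' * V = P := by
    ext z; have := (hV z).mapL V'; simp only [hV'A] at this; exact this.unique (hP z)
  have hV'P : V' * P = V' := by
    rw [← hV'V, ← mul_assoc]
    ext z
    have := (hV z).mapL (V' * V')
    have h2 := (hV' z)
    have h3 := (hP z).mapL V'
    have h4 : (V' * V' * V) z = V' (P z) := by
      rw [mul_assoc, hV'V]; rfl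
    rw [h4]
    refine h3.unique ?_
    rw [← hasSum_nat_add_iff' 1]
    simpa [hV'A, hV'0] using h2
  have hVV' : V * V' = P - E.A 0 * E.B 0 := by
    ext z
    have := (hV' z).mapL V
    simp only [hVA] at this
    refine this.unique ?_
    have h2 := (hasSum_nat_add_iff' 1).2 (hP z)
    simpa using h2
  refine ⟨1 - P + V, 1 - P + V', (Tri.one.sub hPt).add hVt, (Tri.one.sub hPt).add hV't, ?_, ?_, ?_, ?_⟩
  · have : (1 - P + V') * (1 - P + V) = 1 - P - P + P * P + (V - P * V) + (V' - V' * P) + V' * V := by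
      noncomm_ring
    rw [this, hPP, hPV, hV'P, hV'V]; abel
  · have : (1 - P + V) * (1 - P + V') = 1 - P - P + P * P + (V' - P * V') + (V - V * P) + V * V' := by
      noncomm_ring
    rw [this, hPP, hPV', hVP, hVV']; abel
  · ext z
    simp [hBP, hBV]
  · ext z
    simp [hPA, hV'0]

end NEmb

theorem exists_sim [SeparableSpace H] (M N : ContinuousNest H) :
    ∃ S : (H →L[ℂ] H)ˣ, Tri M N (S : H →L[ℂ] H) ∧ Tri N M (↑S⁻¹ : H →L[ℂ] H) := by
  obtain ⟨E⟩ := exists_emb M N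
  obtain ⟨F⟩ := exists_emb N M
  obtain ⟨U, U', hU, hU', h1, h2, h3, h4⟩ := E.exists_U
  obtain ⟨V, V', hV, hV', k1, k2, k3, k4⟩ := F.exists_U
  have hE := E.BA 0 0
  have hF := F.BA 0 0
  simp only [if_true] at hE hF
  refine ⟨⟨U * F.B 0 + E.A 0 * V', V * E.B 0 + F.A 0 * U', ?_, ?_⟩, ?_, ?_⟩
  · have : (U * F.B 0 + E.A 0 * V') * (V * E.B 0 + F.A 0 * U') =
      U * (F.B 0 * V) * E.B 0 + U * (F.B 0 * F.A 0) * U' + E.A 0 * (V' * V) * E.B 0 +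
        E.A 0 * (V' * F.A 0) * U' := by noncomm_ring
    rw [this, k3, hF, k1, k4]
    simp [h2]
  · have : (V * E.B 0 + F.A 0 * U') * (U * F.B 0 + E.A 0 * V') =
      V * (E.B 0 * U) * F.B 0 + V * (E.B 0 * E.A 0) * V' + F.A 0 * (U' * U) * F.B 0 +
        F.A 0 * (U' * E.A 0) * V' := by noncomm_ring
    rw [this, h3, hE, h1, h4]
    simp [k2]
  · exact (hU.mul (F.hB 0)).add ((E.hA 0).mul hV')
  · exact (hV.mul (E.hB 0)).add ((F.hA 0).mul hU')

/-- Reparametrization of a nest. -/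
noncomputable def ContinuousNest.rep (N : ContinuousNest H) (τ : ℝ → ℝ) (h : IsoOn τ 0 1 0 1) :
    ContinuousNest H where
  N t := N.N (τ t)
  idem t ht := N.idem _ (h.surj ▸ mem_image_of_mem τ ht)
  selfAdjoint t ht := N.selfAdjoint _ (h.surj ▸ mem_image_of_mem τ ht)
  range_lt s t hs ht hst := N.range_lt _ _ (h.surj ▸ mem_image_of_mem τ hs)
    (h.surj ▸ mem_image_of_mem τ ht) (h.mono hs ht hst)
  N_zero := by rw [h.left zero_le_one, N.N_zero]
  N_one := by rw [h.right zero_le_one, N.N_one]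
  contOn ξ := by
    have hc : ContinuousOn τ (Icc 0 1) := by
      rw [continuousOn_iff_continuous_domRestrict]
      let f : Icc (0:ℝ) 1 → Icc (0:ℝ) 1 := fun t => ⟨τ t, h.mapsTo t.2⟩
      have hf : Continuous f := by
        refine Monotone.continuous_of_surjective
          (fun s t hst => h.mono.monotoneOn s.2 t.2 hst) fun y => ?_
        obtain ⟨s, hs, h0⟩ : (y:ℝ) ∈ τ '' Icc 0 1 := by rw [h.surj]; exact y.2
        exact ⟨⟨s, hs⟩, Subtype.ext h0⟩
      exact continuous_subtype_val.comp hf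
    exact (N.contOn ξ).comp hc fun t ht => h.surj ▸ mem_image_of_mem τ ht

theorem exists_impl [SeparableSpace H] (N : ContinuousNest H) {τ : ℝ → ℝ}
    (h : IsoOn τ 0 1 0 1) :
    ∃ S : (H →L[ℂ] H)ˣ, Tri N (N.rep τ h) (S : H →L[ℂ] H) ∧
      Tri (N.rep τ h) N (↑S⁻¹ : H →L[ℂ] H) ∧
      (fun T => (↑S : H →L[ℂ] H) * T * (↑S⁻¹ : H →L[ℂ] H)) '' N.alg = N.alg := by
  obtain ⟨S, h1, h2⟩ := exists_sim N (N.rep τ h)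
  have ha : ∀ T, Tri (N.rep τ h) (N.rep τ h) T ↔ Tri N N T := by
    intro T
    constructor
    · intro hT t ht
      obtain ⟨s, hs, rfl⟩ : t ∈ τ '' Icc 0 1 := by rw [h.surj]; exact ht
      exact hT s hs
    · intro hT t ht
      exact hT (τ t) (h.surj ▸ mem_image_of_mem τ ht)
  refine ⟨S, h1, h2, ?_⟩
  ext T
  simp only [mem_image, mem_alg_iff]
  constructor
  · rintro ⟨T, hT, rfl⟩
    exact (ha _).1 ((h1.mul hT).mul h2)
  · intro hT
    refine ⟨↑S⁻¹ * T * S, (h2.mul ((ha _).2 hT)).mul h1, ?_⟩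
    simp [mul_assoc]

end

section

lemma essNorm_le {T K : H →L[ℂ] H} (hK : IsCompactOperator ⇑K) : essNorm T ≤ ‖T - K‖ := by
  rw [← dist_eq_norm]
  exact Metric.infDist_le_dist_of_mem hK

lemma exists_of_essNorm_lt {T : H →L[ℂ] H} {c : ℝ} (h : essNorm T < c) :
    ∃ K : H →L[ℂ] H, IsCompactOperator ⇑K ∧ ‖T - K‖ < c := by
  obtain ⟨K, hK, h⟩ := (Metric.infDist_lt_iff ⟨0, isCompactOperator_zero⟩).1 h
  exact ⟨K, hK, by rwa [← dist_eq_norm]⟩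

lemma essNorm_mul_lt {A T B : H →L[ℂ] H} {c d : ℝ} (hA : ‖A‖ * ‖B‖ < d) (h : essNorm T < c) :
    essNorm (A * T * B) < d * c := by
  obtain ⟨K, hK, h⟩ := exists_of_essNorm_lt h
  have hK' : IsCompactOperator ⇑(A * K * B) := by
    have := (hK.comp_clm B).clm_comp A
    exact this
  refine (essNorm_le hK').trans_lt ?_
  have e : A * T * B - A * K * B = A * (T - K) * B := by noncomm_ring
  rw [e]
  have h1 : ‖A * (T - K) * B‖ ≤ ‖A‖ * ‖T - K‖ * ‖B‖ :=
    (norm_mul_le _ _).trans (mul_le_mul_of_nonneg_right (norm_mul_le _ _) (norm_nonneg _))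
  have hd : 0 < d := lt_of_le_of_lt (by positivity) hA
  nlinarith [norm_nonneg (T - K), norm_nonneg A, norm_nonneg B]

lemma ContinuousNest.int_norm (N : ContinuousNest H) {s t : ℝ} (hs : 0 ≤ s) (h : s ≤ t) (ht : t ≤ 1) :
    ‖N.N t - N.N s‖ ≤ 1 := by
  refine opNorm_le_bound _ zero_le_one fun x => ?_
  have h1 := N.norm_diff_sq ⟨hs, h.trans ht⟩ ⟨hs.trans h, ht⟩ h x
  have h2 := N.norm_le ⟨hs.trans h, ht⟩ x
  rw [one_mul, sub_apply]
  by_contra hc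
  push Not at hc
  nlinarith [norm_nonneg (N.N s x), norm_nonneg x, norm_nonneg (N.N t x)]

/-- Compression to an interval is multiplicative on triangular operators. -/
lemma int_mul {L M N : ContinuousNest H} {A B : H →L[ℂ] H} (hA : Tri M N A) (hB : Tri L M B)
    {s t : ℝ} (hs : 0 ≤ s) (h : s ≤ t) (ht : t ≤ 1) :
    (N.N t - N.N s) * (A * B) * (L.N t - L.N s) =
      (N.N t - N.N s) * A * (M.N t - M.N s) * B * (L.N t - L.N s) := by
  have hs' : s ∈ Icc (0:ℝ) 1 := ⟨hs, h.trans ht⟩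
  have ht' : t ∈ Icc (0:ℝ) 1 := ⟨hs.trans h, ht⟩
  ext x
  simp only [mul_apply_eq_comp]
  have h1 : L.N t ((L.N t - L.N s) x) = (L.N t - L.N s) x := by
    simp [L.NN ht', L.NN_ge hs' ht' h]
  have h2 := hB.mem ht' h1
  set y := B ((L.N t - L.N s) x) with hy
  have h3 : A y = A ((M.N t - M.N s) y) + A (M.N s y) := by
    rw [sub_apply, h2, ← map_add]; simp
  have h4 : (N.N t - N.N s) (A (M.N s y)) = 0 := by
    rw [← hA s hs' y, sub_apply, N.NN_ge hs' ht' h, N.NN hs', sub_self]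
  rw [h3, map_add, h4, add_zero]

lemma ContinuousNest.N_inj (N : ContinuousNest H) {s t : ℝ} (hs : s ∈ Icc (0:ℝ) 1)
    (ht : t ∈ Icc (0:ℝ) 1) (h : N.N s = N.N t) : s = t := by
  rcases lt_trichotomy s t with h1 | h1 | h1
  · exact absurd (h ▸ N.range_lt s t hs ht h1) (lt_irrefl _)
  · exact h1
  · exact absurd (h ▸ N.range_lt t s ht hs h1) (lt_irrefl _)

lemma auto_iso {N : ContinuousNest H} {θ : (H →L[ℂ] H) → H →L[ℂ] H} (h : N.IsAuto θ) :
    ∃ τ, IsoOn τ 0 1 0 1 ∧ ∀ t ∈ Icc (0:ℝ) 1, θ (N.N t) = N.N (τ t) := by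
  have h1 : ∀ t, ∃ r, t ∈ Icc (0:ℝ) 1 → r ∈ Icc (0:ℝ) 1 ∧ N.N r = θ (N.N t) := by
    intro t
    by_cases ht : t ∈ Icc (0:ℝ) 1
    · obtain ⟨r, hr, hr'⟩ := h.1.mapsTo (mem_image_of_mem N.N ht)
      exact ⟨r, fun _ => ⟨hr, hr'⟩⟩
    · exact ⟨0, fun h => absurd h ht⟩
  choose τ hτ using h1
  refine ⟨τ, ⟨?_, ?_⟩, fun t ht => (hτ t ht).2.symm⟩
  · intro s hs t ht hst
    by_contra hc
    push Not at hc
    have hne : τ t ≠ τ s := by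
      intro he
      have h2 : θ (N.N t) = θ (N.N s) := by rw [← (hτ t ht).2, ← (hτ s hs).2, he]
      have := N.N_inj ht hs (h.1.injOn (mem_image_of_mem _ ht) (mem_image_of_mem _ hs) h2)
      linarith
    have hlt := lt_of_le_of_ne hc hne
    obtain ⟨v, v1, v2, v3⟩ := N.exists_unit (hτ t ht).1.1 hlt (hτ s hs).1.2
    have h3 := (h.2 s t hs ht hst.le).2 v
    rw [← (hτ t ht).2, ← (hτ s hs).2, ContinuousLinearMap.reApplyInnerSelf_apply, sub_apply, v1, v2,
      zero_sub, inner_neg_left, map_neg, inner_self_eq_norm_sq] at h3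
    have : 0 < ‖v‖ := norm_pos_iff.2 v3
    nlinarith
  · ext r
    constructor
    · rintro ⟨t, ht, rfl⟩; exact (hτ t ht).1
    · intro hr
      obtain ⟨_, ⟨t, ht, rfl⟩, h2⟩ := h.1.surjOn (mem_image_of_mem N.N hr)
      exact ⟨t, ht, N.N_inj (hτ t ht).1 hr ((hτ t ht).2.trans h2)⟩

/-- The intervals on which `X` is essentially small. -/
def ContinuousNest.small (N : ContinuousNest H) (X : H →L[ℂ] H) (δ : ℝ) : Set (H →L[ℂ] H) :=
  {E | N.IsInterval E ∧ essNorm (E * X * E) < δ}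

/-- The net attached to an ideal. -/
def ContinuousNest.netOf (N : ContinuousNest H) (I : Set (H →L[ℂ] H)) : Set (Set (H →L[ℂ] H)) :=
  {P | N.IsIntervalFamily P ∧ ∃ X ∈ I, ∃ δ > 0, N.small X δ ⊆ P}

variable {N : ContinuousNest H} {I : Set (H →L[ℂ] H)}

/-- If `X = B Z A` then intervals small for `Z` are small for `X`. -/
lemma nest_small_sub {X Z A B : H →L[ℂ] H} (hA : Tri N N A) (hB : Tri N N B) (hZ : Tri N N Z)
    (h : X = B * Z * A) {δ c : ℝ} (hc : ‖B‖ * ‖A‖ < c) : N.small Z (δ / c) ⊆ N.small X δ := by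
  rintro _ ⟨⟨s, t, hs, hst, ht, rfl⟩, h1⟩
  refine ⟨⟨s, t, hs, hst, ht, rfl⟩, ?_⟩
  have hc0 : 0 < c := lt_of_le_of_lt (by positivity) hc
  set E := N.N t - N.N s with hE
  have hn : ‖E‖ ≤ 1 := N.int_norm hs hst ht
  have e : E * X * E = (E * B) * (E * Z * E) * (A * E) := by
    have h1 := int_mul (hB.mul hZ) hA hs hst ht
    have h2 := int_mul hB hZ hs hst ht
    rw [← hE] at h1 h2
    rw [h, h1, h2]
    simp only [mul_assoc]
  rw [e, show δ = c * (δ / c) by field_simp]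
  refine essNorm_mul_lt (lt_of_le_of_lt ?_ hc) h1
  have h2 : ‖E * B‖ ≤ ‖B‖ := (norm_mul_le _ _).trans (by nlinarith [norm_nonneg B])
  have h3 : ‖A * E‖ ≤ ‖A‖ := (norm_mul_le _ _).trans (by nlinarith [norm_nonneg A])
  gcongr

variable [SeparableSpace H]

lemma netOf_isNet (hI : N.IsIdeal I) : N.IsNet (N.netOf I) := by
  refine ⟨fun P hP => hP.1, ?_⟩
  rintro P ⟨-, X, hX, δ, hδ, hP⟩ Q ⟨-, Y, hY, δ', hδ', hQ⟩
  obtain ⟨E⟩ := exists_emb N N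
  have hA : ∀ i, E.A i ∈ N.alg := fun i => mem_alg_iff.2 (E.hA i)
  have hB : ∀ i, E.B i ∈ N.alg := fun i => mem_alg_iff.2 (E.hB i)
  set Z := E.A 0 * X * E.B 0 + E.A 1 * Y * E.B 1 with hZ
  have hZI : Z ∈ I := hI.2.2.1 _ (hI.2.2.2.2 _ (hB 0) _ (hI.2.2.2.2 _ (hA 0) _ hX).1).2 _
    (hI.2.2.2.2 _ (hB 1) _ (hI.2.2.2.2 _ (hA 1) _ hY).1).2
  have hX' : X = E.B 0 * Z * E.A 0 := by
    have : E.B 0 * Z * E.A 0 = (E.B 0 * E.A 0) * X * (E.B 0 * E.A 0) +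
        (E.B 0 * E.A 1) * Y * (E.B 1 * E.A 0) := by rw [hZ]; noncomm_ring
    rw [this]; simp [E.BA]
  have hY' : Y = E.B 1 * Z * E.A 1 := by
    have : E.B 1 * Z * E.A 1 = (E.B 1 * E.A 0) * X * (E.B 0 * E.A 1) +
        (E.B 1 * E.A 1) * Y * (E.B 1 * E.A 1) := by rw [hZ]; noncomm_ring
    rw [this]; simp [E.BA]
  have hZt := mem_alg_iff.1 (hI.1 hZI)
  have h1 := nest_small_sub (E.hA 0) (E.hB 0) hZt hX' (δ := δ) (lt_add_one _)
  have h2 := nest_small_sub (E.hA 1) (E.hB 1) hZt hY' (δ := δ') (lt_add_one _)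
  set a := δ / (‖E.B 0‖ * ‖E.A 0‖ + 1)
  set b := δ' / (‖E.B 1‖ * ‖E.A 1‖ + 1)
  have ha : 0 < a := by positivity
  have hb : 0 < b := by positivity
  have self : ∀ E : H →L[ℂ] H, ContinuousLinearMap.IsPositive (E - E) := fun E => by
    rw [sub_self]; exact ContinuousLinearMap.isPositive_zero
  refine ⟨N.small Z (min a b), ⟨fun F hF => hF.1, Z, hZI, _, lt_min ha hb, Subset.rfl⟩, ?_, ?_⟩
  · exact fun F hF => ⟨F, hP (h1 ⟨hF.1, hF.2.trans_le (min_le_left _ _)⟩), self F⟩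
  · exact fun F hF => ⟨F, hQ (h2 ⟨hF.1, hF.2.trans_le (min_le_right _ _)⟩), self F⟩

lemma netOf_stable (hI : N.IsStableIdeal I) : N.IsStableNet (N.netOf I) := by
  refine ⟨netOf_isNet hI.1, ?_⟩
  rintro θ hθ P ⟨hPf, X, hX, δ, hδ, hP⟩
  obtain ⟨τ, hτ, hθτ⟩ := auto_iso hθ
  obtain ⟨S, h1, h2, h3⟩ := exists_impl N hτ
  have hX' : (↑S : H →L[ℂ] H) * X * (↑S⁻¹ : H →L[ℂ] H) ∈ I := by
    rw [← hI.2.2 S h3]; exact mem_image_of_mem _ hX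
  have hIcc : ∀ {s t : ℝ}, 0 ≤ s → s ≤ t → t ≤ 1 → s ∈ Icc (0:ℝ) 1 ∧ t ∈ Icc (0:ℝ) 1 :=
    fun hs hst ht => ⟨⟨hs, hst.trans ht⟩, ⟨hs.trans hst, ht⟩⟩
  refine ⟨?_, _, hX', δ / (‖(↑S⁻¹ : H →L[ℂ] H)‖ * ‖(↑S : H →L[ℂ] H)‖ + 1), by positivity, ?_⟩
  · rintro _ ⟨s, t, hs, hst, ht, -, rfl⟩
    obtain ⟨hs', ht'⟩ := hIcc hs hst ht
    rw [hθτ s hs', hθτ t ht']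
    exact ⟨τ s, τ t, (hτ.mapsTo hs').1, hτ.mono.monotoneOn hs' ht' hst, (hτ.mapsTo ht').2, rfl⟩
  · rintro _ ⟨⟨s', t', hs, hst, ht, rfl⟩, h⟩
    obtain ⟨hs', ht'⟩ := hIcc hs hst ht
    obtain ⟨s, hs1, rfl⟩ : s' ∈ τ '' Icc 0 1 := by rw [hτ.surj]; exact hs'
    obtain ⟨t, ht1, rfl⟩ : t' ∈ τ '' Icc 0 1 := by rw [hτ.surj]; exact ht'
    have hst' : s ≤ t := (hτ.mono.le_iff_le hs1 ht1).1 hst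
    refine ⟨s, t, hs1.1, hst', ht1.2, hP ⟨⟨s, t, hs1.1, hst', ht1.2, rfl⟩, ?_⟩,
      by rw [hθτ s hs1, hθτ t ht1]⟩
    set c := ‖(↑S⁻¹ : H →L[ℂ] H)‖ * ‖(↑S : H →L[ℂ] H)‖ + 1 with hc
    have hc0 : 0 < c := by positivity
    set E := N.N t - N.N s with hE
    set E' := N.N (τ t) - N.N (τ s) with hE'
    have hXt := mem_alg_iff.1 (hI.1.1 hX)
    have hn : ‖E‖ ≤ 1 := N.int_norm hs1.1 hst' ht1.2
    have eX : X = (↑S⁻¹ : H →L[ℂ] H) * ((↑S * X * ↑S⁻¹) * ↑S) := by simp [mul_assoc]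
    have e : E * X * E = (E * ↑S⁻¹) * (E' * (↑S * X * ↑S⁻¹) * E') * (↑S * E) := by
      conv_lhs => rw [eX]
      rw [int_mul h2 (((h1.mul hXt).mul h2).mul h1) hs1.1 hst' ht1.2]
      have := int_mul ((h1.mul hXt).mul h2) h1 hs1.1 hst' ht1.2
      change E * ↑S⁻¹ * E' * _ * E = _
      change E' * _ * E = E' * _ * E' * _ * E at this
      simp only [mul_assoc] at this ⊢
      rw [this]
    rw [e, show δ = c * (δ / c) by field_simp]
    refine essNorm_mul_lt (lt_of_le_of_lt ?_ (lt_add_one _)) h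
    have h2 : ‖E * ↑S⁻¹‖ ≤ ‖(↑S⁻¹ : H →L[ℂ] H)‖ :=
      (norm_mul_le _ _).trans (by nlinarith [norm_nonneg (↑S⁻¹ : H →L[ℂ] H)])
    have h3 : ‖↑S * E‖ ≤ ‖(↑S : H →L[ℂ] H)‖ :=
      (norm_mul_le _ _).trans (by nlinarith [norm_nonneg (↑S : H →L[ℂ] H)])
    gcongr

/-- Reduction of the theorem to an approximation statement. -/
theorem reduction (hI : N.IsStableIdeal I) {K : ℝ}
    (hmain : ∀ Y ∈ N.alg, ∀ X ∈ I, ∀ δ > 0, ∀ ε > 0, N.small X δ ⊆ N.small Y ε →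
      ∃ Z ∈ I, ‖Y - Z‖ ≤ K * ε) :
    ∃ O : Set (Set (H →L[ℂ] H)), N.IsStableNet O ∧ I = N.kernel O := by
  refine ⟨N.netOf I, netOf_stable hI, Subset.antisymm ?_ ?_⟩
  · intro X hX
    exact ⟨hI.1.1 hX, fun ε hε => ⟨N.small X ε, ⟨fun F hF => hF.1, X, hX, ε, hε, Subset.rfl⟩,
      fun E hE => hE.2⟩⟩
  · rintro Y ⟨hY, h⟩
    rw [← hI.2.1.closure_eq, Metric.mem_closure_iff]
    intro r hr
    obtain ⟨P, ⟨hPf, X, hX, δ, hδ, hP⟩, h1⟩ := h (r / (|K| + 1)) (by positivity)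
    obtain ⟨Z, hZ, h2⟩ := hmain Y hY X hX δ hδ _ (by positivity)
      (fun E hE => ⟨hE.1, h1 E (hP hE)⟩)
    refine ⟨Z, hZ, ?_⟩
    rw [dist_eq_norm]
    refine h2.trans_lt ?_
    have : K * (r / (|K| + 1)) ≤ |K| * (r / (|K| + 1)) := by
      gcongr; exact le_abs_self K
    refine this.trans_lt ?_
    rw [mul_div_assoc', div_lt_iff₀ (by positivity)]
    nlinarith [abs_nonneg K]

end

section

lemma exists_iso_two {a b s t : ℝ} (ha : 0 < a) (hab : a < b) (hb : b < 1) (hs : 0 < s) (hst : s < t)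
    (ht : t < 1) : ∃ τ, IsoOn τ 0 1 0 1 ∧ τ a = s ∧ τ b = t := by
  obtain ⟨f, hf⟩ := IsoOn.linear ha hs
  obtain ⟨g, hg⟩ := IsoOn.linear hab hst
  obtain ⟨k, hk⟩ := IsoOn.linear hb ht
  have h1 := IsoOn.glue ha.le hab.le hf hg
  have h2 := IsoOn.glue (ha.le.trans hab.le) hb.le h1 hk
  refine ⟨_, h2, ?_, ?_⟩
  · simp [hab.le, hf.right ha.le]
  · simp [hab.not_ge, hg.right hab.le]

variable {N : ContinuousNest H} {I : Set (H →L[ℂ] H)}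

lemma exists_witness {X : H →L[ℂ] H} (hX : X ≠ 0) : ∃ a b : ℝ, 0 < a ∧ a < b ∧ b < 1 ∧
    ∃ u v, N.N b u = u ∧ N.N a v = 0 ∧ ⟪v, X u⟫_ℂ ≠ 0 := by
  have hX' : ∃ u v, ⟪v, X u⟫_ℂ ≠ 0 := by
    by_contra hc
    push Not at hc
    exact hX (ContinuousLinearMap.ext fun u => ext_inner_left ℂ fun v => by simpa using hc u v)
  obtain ⟨u, v, huv⟩ := hX'
  have h1 : Tendsto (fun r : ℝ => N.N (1 - r) u) (𝓝[Icc 0 1] 0) (𝓝 u) := by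
    have h := (N.contOn u 1 (by simp)).tendsto
    simp only [N.N_one, one_apply_eq_self] at h
    refine h.comp (tendsto_nhdsWithin_iff.2 ⟨?_, ?_⟩)
    · have : Tendsto (fun r : ℝ => 1 - r) (𝓝 0) (𝓝 (1 - 0)) :=
        tendsto_id.const_sub 1
      rw [sub_zero] at this
      exact this.mono_left nhdsWithin_le_nhds
    · filter_upwards [self_mem_nhdsWithin] with r hr
      exact ⟨by linarith [hr.2], by linarith [hr.1]⟩
  have h2 : Tendsto (fun r : ℝ => v - N.N r v) (𝓝[Icc 0 1] 0) (𝓝 v) := by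
    have h := (N.contOn v 0 (by simp)).tendsto
    simpa [N.N_zero] using h.const_sub v
  have h3 : Tendsto (fun r : ℝ => ⟪v - N.N r v, X (N.N (1 - r) u)⟫_ℂ) (𝓝[Icc 0 1] 0)
      (𝓝 ⟪v, X u⟫_ℂ) := h2.inner ((X.continuous.tendsto u).comp h1)
  have h4 := h3.eventually_ne huv
  rw [eventually_nhdsWithin_iff, Metric.eventually_nhds_iff] at h4
  obtain ⟨ρ, hρ, h5⟩ := h4
  set r := min (ρ / 2) (1 / 4) with hr
  have hr0 : 0 < r := by positivity
  have hr1 : r ≤ 1 / 4 := min_le_right _ _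
  have hr2 : r < ρ := (min_le_left _ _).trans_lt (by linarith)
  have h6 := h5 (y := r) (by simpa [abs_of_pos hr0] using hr2) ⟨hr0.le, by linarith⟩
  refine ⟨r, 1 - r, hr0, by linarith, by linarith, _, _, N.NN ⟨by linarith, by linarith⟩ u, ?_, h6⟩
  rw [map_sub, N.NN ⟨by linarith, by linarith⟩, sub_self]

lemma IsIdeal_smul (hI : N.IsIdeal I) {X : H →L[ℂ] H} (hX : X ∈ I) (c : ℂ) : c • X ∈ I := by
  have := (hI.2.2.2.2 (c • 1) (mem_alg_iff.2 (Tri.one.smul c)) X hX).1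
  simpa using this

theorem rk_mem [SeparableSpace H] (hI : N.IsStableIdeal I) (hI0 : I ≠ {0})
    {s t : ℝ} (hs : 0 ≤ s) (hst : s < t) (ht : t ≤ 1) {c d : H} (hc : N.N s c = c)
    (hd : N.N t d = 0) : rk c d ∈ I := by
  obtain ⟨X, hX, hX0⟩ : ∃ X ∈ I, X ≠ 0 := by
    by_contra h
    push Not at h
    exact hI0 (Subset.antisymm (fun X hX => h X hX) (by simpa using hI.1.2.1))
  obtain ⟨a, b, ha, hab, hb, u, v, hu, hv, huv⟩ := exists_witness (N := N) hX0
  have ha' : a ∈ Icc (0:ℝ) 1 := ⟨by linarith, by linarith⟩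
  have hb' : b ∈ Icc (0:ℝ) 1 := ⟨by linarith, by linarith⟩
  have hI1 : ∀ c d, N.N a c = c → N.N b d = 0 → rk c d ∈ I := by
    intro c d hc hd
    have h1 : rk c v * X * rk u d ∈ I := (hI.1.2.2.2.2 _ (mem_alg_iff.2 (rk_tri' hb' hu hd)) _
      (hI.1.2.2.2.2 _ (mem_alg_iff.2 (rk_tri' ha' hc hv)) _ hX).1).2
    have h2 : rk c v * X * rk u d = ⟪v, X u⟫_ℂ • rk c d := by
      rw [mul_assoc, mul_rk, rk_mul_rk]
    rw [h2] at h1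
    have := IsIdeal_smul hI.1 h1 (⟪v, X u⟫_ℂ)⁻¹
    rwa [smul_smul, inv_mul_cancel₀ huv, one_smul] at this
  have hz : (0 : H →L[ℂ] H) ∈ I := hI.1.2.1
  rcases hs.eq_or_lt with rfl | hs
  · rw [N.N_zero] at hc
    have : c = 0 := by simpa using hc.symm
    rw [this, show rk 0 d = (0 : H →L[ℂ] H) by ext; simp]; exact hz
  rcases ht.eq_or_lt with rfl | ht
  · rw [N.N_one] at hd
    have : d = 0 := by simpa using hd
    rw [this, show rk c 0 = (0 : H →L[ℂ] H) by ext; simp]; exact hz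
  obtain ⟨τ, hτ, hτa, hτb⟩ := exists_iso_two ha hab hb hs hst ht
  obtain ⟨S, h1, h2, h3⟩ := exists_impl N hτ
  have hc' : (N.rep τ hτ).N a c = c := by change N.N (τ a) c = c; rwa [hτa]
  have hd' : (N.rep τ hτ).N b d = 0 := by change N.N (τ b) d = 0; rwa [hτb]
  have h4 := hI1 _ _ (h2.mem ha' hc') (h1.perp hb' hd')
  rw [← hI.2.2 S h3]
  refine ⟨_, h4, ?_⟩
  simp only
  rw [← rk_mul, ← mul_rk]
  simp [mul_assoc]

end

section

namespace Lac
variable {M : ContinuousNest H} {ι : Type} {X : ι → H →L[ℂ] H} {η : ℝ} (L : Lac M X η)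

/-- The difference blocks. -/
noncomputable def dd (a b n : ℕ) : H →L[ℂ] H := L.T (n + a) - L.T (n - b)

lemma dd_apply (a b n : ℕ) (x : H) : L.dd a b n x = L.T (n + a) x - L.T (n - b) x := rfl

lemma dda (a b n : ℕ) : adjoint (L.dd a b n) = adjoint (L.T (n + a)) - adjoint (L.T (n - b)) := by
  rw [dd, map_sub]

lemma dd_norm (a b n : ℕ) : ‖L.dd a b n‖ ≤ 2 := by
  refine (norm_sub_le _ _).trans ?_
  linarith [L.Tn (n + a), L.Tn (n - b)]

lemma dda_norm (a b n : ℕ) : ‖adjoint (L.dd a b n)‖ ≤ 2 := by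
  rw [LinearIsometryEquiv.norm_map]; exact L.dd_norm a b n

lemma dd_tri (a b n : ℕ) : Tri M M (L.dd a b n) := (L.Tri_T _).sub (L.Tri_T _)

lemma dd_mem (a b n : ℕ) (x : H) : L.dd a b n x ∈ L.W (n + a) :=
  Submodule.sub_mem _ (L.T_mem _ _) (L.mono (by omega) (L.T_mem _ _))

lemma dda_mem (a b n : ℕ) (x : H) : adjoint (L.dd a b n) x ∈ L.W (n + a) := by
  rw [dda]
  exact Submodule.sub_mem _ (L.Ta_mem _ _) (L.mono (by omega) (L.Ta_mem _ _))

lemma dd_P {a b n m : ℕ} (h : n + a ≤ m) (x : H) : L.dd a b n (L.P m x) = L.dd a b n x := by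
  rw [dd_apply, dd_apply, L.T_P h, L.T_P (by omega)]

lemma dda_P {a b n m : ℕ} (h : n + a ≤ m) (x : H) :
    adjoint (L.dd a b n) (L.P m x) = adjoint (L.dd a b n) x := by
  rw [dda, sub_apply, sub_apply, L.Ta_P h, L.Ta_P (by omega)]

lemma pow_shift_le {b : ℕ} (hb : b ≤ 3) (n : ℕ) : (1 / 4 : ℝ) ^ (n - b) ≤ 64 * (1 / 4) ^ n := by
  have h1 : (1 / 4 : ℝ) ^ b * 64 ≥ 1 := by interval_cases b <;> norm_num
  have h2 : (1 / 4 : ℝ) ^ n ≥ (1 / 4 : ℝ) ^ (n - b) * (1 / 4) ^ b := by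
    rw [← pow_add]
    exact pow_le_pow_of_le_one (by norm_num) (by norm_num) (by omega)
  have h3 : (0 : ℝ) < (1 / 4 : ℝ) ^ (n - b) := by positivity
  nlinarith

lemma pow_shift_le' (a n : ℕ) : (1 / 4 : ℝ) ^ (n + a) ≤ (1 / 4) ^ n :=
  pow_le_pow_of_le_one (by norm_num) (by norm_num) (by omega)

lemma dd_small (hη : 0 ≤ η) {a b n : ℕ} (hb : b ≤ 3) {w : H} (hw : w ∈ L.W (n - b - 1)) :
    ‖L.dd a b n w‖ ≤ 300 * η * (1 / 4) ^ n * ‖w‖ := by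
  have h1 := L.close hη (show n - b - 1 ≤ n + a - 1 by omega) hw
  have h2 := L.close hη (show n - b - 1 ≤ n - b - 1 by omega) hw
  have h3 : L.dd a b n w = (w - L.T (n - b) w) - (w - L.T (n + a) w) := by
    rw [dd_apply]; abel
  rw [h3]
  refine (norm_sub_le _ _).trans ((add_le_add h2 h1).trans ?_)
  have h4 := mul_le_mul_of_nonneg_left (pow_shift_le hb n) (show 0 ≤ 4 * η * ‖w‖ by positivity)
  have h5 := mul_le_mul_of_nonneg_left (pow_shift_le' a n) (show 0 ≤ 4 * η * ‖w‖ by positivity)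
  have h6 : 0 ≤ η * ‖w‖ * (1 / 4 : ℝ) ^ n := by positivity
  nlinarith

lemma dda_small (hη : 0 ≤ η) {a b n : ℕ} (hb : b ≤ 3) {w : H} (hw : w ∈ L.W (n - b - 1)) :
    ‖adjoint (L.dd a b n) w‖ ≤ 300 * η * (1 / 4) ^ n * ‖w‖ := by
  have h1 := L.closea hη (show n - b - 1 ≤ n + a - 1 by omega) hw
  have h2 := L.closea hη (show n - b - 1 ≤ n - b - 1 by omega) hw
  have h3 : adjoint (L.dd a b n) w = (w - adjoint (L.T (n - b)) w) - (w - adjoint (L.T (n + a)) w) := by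
    rw [dda, sub_apply]; abel
  rw [h3]
  refine (norm_sub_le _ _).trans ((add_le_add h2 h1).trans ?_)
  have h4 := mul_le_mul_of_nonneg_left (pow_shift_le hb n) (show 0 ≤ 4 * η * ‖w‖ by positivity)
  have h5 := mul_le_mul_of_nonneg_left (pow_shift_le' a n) (show 0 ≤ 4 * η * ‖w‖ by positivity)
  have h6 : 0 ≤ η * ‖w‖ * (1 / 4 : ℝ) ^ n := by positivity
  nlinarith

lemma dd_left (hη : 0 ≤ η) {a b n : ℕ} (hb : b ≤ 3) :
    ‖L.dd a b n - L.dd (a + 1) (b + 1) n * L.dd a b n‖ ≤ 1000 * η * (1 / 4) ^ n := by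
  have e1 := L.TT hη (show n + a ≤ n + (a + 1) - 1 by omega)
  have e2 := L.TT hη (show n - b ≤ n + (a + 1) - 1 by omega)
  have e3 := L.TT' hη (show n - (b + 1) ≤ n + a - 1 by omega)
  have e4 := L.TT' hη (show n - (b + 1) ≤ n - b - 1 by omega)
  have h3 : L.dd a b n - L.dd (a + 1) (b + 1) n * L.dd a b n =
      ((L.T (n + a) - L.T (n + (a + 1)) * L.T (n + a)) -
        (L.T (n - b) - L.T (n + (a + 1)) * L.T (n - b))) -
      ((L.T (n - (b + 1)) - L.T (n - (b + 1)) * L.T (n + a)) -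
        (L.T (n - (b + 1)) - L.T (n - (b + 1)) * L.T (n - b))) := by
    simp only [dd]; noncomm_ring
  rw [h3]
  refine (norm_sub_le _ _).trans ((add_le_add (norm_sub_le _ _) (norm_sub_le _ _)).trans ?_)
  have h4 := mul_le_mul_of_nonneg_left (pow_shift_le hb n) (show 0 ≤ 4 * η by positivity)
  have h5 := mul_le_mul_of_nonneg_left (pow_shift_le' a n) (show 0 ≤ 4 * η by positivity)
  have h5' := mul_le_mul_of_nonneg_left (pow_shift_le' (a + 1) n) (show 0 ≤ 4 * η by positivity)
  have h6 : 0 ≤ η * (1 / 4 : ℝ) ^ n := by positivity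
  nlinarith

lemma dd_right (hη : 0 ≤ η) {a b n : ℕ} (hb : b ≤ 3) :
    ‖L.dd a b n - L.dd a b n * L.dd (a + 1) (b + 1) n‖ ≤ 1000 * η * (1 / 4) ^ n := by
  have e1 := L.TT' hη (show n + a ≤ n + (a + 1) - 1 by omega)
  have e2 := L.TT' hη (show n - b ≤ n + (a + 1) - 1 by omega)
  have e3 := L.TT hη (show n - (b + 1) ≤ n + a - 1 by omega)
  have e4 := L.TT hη (show n - (b + 1) ≤ n - b - 1 by omega)
  have h3 : L.dd a b n - L.dd a b n * L.dd (a + 1) (b + 1) n =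
      ((L.T (n + a) - L.T (n + a) * L.T (n + (a + 1))) -
        (L.T (n - b) - L.T (n - b) * L.T (n + (a + 1)))) -
      ((L.T (n - (b + 1)) - L.T (n + a) * L.T (n - (b + 1))) -
        (L.T (n - (b + 1)) - L.T (n - b) * L.T (n - (b + 1)))) := by
    simp only [dd]; noncomm_ring
  rw [h3]
  refine (norm_sub_le _ _).trans ((add_le_add (norm_sub_le _ _) (norm_sub_le _ _)).trans ?_)
  have h4 := mul_le_mul_of_nonneg_left (pow_shift_le hb n) (show 0 ≤ 4 * η by positivity)
  have h5 := mul_le_mul_of_nonneg_left (pow_shift_le' a n) (show 0 ≤ 4 * η by positivity)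
  have h5' := mul_le_mul_of_nonneg_left (pow_shift_le' (a + 1) n) (show 0 ≤ 4 * η by positivity)
  have h6 : 0 ≤ η * (1 / 4 : ℝ) ^ n := by positivity
  nlinarith

lemma dd_sq (hη : 0 ≤ η) (hη1 : η ≤ 1) {a b : ℕ} (ha : a ≤ 4) (hb : b ≤ 3) (z : H) (s : Finset ℕ) :
    ∑ n ∈ s, ‖L.dd a b n z‖ ^ 2 ≤ 1000 ^ 2 * ‖z‖ ^ 2 := by
  refine (L.quasi 4 (fun n => L.dd a b n) (a := 2) (b := 300) (by norm_num) (by norm_num)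
    (fun n x => ?_) (fun n x => L.dd_P (by omega) x) (fun n v hv => ?_) z s).trans ?_
  · exact (L.dd a b n).le_of_opNorm_le (L.dd_norm a b n) x
  · refine (L.dd_small hη hb (L.mono (by omega) hv)).trans ?_
    gcongr
    linarith
  · gcongr
    norm_num

lemma dda_sq (hη : 0 ≤ η) (hη1 : η ≤ 1) {a b : ℕ} (ha : a ≤ 4) (hb : b ≤ 3) (z : H) (s : Finset ℕ) :
    ∑ n ∈ s, ‖adjoint (L.dd a b n) z‖ ^ 2 ≤ 1000 ^ 2 * ‖z‖ ^ 2 := by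
  refine (L.quasi 4 (fun n => adjoint (L.dd a b n)) (a := 2) (b := 300) (by norm_num) (by norm_num)
    (fun n x => ?_) (fun n x => L.dda_P (by omega) x) (fun n v hv => ?_) z s).trans ?_
  · exact (adjoint (L.dd a b n)).le_of_opNorm_le (L.dda_norm a b n) x
  · refine (L.dda_small hη hb (L.mono (by omega) hv)).trans ?_
    gcongr
    linarith
  · gcongr
    norm_num

lemma bl1 (hη : 0 ≤ η) (hη1 : η ≤ 1) {U : ℕ → H →L[ℂ] H} {l : ℝ} (hl : 0 ≤ l) (s : Finset ℕ)
    (hU : ∀ n ∈ s, ‖U n‖ ≤ l) (z : H) :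
    ‖∑ n ∈ s, L.dd 2 1 n (U n (L.dd 4 3 n z))‖ ≤ 1000 ^ 2 * l * ‖z‖ := by
  set v := ∑ n ∈ s, L.dd 2 1 n (U n (L.dd 4 3 n z)) with hv
  have h1 : ‖v‖ ^ 2 ≤ ∑ n ∈ s, (l * ‖adjoint (L.dd 2 1 n) v‖) * ‖L.dd 4 3 n z‖ := by
    have : ‖v‖ ^ 2 = ‖⟪v, v⟫_ℂ‖ := by
      rw [inner_self_eq_norm_sq_to_K, norm_pow]; simp
    rw [this]
    nth_rw 2 [hv]
    rw [inner_sum]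
    refine (norm_sum_le _ _).trans (Finset.sum_le_sum fun n hn => ?_)
    rw [← adjoint_inner_left]
    refine (norm_inner_le_norm _ _).trans ?_
    have := (U n).le_of_opNorm_le (hU n hn) (L.dd 4 3 n z)
    nlinarith [norm_nonneg (adjoint (L.dd 2 1 n) v), norm_nonneg (L.dd 4 3 n z)]
  have h2 := Finset.sum_mul_sq_le_sq_mul_sq s (fun n => l * ‖adjoint (L.dd 2 1 n) v‖)
    (fun n => ‖L.dd 4 3 n z‖)
  have h3 : ∑ n ∈ s, (l * ‖adjoint (L.dd 2 1 n) v‖) ^ 2 ≤ l ^ 2 * (1000 ^ 2 * ‖v‖ ^ 2) := by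
    simp_rw [mul_pow]
    rw [← Finset.mul_sum]
    exact mul_le_mul_of_nonneg_left (L.dda_sq hη hη1 (by norm_num) (by norm_num) v s) (by positivity)
  have h4 := L.dd_sq hη hη1 (show 4 ≤ 4 by norm_num) (show 3 ≤ 3 by norm_num) z s
  have h5 : (‖v‖ ^ 2) ^ 2 ≤ (1000 ^ 2 * l * ‖z‖ * ‖v‖) ^ 2 := by
    calc (‖v‖ ^ 2) ^ 2 ≤ _ := pow_le_pow_left₀ (by positivity) h1 2
      _ ≤ _ := h2
      _ ≤ (l ^ 2 * (1000 ^ 2 * ‖v‖ ^ 2)) * (1000 ^ 2 * ‖z‖ ^ 2) :=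
        mul_le_mul h3 h4 (Finset.sum_nonneg fun _ _ => by positivity) (by positivity)
      _ = _ := by ring
  have h6 : ‖v‖ ^ 2 ≤ 1000 ^ 2 * l * ‖z‖ * ‖v‖ := by
    exact le_of_sq_le_sq h5 (by positivity)
  by_cases h0 : ‖v‖ = 0
  · rw [h0]; positivity
  · have : 0 < ‖v‖ := lt_of_le_of_ne (norm_nonneg _) (Ne.symm h0)
    nlinarith

/-- Operators moving the flag `W` by one step in both directions. -/
def Adm (A : H →L[ℂ] H) : Prop :=
  ∀ n, ∀ w ∈ L.W n, A w ∈ L.W (n + 1) ∧ adjoint A w ∈ L.W (n + 1)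

variable {A : H →L[ℂ] H}

lemma bl2 (hη : 0 ≤ η) (hA : L.Adm A) (n : ℕ) :
    ‖L.dd 1 0 n * A - L.dd 2 1 n * (L.dd 1 0 n * A * L.dd 3 2 n) * L.dd 4 3 n‖ ≤
      10000 * ‖A‖ * η * (1 / 4) ^ n := by
  have hq : 0 ≤ η * (1 / 4 : ℝ) ^ n := by positivity
  have e1 : ‖L.dd 1 0 n * A * (1 - L.T (n + 3))‖ ≤ 8 * ‖A‖ * η * (1 / 4) ^ n := by
    rw [← LinearIsometryEquiv.norm_map adjoint, adjoint_mul', adjoint_mul']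
    refine opNorm_le_bound _ (by positivity) fun x => ?_
    have hw : adjoint A (adjoint (L.dd 1 0 n) x) ∈ L.W (n + 1 + 1) := (hA _ _ (L.dda_mem _ _ _ x)).2
    have h1 := L.closea hη (show n + 1 + 1 ≤ n + 3 - 1 by omega) hw
    have h2 : adjoint (1 - L.T (n + 3)) = 1 - adjoint (L.T (n + 3)) := by
      rw [map_sub]; congr 1; exact ContinuousLinearMap.adjoint_id
    rw [h2]
    simp only [mul_apply_eq_comp, sub_apply, one_apply_eq_self]
    refine h1.trans ?_
    have h3 : ‖adjoint A (adjoint (L.dd 1 0 n) x)‖ ≤ ‖A‖ * (2 * ‖x‖) := by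
      refine ((adjoint A).le_opNorm _).trans ?_
      rw [LinearIsometryEquiv.norm_map]
      gcongr
      exact (adjoint (L.dd 1 0 n)).le_of_opNorm_le (L.dda_norm 1 0 n) x
    have h5 := mul_le_mul_of_nonneg_left (pow_shift_le' 3 n) (show 0 ≤ 4 * η by positivity)
    calc _ ≤ (4 * η * (1 / 4) ^ n) * (‖A‖ * (2 * ‖x‖)) :=
          mul_le_mul h5 h3 (norm_nonneg _) (by positivity)
      _ = _ := by ring
  have e2 : ‖L.dd 1 0 n * A * L.T (n - 2)‖ ≤ 300 * ‖A‖ * η * (1 / 4) ^ n := by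
    refine opNorm_le_bound _ (by positivity) fun x => ?_
    simp only [mul_apply_eq_comp]
    have hw : A (L.T (n - 2) x) ∈ L.W (n - 0 - 1) := by
      by_cases hn : 2 ≤ n
      · have := (hA _ _ (L.T_mem (n - 2) x)).1
        rwa [show n - 2 + 1 = n - 0 - 1 by omega] at this
      · rw [show n - 2 = 0 by omega, L.T0]; simp
    refine (L.dd_small hη (by norm_num) hw).trans ?_
    have h3 : ‖A (L.T (n - 2) x)‖ ≤ ‖A‖ * ‖x‖ :=
      (A.le_opNorm _).trans (by gcongr; exact L.T_norm _ x)
    calc _ ≤ 300 * η * (1 / 4) ^ n * (‖A‖ * ‖x‖) := by gcongr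
      _ = _ := by ring
  have e3 := L.dd_left hη (n := n) (show 0 ≤ 3 by norm_num) (a := 1)
  have e4 := L.dd_right hη (n := n) (show 2 ≤ 3 by norm_num) (a := 3)
  have key : L.dd 1 0 n * A - L.dd 2 1 n * (L.dd 1 0 n * A * L.dd 3 2 n) * L.dd 4 3 n =
      L.dd 1 0 n * A * (1 - L.T (n + 3)) + L.dd 1 0 n * A * L.T (n - 2) +
      ((L.dd 1 0 n - L.dd 2 1 n * L.dd 1 0 n) * (A * L.dd 3 2 n) +
        (L.dd 2 1 n * L.dd 1 0 n * A) * (L.dd 3 2 n - L.dd 3 2 n * L.dd 4 3 n)) := by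
    have : L.dd 1 0 n * A = L.dd 1 0 n * A * (1 - L.T (n + 3)) + L.dd 1 0 n * A * L.T (n - 2) +
      L.dd 1 0 n * A * L.dd 3 2 n := by
      rw [show L.dd 3 2 n = L.T (n + 3) - L.T (n - 2) from rfl]; noncomm_ring
    nth_rw 1 [this]
    noncomm_ring
  rw [key]
  have f3 : ‖(L.dd 1 0 n - L.dd 2 1 n * L.dd 1 0 n) * (A * L.dd 3 2 n)‖ ≤
      1000 * η * (1 / 4) ^ n * (‖A‖ * 2) := by
    refine (norm_mul_le _ _).trans (mul_le_mul e3 ((norm_mul_le _ _).trans ?_) (norm_nonneg _)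
      (by positivity))
    gcongr; exact L.dd_norm _ _ _
  have f4 : ‖(L.dd 2 1 n * L.dd 1 0 n * A) * (L.dd 3 2 n - L.dd 3 2 n * L.dd 4 3 n)‖ ≤
      (2 * 2 * ‖A‖) * (1000 * η * (1 / 4) ^ n) := by
    refine (norm_mul_le _ _).trans (mul_le_mul ((norm_mul_le _ _).trans ?_) e4 (norm_nonneg _)
      (by positivity))
    gcongr
    refine (norm_mul_le _ _).trans ?_
    exact mul_le_mul (L.dd_norm _ _ _) (L.dd_norm _ _ _) (norm_nonneg _) (by norm_num)
  refine (norm_add_le _ _).trans ((add_le_add (norm_add_le _ _) (norm_add_le _ _)).trans ?_)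
  have : 0 ≤ ‖A‖ * (η * (1 / 4 : ℝ) ^ n) := by positivity
  nlinarith

lemma half_pow {i j : ℕ} (h : i ≤ j) : (1 / 4 : ℝ) ^ j ≤ (1 / 2) ^ i * (1 / 2) ^ j := by
  rw [show (1 / 4 : ℝ) = 1 / 2 * (1 / 2) by norm_num, mul_pow]
  gcongr ?_ * _
  exact pow_le_pow_of_le_one (by norm_num) (by norm_num) h

lemma far (hη : 0 ≤ η) (hA : L.Adm A) {i j : ℕ} (h : i + 6 ≤ j ∨ j + 6 ≤ i) :
    ‖L.dd 1 0 i * A * L.dd 3 2 j‖ ≤ 600 * ‖A‖ * η * ((1 / 2) ^ i * (1 / 2) ^ j) := by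
  rcases h with h | h
  · rw [← LinearIsometryEquiv.norm_map adjoint, adjoint_mul', adjoint_mul']
    refine opNorm_le_bound _ (by positivity) fun x => ?_
    simp only [mul_apply_eq_comp]
    have hw : adjoint A (adjoint (L.dd 1 0 i) x) ∈ L.W (i + 1 + 1) := (hA _ _ (L.dda_mem _ _ _ x)).2
    refine (L.dda_small hη (by norm_num) (L.mono (by omega) hw)).trans ?_
    have h3 : ‖adjoint A (adjoint (L.dd 1 0 i) x)‖ ≤ ‖A‖ * (2 * ‖x‖) := by
      refine ((adjoint A).le_opNorm _).trans ?_
      rw [LinearIsometryEquiv.norm_map]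
      gcongr
      exact (adjoint (L.dd 1 0 i)).le_of_opNorm_le (L.dda_norm 1 0 i) x
    calc _ ≤ 300 * η * ((1 / 2) ^ i * (1 / 2) ^ j) * (‖A‖ * (2 * ‖x‖)) := by
          gcongr; exact half_pow (by omega)
      _ = _ := by ring
  · refine opNorm_le_bound _ (by positivity) fun x => ?_
    simp only [mul_apply_eq_comp]
    have hw : A (L.dd 3 2 j x) ∈ L.W (j + 3 + 1) := (hA _ _ (L.dd_mem _ _ _ x)).1
    refine (L.dd_small hη (by norm_num) (L.mono (by omega) hw)).trans ?_
    have h3 : ‖A (L.dd 3 2 j x)‖ ≤ ‖A‖ * (2 * ‖x‖) := by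
      refine (A.le_opNorm _).trans ?_
      gcongr
      exact (L.dd 3 2 j).le_of_opNorm_le (L.dd_norm 3 2 j) x
    calc _ ≤ 300 * η * ((1 / 2) ^ i * (1 / 2) ^ j) * (‖A‖ * (2 * ‖x‖)) := by
          gcongr; rw [mul_comm ((1 / 2 : ℝ) ^ i)]; exact half_pow (by omega)
      _ = _ := by ring

lemma sum_dd (K : ℕ) : ∑ n ∈ Finset.range K, L.dd 1 0 n = L.T K := by
  have := Finset.sum_range_sub L.T K
  rw [L.T0, sub_zero] at this
  exact this

end Lac
end

section

lemma tendsto_mul_compact {A : ℕ → H →L[ℂ] H} {K : H →L[ℂ] H} (hA : ∀ n, ‖A n‖ ≤ 2)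
    (hA0 : ∀ x, Tendsto (fun n => A n x) atTop (𝓝 0)) (hK : IsCompactOperator ⇑K) {e : ℝ}
    (he : 0 < e) : ∀ᶠ n in atTop, ‖A n * K‖ ≤ e := by
  obtain ⟨S, hS, hKS⟩ := IsCompactOperator.image_closedBall_subset_compact
    (f := (K : H →ₗ[ℂ] H)) (𝕜₁ := ℂ) hK 1
  obtain ⟨F, -, hF, hcov⟩ := hS.finite_cover_balls (show 0 < e / 4 by positivity)
  have h1 : ∀ᶠ n in atTop, ∀ y ∈ F, ‖A n y‖ < e / 2 := by
    rw [hF.eventually_all]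
    intro y _
    have := (hA0 y).norm
    rw [norm_zero] at this
    exact this.eventually (gt_mem_nhds (by positivity))
  filter_upwards [h1] with n hn
  refine ContinuousLinearMap.opNorm_le_of_unit_norm he.le fun x hx => ?_
  have h2 : K x ∈ S := hKS ⟨x, by simp [hx], rfl⟩
  have h3 := hcov h2
  simp only [mem_iUnion, Metric.mem_ball, dist_eq_norm] at h3
  obtain ⟨y, hy, hxy⟩ := h3
  have h4 : A n (K x) = A n (K x - y) + A n y := by rw [map_sub]; abel
  rw [mul_apply_eq_comp, h4]
  refine (norm_add_le _ _).trans ?_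
  have h5 := (A n).le_of_opNorm_le (hA n) (K x - y)
  have h6 := hn y hy
  linarith

namespace Lac
variable {N : ContinuousNest H} {ι : Type} {X : ι → H →L[ℂ] H} {η : ℝ} (L : Lac N X η)

/-- The compressed diagonal block. -/
noncomputable def bk (A : H →L[ℂ] H) (n : ℕ) : H →L[ℂ] H := L.dd 1 0 n * A * L.dd 3 2 n

lemma bk_norm (A : H →L[ℂ] H) (n : ℕ) : ‖L.bk A n‖ ≤ 4 * ‖A‖ := by
  refine (norm_mul_le _ _).trans ?_
  have h1 := norm_mul_le (L.dd 1 0 n) A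
  have h2 : ‖L.dd 1 0 n‖ * ‖A‖ ≤ 2 * ‖A‖ := by gcongr; exact L.dd_norm _ _ _
  have h3 : ‖L.dd 1 0 n * A‖ * ‖L.dd 3 2 n‖ ≤ (2 * ‖A‖) * 2 :=
    mul_le_mul (h1.trans h2) (L.dd_norm _ _ _) (norm_nonneg _) (by positivity)
  linarith

lemma bk_tri {A : H →L[ℂ] H} (hA : Tri N N A) (n : ℕ) : Tri N N (L.bk A n) :=
  ((L.dd_tri 1 0 n).mul hA).mul (L.dd_tri 3 2 n)

lemma T_compact (n : ℕ) : IsCompactOperator ⇑(L.T n) := by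
  have : ProperSpace (L.W n) := FiniteDimensional.proper ℂ (L.W n)
  let f : H →L[ℂ] L.W n := (L.T n).codRestrict (L.W n) (L.T_mem n)
  have h1 : IsCompactOperator ⇑f := isCompactOperator_of_locallyCompactSpace_dom f
  exact h1.clm_comp (L.W n).subtypeL

lemma upper (hη : 0 ≤ η) {Y : H →L[ℂ] H} (hY : Tri N N Y) {s t ε : ℝ} (hs : 0 ≤ s) (h : s ≤ t)
    (ht : t ≤ 1) (hY2 : essNorm ((N.N t - N.N s) * Y * (N.N t - N.N s)) < ε) :
    ∀ᶠ n in atTop, ‖(N.N t - N.N s) * L.bk Y n * (N.N t - N.N s)‖ < 5 * ε := by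
  set E := N.N t - N.N s with hE
  have hEn : ‖E‖ ≤ 1 := N.int_norm hs h ht
  obtain ⟨K, hK, hK2⟩ := exists_of_essNorm_lt hY2
  have hε : 0 < ε := lt_of_le_of_lt (norm_nonneg _) hK2
  have hc := tendsto_mul_compact (A := fun n => L.dd 1 0 n) (fun n => L.dd_norm 1 0 n) (fun x => by
    have h1 := L.tendsto_T hη x
    have h2 := ((tendsto_add_atTop_iff_nat 1).2 h1).sub h1
    rw [sub_self] at h2
    exact h2) hK (show 0 < ε / 4 by positivity)
  filter_upwards [hc] with n hn
  have e1 : E * L.bk Y n * E = E * L.dd 1 0 n * (E * Y * E) * (L.dd 3 2 n * E) := by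
    have h1 := int_mul ((L.dd_tri 1 0 n).mul hY) (L.dd_tri 3 2 n) hs h ht
    have h2 := int_mul (L.dd_tri 1 0 n) hY hs h ht
    rw [← hE] at h1 h2
    rw [bk, h1, h2]; noncomm_ring
  have e2 : E * L.bk Y n * E = E * L.dd 1 0 n * (E * Y * E - K) * (L.dd 3 2 n * E) +
      E * (L.dd 1 0 n * K) * (L.dd 3 2 n * E) := by rw [e1]; noncomm_ring
  have f1 : ‖E * L.dd 1 0 n‖ ≤ 2 := (norm_mul_le _ _).trans
    ((mul_le_mul hEn (L.dd_norm 1 0 n) (norm_nonneg _) zero_le_one).trans (by norm_num))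
  have f2 : ‖L.dd 3 2 n * E‖ ≤ 2 := (norm_mul_le _ _).trans
    ((mul_le_mul (L.dd_norm 3 2 n) hEn (norm_nonneg _) zero_le_two).trans (by norm_num))
  have f3 : ‖E * L.dd 1 0 n * (E * Y * E - K) * (L.dd 3 2 n * E)‖ ≤ 2 * ‖E * Y * E - K‖ * 2 :=
    (norm_mul_le _ _).trans (mul_le_mul ((norm_mul_le _ _).trans (by gcongr)) f2 (norm_nonneg _)
      (by positivity))
  have f4 : ‖E * (L.dd 1 0 n * K) * (L.dd 3 2 n * E)‖ ≤ 1 * (ε / 4) * 2 :=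
    (norm_mul_le _ _).trans (mul_le_mul ((norm_mul_le _ _).trans (mul_le_mul hEn hn (norm_nonneg _)
      zero_le_one)) f2 (norm_nonneg _) (by positivity))
  rw [e2]
  refine (norm_add_le _ _).trans_lt ?_
  linarith

lemma bl4 (hη : 0 ≤ η) (hη1 : η ≤ 1) {A : H →L[ℂ] H} (hA : L.Adm A) {U : ℕ → H →L[ℂ] H} {l : ℝ}
    (hl : 0 ≤ l) (s : Finset ℕ) (hU : ∀ n ∈ s, ‖U n‖ ≤ l) (z : H) :
    ‖∑ n ∈ s, (L.dd 1 0 n (A z) - L.dd 2 1 n ((L.bk A n - U n) (L.dd 4 3 n z)))‖ ≤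
      (1000 ^ 2 * l + 20000 * ‖A‖ * η) * ‖z‖ := by
  have h1 : ∀ n, L.dd 1 0 n (A z) - L.dd 2 1 n ((L.bk A n - U n) (L.dd 4 3 n z)) =
      (L.dd 1 0 n * A - L.dd 2 1 n * (L.dd 1 0 n * A * L.dd 3 2 n) * L.dd 4 3 n) z +
        L.dd 2 1 n (U n (L.dd 4 3 n z)) := by
    intro n
    simp only [sub_apply, mul_apply_eq_comp, bk, map_sub]
    abel
  simp_rw [h1]
  rw [Finset.sum_add_distrib]
  refine (norm_add_le _ _).trans ?_
  have h2 := L.bl1 hη hη1 hl s hU z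
  have h3 : ‖∑ n ∈ s, (L.dd 1 0 n * A - L.dd 2 1 n * (L.dd 1 0 n * A * L.dd 3 2 n) * L.dd 4 3 n) z‖
      ≤ ∑ n ∈ s, (10000 * ‖A‖ * η * ‖z‖) * (1 / 4) ^ n := by
    refine (norm_sum_le _ _).trans (Finset.sum_le_sum fun n _ => ?_)
    refine (ContinuousLinearMap.le_of_opNorm_le _ (L.bl2 hη hA n) z).trans (le_of_eq (by ring))
  have h4 : ∑ n ∈ s, (1 / 4 : ℝ) ^ n ≤ 2 := by
    have hs : Summable (fun n : ℕ => (1 / 4 : ℝ) ^ n) :=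
      summable_geometric_of_lt_one (by norm_num) (by norm_num)
    refine (hs.sum_le_tsum s fun _ _ => by positivity).trans ?_
    rw [tsum_geometric_of_lt_one (by norm_num) (by norm_num)]; norm_num
  rw [← Finset.mul_sum] at h3
  have h5 := mul_le_mul_of_nonneg_left h4 (show 0 ≤ 10000 * ‖A‖ * η * ‖z‖ by positivity)
  linarith

lemma lower (hη : 0 ≤ η) (hη1 : η ≤ 1) {A : H →L[ℂ] H} (hA : L.Adm A) (hAt : Tri N N A)
    {s t l : ℝ} (hs : 0 ≤ s) (h : s ≤ t) (ht : t ≤ 1) (hl : 0 ≤ l) {n0 : ℕ}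
    (hb : ∀ n, n0 ≤ n → ‖(N.N t - N.N s) * L.bk A n * (N.N t - N.N s)‖ ≤ l) :
    essNorm ((N.N t - N.N s) * A * (N.N t - N.N s)) ≤ 1000 ^ 2 * l + 20000 * ‖A‖ * η := by
  set E := N.N t - N.N s with hE
  have hEn : ‖E‖ ≤ 1 := N.int_norm hs h ht
  have hEz : ∀ z, ‖E z‖ ≤ ‖z‖ := fun z => by simpa using E.le_of_opNorm_le hEn z
  have hK : IsCompactOperator ⇑(E * L.T n0 * A * E) :=
    ((L.T_compact n0).comp_clm (A * E)).clm_comp E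
  refine (essNorm_le hK).trans ?_
  refine opNorm_le_bound _ (by positivity) fun z => ?_
  have hlim : Tendsto (fun K => ‖E (L.T K (A (E z))) - E (L.T n0 (A (E z)))‖) atTop
      (𝓝 ‖(E * A * E - E * L.T n0 * A * E) z‖) :=
    (((E.continuous.tendsto _).comp (L.tendsto_T hη (A (E z)))).sub_const _).norm
  refine le_of_tendsto hlim ?_
  filter_upwards [eventually_ge_atTop n0] with K hK
  have h1 := L.bl4 hη hη1 hA hl (Finset.Ico n0 K) (U := fun n => E * L.bk A n * E)
    (fun n hn => hb n (Finset.mem_Ico.1 hn).1) (E z)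
  have h2 : E (∑ n ∈ Finset.Ico n0 K, (L.dd 1 0 n (A (E z)) -
      L.dd 2 1 n ((L.bk A n - E * L.bk A n * E) (L.dd 4 3 n (E z))))) =
      E (L.T K (A (E z))) - E (L.T n0 (A (E z))) := by
    have h3 : ∀ n, E (L.dd 2 1 n ((L.bk A n - E * L.bk A n * E) (L.dd 4 3 n (E z)))) = 0 := by
      intro n
      have g1 := int_mul ((L.dd_tri 2 1 n).mul (L.bk_tri hAt n)) (L.dd_tri 4 3 n) hs h ht
      have g2 := int_mul (L.dd_tri 2 1 n) (L.bk_tri hAt n) hs h ht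
      rw [← hE] at g1 g2
      rw [g2] at g1
      have := congrArg (fun T => T z) g1
      simp only [mul_apply_eq_comp] at this
      simp only [sub_apply, mul_apply_eq_comp, map_sub]
      rw [this, sub_self]
    rw [map_sum]
    simp_rw [map_sub, h3, sub_zero]
    rw [← map_sum, ← map_sub]
    congr 1
    have h4 := Finset.sum_Ico_eq_sub (fun n => L.dd 1 0 n) hK
    rw [sum_dd, sum_dd] at h4
    have := congrArg (fun T => T (A (E z))) h4
    simpa [sum_apply] using this
  rw [← h2]
  refine (hEz _).trans (h1.trans ?_)
  gcongr
  exact hEz z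

end Lac
end

section

lemma parrott_core {T P C : H →L[ℂ] H} {l : ℝ}
    (hPs : ∀ x y, ⟪P x, y⟫_ℂ = ⟪x, P y⟫_ℂ) (hT : ∀ x, ‖T x‖ ≤ l * ‖x‖) (hl : 0 ≤ l)
    (hcol : ∀ x, P x = x → ‖T x‖ ^ 2 + ‖C x‖ ^ 2 ≤ l ^ 2 * ‖x‖ ^ 2) {x y z : H}
    (hx : P x = x) (hz : P z = z) (hy : P y = 0)
    (hz2 : ∀ x, P x = x → (l ^ 2 : ℂ) * ⟪x, z⟫_ℂ = ⟪T x, T z + T y⟫_ℂ) :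
    ‖T x + T y‖ ^ 2 + ‖C (x - z)‖ ^ 2 ≤ l ^ 2 * (‖x‖ ^ 2 + ‖y‖ ^ 2) := by
  have h1 := hcol (x - z) (by rw [map_sub, hx, hz])
  have hcast : ∀ w : ℂ, RCLike.re ((l ^ 2 : ℂ) * w) = l ^ 2 * RCLike.re w := by
    intro w
    rw [← Complex.ofReal_pow]
    exact RCLike.re_ofReal_mul _ _
  have h2 := congrArg RCLike.re (hz2 x hx)
  have h3 := congrArg RCLike.re (hz2 z hz)
  rw [hcast, inner_add_right, map_add] at h2 h3
  rw [inner_self_eq_norm_sq, inner_self_eq_norm_sq] at h3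
  have h4 : ⟪z, y⟫_ℂ = 0 := by rw [← hz, hPs, hy, inner_zero_right]
  have h5 := hT (z + y)
  have h6 : ‖T (z + y)‖ ^ 2 ≤ l ^ 2 * ‖z + y‖ ^ 2 := by
    rw [← mul_pow]; exact pow_le_pow_left₀ (norm_nonneg _) h5 2
  rw [norm_add_sq (𝕜 := ℂ) z y, h4, map_add, norm_add_sq (𝕜 := ℂ) (T z)] at h6
  simp only [map_zero, mul_zero, add_zero] at h6
  rw [map_sub T, norm_sub_sq (𝕜 := ℂ) (T x), norm_sub_sq (𝕜 := ℂ) x] at h1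
  rw [norm_add_sq (𝕜 := ℂ) (T x)]
  nlinarith

lemma exists_resolvent {B : H →L[ℂ] H} {l : ℝ} (hl : 0 < l) (hB : ‖B‖ < l ^ 2) :
    ∃ G : H →L[ℂ] H, ∀ x, (l ^ 2 : ℂ) • G x = B (G x) + x := by
  have hl2 : (l ^ 2 : ℂ) ≠ 0 := by exact_mod_cast (pow_pos hl 2).ne'
  have hn : ‖((l ^ 2 : ℂ)⁻¹) • B‖ < 1 := by
    rw [norm_smul, norm_inv, norm_pow, Complex.norm_real, Real.norm_of_nonneg hl.le,
      inv_mul_lt_iff₀ (by positivity), mul_one]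
    exact hB
  let u := Units.oneSub _ hn
  refine ⟨((l ^ 2 : ℂ)⁻¹) • (↑u⁻¹ : H →L[ℂ] H), fun x => ?_⟩
  have h1 : (↑u : H →L[ℂ] H) * ↑u⁻¹ = 1 := u.mul_inv
  have h2 := congrArg (fun T : H →L[ℂ] H => T x) h1
  simp only [u, Units.val_oneSub, mul_apply_eq_comp, sub_apply, one_apply_eq_self, smul_apply] at h2
  rw [smul_apply, smul_smul, mul_inv_cancel₀ hl2, one_smul, map_smul]
  rw [sub_eq_iff_eq_add] at h2
  rw [add_comm]
  exact h2

lemma parrott {T P C : H →L[ℂ] H} {l l1 : ℝ} (hP : ∀ x, P (P x) = P x)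
    (hPs : ∀ x y, ⟪P x, y⟫_ℂ = ⟪x, P y⟫_ℂ) (hPn : ‖P‖ ≤ 1) (hCP : ∀ x, C (P x) = C x)
    (hTC : ∀ x y, ⟪T x, C y⟫_ℂ = 0) (hT : ‖T‖ ≤ l1) (hl1 : l1 < l)
    (hcol : ∀ x, P x = x → ‖T x‖ ^ 2 + ‖C x‖ ^ 2 ≤ l ^ 2 * ‖x‖ ^ 2) :
    ∃ R : H →L[ℂ] H, (∀ x, R (P x) = 0) ∧ ‖T + C + C * R‖ ≤ l := by
  have hl10 : 0 ≤ l1 := (norm_nonneg _).trans hT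
  have hl : 0 < l := by linarith
  have hB : ‖P * (adjoint T * T) * P‖ < l ^ 2 := by
    have h1 : ‖adjoint T * T‖ ≤ l1 * l1 := by
      refine (norm_mul_le _ _).trans ?_
      rw [LinearIsometryEquiv.norm_map]
      exact mul_le_mul hT hT (norm_nonneg _) hl10
    have h2 : ‖P * (adjoint T * T) * P‖ ≤ 1 * (l1 * l1) * 1 :=
      (norm_mul_le _ _).trans (mul_le_mul ((norm_mul_le _ _).trans (mul_le_mul hPn h1 (norm_nonneg _)
        zero_le_one)) hPn (norm_nonneg _) (by positivity))
    nlinarith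
  obtain ⟨G, hG⟩ := exists_resolvent hl hB
  have hl2 : (l ^ 2 : ℂ) ≠ 0 := by exact_mod_cast (pow_pos hl 2).ne'
  refine ⟨-(G * P * adjoint T * T * (1 - P)), fun x => ?_, ?_⟩
  · simp [hP]
  refine opNorm_le_bound _ hl.le fun w => ?_
  set y := w - P w with hy
  set x := P w with hx
  set z := G (P (adjoint T (T y))) with hz
  have hPx : P x = x := hP w
  have hPy : P y = 0 := by rw [hy, map_sub, hP, sub_self]
  have hGz := hG (P (adjoint T (T y)))
  rw [← hz] at hGz
  simp only [mul_apply_eq_comp] at hGz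
  have hPz : P z = z := by
    have h1 : P ((l ^ 2 : ℂ) • z) = (l ^ 2 : ℂ) • z := by
      rw [hGz, map_add, hP, hP]
    rw [map_smul] at h1
    exact (smul_right_injective H hl2) h1
  have hz2 : ∀ x, P x = x → (l ^ 2 : ℂ) * ⟪x, z⟫_ℂ = ⟪T x, T z + T y⟫_ℂ := by
    intro x hx
    rw [← inner_smul_right, hGz, hPz, inner_add_right, ← hPs, ← hPs, hx,
      adjoint_inner_right, adjoint_inner_right,
      inner_add_right]
  have key := parrott_core hPs (fun x => T.le_of_opNorm_le (hT.trans hl1.le) x) hl.le hcol hPx hPz hPy hz2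
  have e1 : (T + C + C * -(G * P * adjoint T * T * (1 - P))) w = (T x + T y) + C (x - z) := by
    have : (T + C + C * -(G * P * adjoint T * T * (1 - P))) w = T w + C w - C z := by
      simp only [add_apply, mul_apply_eq_comp, neg_apply, sub_apply, one_apply_eq_self, map_neg]
      rw [hz, hy]; abel
    rw [this, ← map_add, show x + y = w by rw [hy]; abel, map_sub, hx, hCP]; abel
  have e2 : ‖(T x + T y) + C (x - z)‖ ^ 2 = ‖T x + T y‖ ^ 2 + ‖C (x - z)‖ ^ 2 := by
    rw [norm_add_sq (𝕜 := ℂ), ← map_add, hTC]; simp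
  have e3 : ‖w‖ ^ 2 = ‖x‖ ^ 2 + ‖y‖ ^ 2 := by
    have h0 : ⟪x, y⟫_ℂ = 0 := by rw [← hPx, hPs, hPy, inner_zero_right]
    rw [show w = x + y by rw [hy]; abel, norm_add_sq (𝕜 := ℂ), h0]; simp
  rw [e1]
  refine le_of_sq_le_sq ?_ (by positivity)
  rw [e2, mul_pow, e3]
  exact key

lemma stair (N : ContinuousNest H) (Q : H →L[ℂ] H) {m : ℕ} {t : ℕ → ℝ} (hmono : Monotone t)
    (ht : ∀ i, t i ∈ Icc (0:ℝ) 1) (htm : t m = 1) {k : ℕ → ℕ} (hk : Monotone k) {e : ℝ}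
    (he : 0 ≤ e) (hcor : ∀ i, ‖(1 - N.N (t i)) * Q * N.N (t (k i))‖ ≤ e) (r : ℕ) (hr : r ≤ m) :
    ∀ l, e < l → ∃ T : H →L[ℂ] H, ‖T‖ ≤ l ∧ (∀ x, N.N (t (m - r)) (T x) = 0) ∧
      (∀ x, T (N.N (t (k (m - r))) x) =
        Q (N.N (t (k (m - r))) x) - N.N (t (m - r)) (Q (N.N (t (k (m - r))) x))) ∧
      ∀ j, m - r ≤ j → j < m → ∃ R : H →L[ℂ] H,
        (∀ x, N.N (t (j + 1)) (T x) - N.N (t j) (T x) =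
          N.N (t (j + 1)) (Q (R x)) - N.N (t j) (Q (R x))) ∧
        ∀ x, R (N.N (t (k j)) x) = N.N (t (k j)) x := by
  induction r with
  | zero =>
    intro l hl
    refine ⟨0, by simpa using he.trans hl.le, by simp, ?_, ?_⟩
    · intro x; rw [Nat.sub_zero, htm, N.N_one]; simp
    · intro j h1 h2; omega
  | succ r ih =>
    intro l hl
    obtain ⟨T, hTn, hT0, hT1, hT2⟩ := ih (by omega) ((e + l) / 2) (by linarith)
    obtain ⟨i, hi⟩ : ∃ i, m - r = i + 1 := ⟨m - r - 1, by omega⟩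
    have hi' : m - (r + 1) = i := by omega
    rw [hi'] at *
    rw [hi] at hT0 hT1 hT2
    have hii : t i ≤ t (i + 1) := hmono (by omega)
    have hki : t (k i) ≤ t (k (i + 1)) := hmono (hk (by omega))
    set P := N.N (t (k i)) with hPd
    set C := (N.N (t (i + 1)) - N.N (t i)) * Q * P with hCd
    have hCx : ∀ x, C x = N.N (t (i + 1)) (Q (P x)) - N.N (t i) (Q (P x)) := fun x => by
      simp [hCd]
    have hPP : ∀ x, P (P x) = P x := N.NN (ht _)
    have hTP : ∀ x, T (P x) = Q (P x) - N.N (t (i + 1)) (Q (P x)) := by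
      intro x
      have := hT1 (P x)
      rwa [hPd, N.NN_ge (ht _) (ht _) hki] at this
    have hNC : ∀ x, N.N (t (i + 1)) (C x) = C x := by
      intro x
      rw [hCx, map_sub, N.NN (ht _), N.NN_ge (ht _) (ht _) hii]
    have hNC0 : ∀ x, N.N (t i) (C x) = 0 := by
      intro x
      rw [hCx, map_sub, N.NN (ht _), N.NN_le (ht _) (ht _) hii, sub_self]
    have hTC : ∀ x y, ⟪T x, C y⟫_ℂ = 0 := by
      intro x y
      rw [← hNC, ← N.inner_left (ht _), hT0, inner_zero_left]
    have hcol : ∀ x, P x = x → ‖T x‖ ^ 2 + ‖C x‖ ^ 2 ≤ l ^ 2 * ‖x‖ ^ 2 := by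
      intro x hx
      have h1 : T x + C x = ((1 - N.N (t i)) * Q * P) x := by
        simp only [mul_apply_eq_comp, sub_apply, one_apply_eq_self]
        have := hTP x
        rw [hx] at this
        rw [this, hCx, hx]; abel
      have h2 : ‖T x + C x‖ ^ 2 = ‖T x‖ ^ 2 + ‖C x‖ ^ 2 := by
        rw [norm_add_sq (𝕜 := ℂ), hTC]; simp
      rw [← h2, h1, ← mul_pow]
      refine pow_le_pow_left₀ (norm_nonneg _) (ContinuousLinearMap.le_of_opNorm_le _ ?_ x) 2
      exact (hcor i).trans hl.le
    obtain ⟨R, hR, hn⟩ := parrott hPP (N.inner_left (ht _)) (N.opNorm_le (ht _))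
      (fun x => by rw [hCx, hCx, hPP]) hTC hTn (by linarith) hcol
    refine ⟨T + C + C * R, hn, ?_, ?_, ?_⟩
    · intro x
      simp only [add_apply, mul_apply_eq_comp, map_add, hNC0, add_zero]
      exact N.perp_mono (ht _) (ht _) hii (hT0 x)
    · intro x
      simp only [add_apply, mul_apply_eq_comp, hR, map_zero, add_zero]
      rw [hTP, hCx, hPP]; abel
    · intro j hj hjm
      rcases Nat.eq_or_lt_of_le hj with rfl | hj'
      · refine ⟨P * (1 + R), fun x => ?_, fun x => ?_⟩
        · simp only [add_apply, mul_apply_eq_comp, map_add, hNC, hNC0, hT0,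
            N.perp_mono (ht _) (ht _) hii (hT0 x), one_apply_eq_self]
          rw [hCx, hCx]; abel
        · rw [← hPd, mul_apply_eq_comp, add_apply, hR, one_apply_eq_self, add_zero, hPP]
      · obtain ⟨R', h1, h2⟩ := hT2 j hj' hjm
        refine ⟨R', fun x => ?_, h2⟩
        rw [← h1]
        have h3 : ∀ x, N.N (t j) (C x) = C x := fun x =>
          N.mem_mono (ht _) (ht _) (hmono hj') (hNC x)
        have h4 : ∀ x, N.N (t (j + 1)) (C x) = C x := fun x =>
          N.mem_mono (ht _) (ht _) (hmono (by omega)) (hNC x)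
        simp only [add_apply, mul_apply_eq_comp, map_add, h3, h4]
        abel

end

section

/-- The uniform grid. -/
noncomputable def grid (m i : ℕ) : ℝ := min ((i : ℝ) / m) 1

lemma grid_mem (m i : ℕ) : grid m i ∈ Icc (0:ℝ) 1 :=
  ⟨le_min (by positivity) zero_le_one, min_le_right _ _⟩

lemma grid_mono (m : ℕ) : Monotone (grid m) := fun i j h =>
  min_le_min_right _ (by gcongr)

lemma grid_zero (m : ℕ) : grid m 0 = 0 := by simp [grid]

lemma grid_self {m : ℕ} (hm : 0 < m) : grid m m = 1 := by
  have : (m : ℝ) ≠ 0 := by positivity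
  simp [grid, this]

lemma grid_step (m i : ℕ) : dist (grid m (i + 1)) (grid m i) ≤ 1 / m := by
  have h1 := grid_mono m (Nat.le_succ i)
  rw [Real.dist_eq, abs_of_nonneg (by simpa using h1)]
  have h2 : ((i + 1 : ℕ) : ℝ) / m = i / m + 1 / m := by push_cast; ring
  have h3 : (0:ℝ) ≤ 1 / m := by positivity
  simp only [grid, h2]
  rcases le_total ((i : ℝ) / m) 1 with h | h
  · rw [min_eq_left h]; linarith [min_le_left ((i : ℝ) / m + 1 / m) 1]
  · rw [min_eq_right h]; linarith [min_le_right ((i : ℝ) / m + 1 / m) 1]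

lemma strips (N : ContinuousNest H) {Q : H →L[ℂ] H} (hQ : IsCompactOperator ⇑Q) {e : ℝ} (he : 0 < e) :
    ∀ᶠ m in atTop, ∀ i, ‖(N.N (grid m (i + 1)) - N.N (grid m i)) * Q‖ ≤ e := by
  classical
  have hc : ∀ m, ∃ i, (∃ i, e < ‖(N.N (grid m (i + 1)) - N.N (grid m i)) * Q‖) →
      e < ‖(N.N (grid m (i + 1)) - N.N (grid m i)) * Q‖ := by
    intro m
    by_cases h : ∃ i, e < ‖(N.N (grid m (i + 1)) - N.N (grid m i)) * Q‖
    · exact ⟨h.choose, fun _ => h.choose_spec⟩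
    · exact ⟨0, fun h' => absurd h' h⟩
  choose i hi using hc
  have h1 := tendsto_mul_compact (A := fun m => N.N (grid m (i m + 1)) - N.N (grid m (i m)))
    (fun m => (N.int_norm (grid_mem _ _).1 (grid_mono m (Nat.le_succ _)) (grid_mem _ _).2).trans
      one_le_two) (fun x => ?_) hQ he
  · filter_upwards [h1] with m hm j
    by_contra hcon
    exact absurd (hi m ⟨j, not_le.1 hcon⟩) (not_lt.2 hm)
  · have hu := isCompact_Icc.uniformContinuousOn_of_continuous (N.contOn x)
    rw [Metric.uniformContinuousOn_iff] at hu
    rw [Metric.tendsto_atTop]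
    intro r hr
    obtain ⟨δ, hδ, h2⟩ := hu r hr
    obtain ⟨n, hn⟩ := exists_nat_one_div_lt hδ
    refine ⟨n + 1, fun m hm => ?_⟩
    rw [dist_zero_right]
    have h3 := h2 _ (grid_mem m (i m + 1)) _ (grid_mem m (i m)) (lt_of_le_of_lt (grid_step _ _)
      (lt_of_le_of_lt ?_ hn))
    · rwa [dist_eq_norm] at h3
    · have : (n + 1 : ℝ) ≤ m := by exact_mod_cast hm
      gcongr

lemma fin_compact {Q : H →L[ℂ] H} {W : Submodule ℂ H} [FiniteDimensional ℂ W] (hW : ∀ x, Q x ∈ W) :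
    IsCompactOperator ⇑Q := by
  have : ProperSpace W := FiniteDimensional.proper ℂ W
  let f : H →L[ℂ] W := Q.codRestrict W hW
  have h1 : IsCompactOperator ⇑f := isCompactOperator_of_locallyCompactSpace_dom f
  exact h1.clm_comp W.subtypeL

lemma corner_eq (N : ContinuousNest H) {Q : H →L[ℂ] H} (hQ : Tri N N Q) {s t : ℝ}
    (hs : s ∈ Icc (0:ℝ) 1) (ht : t ∈ Icc (0:ℝ) 1) (h : s ≤ t) :
    (1 - N.N s) * Q * N.N t = (N.N t - N.N s) * Q * (N.N t - N.N s) := by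
  ext x
  simp only [mul_apply_eq_comp, sub_apply, one_apply_eq_self, map_sub]
  rw [hQ t ht, hQ s hs, N.mem_mono hs ht h (hQ s hs x)]; abel

lemma corner_zero (N : ContinuousNest H) {Q : H →L[ℂ] H} (hQ : Tri N N Q) {s t : ℝ}
    (hs : s ∈ Icc (0:ℝ) 1) (ht : t ∈ Icc (0:ℝ) 1) (h : t ≤ s) :
    (1 - N.N s) * Q * N.N t = 0 := by
  ext x
  simp only [mul_apply_eq_comp, sub_apply, one_apply_eq_self, zero_apply]
  rw [N.mem_mono ht hs h (hQ t ht x), sub_self]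

lemma one_sub_N_norm (N : ContinuousNest H) {s : ℝ} (hs : s ∈ Icc (0:ℝ) 1) : ‖1 - N.N s‖ ≤ 1 := by
  have := N.int_norm hs.1 hs.2 le_rfl
  rwa [N.N_one] at this

lemma extract (N : ContinuousNest H) {Q : H →L[ℂ] H} (hQ : Tri N N Q) {W : Submodule ℂ H}
    [FiniteDimensional ℂ W] (hW : ∀ x, Q x ∈ W) (hW' : ∀ x, adjoint Q x ∈ W) {e : ℝ} (he : 0 < e) :
    ∃ (κ : Type) (_ : Fintype κ) (c d : κ → H) (s t : κ → ℝ) (Q' : H →L[ℂ] H), ‖Q - Q'‖ ≤ 2 * e ∧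
      Orthonormal ℂ c ∧ (∀ l, d l = adjoint Q' (c l)) ∧
      (∀ l, 0 ≤ s l ∧ s l < t l ∧ t l ≤ 1 ∧ N.N (s l) (c l) = c l ∧ N.N (t l) (d l) = 0 ∧
        e / 2 < ‖(N.N (t l) - N.N (s l)) * Q * (N.N (t l) - N.N (s l))‖) ∧
      ∀ z, Q' z = ∑ l, rk (c l) (d l) z := by
  classical
  obtain ⟨m, hm1, hm2, hm0⟩ := ((strips N (fin_compact hW) (show 0 < e / 4 by positivity)).and
    ((strips N (fin_compact hW') (show 0 < e / 4 by positivity)).and (eventually_gt_atTop 0))).exists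
  set t := grid m with htd
  have ht : ∀ i, t i ∈ Icc (0:ℝ) 1 := grid_mem m
  have hmono : Monotone t := grid_mono m
  have hm2' : ∀ i, ‖Q * (N.N (t (i + 1)) - N.N (t i))‖ ≤ e / 4 := by
    intro i
    rw [← LinearIsometryEquiv.norm_map adjoint, adjoint_mul']
    have : adjoint (N.N (t (i + 1)) - N.N (t i)) = N.N (t (i + 1)) - N.N (t i) :=
      (N.selfAdjoint _ (ht _)).sub (N.selfAdjoint _ (ht _))
    rw [this]; exact hm2 i
  let k : ℕ → ℕ := fun i => Nat.findGreatest (fun k => ‖(1 - N.N (t i)) * Q * N.N (t k)‖ ≤ e) m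
  have hk : Monotone k := by
    intro i i' h
    refine Nat.findGreatest_mono_left (fun j hj => ?_) m
    refine le_trans ?_ hj
    have : (1 - N.N (t i')) * Q * N.N (t j) = (1 - N.N (t i')) * ((1 - N.N (t i)) * Q * N.N (t j)) := by
      ext x
      simp only [mul_apply_eq_comp, sub_apply, one_apply_eq_self, map_sub]
      rw [N.NN_ge (ht _) (ht _) (hmono h)]; abel
    rw [this]
    refine (norm_mul_le _ _).trans ?_
    exact mul_le_of_le_one_left (norm_nonneg _) (one_sub_N_norm N (ht _))
  have hcor : ∀ i, ‖(1 - N.N (t i)) * Q * N.N (t (k i))‖ ≤ e := by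
    intro i
    refine Nat.findGreatest_spec (P := fun k => ‖(1 - N.N (t i)) * Q * N.N (t k)‖ ≤ e)
      (Nat.zero_le m) ?_
    simp only [htd, grid_zero, N.N_zero, mul_zero, norm_zero]
    exact he.le
  have hkm : ∀ i, k i ≤ m := fun i => Nat.findGreatest_le m
  obtain ⟨T, hTn, -, -, hT⟩ := stair N Q hmono ht (grid_self hm0) hk he.le hcor m le_rfl (2 * e)
    (by linarith)
  rw [Nat.sub_self] at hT
  let J : ℕ → H →L[ℂ] H := fun i => N.N (t (i + 1)) - N.N (t i)
  have hJ : ∀ i x, J i x = N.N (t (i + 1)) x - N.N (t i) x := fun i x => rfl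
  have hJJ : ∀ i x, J i (J i x) = J i x := by
    intro i x
    rw [hJ, hJ, map_sub, map_sub, N.NN (ht _), N.NN (ht _), N.NN_ge (ht _) (ht _) (hmono (Nat.le_succ i)),
      N.NN_le (ht _) (ht _) (hmono (Nat.le_succ i))]; abel
  have hJs : ∀ i x y, ⟪J i x, y⟫_ℂ = ⟪x, J i y⟫_ℂ := by
    intro i x y
    rw [hJ, hJ, inner_sub_left, inner_sub_right, N.inner_left (ht _), N.inner_left (ht _)]
  have hJ0 : ∀ i j, i < j → ∀ x, J i (J j x) = 0 := by
    intro i j h x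
    rw [hJ i, hJ j, map_sub, map_sub, N.NN_le (ht _) (ht _) (hmono (show i ≤ j by omega)),
      N.NN_le (ht _) (ht _) (hmono (show i ≤ j + 1 by omega)),
      N.NN_le (ht _) (ht _) (hmono (show i + 1 ≤ j by omega)),
      N.NN_le (ht _) (ht _) (hmono (show i + 1 ≤ j + 1 by omega))]; abel
  let V : Fin m → Submodule ℂ H := fun i =>
    if k i < m then LinearMap.range ((J i * Q : H →L[ℂ] H) : H →ₗ[ℂ] H) else ⊥
  have hVmem : ∀ i x, x ∈ V i → J i x = x := by
    intro i x hx
    simp only [V] at hx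
    split_ifs at hx with h
    · obtain ⟨y, rfl⟩ := hx
      exact hJJ i (Q y)
    · rw [Submodule.mem_bot] at hx
      rw [hx, map_zero]
  have hVfd : ∀ i, FiniteDimensional ℂ (V i) := by
    intro i
    by_cases h : k i < m
    · have hV : V i = LinearMap.range ((J i * Q : H →L[ℂ] H) : H →ₗ[ℂ] H) := if_pos h
      have : LinearMap.range ((J i * Q : H →L[ℂ] H) : H →ₗ[ℂ] H) ≤
          W.map ((J i : H →L[ℂ] H) : H →ₗ[ℂ] H) := by
        rintro _ ⟨y, rfl⟩
        exact ⟨Q y, hW y, rfl⟩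
      rw [hV]
      exact Submodule.finiteDimensional_of_le this
    · have hV : V i = ⊥ := if_neg h
      rw [hV]
      infer_instance
  have hVort : OrthogonalFamily ℂ (fun i => V i) (fun i => (V i).subtypeₗᵢ) := by
    intro i j hij x y
    show ⟪(x : H), (y : H)⟫_ℂ = 0
    rcases lt_or_gt_of_ne hij with h | h
    · rw [← hVmem i x x.2, hJs, ← hVmem j y y.2, hJ0 i j h, inner_zero_right]
    · rw [← hVmem j y y.2, ← hJs, ← hVmem i x x.2, hJ0 j i h, inner_zero_left]
  let b := fun i => stdOrthonormalBasis ℂ (V i)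
  let c : (Σ i : Fin m, Fin (Module.finrank ℂ (V i))) → H := fun l => (b l.1 l.2 : V l.1)
  set Q' := Q - T with hQ'
  have hQz : ∀ z, Q' z = Q z - T z := fun _ => rfl
  have hcV : ∀ l, c l ∈ V l.1 := fun l => (b l.1 l.2).2
  have hJQ : ∀ (i : Fin m) z, J i (Q' z) ∈ V i := by
    intro i z
    obtain ⟨R, hR1, hR2⟩ := hT i (Nat.zero_le _) i.2
    have h1 : J i (Q' z) = J i (Q (z - R z)) := by
      have h2 : J i (T z) = J i (Q (R z)) := hR1 z
      rw [hQz, map_sub (J _), h2, map_sub Q, map_sub (J i)]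
    rw [h1]
    simp only [V]
    split_ifs with h
    · exact ⟨z - R z, rfl⟩
    · have h3 : k i = m := le_antisymm (hkm i) (not_lt.1 h)
      have h4 := hR2 z
      rw [h3, show t m = 1 from grid_self hm0, N.N_one, one_apply_eq_self] at h4
      rw [h4]; simp
  have hki : ∀ l : (Σ i : Fin m, Fin (Module.finrank ℂ (V i))), k l.1 < m := by
    rintro ⟨i, l⟩
    by_contra hcon
    have : V i = ⊥ := if_neg hcon
    rw [this, finrank_bot] at l
    exact l.elim0
  refine ⟨_, inferInstance, c, fun l => adjoint Q' (c l), fun l => t (l.1 + 1), fun l => t (k l.1),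
    Q', ?_, ?_, fun l => rfl, ?_, ?_⟩
  · rw [hQ']; simpa using hTn
  · exact hVort.orthonormal_sigma_orthonormal (fun i => (b i).orthonormal)
  · intro l
    have hcl : J l.1 (c l) = c l := hVmem _ _ (hcV l)
    have hbig : e < ‖(1 - N.N (t l.1)) * Q * N.N (t (k l.1 + 1))‖ := not_le.1
      (Nat.findGreatest_is_greatest (P := fun k => ‖(1 - N.N (t l.1)) * Q * N.N (t k)‖ ≤ e)
        (Nat.lt_succ_self (k l.1)) (hki l))
    have hlow : e / 2 < ‖(1 - N.N (t (l.1 + 1))) * Q * N.N (t (k l.1))‖ := by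
      have h1 : (1 - N.N (t l.1)) * Q * N.N (t (k l.1 + 1)) =
          (1 - N.N (t (l.1 + 1))) * Q * N.N (t (k l.1)) +
          (1 - N.N (t (l.1 + 1))) * (Q * (N.N (t (k l.1 + 1)) - N.N (t (k l.1)))) +
          ((N.N (t (l.1 + 1)) - N.N (t l.1)) * Q) * N.N (t (k l.1 + 1)) := by noncomm_ring
      have h2 : ‖(1 - N.N (t (l.1 + 1))) * (Q * (N.N (t (k l.1 + 1)) - N.N (t (k l.1))))‖ ≤ e / 4 :=
        (norm_mul_le _ _).trans ((mul_le_of_le_one_left (norm_nonneg _)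
          (one_sub_N_norm N (ht _))).trans (hm2' _))
      have h3 : ‖((N.N (t (l.1 + 1)) - N.N (t l.1)) * Q) * N.N (t (k l.1 + 1))‖ ≤ e / 4 :=
        (norm_mul_le _ _).trans ((mul_le_of_le_one_right (norm_nonneg _)
          (N.opNorm_le (ht _))).trans (hm1 _))
      rw [h1] at hbig
      have h4 := norm_add_le ((1 - N.N (t (l.1 + 1))) * Q * N.N (t (k l.1)) +
          (1 - N.N (t (l.1 + 1))) * (Q * (N.N (t (k l.1 + 1)) - N.N (t (k l.1)))))
          (((N.N (t (l.1 + 1)) - N.N (t l.1)) * Q) * N.N (t (k l.1 + 1)))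
      have h5 := norm_add_le ((1 - N.N (t (l.1 + 1))) * Q * N.N (t (k l.1)))
          ((1 - N.N (t (l.1 + 1))) * (Q * (N.N (t (k l.1 + 1)) - N.N (t (k l.1)))))
      linarith
    have hlt : t (l.1 + 1) < t (k l.1) := by
      by_contra hcon
      rw [corner_zero N hQ (ht _) (ht _) (not_lt.1 hcon), norm_zero] at hlow
      linarith
    refine ⟨(ht _).1, hlt, (ht _).2, ?_, ?_, ?_⟩
    · rw [← hcl, hJ, map_sub, N.NN (ht _), N.NN_ge (ht _) (ht _) (hmono (Nat.le_succ _))]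
    · obtain ⟨R, hR1, hR2⟩ := hT l.1 (Nat.zero_le _) l.1.2
      refine ext_inner_right ℂ fun y => ?_
      rw [N.inner_left (ht _), adjoint_inner_left, inner_zero_left, ← hcl, hJs]
      have h2 : J l.1 (T (N.N (t (k l.1)) y)) = J l.1 (Q (R (N.N (t (k l.1)) y))) := hR1 _
      rw [hR2] at h2
      rw [hQz, map_sub (J _), h2, sub_self, inner_zero_right]
    · rwa [corner_eq N hQ (ht _) (ht _) hlt.le] at hlow
  · intro z
    have h1 : Q' z = ∑ i : Fin m, J i (Q' z) := by
      rw [Fin.sum_univ_eq_sum_range (fun i => J i (Q' z)) m]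
      have := Finset.sum_range_sub (fun i => N.N (t i) (Q' z)) m
      refine Eq.trans ?_ this.symm
      rw [show t m = 1 from grid_self hm0, show t 0 = 0 from grid_zero m, N.N_one, N.N_zero]; simp
    rw [h1, Fintype.sum_sigma]
    refine Finset.sum_congr rfl fun i _ => ?_
    have h2 := (b i).sum_repr' ⟨J i (Q' z), hJQ i z⟩
    have h3 := congrArg Subtype.val h2
    simp only [Submodule.coe_inner, Submodule.coe_sum, Submodule.coe_smul] at h3
    rw [← h3]
    refine Finset.sum_congr rfl fun l _ => ?_
    rw [rk_apply]
    congr 1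
    have hcl : J i (c ⟨i, l⟩) = c ⟨i, l⟩ := hVmem _ _ (hcV ⟨i, l⟩)
    rw [adjoint_inner_left, ← hcl, hJs]

end

section

lemma Bess.comp_inj {ι κ : Type*} {x : ι → H} {C : ℝ} (h : Bess x C) {e : κ → ι}
    (he : Function.Injective e) : Bess (fun k => x (e k)) C := by
  intro z s
  have := h z (s.map ⟨e, he⟩)
  simpa using this

lemma Bess.inner_le {ι : Type*} {x : ι → H} {C : ℝ} (h : Bess x C) (hC : 0 ≤ C) (j : ι) (z : H) :
    ‖⟪x j, z⟫_ℂ‖ ≤ C * ‖z‖ := by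
  have := h z {j}
  rw [Finset.sum_singleton, ← mul_pow] at this
  exact abs_le_of_sq_le_sq' this (by positivity) |>.2

lemma Bess.norm_le {ι : Type*} {x : ι → H} {C : ℝ} (h : Bess x C) (hC : 0 ≤ C) (j : ι) :
    ‖x j‖ ≤ C := by
  rcases eq_or_ne (x j) 0 with h0 | h0
  · rw [h0]; simpa using hC
  have := h.inner_le hC j (x j)
  rw [inner_self_eq_norm_sq_to_K] at this
  simp only [norm_pow, RCLike.norm_ofReal, abs_norm] at this
  have h1 : 0 < ‖x j‖ := norm_pos_iff.2 h0
  nlinarith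

lemma bess_of_sq {κ : Type*} {R : ℕ → H →L[ℂ] H} {C a : ℝ}
    (hR : ∀ z, ∀ s : Finset ℕ, ∑ n ∈ s, ‖R n z‖ ^ 2 ≤ C ^ 2 * ‖z‖ ^ 2) {n : κ → ℕ}
    (hn : Function.Injective n) (B : H →L[ℂ] H) {x : κ → H}
    (hx : ∀ j z, ‖⟪x j, z⟫_ℂ‖ ≤ a * ‖R (n j) (B z)‖) : Bess x (a * C * ‖B‖) := by
  intro z s
  calc ∑ j ∈ s, ‖⟪x j, z⟫_ℂ‖ ^ 2 ≤ ∑ j ∈ s, a ^ 2 * ‖R (n j) (B z)‖ ^ 2 :=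
        Finset.sum_le_sum fun j _ => by
          rw [← mul_pow]; exact pow_le_pow_left₀ (norm_nonneg _) (hx j z) 2
    _ = a ^ 2 * ∑ k ∈ s.map ⟨n, hn⟩, ‖R k (B z)‖ ^ 2 := by simp [Finset.mul_sum]
    _ ≤ a ^ 2 * (C ^ 2 * ‖B z‖ ^ 2) := by gcongr; exact hR _ _
    _ ≤ a ^ 2 * (C ^ 2 * (‖B‖ * ‖z‖) ^ 2) := by gcongr; exact B.le_opNorm z
    _ = _ := by ring

variable {N : ContinuousNest H} {I : Set (H →L[ℂ] H)} {ι : Type} {XX : ι → H →L[ℂ] H} {η : ℝ}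

/-- The data needed to cover a diagonal family by blocks of `X`. -/
structure CovHyp (L : Lac N XX η) (X : H →L[ℂ] H) (ψ : ℝ → ℝ) (l C D : ℝ) {κ : Type*}
    (c d : κ → H) (s t : κ → ℝ) (n : κ → ℕ) (u v : κ → H) : Prop where
  bc : Bess c C
  bd : Bess d D
  s0 : ∀ j, 0 ≤ s j
  st : ∀ j, s j < t j
  t1 : ∀ j, t j ≤ 1
  hc : ∀ j, N.N (s j) (c j) = c j
  hd : ∀ j, N.N (t j) (d j) = 0
  inj : Function.Injective n
  md : ∀ i j, n i % 6 = n j % 6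
  nu : ∀ j, ‖u j‖ ≤ 1
  nv : ∀ j, ‖v j‖ ≤ 1
  hu : ∀ j, N.N (ψ (t j)) (u j) = u j
  hv : ∀ j, N.N (ψ (s j)) (v j) = 0
  hl : ∀ j, l < ‖⟪v j, L.bk X (n j) (u j)⟫_ℂ‖

lemma CovHyp.comp {L : Lac N XX η} {X : H →L[ℂ] H} {ψ : ℝ → ℝ} {l C D : ℝ} {κ κ' : Type*}
    {c d : κ → H} {s t : κ → ℝ} {n : κ → ℕ} {u v : κ → H} (h : CovHyp L X ψ l C D c d s t n u v)
    {e : κ' → κ} (he : Function.Injective e) : CovHyp L X ψ l C D (fun k => c (e k))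
      (fun k => d (e k)) (fun k => s (e k)) (fun k => t (e k)) (fun k => n (e k)) (fun k => u (e k))
      (fun k => v (e k)) where
  bc := h.bc.comp_inj he
  bd := h.bd.comp_inj he
  s0 := fun _ => h.s0 _
  st := fun _ => h.st _
  t1 := fun _ => h.t1 _
  hc := fun _ => h.hc _
  hd := fun _ => h.hd _
  inj := h.inj.comp he
  md := fun _ _ => h.md _ _
  nu := fun _ => h.nu _
  nv := fun _ => h.nv _
  hu := fun _ => h.hu _
  hv := fun _ => h.hv _
  hl := fun _ => h.hl _

lemma cov_dist [SeparableSpace H] (hI : N.IsStableIdeal I) {L : Lac N XX η}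
    (hη : 0 ≤ η) (hη1 : η ≤ 1) {X : H →L[ℂ] H} (hX : X ∈ I) (hXA : L.Adm X) {ψ : ℝ → ℝ}
    (hψ : IsoOn ψ 0 1 0 1) {l C D : ℝ} (hl : 0 < l) (hC : 0 ≤ C) (hD : 0 ≤ D) {κ : Type*}
    {c d : κ → H} {s t : κ → ℝ} {n : κ → ℕ} {u v : κ → H} (h : CovHyp L X ψ l C D c d s t n u v)
    {S : H →L[ℂ] H} (hS : IsSyn c d S) :
    ∃ Z ∈ I, ‖S - Z‖ ≤ C * (D * (600 * ‖X‖ * η) * l⁻¹ * 2) * ∑' j, (1 / 2 : ℝ) ^ n j := by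
  obtain ⟨S0, h1, h2, h3⟩ := exists_impl N hψ
  have hsum : Summable fun j => (1 / 2 : ℝ) ^ n j := summable_geometric_two.comp_injective h.inj
  have hsum2 : ∑' j, (1 / 2 : ℝ) ^ n j ≤ 2 := by
    refine le_trans ?_ tsum_geometric_two.le
    exact hsum.tsum_le_tsum_of_inj n h.inj (fun _ _ => by positivity) (fun _ => le_rfl)
      summable_geometric_two
  have hs : ∀ j, s j ∈ Icc (0:ℝ) 1 := fun j => ⟨h.s0 j, ((h.st j).le.trans (h.t1 j))⟩
  have ht : ∀ j, t j ∈ Icc (0:ℝ) 1 := fun j => ⟨(h.s0 j).trans (h.st j).le, h.t1 j⟩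
  have hψs : ∀ j, ψ (s j) ∈ Icc (0:ℝ) 1 := fun j => hψ.mapsTo (hs j)
  have hψt : ∀ j, ψ (t j) ∈ Icc (0:ℝ) 1 := fun j => hψ.mapsTo (ht j)
  obtain ⟨X', hX', hXX⟩ : ∃ X' ∈ I, (S0 : H →L[ℂ] H) * X' * (↑S0⁻¹ : H →L[ℂ] H) = X := by
    have := hI.2.2 S0 h3
    rw [← this] at hX
    exact hX
  set v' : κ → H := fun j => adjoint (S0 : H →L[ℂ] H) (adjoint (L.dd 1 0 (n j)) (v j)) with hv'
  set u' : κ → H := fun j => (↑S0⁻¹ : H →L[ℂ] H) (L.dd 3 2 (n j) (u j)) with hu'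
  have hx : ∀ i j, ⟪v' i, X' (u' j)⟫_ℂ = ⟪v i, (L.dd 1 0 (n i) * X * L.dd 3 2 (n j)) (u j)⟫_ℂ := by
    intro i j
    rw [hv', hu']
    simp only
    rw [adjoint_inner_left, adjoint_inner_left, ← hXX]
    simp only [mul_apply_eq_comp]
  have hxl : ∀ j, l < ‖⟪v' j, X' (u' j)⟫_ℂ‖ := fun j => by rw [hx]; exact h.hl j
  have hx0 : ∀ j, ⟪v' j, X' (u' j)⟫_ℂ ≠ 0 := fun j hj => by
    have := hxl j
    rw [hj, norm_zero] at this
    linarith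
  set ut : κ → H := fun j => (⟪v' j, X' (u' j)⟫_ℂ)⁻¹ • u' j with hut
  have hNv : ∀ j, N.N (s j) (v' j) = 0 := fun j =>
    h1.perp (hs j) ((L.dd_tri 1 0 (n j)).perp (hψs j) (h.hv j))
  have hNu : ∀ j, N.N (t j) (ut j) = ut j := fun j => by
    have : N.N (t j) (u' j) = u' j := h2.mem (ht j) ((L.dd_tri 3 2 (n j)).mem (hψt j) (h.hu j))
    rw [hut]
    simp only
    rw [map_smul, this]
  have hBv : Bess v' (1 * 1000 * ‖(S0 : H →L[ℂ] H)‖) := by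
    refine bess_of_sq (L.dd_sq hη hη1 (a := 1) (b := 0) (by norm_num) (by norm_num))
      h.inj _ fun j z => ?_
    rw [hv']
    simp only
    rw [adjoint_inner_left, adjoint_inner_left]
    exact (norm_inner_le_norm _ _).trans (by gcongr; exact h.nv j)
  have hBu : Bess ut (l⁻¹ * 1000 * ‖adjoint (↑S0⁻¹ : H →L[ℂ] H)‖) := by
    refine bess_of_sq (L.dda_sq hη hη1 (a := 3) (b := 2) (by norm_num) (by norm_num)) h.inj _ fun j z => ?_
    rw [hut]
    simp only
    rw [inner_smul_left, norm_mul, RCLike.norm_conj, norm_inv]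
    have h6 : ‖⟪v' j, X' (u' j)⟫_ℂ‖⁻¹ ≤ l⁻¹ := inv_anti₀ hl (hxl j).le
    have h7 : ‖⟪u' j, z⟫_ℂ‖ ≤ ‖adjoint (L.dd 3 2 (n j)) (adjoint (↑S0⁻¹ : H →L[ℂ] H) z)‖ := by
      rw [← adjoint_inner_right, ← adjoint_inner_right]
      exact (norm_inner_le_norm _ _).trans (mul_le_of_le_one_left (norm_nonneg _) (h.nu j))
    exact mul_le_mul h6 h7 (norm_nonneg _) (by positivity)
  obtain ⟨Dop, hDop, -⟩ := exists_syn (by positivity) hD hBu h.bd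
  obtain ⟨Cop, hCop, -⟩ := exists_syn hC (by positivity) h.bc hBv
  have hDt : Dop ∈ N.alg := mem_alg_iff.2
    (IsSyn.tri hDop fun j => rk_tri' (ht j) (hNu j) (h.hd j))
  have hCt : Cop ∈ N.alg := mem_alg_iff.2
    (IsSyn.tri hCop fun j => rk_tri' (hs j) (h.hc j) (hNv j))
  refine ⟨Cop * (X' * Dop), (hI.1.2.2.2.2 _ hCt _ (hI.1.2.2.2.2 _ hDt _ hX').2).1, ?_⟩
  refine opNorm_le_bound _ (by positivity) fun z => ?_
  -- the error coefficients
  have hcoef : ∀ i, ‖⟪d i, z⟫_ℂ - ⟪v' i, X' (Dop z)⟫_ℂ‖ ≤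
      D * (600 * ‖X‖ * η) * l⁻¹ * 2 * ‖z‖ * (1 / 2) ^ n i := by
    intro i
    have ha : HasSum (fun j => ⟪v' i, X' (rk (ut j) (d j) z)⟫_ℂ) ⟪v' i, X' (Dop z)⟫_ℂ :=
      ((hDop z).mapL X').mapL (innerSL ℂ (v' i))
    classical
    have hb := ha.update i 0
    have hdiag : ⟪v' i, X' (rk (ut i) (d i) z)⟫_ℂ = ⟪d i, z⟫_ℂ := by
      rw [rk_apply, map_smul, inner_smul_right, hut]
      simp only
      rw [map_smul, inner_smul_right, inv_mul_cancel₀ (hx0 i), mul_one]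
    have hc := HasSum.norm_le_of_bounded hb
      (hsum.hasSum.mul_left (D * (600 * ‖X‖ * η) * l⁻¹ * ‖z‖ * (1 / 2) ^ n i)) ?_
    · rw [hdiag] at hc
      calc _ = ‖0 - ⟪d i, z⟫_ℂ + ⟪v' i, X' (Dop z)⟫_ℂ‖ := by
            rw [← norm_neg]; congr 1; ring
        _ ≤ _ := hc
        _ ≤ D * (600 * ‖X‖ * η) * l⁻¹ * ‖z‖ * (1 / 2) ^ n i * 2 := by gcongr
        _ = _ := by ring
    intro j
    rcases eq_or_ne j i with rfl | hji
    · rw [Function.update_self, norm_zero]; positivity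
    rw [Function.update_of_ne hji, rk_apply, map_smul, inner_smul_right, hut]
    simp only
    rw [map_smul, inner_smul_right, norm_mul, norm_mul, norm_inv, hx i j]
    have h5 : ‖⟪d j, z⟫_ℂ‖ ≤ D * ‖z‖ := h.bd.inner_le hD j z
    have h6 : ‖⟪v' j, X' (u' j)⟫_ℂ‖⁻¹ ≤ l⁻¹ := inv_anti₀ hl (hxl j).le
    have h7 : ‖⟪v i, (L.dd 1 0 (n i) * X * L.dd 3 2 (n j)) (u j)⟫_ℂ‖ ≤
        600 * ‖X‖ * η * ((1 / 2) ^ n i * (1 / 2) ^ n j) := by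
      have hne : n i ≠ n j := fun he => hji (h.inj he).symm
      have hmd := h.md i j
      refine (norm_inner_le_norm _ _).trans ?_
      refine (mul_le_of_le_one_left (norm_nonneg _) (h.nv i)).trans ?_
      refine (ContinuousLinearMap.le_opNorm _ _).trans ?_
      refine (mul_le_of_le_one_right (norm_nonneg _) (h.nu j)).trans ?_
      exact L.far hη hXA (by omega)
    calc _ ≤ D * ‖z‖ * (l⁻¹ * (600 * ‖X‖ * η * ((1 / 2) ^ n i * (1 / 2) ^ n j))) :=
          mul_le_mul h5 (mul_le_mul h6 h7 (norm_nonneg _) (by positivity)) (by positivity)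
            (by positivity)
      _ = _ := by ring
  have ha : HasSum (fun i => (⟪d i, z⟫_ℂ - ⟪v' i, X' (Dop z)⟫_ℂ) • c i)
      ((S - Cop * (X' * Dop)) z) := by
    have := (hS z).sub (hCop ((X' * Dop) z))
    simp only [rk_apply, ← sub_smul] at this
    exact this
  have := HasSum.norm_le_of_bounded ha
    (hsum.hasSum.mul_left (C * (D * (600 * ‖X‖ * η) * l⁻¹ * 2) * ‖z‖)) (fun i => by
      rw [norm_smul]
      calc _ ≤ D * (600 * ‖X‖ * η) * l⁻¹ * 2 * ‖z‖ * (1 / 2) ^ n i * C :=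
            mul_le_mul (hcoef i) (h.bc.norm_le hC i) (norm_nonneg _) (by positivity)
        _ = _ := by ring)
  refine this.trans (le_of_eq (by ring))

lemma ideal_sum (hI : N.IsIdeal I) {κ : Type*} {T : κ → H →L[ℂ] H} (s : Finset κ)
    (h : ∀ k ∈ s, T k ∈ I) : ∑ k ∈ s, T k ∈ I := by
  classical
  induction s using Finset.induction_on with
  | empty => simpa using hI.2.1
  | insert a s ha ih =>
    rw [Finset.sum_insert ha]
    exact hI.2.2.1 _ (h a (by simp)) _ (ih fun k hk => h k (by simp [hk]))

lemma cov_good [SeparableSpace H] (hI : N.IsStableIdeal I) (hI0 : I ≠ {0})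
    {L : Lac N XX η}
    (hη : 0 ≤ η) (hη1 : η ≤ 1) {X : H →L[ℂ] H} (hX : X ∈ I) (hXA : L.Adm X) {ψ : ℝ → ℝ}
    (hψ : IsoOn ψ 0 1 0 1) {l C D : ℝ} (hl : 0 < l) (hC : 0 ≤ C) (hD : 0 ≤ D) {κ : Type*}
    {c d : κ → H} {s t : κ → ℝ} {n : κ → ℕ} {u v : κ → H} (h : CovHyp L X ψ l C D c d s t n u v)
    {S : H →L[ℂ] H} (hS : IsSyn c d S) : S ∈ I := by
  have hcl : IsClosed I := hI.2.1
  rw [← hcl.closure_eq, Metric.mem_closure_iff]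
  intro e he
  set K := C * (D * (600 * ‖X‖ * η) * l⁻¹ * 2) with hK
  have hK0 : 0 ≤ K := by positivity
  have h1 := (tendsto_tsum_compl_atTop_zero (fun j => (1 / 2 : ℝ) ^ n j)).const_mul K
  rw [mul_zero] at h1
  obtain ⟨F, hF⟩ := (h1.eventually (gt_mem_nhds he)).exists
  have h2 : IsSyn (fun k : {x // x ∉ F} => c k) (fun k => d k)
      (S - ∑ j ∈ F, rk (c j) (d j)) := by
    intro z
    have := (Finset.hasSum_compl_iff (f := fun j => rk (c j) (d j) z) F
      (a := (S - ∑ j ∈ F, rk (c j) (d j)) z)).2 (by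
        rw [sub_apply, sum_apply, sub_add_cancel]; exact hS z)
    exact this
  obtain ⟨Z, hZ, hle⟩ := cov_dist hI hη hη1 hX hXA hψ hl hC hD
    (h.comp (e := fun k : {x // x ∉ F} => (k : κ)) Subtype.val_injective) h2
  refine ⟨Z + ∑ j ∈ F, rk (c j) (d j), hI.1.2.2.1 _ hZ _ (ideal_sum hI.1 F fun j _ =>
    rk_mem hI hI0 (h.s0 j) (h.st j) (h.t1 j) (h.hc j) (h.hd j)), ?_⟩
  rw [dist_eq_norm]
  refine lt_of_le_of_lt (le_trans (le_of_eq ?_) hle) hF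
  congr 1; abel

end

section
variable {N : ContinuousNest H} {I : Set (H →L[ℂ] H)} {ι : Type} {XX : ι → H →L[ℂ] H} {η : ℝ}

/-- The intervals on which the `n`-th block of `X` is bounded below. -/
def bigInt (L : Lac N XX η) (X : H →L[ℂ] H) (l : ℝ) (n : ℕ) : Set (ℝ × ℝ) :=
  {b | 0 ≤ b.1 ∧ b.1 < b.2 ∧ b.2 ≤ 1 ∧ ∃ u v : H, ‖u‖ ≤ 1 ∧ ‖v‖ ≤ 1 ∧ N.N b.2 u = u ∧
    N.N b.1 v = 0 ∧ l < ‖⟪v, L.bk X n u⟫_ℂ‖}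

/-- The part of the diagonal family indexed by `K` sums to an element of `I`. -/
def GoodSet (I : Set (H →L[ℂ] H)) (c d : ℕ → H) (K : Set ℕ) : Prop :=
  ∃ T ∈ I, ∀ z, HasSum (K.indicator (fun j => rk (c j) (d j) z)) (T z)

lemma GoodSet.union (hI : N.IsIdeal I) {c d : ℕ → H} {K K' : Set ℕ} (h : GoodSet I c d K)
    (h' : GoodSet I c d K') (hd : Disjoint K K') : GoodSet I c d (K ∪ K') := by
  obtain ⟨T, hT, h1⟩ := h
  obtain ⟨T', hT', h2⟩ := h'
  refine ⟨T + T', hI.2.2.1 _ hT _ hT', fun z => ?_⟩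
  rw [indicator_union_of_disjoint hd]
  exact (h1 z).add (h2 z)

lemma GoodSet.finite (hI : N.IsIdeal I) {c d : ℕ → H} (hr : ∀ j, rk (c j) (d j) ∈ I) {K : Set ℕ}
    (hK : K.Finite) : GoodSet I c d K := by
  refine ⟨∑ j ∈ hK.toFinset, rk (c j) (d j), ideal_sum hI _ fun j _ => hr j, fun z => ?_⟩
  have h1 : HasSum (K.indicator (fun j => rk (c j) (d j) z))
      (∑ j ∈ hK.toFinset, K.indicator (fun j => rk (c j) (d j) z) j) :=
    hasSum_sum_of_ne_finset_zero fun j hj => indicator_of_notMem (by simpa using hj) _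
  have h2 : ∑ j ∈ hK.toFinset, K.indicator (fun j => rk (c j) (d j) z) j =
      (∑ j ∈ hK.toFinset, rk (c j) (d j)) z := by
    rw [sum_apply]
    exact Finset.sum_congr rfl fun j hj => indicator_of_mem (by simpa using hj) _
  rwa [h2] at h1

lemma Cov.mono {A B : ℝ} {F : ℕ → Set (ℝ × ℝ)} {s t : ℕ → ℝ} {J K : Set ℕ} (h : Cov A B F s t K)
    (hJ : J ⊆ K) : Cov A B F s t J := by
  obtain ⟨ψ, hψ, n, β, hn, hβ⟩ := h
  exact ⟨ψ, hψ, n, β, hn.mono hJ, fun j hj => hβ j (hJ hj)⟩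

theorem syn_mem [SeparableSpace H] (hI : N.IsStableIdeal I) (hI0 : I ≠ {0})
    {L : Lac N XX η}
    (hη : 0 ≤ η) (hη1 : η ≤ 1) {X : H →L[ℂ] H} (hX : X ∈ I) (hXA : L.Adm X)
    {l C D : ℝ} (hl : 0 < l) (hC : 0 ≤ C) (hD : 0 ≤ D)
    {c d : ℕ → H} {s t : ℕ → ℝ} (bc : Bess c C) (bd : Bess d D)
    (hc : ∀ j, N.N (s j) (c j) = c j) (hd : ∀ j, N.N (t j) (d j) = 0)
    (hCL : CL 0 1 (bigInt L X l) s t)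
    {S : H →L[ℂ] H} (hS : IsSyn c d S) : S ∈ I := by
  have hs : ∀ j, s j ∈ Icc (0:ℝ) 1 := fun j => ⟨(hCL.hst j).1, (hCL.hst j).2.1.le.trans (hCL.hst j).2.2⟩
  have ht : ∀ j, t j ∈ Icc (0:ℝ) 1 := fun j => ⟨(hCL.hst j).1.trans (hCL.hst j).2.1.le, (hCL.hst j).2.2⟩
  have hr : ∀ j, rk (c j) (d j) ∈ I := fun j =>
    rk_mem hI hI0 (hCL.hst j).1 (hCL.hst j).2.1 (hCL.hst j).2.2 (hc j) (hd j)
  have hcov : ∀ K, Cov 0 1 (bigInt L X l) s t K → GoodSet I c d K := by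
    rintro K ⟨ψ, hψ, n, β, hn, hβ⟩
    have hmod : ∀ r, GoodSet I c d (K ∩ {j | n j % 6 = r}) := by
      intro r
      set K' := K ∩ {j | n j % 6 = r} with hK'
      have hβ' : ∀ j : K', ∃ u v : H, ‖u‖ ≤ 1 ∧ ‖v‖ ≤ 1 ∧ N.N (ψ (t j)) u = u ∧
          N.N (ψ (s j)) v = 0 ∧ l < ‖⟪v, L.bk X (n j) u⟫_ℂ‖ := by
        rintro ⟨j, hj⟩
        obtain ⟨⟨h0, h01, h1, u, v, hu, hv, hNu, hNv, hl'⟩, h2, h3⟩ := hβ j hj.1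
        exact ⟨u, v, hu, hv,
          N.mem_mono ⟨by linarith, by linarith⟩ (hψ.mapsTo (ht j)) h3 hNu,
          N.perp_mono (hψ.mapsTo (hs j)) ⟨by linarith, by linarith⟩ h2 hNv, hl'⟩
      choose u v hu hv hNu hNv hlt using hβ'
      have bc' : Bess (fun j : K' => c j) C := bc.comp_inj Subtype.val_injective
      have bd' : Bess (fun j : K' => d j) D := bd.comp_inj Subtype.val_injective
      obtain ⟨T, hT, -⟩ := exists_syn hC hD bc' bd'
      have hTI : T ∈ I := cov_good (κ := K') (n := fun j => n j) (s := fun j => s j) (t := fun j => t j)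
        (u := u) (v := v) hI hI0 hη hη1 hX hXA hψ hl hC hD
        { bc := bc', bd := bd', s0 := fun j => (hCL.hst j).1, st := fun j => (hCL.hst j).2.1
          t1 := fun j => (hCL.hst j).2.2, hc := fun j => hc j, hd := fun j => hd j
          inj := fun i j hij => Subtype.ext (hn i.2.1 j.2.1 hij)
          md := fun i j => by rw [i.2.2, j.2.2]
          nu := hu, nv := hv, hu := hNu, hv := hNv, hl := hlt } hT
      refine ⟨T, hTI, fun z => ?_⟩
      rw [← hasSum_subtype_iff_indicator]
      exact hT z
    have hlt : ∀ r, GoodSet I c d (K ∩ {j | n j % 6 < r}) := by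
      intro r
      induction r with
      | zero => exact GoodSet.finite hI.1 hr (by simp)
      | succ r ih =>
        have h1 := ih.union hI.1 (hmod r) (by
          rw [Set.disjoint_left]
          rintro j ⟨_, h1⟩ ⟨_, h2⟩
          simp only [mem_setOf_eq] at h1 h2
          omega)
        convert h1 using 1
        ext j
        simp only [mem_inter_iff, mem_union, mem_setOf_eq, Nat.lt_succ_iff_lt_or_eq]
        tauto
    have := hlt 6
    rwa [show K ∩ {j | n j % 6 < 6} = K from by
      ext j; simp only [mem_inter_iff, mem_setOf_eq, and_iff_left_iff_imp]; omega] at this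
  obtain ⟨Lc, hLf, hLc, hfin⟩ := CL.main hCL
  have key : ∀ P : Set (Set ℕ), P.Finite → (∀ K ∈ P, Cov 0 1 (bigInt L X l) s t K) →
      ∀ J : Set ℕ, (J \ ⋃₀ P).Finite → GoodSet I c d J := by
    intro P hP
    induction P, hP using Set.Finite.induction_on with
    | empty => intro _ J hJ; exact GoodSet.finite hI.1 hr (by simpa using hJ)
    | @insert K P _ _ ih =>
      intro hP J hJ
      have h1 := hcov _ ((hP K (mem_insert _ _)).mono (inter_subset_right (s := J)))
      have h2 := ih (fun K hK => hP K (mem_insert_of_mem _ hK)) (J \ K) (by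
        rwa [sUnion_insert, ← diff_diff] at hJ)
      have h3 := h1.union hI.1 h2 (disjoint_sdiff_inter.symm)
      rwa [inter_union_diff] at h3
  obtain ⟨T, hT, hT'⟩ := key Lc hLf hLc univ hfin
  simp only [indicator_univ] at hT'
  rwa [IsSyn.unique hS hT']

end

section
variable {N : ContinuousNest H} {I : Set (H →L[ℂ] H)} {ι : Type} {XX : ι → H →L[ℂ] H} {η : ℝ}

lemma shrink_witness {Q : H →L[ℂ] H} {s t l : ℝ} (hs : 0 ≤ s) (hst : s < t) (ht : t ≤ 1)
    (hl0 : 0 ≤ l) (hl : l < ‖(N.N t - N.N s) * Q * (N.N t - N.N s)‖) :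
    ∃ p q : ℝ, s < p ∧ p < q ∧ q < t ∧ ∃ u v : H, ‖u‖ ≤ 1 ∧ ‖v‖ ≤ 1 ∧ N.N q u = u ∧ N.N p v = 0 ∧
      l < ‖⟪v, Q u⟫_ℂ‖ := by
  have hs' : s ∈ Icc (0:ℝ) 1 := ⟨hs, hst.le.trans ht⟩
  have ht' : t ∈ Icc (0:ℝ) 1 := ⟨hs.trans hst.le, ht⟩
  have hEn := N.int_norm hs hst.le ht
  obtain ⟨x, hx, hlx⟩ := ContinuousLinearMap.exists_lt_apply_of_lt_opNorm _ hl
  set E := N.N t - N.N s with hE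
  have hEz : ∀ z, ‖E z‖ ≤ ‖z‖ := fun z => by simpa using E.le_of_opNorm_le hEn z
  have hEt : ∀ z, N.N t (E z) = E z := fun z => by
    rw [hE, sub_apply, map_sub, N.NN ht', N.NN_ge hs' ht' hst.le]
  have hEs : ∀ z, N.N s (E z) = 0 := fun z => by
    rw [hE, sub_apply, map_sub, N.NN hs', N.NN_le hs' ht' hst.le, sub_self]
  have hEa : ∀ y z, ⟪E y, z⟫_ℂ = ⟪y, E z⟫_ℂ := fun y z => by
    rw [hE, sub_apply, sub_apply, inner_sub_left, inner_sub_right, N.inner_left ht', N.inner_left hs']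
  set y := (E * Q * E) x with hy
  have hy0 : 0 < ‖y‖ := lt_of_le_of_lt hl0 hlx
  set v0 : H := ((‖y‖ : ℂ)⁻¹) • y with hv0
  have hv0n : ‖v0‖ = 1 := by
    rw [hv0, norm_smul, norm_inv, Complex.norm_real, norm_norm, inv_mul_cancel₀ hy0.ne']
  have hin : l < ‖⟪E v0, Q (E x)⟫_ℂ‖ := by
    have h1 : ⟪E v0, Q (E x)⟫_ℂ = ‖y‖ := by
      rw [hEa]
      change ⟪v0, y⟫_ℂ = _
      rw [hv0, inner_smul_left, inner_self_eq_norm_sq_to_K]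
      have : (‖y‖ : ℂ) ≠ 0 := by exact_mod_cast hy0.ne'
      simp
      field_simp
    rw [h1, Complex.norm_real, norm_norm]
    exact hlx
  have hIoo : Ioo (0:ℝ) ((t - s) / 2) ∈ 𝓝[>] (0:ℝ) := Ioo_mem_nhdsGT (by linarith)
  have hid : Tendsto (fun r : ℝ => r) (𝓝[>] 0) (𝓝 0) := tendsto_id.mono_left nhdsWithin_le_nhds
  have h1 : Tendsto (fun r : ℝ => N.N (t - r) (E x)) (𝓝[>] 0) (𝓝 (E x)) := by
    have h := (N.contOn (E x) t ht').tendsto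
    rw [hEt] at h
    refine h.comp (tendsto_nhdsWithin_iff.2 ⟨by simpa using hid.const_sub t, ?_⟩)
    filter_upwards [hIoo] with r hr
    exact ⟨by linarith [hr.2], by linarith [hr.1]⟩
  have h2 : Tendsto (fun r : ℝ => E v0 - N.N (s + r) (E v0)) (𝓝[>] 0) (𝓝 (E v0)) := by
    have h := (N.contOn (E v0) s hs').tendsto
    rw [hEs] at h
    have h3 : Tendsto (fun r : ℝ => N.N (s + r) (E v0)) (𝓝[>] 0) (𝓝 0) := by
      refine h.comp (tendsto_nhdsWithin_iff.2 ⟨by simpa using hid.const_add s, ?_⟩)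
      filter_upwards [hIoo] with r hr
      exact ⟨by linarith [hr.1], by linarith [hr.2]⟩
    simpa using h3.const_sub (E v0)
  have h3 := (h2.inner (𝕜 := ℂ) ((Q.continuous.tendsto (E x)).comp h1)).norm
  obtain ⟨r, hr, hr2⟩ := ((h3.eventually (lt_mem_nhds hin)).and hIoo).exists
  have hp : s + r ∈ Icc (0:ℝ) 1 := ⟨by linarith [hr2.1], by linarith [hr2.2]⟩
  have hq : t - r ∈ Icc (0:ℝ) 1 := ⟨by linarith [hr2.2], by linarith [hr2.1]⟩
  refine ⟨s + r, t - r, by linarith [hr2.1], by linarith [hr2.2], by linarith [hr2.1],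
    N.N (t - r) (E x), E v0 - N.N (s + r) (E v0), ?_, ?_, N.NN hq _, ?_, hr⟩
  · exact (N.norm_le hq _).trans ((hEz x).trans hx.le)
  · have h4 := (1 - N.N (s + r)).le_of_opNorm_le (one_sub_N_norm N hp) (E v0)
    have h5 := hEz v0
    rw [hv0n] at h5
    rw [one_mul] at h4
    exact h4.trans h5
  · rw [map_sub, N.NN hp, sub_self]

lemma int_sub_norm {Q : H →L[ℂ] H} {s t u v : ℝ} (hu : 0 ≤ u) (hus : u ≤ s) (hst : s ≤ t)
    (htv : t ≤ v) (hv : v ≤ 1) : ‖(N.N t - N.N s) * Q * (N.N t - N.N s)‖ ≤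
      ‖(N.N v - N.N u) * Q * (N.N v - N.N u)‖ := by
  have iu : u ∈ Icc (0:ℝ) 1 := ⟨by linarith, by linarith⟩
  have is : s ∈ Icc (0:ℝ) 1 := ⟨by linarith, by linarith⟩
  have it : t ∈ Icc (0:ℝ) 1 := ⟨by linarith, by linarith⟩
  have iv : v ∈ Icc (0:ℝ) 1 := ⟨by linarith, by linarith⟩
  have e1 : (N.N t - N.N s) * (N.N v - N.N u) = N.N t - N.N s := by
    ext x
    simp only [mul_apply_eq_comp, sub_apply, map_sub, N.NN_le it iv htv,
      N.NN_le is iv (hst.trans htv), N.NN_ge iu it (hus.trans hst), N.NN_ge iu is hus]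
    abel
  have e2 : (N.N v - N.N u) * (N.N t - N.N s) = N.N t - N.N s := by
    ext x
    simp only [mul_apply_eq_comp, sub_apply, map_sub, N.NN_ge it iv htv,
      N.NN_ge is iv (hst.trans htv), N.NN_le iu it (hus.trans hst), N.NN_le iu is hus]
    abel
  have hE := N.int_norm (hu.trans hus) hst (htv.trans hv)
  have e3 : (N.N t - N.N s) * Q * (N.N t - N.N s) = (N.N t - N.N s) *
      ((N.N v - N.N u) * Q * (N.N v - N.N u)) * (N.N t - N.N s) := by
    calc _ = ((N.N t - N.N s) * (N.N v - N.N u)) * Q * ((N.N v - N.N u) * (N.N t - N.N s)) := by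
          rw [e1, e2]
      _ = _ := by simp only [mul_assoc]
  rw [e3]
  refine (norm_mul_le _ _).trans ((mul_le_of_le_one_right (norm_nonneg _) hE).trans ?_)
  exact (norm_mul_le _ _).trans (mul_le_of_le_one_left (norm_nonneg _) hE)

theorem syn_mem_gen [SeparableSpace H] (hI : N.IsStableIdeal I) (hI0 : I ≠ {0})
    {L : Lac N XX η}
    (hη : 0 ≤ η) (hη1 : η ≤ 1) {X : H →L[ℂ] H} (hX : X ∈ I) (hXA : L.Adm X)
    {l C D : ℝ} (hl : 0 < l) (hC : 0 ≤ C) (hD : 0 ≤ D) {σ : Type} [Countable σ]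
    {c d : σ → H} {s t : σ → ℝ} (bc : Bess c C) (bd : Bess d D)
    (hst : ∀ j, 0 ≤ s j ∧ s j < t j ∧ t j ≤ 1)
    (hc : ∀ j, N.N (s j) (c j) = c j) (hd : ∀ j, N.N (t j) (d j) = 0)
    (hH : ∀ u v, {j | u ≤ s j ∧ t j ≤ v}.Infinite → INF (bigInt L X l) u v)
    {S : H →L[ℂ] H} (hS : IsSyn c d S) : S ∈ I := by
  rcases finite_or_infinite σ with hf | hf
  · have := Fintype.ofFinite σ
    have h1 : S = ∑ j, rk (c j) (d j) := by
      ext z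
      rw [(hS z).unique (hasSum_fintype _), sum_apply]
    rw [h1]
    exact ideal_sum hI.1 _ fun j _ => rk_mem hI hI0 (hst j).1 (hst j).2.1 (hst j).2.2 (hc j) (hd j)
  · obtain ⟨hden⟩ := nonempty_denumerable σ
    let e : ℕ ≃ σ := (Denumerable.eqv σ).symm
    refine syn_mem (c := fun k => c (e k)) (d := fun k => d (e k)) (s := fun k => s (e k))
      (t := fun k => t (e k)) hI hI0 hη hη1 hX hXA hl hC hD
      (bc.comp_inj e.injective) (bd.comp_inj e.injective) (fun k => hc _) (fun k => hd _)
      ⟨fun j => hst _, fun n b hb => hb.2.1, fun u v huv => hH u v ?_⟩ (S := S) ?_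
    · refine (huv.image e.injective.injOn).mono ?_
      rintro _ ⟨j, hj, rfl⟩
      exact hj
    · intro z
      exact (e.hasSum_iff (f := fun j => rk (c j) (d j) z)).2 (hS z)

end

section
variable {N : ContinuousNest H} {I : Set (H →L[ℂ] H)} {ι : Type} {XX : ι → H →L[ℂ] H} {η : ℝ}

lemma inf_of_small {L : Lac N XX η} (hη : 0 ≤ η) (hη1 : η ≤ 1) {X Y : H →L[ℂ] H}
    (hX : Tri N N X) (hY : Tri N N Y) (hXA : L.Adm X) {δ ε l : ℝ} (hl : 0 < l)
    (hδ : 1000 ^ 2 * l + 20000 * ‖X‖ * η < δ) (hsub : N.small X δ ⊆ N.small Y ε) {u v : ℝ}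
    (hu : 0 ≤ u) (huv : u < v) (hv : v ≤ 1)
    (hinf : {n | 5 * ε < ‖(N.N v - N.N u) * L.bk Y n * (N.N v - N.N u)‖}.Infinite) :
    INF (bigInt L X l) u v := by
  have h1 : ¬ essNorm ((N.N v - N.N u) * Y * (N.N v - N.N u)) < ε := by
    intro h
    obtain ⟨n0, hn0⟩ := eventually_atTop.1 (L.upper hη hY hu huv.le hv h)
    refine hinf ((finite_lt_nat n0).subset fun n hn => ?_)
    by_contra hc
    exact absurd (hn0 n (not_lt.1 hc)) (not_lt.2 (le_of_lt hn))
  have h2 : ¬ essNorm ((N.N v - N.N u) * X * (N.N v - N.N u)) < δ := fun h =>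
    h1 (hsub ⟨⟨u, v, hu, huv.le, hv, rfl⟩, h⟩).2
  refine infinite_of_forall_exists_gt fun n0 => ?_
  by_contra hc
  push Not at hc
  refine h2 (lt_of_le_of_lt (L.lower hη hη1 hXA hX hu huv.le hv hl.le (n0 := n0 + 1) ?_) hδ)
  intro n hn
  by_contra hlt
  obtain ⟨p, q, hp, hpq, hq, w⟩ := shrink_witness hu huv hv hl.le (not_le.1 hlt)
  have := hc n ⟨(p, q), ⟨by simp only; linarith, hpq, by simp only; linarith, w⟩, hp, hq⟩
  omega

theorem main_approx [SeparableSpace H] (hI : N.IsStableIdeal I) (hI0 : I ≠ {0})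
    {Y : H →L[ℂ] H} (hYa : Y ∈ N.alg) {X : H →L[ℂ] H} (hX : X ∈ I) {δ ε : ℝ} (hδ : 0 < δ) (hε : 0 < ε)
    (hsub : N.small X δ ⊆ N.small Y ε) : ∃ Z ∈ I, ‖Y - Z‖ ≤ 30000000 * ε := by
  have hYt : Tri N N Y := mem_alg_iff.1 hYa
  have hXt : Tri N N X := mem_alg_iff.1 (hI.1.1 hX)
  obtain ⟨η, hη0, hη1, hηX, hηY⟩ : ∃ η : ℝ, 0 < η ∧ η ≤ 1 ∧ 20000 * ‖X‖ * η ≤ δ / 4 ∧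
      20000 * ‖Y‖ * η ≤ ε := by
    have a1 : (0:ℝ) < 80000 * (‖X‖ + 1) := by positivity
    have a2 : (0:ℝ) < 20000 * (‖Y‖ + 1) := by positivity
    refine ⟨min 1 (min (δ / (80000 * (‖X‖ + 1))) (ε / (20000 * (‖Y‖ + 1)))), by positivity,
      min_le_left _ _, ?_, ?_⟩
    · have h1 := (min_le_right 1 _).trans
        (min_le_left (δ / (80000 * (‖X‖ + 1))) (ε / (20000 * (‖Y‖ + 1))))
      have h2 : δ / (80000 * (‖X‖ + 1)) * (80000 * (‖X‖ + 1)) = δ := div_mul_cancel₀ _ a1.ne'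
      have h3 : 0 < δ / (80000 * (‖X‖ + 1)) := by positivity
      have h4 := mul_le_mul_of_nonneg_left h1 (show 0 ≤ 20000 * ‖X‖ by positivity)
      linarith
    · have h1 := (min_le_right 1 _).trans
        (min_le_right (δ / (80000 * (‖X‖ + 1))) (ε / (20000 * (‖Y‖ + 1))))
      have h2 : ε / (20000 * (‖Y‖ + 1)) * (20000 * (‖Y‖ + 1)) = ε := div_mul_cancel₀ _ a2.ne'
      have h3 : 0 < ε / (20000 * (‖Y‖ + 1)) := by positivity
      have h4 := mul_le_mul_of_nonneg_left h1 (show 0 ≤ 20000 * ‖Y‖ by positivity)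
      linarith
  have hη : 0 ≤ η := hη0.le
  obtain ⟨L⟩ := exists_lac N ![X, adjoint X, Y, adjoint Y] hη0
  have hXA : L.Adm X := fun n w hw => ⟨L.maps 0 n w hw, L.maps 1 n w hw⟩
  have hYA : L.Adm Y := fun n w hw => ⟨L.maps 2 n w hw, L.maps 3 n w hw⟩
  set l : ℝ := δ / 4 / 1000 ^ 2 with hl
  have hl0 : 0 < l := by positivity
  have hlδ : 1000 ^ 2 * l + 20000 * ‖X‖ * η < δ := by
    have : 1000 ^ 2 * l = δ / 4 := by rw [hl]; field_simp
    linarith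
  have hex := fun n => extract N (Q := L.bk Y n) (W := L.W (n + 3)) (L.bk_tri hYt n)
    (fun x => L.mono (by omega : n + 1 ≤ n + 3) (L.dd_mem 1 0 n _))
    (fun x => by
      have : adjoint (L.bk Y n) x =
          adjoint (L.dd 3 2 n) (adjoint Y (adjoint (L.dd 1 0 n) x)) := by
        rw [Lac.bk, adjoint_mul', adjoint_mul']; rfl
      rw [this]
      exact L.dda_mem 3 2 n _) (e := 10 * ε) (by positivity)
  choose κ hκ c d s t Q' hQ hcO hdQ hprop hQs using hex
  have hi : ∀ n (i : κ n), s n i ∈ Icc (0:ℝ) 1 ∧ t n i ∈ Icc (0:ℝ) 1 := fun n i => by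
    obtain ⟨h1, h2, h3, -⟩ := hprop n i
    exact ⟨⟨h1, by linarith⟩, ⟨by linarith, h3⟩⟩
  have hQn : ∀ n, ‖Q' n‖ ≤ 4 * ‖Y‖ + 20 * ε := fun n => by
    have h1 := L.bk_norm Y n
    have h2 := hQ n
    have h3 : ‖Q' n‖ ≤ ‖L.bk Y n‖ + ‖L.bk Y n - Q' n‖ := by
      rw [← norm_neg (L.bk Y n - Q' n)]
      refine le_trans (le_of_eq ?_) (norm_add_le _ _)
      congr 1; abel
    linarith
  have bc : Bess (fun x : (Σ n, κ n) => L.dd 2 1 x.1 (c x.1 x.2)) 1000 :=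
    bess_sigma (g := fun n i => L.dd 2 1 n (c n i)) (R := fun n => adjoint (L.dd 2 1 n)) hcO
      (fun n i z => (adjoint_inner_right _ _ _).symm)
      (L.dda_sq hη hη1 (by norm_num) (by norm_num))
  have bd : Bess (fun x : (Σ n, κ n) => adjoint (L.dd 4 3 x.1) (d x.1 x.2))
      ((4 * ‖Y‖ + 20 * ε) * 1000) := by
    refine bess_sigma (g := fun n i => adjoint (L.dd 4 3 n) (d n i))
      (R := fun n => Q' n * L.dd 4 3 n) hcO (fun n i z => ?_) (fun z f => ?_)
    · rw [adjoint_inner_left, hdQ, adjoint_inner_left]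
      rfl
    · calc ∑ n ∈ f, ‖(Q' n * L.dd 4 3 n) z‖ ^ 2
          ≤ ∑ n ∈ f, (4 * ‖Y‖ + 20 * ε) ^ 2 * ‖L.dd 4 3 n z‖ ^ 2 := by
            refine Finset.sum_le_sum fun n _ => ?_
            rw [← mul_pow]
            exact pow_le_pow_left₀ (norm_nonneg _) ((Q' n).le_of_opNorm_le (hQn n) _) 2
        _ ≤ (4 * ‖Y‖ + 20 * ε) ^ 2 * (1000 ^ 2 * ‖z‖ ^ 2) := by
            rw [← Finset.mul_sum]
            gcongr
            exact L.dd_sq hη hη1 (by norm_num) (by norm_num) z f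
        _ = _ := by ring
  obtain ⟨S, hS, -⟩ := exists_syn (by norm_num) (by positivity) bc bd
  refine ⟨S, ?_, ?_⟩
  · refine syn_mem_gen (s := fun x : (Σ n, κ n) => s x.1 x.2) (t := fun x => t x.1 x.2)
      hI hI0 hη hη1 hX hXA hl0 (by norm_num) (by positivity) bc bd ?_ ?_ ?_ ?_ hS
    · rintro ⟨n, i⟩
      exact ⟨(hprop n i).1, (hprop n i).2.1, (hprop n i).2.2.1⟩
    · rintro ⟨n, i⟩
      exact (L.dd_tri 2 1 n).mem (hi n i).1 (hprop n i).2.2.2.1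
    · rintro ⟨n, i⟩
      exact (L.dd_tri 4 3 n).perp (hi n i).2 (hprop n i).2.2.2.2.1
    · intro u v hinf
      set J := {x : (Σ n, κ n) | u ≤ s x.1 x.2 ∧ t x.1 x.2 ≤ v} with hJ
      have hle : ∀ x ∈ J, max u 0 ≤ s x.1 x.2 ∧ t x.1 x.2 ≤ min v 1 := fun x hx =>
        ⟨max_le hx.1 (hprop x.1 x.2).1, le_min hx.2 (hprop x.1 x.2).2.2.1⟩
      obtain ⟨x0, hx0⟩ := hinf.nonempty
      have huv : max u 0 < min v 1 :=
        (hle x0 hx0).1.trans_lt ((hprop x0.1 x0.2).2.1.trans_le (hle x0 hx0).2)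
      have hfst : (Sigma.fst '' J).Infinite := by
        intro hfin
        refine hinf (Set.Finite.subset (hfin.preimage' fun n _ => ?_)
          (subset_preimage_image Sigma.fst J))
        rw [← range_sigmaMk]
        exact finite_range _
      have h1 : INF (bigInt L X l) (max u 0) (min v 1) := by
        refine inf_of_small hη hη1 hXt hYt hXA hl0 hlδ hsub (le_max_right _ _) huv
          (min_le_right _ _) (hfst.mono ?_)
        rintro _ ⟨x, hx, rfl⟩
        have h2 := (hprop x.1 x.2).2.2.2.2.2
        have h3 := int_sub_norm (N := N) (Q := L.bk Y x.1) (le_max_right u 0) (hle x hx).1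
          (hprop x.1 x.2).2.1.le (hle x hx).2 (min_le_right v 1)
        simp only [mem_setOf_eq]
        linarith
      exact h1.mono (le_max_left _ _) (min_le_left _ _)
  · refine opNorm_le_bound _ (by positivity) fun z => ?_
    have h1 : HasSum (fun n => L.dd 2 1 n (Q' n (L.dd 4 3 n z))) (S z) := by
      refine (hS z).sigma fun n => ?_
      have : L.dd 2 1 n (Q' n (L.dd 4 3 n z)) = ∑ i : κ n,
          rk (L.dd 2 1 n (c n i)) (adjoint (L.dd 4 3 n) (d n i)) z := by
        rw [hQs, map_sum]
        refine Finset.sum_congr rfl fun i _ => ?_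
        rw [rk_apply, rk_apply, map_smul, adjoint_inner_left]
      rw [this]
      exact hasSum_fintype _
    have h2 := ((L.tendsto_T hη (Y z)).sub h1.tendsto_sum_nat).norm
    refine le_of_tendsto h2 (Eventually.of_forall fun K => ?_)
    have h3 := L.bl4 hη hη1 hYA (l := 20 * ε) (by positivity) (Finset.range K)
      (U := fun n => L.bk Y n - Q' n) (fun n _ => by have := hQ n; linarith) z
    have h4 : ∑ n ∈ Finset.range K, (L.dd 1 0 n (Y z) -
        L.dd 2 1 n ((L.bk Y n - (L.bk Y n - Q' n)) (L.dd 4 3 n z))) =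
        L.T K (Y z) - ∑ n ∈ Finset.range K, L.dd 2 1 n (Q' n (L.dd 4 3 n z)) := by
      rw [Finset.sum_sub_distrib, ← L.sum_dd K, sum_apply]
      simp only [sub_sub_cancel]
    rw [h4] at h3
    refine h3.trans ?_
    gcongr
    linarith

end

end

/-- Every nonzero stable ideal of a continuous nest algebra on a separable
infinite-dimensional complex Hilbert space is the kernel of a stable net of intervals. -/
theorem stmt0 {H : Type*} [NormedAddCommGroup H] [InnerProductSpace ℂ H] [CompleteSpace H]
    [TopologicalSpace.SeparableSpace H] (hH : ¬FiniteDimensional ℂ H)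
    (𝒩 : ContinuousNest H) (I : Set (H →L[ℂ] H))
    (hI : 𝒩.IsStableIdeal I) (hI0 : I ≠ {0}) :
    ∃ O : Set (Set (H →L[ℂ] H)), 𝒩.IsStableNet O ∧ I = 𝒩.kernel O := by
  exact reduction hI (K := 30000000) fun Y hY X hX δ hδ ε hε hsub =>
    main_approx hI hI0 hY hX hδ hε hsub
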